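/- The fundamental group π₁𝒲_n (the wicket group W_n) is isomorphic to the group with presentation having generators ρ_1,…,ρ_{n−1}, σ_1,…,σ_{n−1}, τ_1,…,τ_n and relations: ρ_iρ_j = ρ_jρ_i, σ_iσ_j = σ_jσ_i, ρ_iσ_j = σ_jρ_i whenever |i−j| ≥ 2; ρ_iρ_{i+1}ρ_i = ρ_{i+1}ρ_iρ_{i+1} and σ_iσ_{i+1}σ_i = σ_{i+1}σ_iσ_{i+1}; ρ_iσ_{i+1}σ_i = σ_{i+1}σ_iρ_{i+1}, σ_iσ_{i+1}ρ_i = ρ_{i+1}σ_iσ_{i+1}, σ_iρ_{i+1}ρ_i = ρ_{i+1}ρ_iσ_{i+1}; τ_iτ_j = τ_jτ_i for i ≠ j; ρ_iτ_j = τ_jρ_i and σ_iτ_j = τ_jσ_i for j ∉ {i, i+1}; τ_i^ε σ_i^η = σ_i^η τ_{i+1}^ε and τ_{i+1}^ε σ_i^η = σ_i^η τ_i^ε for ε, η ∈ {+1, −1}; τ_i^ε ρ_i = ρ_i τ_{i+1}^ε and τ_{i+1}^ε ρ_i = σ_i^{−ε} ρ_i^{−1} σ_i^ε τ_i^ε for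 ε ∈ {+1, −1}; τ_i^ε ρ_i^{−1} = σ_i^{−ε} ρ_i σ_i^ε τ_{i+1}^ε and τ_{i+1}^ε ρ_i^{−1} = ρ_i^{−1} τ_i^ε for ε ∈ {+1, −1}. -/

import Mathlib

noncomputable section

open CategoryTheory

abbrev E2 : Type := EuclideanSpace ℝ (Fin 2)
abbrev E3 : Type := EuclideanSpace ℝ (Fin 3)

/-- The point of `ℝ³` with the given coordinates. -/
def e3mk (x y z : ℝ) : E3 := (WithLp.equiv 2 (Fin 3 → ℝ)).symm ![x, y, z]

/-- The wicket with endpoints `a, b ∈ ℝ²`: the semicircle in upper half-space lying in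
the vertical plane through `(a,0)` and `(b,0)`, with center `m = ((a+b)/2, 0)` and
radius `‖a-b‖/2`. -/
def wicket (a b : E2) : Set E3 :=
  {x | 0 ≤ x 2 ∧ dist x (e3mk ((a 0 + b 0) / 2) ((a 1 + b 1) / 2) 0) = dist a b / 2 ∧
    ∃ t : ℝ, x 0 = a 0 + t * (b 0 - a 0) ∧ x 1 = a 1 + t * (b 1 - a 1)}

/-- An `n`-tuple of endpoint pairs of pairwise disjoint wickets. -/
def IsWicketTuple {n : ℕ} (f : Fin n → E2 × E2) : Prop :=
  (∀ i, (f i).1 ≠ (f i).2) ∧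
  (∀ i j, i ≠ j → Disjoint (wicket (f i).1 (f i).2) (wicket (f j).1 (f j).2))

/-- The space of ordered `n`-tuples of pairwise disjoint wickets. -/
abbrev WicketTuple (n : ℕ) : Type := {f : Fin n → E2 × E2 // IsWicketTuple f}

/-- Two tuples are identified iff they determine the same `n`-element set of wickets
(this permutes the wickets and swaps endpoints). -/
def wicketSetoid (n : ℕ) : Setoid (WicketTuple n) where
  r f g := (Set.range fun i => wicket (f.1 i).1 (f.1 i).2) =
    Set.range fun i => wicket (g.1 i).1 (g.1 i).2
  iseqv := ⟨fun _ => rfl, Eq.symm, Eq.trans⟩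

/-- The wicket space `𝒲_n`: configurations of `n` disjoint wickets, with the quotient
topology. -/
abbrev WConf (n : ℕ) : Type := Quotient (wicketSetoid n)

/-- All wickets of the tuple lie in planes perpendicular to the `x`-axis: both endpoints
of each wicket have the same `x`-coordinate. -/
def IsUWTuple {n : ℕ} (f : WicketTuple n) : Prop := ∀ i, (f.1 i).1 0 = (f.1 i).2 0

/-- The untwisted wicket space `𝒰𝒲_n ⊆ 𝒲_n`. -/
def UWConf (n : ℕ) : Set (WConf n) :=
  {x | ∃ f, Quotient.mk (wicketSetoid n) f = x ∧ IsUWTuple f}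

/-- Generators `ρ_0, …, ρ_{n-2}`, `σ_0, …, σ_{n-2}`, `τ_0, …, τ_{n-1}`
(indexed from 0). -/
abbrev WGen (n : ℕ) : Type := Fin (n - 1) ⊕ Fin (n - 1) ⊕ Fin n

/-- The generator `ρ_i`. -/
def wρ {n : ℕ} (i : Fin (n - 1)) : FreeGroup (WGen n) := FreeGroup.of (Sum.inl i)

/-- The generator `σ_i`. -/
def wσ {n : ℕ} (i : Fin (n - 1)) : FreeGroup (WGen n) := FreeGroup.of (Sum.inr (Sum.inl i))

/-- The generator `τ_j`. -/
def wτ {n : ℕ} (j : Fin n) : FreeGroup (WGen n) := FreeGroup.of (Sum.inr (Sum.inr j))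

/-- The relations of the wicket group, written as relators: the braid relations on the
`ρ_i` and on the `σ_i`, the braid-like relations mixing them, the commutation relations
among the `τ_i` and of `τ_j` with `ρ_i, σ_i` for `j ∉ {i, i+1}`, and the relations
`τ_i^ε σ_i^η = σ_i^η τ_{i+1}^ε`, `τ_{i+1}^ε σ_i^η = σ_i^η τ_i^ε`,
`τ_i^ε ρ_i = ρ_i τ_{i+1}^ε`, `τ_{i+1}^ε ρ_i = σ_i^{-ε} ρ_i^{-1} σ_i^ε τ_i^ε`,
`τ_i^ε ρ_i^{-1} = σ_i^{-ε} ρ_i σ_i^ε τ_{i+1}^ε`, `τ_{i+1}^ε ρ_i^{-1} = ρ_i^{-1} τ_i^ε`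
for `ε, η ∈ {1, -1}`. -/
def wickRels (n : ℕ) : Set (FreeGroup (WGen n)) :=
  (⋃ (i : Fin (n - 1)) (j : Fin (n - 1)) (_ : (i : ℕ) + 2 ≤ (j : ℕ) ∨ (j : ℕ) + 2 ≤ (i : ℕ)),
    {wρ i * wρ j * (wρ j * wρ i)⁻¹, wσ i * wσ j * (wσ j * wσ i)⁻¹,
      wρ i * wσ j * (wσ j * wρ i)⁻¹}) ∪
  (⋃ (i : Fin (n - 1)) (j : Fin (n - 1)) (_ : (j : ℕ) = (i : ℕ) + 1),
    {wρ i * wρ j * wρ i * (wρ j * wρ i * wρ j)⁻¹,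
      wσ i * wσ j * wσ i * (wσ j * wσ i * wσ j)⁻¹,
      wρ i * wσ j * wσ i * (wσ j * wσ i * wρ j)⁻¹,
      wσ i * wσ j * wρ i * (wρ j * wσ i * wσ j)⁻¹,
      wσ i * wρ j * wρ i * (wρ j * wρ i * wσ j)⁻¹}) ∪
  (⋃ (i : Fin n) (j : Fin n) (_ : i ≠ j), {wτ i * wτ j * (wτ j * wτ i)⁻¹}) ∪
  (⋃ (i : Fin (n - 1)) (j : Fin n) (_ : (j : ℕ) ≠ (i : ℕ) ∧ (j : ℕ) ≠ (i : ℕ) + 1),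
    {wρ i * wτ j * (wτ j * wρ i)⁻¹, wσ i * wτ j * (wτ j * wσ i)⁻¹}) ∪
  (⋃ (i : Fin (n - 1)) (j : Fin n) (j' : Fin n) (_ : (j : ℕ) = (i : ℕ))
      (_ : (j' : ℕ) = (i : ℕ) + 1) (ε : ℤ) (_ : ε = 1 ∨ ε = -1) (η : ℤ)
      (_ : η = 1 ∨ η = -1),
    {wτ j ^ ε * wσ i ^ η * (wσ i ^ η * wτ j' ^ ε)⁻¹,
      wτ j' ^ ε * wσ i ^ η * (wσ i ^ η * wτ j ^ ε)⁻¹}) ∪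
  (⋃ (i : Fin (n - 1)) (j : Fin n) (j' : Fin n) (_ : (j : ℕ) = (i : ℕ))
      (_ : (j' : ℕ) = (i : ℕ) + 1) (ε : ℤ) (_ : ε = 1 ∨ ε = -1),
    {wτ j ^ ε * wρ i * (wρ i * wτ j' ^ ε)⁻¹,
      wτ j' ^ ε * wρ i * (wσ i ^ (-ε) * (wρ i)⁻¹ * wσ i ^ ε * wτ j ^ ε)⁻¹,
      wτ j ^ ε * (wρ i)⁻¹ * (wσ i ^ (-ε) * wρ i * wσ i ^ ε * wτ j' ^ ε)⁻¹,
      wτ j' ^ ε * (wρ i)⁻¹ * ((wρ i)⁻¹ * wτ j ^ ε)⁻¹})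

open scoped unitInterval

section Subdivision

variable {Z : Type*} [TopologicalSpace Z] {ι : Type*} {H : Type*} [Group H]

/-- The image under `f` of the straight segment from `p` to `q`. -/
def segPath {W : Type*} [AddCommGroup W] [Module ℝ W] [TopologicalSpace W]
    [IsTopologicalAddGroup W] [ContinuousSMul ℝ W] (f : C(W, Z)) (p q : W) :
    Path (f p) (f q) where
  toFun t := f (AffineMap.lineMap p q (t : ℝ))
  continuous_toFun := by
    refine f.continuous.comp ?_
    exact AffineMap.lineMap_continuous.comp continuous_subtype_val
  source' := by simp
  target' := by simp

/-- A group-valued function on the paths lying in one of the sets `V i`, multiplicative and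
invariant under homotopies in `V i`. -/
structure LocalHolonomy (V : ι → Set Z) (H : Type*) [Group H] where
  map : ∀ (i : ι) {x y : Z} (γ : Path x y), (∀ t, γ t ∈ V i) → H
  map_homotopy : ∀ (i : ι) {x y : Z} (γ γ' : Path x y) (F : γ.Homotopy γ') (_ : ∀ p, F p ∈ V i)
    (h : ∀ t, γ t ∈ V i) (h' : ∀ t, γ' t ∈ V i), map i γ h = map i γ' h'
  map_trans : ∀ (i : ι) {x y z : Z} (γ : Path x y) (γ' : Path y z) (h : ∀ t, γ t ∈ V i)
    (h' : ∀ t, γ' t ∈ V i) (h'' : ∀ t, γ.trans γ' t ∈ V i),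
    map i (γ.trans γ') h'' = map i γ h * map i γ' h'
  map_agree : ∀ (i j : ι) {x y : Z} (γ : Path x y) (h : ∀ t, γ t ∈ V i) (h' : ∀ t, γ t ∈ V j),
    map i γ h = map j γ h'

namespace LocalHolonomy

variable {V : ι → Set Z} (L : LocalHolonomy V H)

theorem map_congr {i j : ι} {x y x' y' : Z} {γ : Path x y} {γ' : Path x' y'}
    (e : ∀ t, γ t = γ' t) (h : ∀ t, γ t ∈ V i) (h' : ∀ t, γ' t ∈ V j) :
    L.map i γ h = L.map j γ' h' := by
  obtain rfl : x = x' := by simpa using e 0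
  obtain rfl : y = y' := by simpa using e 1
  obtain rfl : γ = γ' := by ext t; exact e t
  exact L.map_agree _ _ _ _ _

section Small

variable {W : Type*} [AddCommGroup W] [Module ℝ W] [TopologicalSpace W]
  [IsTopologicalAddGroup W] [ContinuousSMul ℝ W]

open Classical in
/-- The value of a local holonomy on a small segment (junk value `1` on other segments). -/
def small (f : C(W, Z)) (p q : W) : H :=
  if h : ∃ i, ∀ t, segPath f p q t ∈ V i then L.map h.choose _ h.choose_spec else 1

theorem small_eq {f : C(W, Z)} {p q : W} {i : ι} (h : ∀ t, segPath f p q t ∈ V i) :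
    L.small f p q = L.map i _ h := by
  have h' : ∃ i, ∀ t, segPath f p q t ∈ V i := ⟨i, h⟩
  rw [small, dif_pos h']
  exact L.map_agree _ _ _ _ _

theorem small_congr {W' : Type*} [AddCommGroup W'] [Module ℝ W'] [TopologicalSpace W']
    [IsTopologicalAddGroup W'] [ContinuousSMul ℝ W'] {f : C(W, Z)} {g : C(W', Z)}
    {p q : W} {p' q' : W'} (e : ∀ t, segPath f p q t = segPath g p' q' t) :
    L.small f p q = L.small g p' q' := by
  by_cases h : ∃ i, ∀ t, segPath f p q t ∈ V i
  · obtain ⟨i, hi⟩ := h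
    have hi' : ∀ t, segPath g p' q' t ∈ V i := fun t => e t ▸ hi t
    rw [L.small_eq hi, L.small_eq hi']
    exact L.map_congr e _ _
  · have h' : ¬ ∃ i, ∀ t, segPath g p' q' t ∈ V i := by simpa only [← e] using h
    rw [small, dif_neg h, small, dif_neg h']

theorem segPath_mem {f : C(W, Z)} {K : Set W} (hK : Convex ℝ K) {A : Set Z}
    (hf : ∀ x ∈ K, f x ∈ A) {p q : W} (hp : p ∈ K) (hq : q ∈ K) (t : I) :
    segPath f p q t ∈ A :=
  hf _ (hK.lineMap_mem hp hq t.2)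

theorem small_mul {f : C(W, Z)} {K : Set W} (hK : Convex ℝ K) {i : ι}
    (hf : ∀ x ∈ K, f x ∈ V i) {p q r : W} (hp : p ∈ K) (hq : q ∈ K) (hr : r ∈ K) :
    L.small f p q * L.small f q r = L.small f p r := by
  have h1 := segPath_mem hK hf hp hq
  have h2 := segPath_mem hK hf hq hr
  have h3 := segPath_mem hK hf hp hr
  let ida : C(W, W) := ContinuousMap.id W
  let a₁ : Path p q := segPath ida p q
  let a₂ : Path q r := segPath ida q r
  let a : Path p r := a₁.trans a₂
  let b : Path p r := segPath ida p r
  have ha : ∀ t, a t ∈ K := by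
    intro t
    simp only [a, Path.trans_apply]
    split_ifs
    · exact segPath_mem hK (fun x hx => hx) hp hq _
    · exact segPath_mem hK (fun x hx => hx) hq hr _
  have hb : ∀ t, b t ∈ K := segPath_mem hK (fun x hx => hx) hp hr
  let F0 : a.Homotopy b :=
    { toFun := fun x => AffineMap.lineMap (a x.2) (b x.2) (x.1 : ℝ)
      continuous_toFun := by
        simp only [AffineMap.lineMap_apply_module]
        fun_prop
      map_zero_left := by intro t; simp
      map_one_left := by intro t; simp
      prop' := by
        rintro t x (rfl | rfl) <;> simp }
  have hF0 : ∀ x, F0 x ∈ K := fun x => hK.lineMap_mem (ha _) (hb _) x.1.2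
  have e1 : (segPath f p q).trans (segPath f q r) = a.map f.continuous := by
    simp only [a, Path.map_trans]; rfl
  have e2 : segPath f p r = b.map f.continuous := rfl
  have h12 : ∀ t, ((segPath f p q).trans (segPath f q r)) t ∈ V i := by
    intro t; rw [e1]; exact hf _ (ha t)
  rw [L.small_eq h1, L.small_eq h2, L.small_eq h3, ← L.map_trans i _ _ h1 h2 h12]
  refine L.map_homotopy i _ _ ((F0.map f).cast e1.symm e2.symm) ?_ _ _
  intro x
  exact hf _ (hF0 x)

theorem small_self {f : C(W, Z)} {p : W} {i : ι} (hf : f p ∈ V i) : L.small f p p = 1 := by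
  have := L.small_mul (f := f) (convex_singleton p) (i := i) (by simpa using hf)
    (Set.mem_singleton p) (Set.mem_singleton p) (Set.mem_singleton p)
  simpa using this

theorem small_const {f : C(W, Z)} {p q : W} {i : ι} (hf : f p ∈ V i)
    (hc : ∀ t, segPath f p q t = f p) : L.small f p q = 1 := by
  rw [← L.small_self hf]
  exact L.small_congr fun t => by rw [hc]; simp [segPath]

end Small

/-- All the intervals `[k/N, (k+1)/N]` are mapped into sets of the cover. -/
def Good (V : ι → Set Z) (f : C(ℝ, Z)) (N : ℕ) : Prop :=
  0 < N ∧ ∀ k < N, ∃ i, ∀ t ∈ Set.Icc ((k : ℝ) / N) ((k + 1 : ℝ) / N), f t ∈ V i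

/-- The product of the values on the first `k` of the intervals `[j/N, (j+1)/N]`. -/
def partialProd (f : C(ℝ, Z)) (N : ℕ) : ℕ → H
  | 0 => 1
  | k + 1 => partialProd f N k * L.small f ((k : ℝ) / N) ((k + 1 : ℝ) / N)

theorem partialProd_refine {f : C(ℝ, Z)} {N M : ℕ} (hN : Good V f N) (hM : 0 < M) {k : ℕ}
    (hk : k ≤ N) : L.partialProd f (N * M) (k * M) = L.partialProd f N k := by
  have hN0 : (0 : ℝ) < N := by exact_mod_cast hN.1
  have hM0 : (0 : ℝ) < M := by exact_mod_cast hM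
  induction k with
  | zero => simp [partialProd]
  | succ k ih =>
    obtain ⟨i, hi⟩ := hN.2 k (by omega)
    have key : ∀ j ≤ M, L.partialProd f (N * M) (k * M + j) =
        L.partialProd f (N * M) (k * M) * L.small f ((k : ℝ) / N) ((k * M + j : ℝ) / (N * M)) := by
      intro j hj
      induction j with
      | zero =>
        have : ((k * M + (0 : ℕ) : ℝ) / (N * M)) = (k : ℝ) / N := by
          field_simp; simp
        rw [this, L.small_self (i := i), mul_one, add_zero]
        exact hi _ ⟨le_rfl, by gcongr; linarith⟩
      | succ j ihj =>
        rw [← add_assoc, partialProd, ihj (by omega), mul_assoc]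
        have hj' : (j : ℝ) + 1 ≤ M := by exact_mod_cast hj
        have mem : ∀ s : ℝ, 0 ≤ s → s ≤ M →
            (k * M + s) / (N * M) ∈ Set.Icc ((k : ℝ) / N) ((k + 1 : ℝ) / N) := by
          intro s h0 h1
          constructor
          · rw [div_le_div_iff₀ hN0 (by positivity)]; nlinarith [mul_nonneg h0 hN0.le]
          · rw [div_le_div_iff₀ (by positivity) hN0]
            nlinarith [mul_le_mul_of_nonneg_right h1 hN0.le]
        have := L.small_mul (f := f) (convex_Icc ((k : ℝ) / N) ((k + 1 : ℝ) / N)) hi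
          (p := (k : ℝ) / N) (q := (k * M + j : ℝ) / (N * M))
          (r := (k * M + (j + 1) : ℝ) / (N * M))
          ⟨le_rfl, by gcongr; linarith⟩ (mem j (by positivity) (by linarith))
          (mem (j + 1) (by positivity) hj')
        push_cast
        rw [← this]
        simp only [add_assoc]
    rw [add_mul, one_mul, key M le_rfl, ih (by omega), partialProd]
    congr 2
    field_simp

theorem partialProd_eq {f : C(ℝ, Z)} {N M : ℕ} (hN : Good V f N) (hM : Good V f M) :
    L.partialProd f N N = L.partialProd f M M := by
  rw [← L.partialProd_refine hN hM.1 le_rfl, ← L.partialProd_refine hM hN.1 le_rfl, mul_comm N M]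

end LocalHolonomy

/-- A cover of the unit square is fine enough for a uniform grid. -/
theorem exists_grid {V : ι → Set Z} (hV : ∀ i, IsOpen (V i)) (hc : ∀ z, ∃ i, z ∈ V i)
    (f : C(ℝ × ℝ, Z)) : ∃ N : ℕ, 0 < N ∧ ∀ M : ℕ, 0 < M → ∀ k < N * M, ∀ l < N * M, ∃ i,
      ∀ x ∈ Set.Icc ((k : ℝ) / (N * M : ℕ)) ((k + 1 : ℝ) / (N * M : ℕ)) ×ˢ
        Set.Icc ((l : ℝ) / (N * M : ℕ)) ((l + 1 : ℝ) / (N * M : ℕ)), f x ∈ V i := by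
  have hK : IsCompact (Set.Icc (0 : ℝ) 1 ×ˢ Set.Icc (0 : ℝ) 1) := isCompact_Icc.prod isCompact_Icc
  obtain ⟨δ, δ0, hδ⟩ := lebesgue_number_lemma_of_metric (c := fun i => f ⁻¹' V i) hK
    (fun i => (hV i).preimage f.continuous)
    (fun x _ => by obtain ⟨i, hi⟩ := hc (f x); exact Set.mem_iUnion.2 ⟨i, hi⟩)
  obtain ⟨N, hN⟩ := exists_nat_gt (1 / δ)
  have hN0 : (0 : ℝ) < N := lt_trans (by positivity) hN
  refine ⟨N, by exact_mod_cast hN0, ?_⟩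
  intro M hM k hk l hl
  have hM1 : (1 : ℝ) ≤ M := by exact_mod_cast hM
  set n : ℕ := N * M with hn
  have hn0 : (0 : ℝ) < n := by rw [hn]; push_cast; positivity
  have hnN : (N : ℝ) ≤ n := by rw [hn]; push_cast; nlinarith
  have h1 : 1 / (n : ℝ) < δ := by
    rw [div_lt_iff₀ hn0]; rw [div_lt_iff₀ δ0] at hN; nlinarith
  have hkn : (k : ℝ) + 1 ≤ n := by exact_mod_cast hk
  have hln : (l : ℝ) + 1 ≤ n := by exact_mod_cast hl
  obtain ⟨i, hi⟩ := hδ ((k : ℝ) / n, (l : ℝ) / n)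
    ⟨⟨by positivity, by rw [div_le_one hn0]; linarith⟩,
      ⟨by positivity, by rw [div_le_one hn0]; linarith⟩⟩
  refine ⟨i, fun x hx => hi ?_⟩
  have aux : ∀ (m : ℕ) (s : ℝ), s ∈ Set.Icc ((m : ℝ) / n) ((m + 1 : ℝ) / n) →
      dist s ((m : ℝ) / n) < δ := by
    intro m s hs
    rw [Real.dist_eq, abs_of_nonneg (by linarith [hs.1])]
    have := hs.2
    rw [add_div] at this
    linarith
  rw [Metric.mem_ball, Prod.dist_eq]
  exact max_lt (aux k _ hx.1) (aux l _ hx.2)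

theorem exists_good {V : ι → Set Z} (hV : ∀ i, IsOpen (V i)) (hc : ∀ z, ∃ i, z ∈ V i)
    (f : C(ℝ, Z)) : ∃ N : ℕ, 0 < N ∧ ∀ M : ℕ, 0 < M → LocalHolonomy.Good V f (N * M) := by
  obtain ⟨N, hN, h⟩ := exists_grid hV hc (f.comp ⟨Prod.snd, continuous_snd⟩)
  refine ⟨N, hN, fun M hM => ⟨Nat.mul_pos hN hM, fun k hk => ?_⟩⟩
  obtain ⟨i, hi⟩ := h M hM k hk k hk
  exact ⟨i, fun t ht => hi (t, t) ⟨ht, ht⟩⟩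

namespace LocalHolonomy

variable {V : ι → Set Z} (L : LocalHolonomy V H)

/-- The holonomy along an arbitrary path. -/
def total (hV : ∀ i, IsOpen (V i)) (hc : ∀ z, ∃ i, z ∈ V i) {x y : Z} (γ : Path x y) : H :=
  L.partialProd γ.extend (exists_good hV hc γ.extend).choose
    (exists_good hV hc γ.extend).choose

variable (hV : ∀ i, IsOpen (V i)) (hc : ∀ z, ∃ i, z ∈ V i)

theorem total_eq {x y : Z} (γ : Path x y) {N : ℕ} (hN : Good V γ.extend N) :
    L.total hV hc γ = L.partialProd γ.extend N N := by
  have := (exists_good hV hc γ.extend).choose_spec.2 1 one_pos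
  rw [mul_one] at this
  exact L.partialProd_eq this hN

theorem total_map {x y : Z} (γ : Path x y) (i : ι) (h : ∀ t, γ t ∈ V i) :
    L.total hV hc γ = L.map i γ h := by
  have h' : ∀ t : ℝ, γ.extend t ∈ V i := fun t => h _
  have hg : Good V γ.extend 1 := ⟨one_pos, fun k hk => ⟨i, fun t _ => h' t⟩⟩
  rw [L.total_eq hV hc γ hg, partialProd, partialProd, one_mul,
    L.small_eq (i := i) (fun t => h' _)]
  refine L.map_congr (fun t => ?_) _ _
  simp [segPath, AffineMap.lineMap_apply]

theorem total_homotopic {x y : Z} {γ γ' : Path x y} (h : γ.Homotopic γ') :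
    L.total hV hc γ = L.total hV hc γ' := by
  obtain ⟨F⟩ := h
  let f : C(ℝ × ℝ, Z) := ⟨fun p => F (Set.projIcc 0 1 zero_le_one p.1,
    Set.projIcc 0 1 zero_le_one p.2), by fun_prop⟩
  obtain ⟨N, hN, hg⟩ := exists_grid hV hc f
  replace hg := hg 1 one_pos
  rw [mul_one] at hg
  have hN0 : (0 : ℝ) < N := by exact_mod_cast hN
  let row : ℝ → C(ℝ, Z) := fun s => f.comp ⟨fun t => (s, t), by fun_prop⟩
  have hrow : ∀ s a b, L.small (row s) a b = L.small f (s, a) (s, b) := by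
    intro s a b
    refine L.small_congr fun t => ?_
    simp [row, segPath, AffineMap.lineMap_apply]
  have hside : ∀ (s s' : ℝ) (e : ℝ) (z : Z), (∀ s, f (s, e) = z) → L.small f (s, e) (s', e) = 1 := by
    intro s s' e z hz
    obtain ⟨i, hi⟩ := hc z
    refine L.small_const (i := i) (by rw [hz]; exact hi) fun t => ?_
    have : AffineMap.lineMap (s, e) (s', e) (t : ℝ) = (s + t * (s' - s), e) := by
      simp [AffineMap.lineMap_apply, add_comm]
    change f _ = _
    rw [this, hz, hz]
  have hx : ∀ s, f (s, 0) = x := by intro s; simp [f]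
  have hy : ∀ s, f (s, 1) = y := by intro s; simp [f]
  have hsq : ∀ l < N, ∀ k ≤ N, L.partialProd (row (l / N)) N k *
      L.small f ((l : ℝ) / N, (k : ℝ) / N) ((l + 1 : ℝ) / N, (k : ℝ) / N) =
      L.partialProd (row ((l + 1) / N)) N k := by
    intro l hl k hk
    induction k with
    | zero =>
      simp only [partialProd, Nat.cast_zero, zero_div, one_mul]
      exact hside _ _ _ x hx
    | succ k ih =>
      specialize ih (by omega)
      obtain ⟨i, hi⟩ := hg l hl k (by omega)
      have hconv := (convex_Icc (𝕜 := ℝ) ((l : ℝ) / N) ((l + 1 : ℝ) / N)).prod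
        (convex_Icc (𝕜 := ℝ) ((k : ℝ) / N) ((k + 1 : ℝ) / N))
      have hle : ∀ m : ℕ, (m : ℝ) / N ≤ (m + 1 : ℝ) / N := fun m => by gcongr; linarith
      rw [partialProd, partialProd, ← ih, hrow, hrow]
      push_cast
      rw [mul_assoc, mul_assoc]
      congr 1
      rw [L.small_mul hconv hi, L.small_mul hconv hi]
      all_goals exact ⟨⟨by simp [hle], by simp [hle]⟩, ⟨by simp [hle], by simp [hle]⟩⟩
  have hrows : ∀ l ≤ N, L.partialProd (row (l / N)) N N = L.partialProd (row 0) N N := by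
    intro l hl
    induction l with
    | zero => simp
    | succ l ih =>
      rw [← ih (by omega)]
      push_cast
      rw [← hsq l (by omega) N le_rfl, div_self hN0.ne', hside _ _ _ y hy, mul_one]
  have hgood : ∀ s ∈ Set.Icc (0 : ℝ) 1, Good V (row s) N := by
    intro s hs
    refine ⟨hN, fun k hk => ?_⟩
    obtain ⟨l, hl, hls⟩ : ∃ l < N, s ∈ Set.Icc ((l : ℝ) / N) ((l + 1 : ℝ) / N) := by
      rcases hs.2.lt_or_eq with h1 | rfl
      · refine ⟨⌊s * N⌋₊, ?_, ?_, ?_⟩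
        · rw [Nat.floor_lt (by have := hs.1; positivity)]; nlinarith
        · rw [div_le_iff₀ hN0]; exact Nat.floor_le (by have := hs.1; positivity)
        · rw [le_div_iff₀ hN0]; exact (Nat.lt_floor_add_one _).le
      · refine ⟨N - 1, by omega, ?_, ?_⟩
        · rw [div_le_one hN0]; exact_mod_cast Nat.sub_le _ _
        · rw [one_le_div hN0]; exact_mod_cast (by omega : N ≤ N - 1 + 1)
    obtain ⟨i, hi⟩ := hg l hl k hk
    exact ⟨i, fun t ht => hi (s, t) ⟨hls, ht⟩⟩
  have e0 : row 0 = γ.extend := by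
    ext t; simp [row, f, Path.extend, Set.IccExtend]
  have e1 : row 1 = γ'.extend := by
    ext t; simp [row, f, Path.extend, Set.IccExtend]
  have g0 := hgood 0 (by simp)
  have g1 := hgood 1 (by simp)
  have := hrows N le_rfl
  rw [div_self hN0.ne', e0, e1] at this
  rw [e0] at g0
  rw [e1] at g1
  rw [L.total_eq hV hc γ g0, L.total_eq hV hc γ' g1, this]

theorem total_trans {x y z : Z} (γ : Path x y) (γ' : Path y z) :
    L.total hV hc (γ.trans γ') = L.total hV hc γ * L.total hV hc γ' := by
  obtain ⟨N, hN, hg⟩ := exists_good hV hc γ.extend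
  obtain ⟨N', hN', hg'⟩ := exists_good hV hc γ'.extend
  set M := N * N' with hM
  have g1 : Good V γ.extend M := hg N' hN'
  have g2 : Good V γ'.extend M := by rw [hM, mul_comm]; exact hg' N hN
  have hM0 : (0 : ℝ) < M := by exact_mod_cast g1.1
  have m1 : ∀ t : ℝ, t ≤ 1 / 2 → (γ.trans γ').extend t = γ.extend (2 * t) :=
    fun t ht => Path.extend_trans_of_le_half _ _ ht
  have m2 : ∀ t : ℝ, 1 / 2 ≤ t → (γ.trans γ').extend t = γ'.extend (2 * t - 1) :=
    fun t ht => Path.extend_trans_of_half_le _ _ ht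
  have g : Good V (γ.trans γ').extend (2 * M) := by
    refine ⟨by have := g1.1; omega, fun k hk => ?_⟩
    by_cases hkM : k < M
    · obtain ⟨i, hi⟩ := g1.2 k hkM
      refine ⟨i, fun t ht => ?_⟩
      have hk1 : (k : ℝ) + 1 ≤ M := by exact_mod_cast hkM
      have h1 := ht.1
      have h2 := ht.2
      push_cast at h1 h2
      rw [div_le_iff₀ (by positivity)] at h1
      rw [le_div_iff₀ (by positivity)] at h2
      rw [m1 t (by nlinarith)]
      exact hi _ ⟨by rw [div_le_iff₀ hM0]; linarith, by rw [le_div_iff₀ hM0]; linarith⟩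
    · obtain ⟨i, hi⟩ := g2.2 (k - M) (by omega)
      refine ⟨i, fun t ht => ?_⟩
      have hk1 : (M : ℝ) ≤ k := by exact_mod_cast not_lt.1 hkM
      have h1 := ht.1
      have h2 := ht.2
      push_cast at h1 h2
      rw [div_le_iff₀ (by positivity)] at h1
      rw [le_div_iff₀ (by positivity)] at h2
      rw [m2 t (by nlinarith)]
      have hc : ((k - M : ℕ) : ℝ) = k - M := by push_cast [not_lt.1 hkM]; rfl
      rw [hc] at hi
      exact hi _ ⟨by rw [div_le_iff₀ hM0]; linarith, by rw [le_div_iff₀ hM0]; linarith⟩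
  have p1 : ∀ k ≤ M, L.partialProd (γ.trans γ').extend (2 * M) k = L.partialProd γ.extend M k := by
    intro k hk
    induction k with
    | zero => rfl
    | succ k ih =>
      rw [partialProd, partialProd, ih (by omega)]
      congr 1
      have hk1 : (k : ℝ) + 1 ≤ M := by exact_mod_cast hk
      refine L.small_congr fun t => ?_
      change (γ.trans γ').extend _ = γ.extend _
      simp only [AffineMap.lineMap_apply, vsub_eq_sub, smul_eq_mul, vadd_eq_add]
      have e : (t : ℝ) * (((k + 1 : ℝ)) / (2 * M : ℕ) - k / (2 * M : ℕ)) + k / (2 * M : ℕ) =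
          (t + k) / (2 * M) := by push_cast; field_simp; ring
      rw [e, m1]
      · congr 1; field_simp; ring
      · rw [div_le_div_iff₀ (by positivity) two_pos]; nlinarith [t.2.2]
  have p2 : ∀ k ≤ M, L.partialProd (γ.trans γ').extend (2 * M) (M + k) =
      L.partialProd γ.extend M M * L.partialProd γ'.extend M k := by
    intro k hk
    induction k with
    | zero => simp [p1 M le_rfl, partialProd]
    | succ k ih =>
      rw [← add_assoc, partialProd, partialProd, ih (by omega), mul_assoc]
      congr 2
      refine L.small_congr fun t => ?_
      change (γ.trans γ').extend _ = γ'.extend _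
      simp only [AffineMap.lineMap_apply, vsub_eq_sub, smul_eq_mul, vadd_eq_add]
      have e : (t : ℝ) * ((((M + k : ℕ) : ℝ) + 1) / (2 * M : ℕ) - (M + k : ℕ) / (2 * M : ℕ)) +
          (M + k : ℕ) / (2 * M : ℕ) = (t + k + M) / (2 * M) := by push_cast; field_simp; ring
      rw [e, m2]
      · congr 1; field_simp; ring
      · rw [div_le_div_iff₀ two_pos (by positivity)]; nlinarith [t.2.1, (Nat.cast_nonneg k : (0 : ℝ) ≤ k)]
  rw [L.total_eq hV hc _ g, L.total_eq hV hc _ g1, L.total_eq hV hc _ g2, two_mul, ← p2 M le_rfl]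
  rw [← two_mul]

end LocalHolonomy

/-- To prove a property of all paths it suffices to prove it for paths in the sets of an open
cover, and to check that it is stable under concatenation and homotopy. -/
theorem path_induction {V : ι → Set Z} (hV : ∀ i, IsOpen (V i)) (hc : ∀ z, ∃ i, z ∈ V i)
    {P : ∀ {x y : Z}, Path x y → Prop}
    (hsmall : ∀ {x y : Z} (γ : Path x y) (i : ι), (∀ t, γ t ∈ V i) → P γ)
    (htrans : ∀ {x y z : Z} (γ : Path x y) (γ' : Path y z), P γ → P γ' → P (γ.trans γ'))
    (hhom : ∀ {x y : Z} (γ γ' : Path x y), γ.Homotopic γ' → P γ → P γ')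
    {x y : Z} (γ : Path x y) : P γ := by
  obtain ⟨N, hN, hg⟩ := exists_good hV hc γ.extend
  replace hg := hg 1 one_pos
  rw [mul_one] at hg
  have hN0 : (0 : ℝ) < N := by exact_mod_cast hN
  let pt : ℕ → I := fun k => Set.projIcc 0 1 zero_le_one ((k : ℝ) / N)
  have hpt : ∀ k ≤ N, (pt k : ℝ) = k / N := by
    intro k hk
    have : (k : ℝ) ≤ N := by exact_mod_cast hk
    simp only [pt]
    rw [Set.projIcc_of_mem zero_le_one ⟨by positivity, by rw [div_le_one hN0]; exact this⟩]
  have key : ∀ k ≤ N, P (γ.subpath 0 (pt k)) := by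
    intro k hk
    induction k with
    | zero =>
      have : pt 0 = 0 := by ext; rw [hpt 0 hk]; simp
      rw [this, Path.subpath_self]
      obtain ⟨i, hi⟩ := hc (γ 0)
      exact hsmall _ i fun _ => hi
    | succ k ih =>
      refine hhom _ _ ⟨Path.Homotopy.subpathTransSubpath γ 0 (pt k) (pt (k + 1))⟩
        (htrans _ _ (ih (by omega)) ?_)
      obtain ⟨i, hi⟩ := hg.2 k (by omega)
      refine hsmall _ i fun t => ?_
      have hm : (γ.subpath (pt k) (pt (k + 1))) t ∈ γ '' Set.uIcc (pt k) (pt (k + 1)) := by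
        rw [← Path.range_subpath]; exact Set.mem_range_self t
      have hle : pt k ≤ pt (k + 1) := by
        rw [← Subtype.coe_le_coe, hpt k (by omega), hpt _ hk]; push_cast; gcongr; linarith
      rw [Set.uIcc_of_le hle] at hm
      obtain ⟨s, hs, e⟩ := hm
      rw [← e, ← Path.extend_extends' γ s]
      refine hi _ ⟨?_, ?_⟩
      · rw [← hpt k (by omega)]; exact hs.1
      · have := hpt _ hk; push_cast at this; rw [← this]; exact hs.2
  have h1 : pt N = 1 := by ext; rw [hpt N le_rfl, div_self hN0.ne']; rfl
  have h2 := key N le_rfl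
  rw [h1, Path.subpath_zero_one] at h2
  have hcast : ∀ {x y x' y' : Z} (γ : Path x y) (hx : x' = x) (hy : y' = y),
      P (γ.cast hx hy) → P γ := by
    intro x y x' y' γ hx hy h
    subst hx hy
    exact h
  exact hcast _ _ _ h2

end Subdivision

section Connection

variable {C : Type*} [Groupoid C] (x₀ : C)

open Classical in
/-- A chosen arrow from `x₀` to each object in its component. -/
def chosenArrow (x : C) (h : Nonempty (x₀ ⟶ x)) : x₀ ⟶ x :=
  if e : x₀ = x then eqToHom e else h.some

theorem chosenArrow_self (h : Nonempty (x₀ ⟶ x₀)) : chosenArrow x₀ x₀ h = 𝟙 x₀ := by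
  simp [chosenArrow]

open Classical in
/-- The retraction of a groupoid onto the vertex group at `x₀`, trivial on other components. -/
def groupoidHolonomy {x y : C} (f : x ⟶ y) : (End x₀)ᵐᵒᵖ :=
  if h : Nonempty (x₀ ⟶ x) then
    MulOpposite.op (chosenArrow x₀ x h ≫ f ≫ inv (chosenArrow x₀ y ⟨h.some ≫ f⟩)) else 1

theorem groupoidHolonomy_comp {x y z : C} (f : x ⟶ y) (g : y ⟶ z) :
    groupoidHolonomy x₀ (f ≫ g) = groupoidHolonomy x₀ f * groupoidHolonomy x₀ g := by
  by_cases h : Nonempty (x₀ ⟶ x)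
  · have h' : Nonempty (x₀ ⟶ y) := ⟨h.some ≫ f⟩
    simp only [groupoidHolonomy, dif_pos h, dif_pos h', ← MulOpposite.op_mul, End.mul_def]
    congr 1
    simp
  · have h' : ¬ Nonempty (x₀ ⟶ y) := fun ⟨k⟩ => h ⟨k ≫ inv f⟩
    simp [groupoidHolonomy, dif_neg h, dif_neg h']

theorem groupoidHolonomy_self (f : x₀ ⟶ x₀) :
    groupoidHolonomy x₀ f = MulOpposite.op (End.of f) := by
  have h : Nonempty (x₀ ⟶ x₀) := ⟨f⟩
  simp only [groupoidHolonomy, dif_pos h, chosenArrow_self]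
  congr 1
  simp

end Connection

section PathsInSets

variable {X : Type*} [TopologicalSpace X] {x y z : X} {S T : Set X}

/-- Two paths are homotopic relative to their endpoints within the set `S`. -/
def HomIn (S : Set X) (γ γ' : Path x y) : Prop := ∃ F : γ.Homotopy γ', ∀ p, F p ∈ S

/-- A path lying in `S`, as a path in the subtype. -/
def toSub (S : Set X) (γ : Path x y) (h : ∀ t, γ t ∈ S) :
    Path (⟨x, by simpa using h 0⟩ : S) ⟨y, by simpa using h 1⟩ where
  toFun t := ⟨γ t, h t⟩
  continuous_toFun := by fun_prop
  source' := by simp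
  target' := by simp

@[simp] theorem toSub_apply (γ : Path x y) (h : ∀ t, γ t ∈ S) (t : I) :
    toSub S γ h t = ⟨γ t, h t⟩ := rfl

theorem trans_mem {γ : Path x y} {γ' : Path y z} (h : ∀ t, γ t ∈ S) (h' : ∀ t, γ' t ∈ S) :
    ∀ t, γ.trans γ' t ∈ S := by
  intro t
  rw [Path.trans_apply]
  split_ifs
  · exact h _
  · exact h' _

theorem symm_mem {γ : Path x y} (h : ∀ t, γ t ∈ S) : ∀ t, γ.symm t ∈ S := fun _ => h _

/-- The class in the fundamental groupoid of `S` of a path lying in `S`. -/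
def cl (S : Set X) (γ : Path x y) (h : ∀ t, γ t ∈ S) :
    (⟨⟨x, by simpa using h 0⟩⟩ : FundamentalGroupoid S) ⟶ ⟨⟨y, by simpa using h 1⟩⟩ :=
  Path.Homotopic.Quotient.mk (toSub S γ h)

theorem cl_trans (γ : Path x y) (γ' : Path y z) (h : ∀ t, γ t ∈ S) (h' : ∀ t, γ' t ∈ S) :
    cl S (γ.trans γ') (trans_mem h h') = cl S γ h ≫ cl S γ' h' := by
  have : toSub S (γ.trans γ') (trans_mem h h') = (toSub S γ h).trans (toSub S γ' h') := by
    ext t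
    simp only [toSub_apply, Path.trans_apply]
    split_ifs <;> rfl
  rw [cl, this]
  rfl

theorem cl_symm (γ : Path x y) (h : ∀ t, γ t ∈ S) :
    cl S γ.symm (symm_mem h) = Groupoid.inv (cl S γ h) := rfl

theorem cl_refl (h : x ∈ S) : cl S (Path.refl x) (fun _ => h) = 𝟙 _ := rfl

theorem cl_eq_iff {γ γ' : Path x y} (h : ∀ t, γ t ∈ S) (h' : ∀ t, γ' t ∈ S) :
    cl S γ h = cl S γ' h' ↔ HomIn S γ γ' := by
  rw [cl, cl, Path.Homotopic.Quotient.eq]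
  constructor
  · rintro ⟨F⟩
    exact ⟨(F.map ⟨Subtype.val, continuous_subtype_val⟩).cast rfl rfl, fun p => (F p).2⟩
  · rintro ⟨F, hF⟩
    refine ⟨⟨⟨⟨fun p => ⟨F p, hF p⟩, by fun_prop⟩, fun t => ?_, fun t => ?_⟩, fun t p hp => ?_⟩⟩
    · exact Subtype.ext (by simp)
    · exact Subtype.ext (by simp)
    · exact Subtype.ext (F.prop' t p hp)

theorem HomIn.left {γ γ' : Path x y} (h : HomIn S γ γ') : ∀ t, γ t ∈ S := by
  obtain ⟨F, hF⟩ := h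
  intro t
  have := hF (0, t)
  simpa using this

theorem HomIn.right {γ γ' : Path x y} (h : HomIn S γ γ') : ∀ t, γ' t ∈ S := by
  obtain ⟨F, hF⟩ := h
  intro t
  have := hF (1, t)
  simpa using this

theorem HomIn.cl_eq {γ γ' : Path x y} (h : HomIn S γ γ') : cl S γ h.left = cl S γ' h.right :=
  (cl_eq_iff _ _).2 h

theorem HomIn.mono {γ γ' : Path x y} (hST : S ⊆ T) (h : HomIn S γ γ') : HomIn T γ γ' :=
  ⟨h.choose, fun p => hST (h.choose_spec p)⟩

theorem HomIn.homotopic {γ γ' : Path x y} (h : HomIn S γ γ') : γ.Homotopic γ' := ⟨h.choose⟩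

theorem HomIn.symm {γ γ' : Path x y} (h : HomIn S γ γ') : HomIn S γ' γ :=
  (cl_eq_iff _ _).1 h.cl_eq.symm

theorem HomIn.trans {γ γ' γ'' : Path x y} (h : HomIn S γ γ') (h' : HomIn S γ' γ'') :
    HomIn S γ γ'' :=
  (cl_eq_iff _ _).1 (h.cl_eq.trans h'.cl_eq)

/-- The functor of fundamental groupoids induced by the inclusion of a subset. -/
abbrev inclF (S : Set X) : FundamentalGroupoid S ⥤ FundamentalGroupoid X :=
  FundamentalGroupoid.map ⟨Subtype.val, continuous_subtype_val⟩

theorem inclF_essSurj_iff : (inclF S).EssSurj ↔ ∀ z, ∃ w ∈ S, Joined w z := by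
  constructor
  · intro h z
    obtain ⟨⟨⟨w, hw⟩⟩, ⟨i⟩⟩ := h.mem_essImage ⟨z⟩
    obtain ⟨p⟩ := i.hom
    exact ⟨w, hw, ⟨p⟩⟩
  · intro h
    refine ⟨fun ⟨z⟩ => ?_⟩
    obtain ⟨w, hw, ⟨p⟩⟩ := h z
    let f : (⟨w⟩ : FundamentalGroupoid X) ⟶ ⟨z⟩ := Path.Homotopic.Quotient.mk p
    exact ⟨⟨⟨w, hw⟩⟩, ⟨Groupoid.isoEquivHom _ _ |>.symm f⟩⟩

theorem inclF_full_iff : (inclF S).Full ↔ ∀ (x y : X) (_ : x ∈ S) (_ : y ∈ S) (γ : Path x y),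
    ∃ δ : Path x y, (∀ t, δ t ∈ S) ∧ γ.Homotopic δ := by
  constructor
  · intro h x y hx hy γ
    let f : (inclF S).obj ⟨⟨x, hx⟩⟩ ⟶ (inclF S).obj ⟨⟨y, hy⟩⟩ := Path.Homotopic.Quotient.mk γ
    obtain ⟨g, hg⟩ := h.map_surjective f
    obtain ⟨d⟩ := g
    refine ⟨d.map continuous_subtype_val, fun t => (d t).2, ?_⟩
    exact (Path.Homotopic.Quotient.eq.1 hg).symm
  · intro h
    refine ⟨?_⟩
    rintro ⟨⟨x, hx⟩⟩ ⟨⟨y, hy⟩⟩ ⟨γ⟩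
    obtain ⟨δ, hδ, e⟩ := h x y hx hy γ
    refine ⟨cl S δ hδ, ?_⟩
    exact Path.Homotopic.Quotient.eq.2 e.symm

theorem inclF_faithful_iff : (inclF S).Faithful ↔ ∀ (x : X) (_ : x ∈ S) (γ : Path x x),
    (∀ t, γ t ∈ S) → γ.Homotopic (Path.refl x) → HomIn S γ (Path.refl x) := by
  constructor
  · intro h x hx γ hγ e
    refine (cl_eq_iff hγ (fun _ => hx)).1 (h.map_injective ?_)
    exact Path.Homotopic.Quotient.eq.2 e
  · intro h
    have key : ∀ (a : FundamentalGroupoid S) (f : a ⟶ a), (inclF S).map f = 𝟙 _ → f = 𝟙 a := by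
      rintro ⟨⟨x, hx⟩⟩ ⟨γ⟩ e
      have := h x hx (γ.map continuous_subtype_val) (fun t => (γ t).2)
        (Path.Homotopic.Quotient.eq.1 e)
      exact this.cl_eq
    refine ⟨fun {a b f g} e => ?_⟩
    have := key a (f ≫ inv g) (by rw [Functor.map_comp, e, ← Functor.map_comp, IsIso.hom_inv_id,
      CategoryTheory.Functor.map_id])
    simpa using (IsIso.comp_inv_eq g).1 this

end PathsInSets

section Transfer

variable {X Y : Type*} [TopologicalSpace X] [TopologicalSpace Y]

/-- A homotopy equivalence induces an equivalence of fundamental groupoids. -/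
theorem map_isEquivalence (f : C(X, Y)) (g : C(Y, X))
    (h : (g.comp f).Homotopic (ContinuousMap.id X)) (h' : (f.comp g).Homotopic (ContinuousMap.id Y)) :
    (FundamentalGroupoid.map f).IsEquivalence :=
  (FundamentalGroupoidFunctor.equivOfHomotopyEquiv ⟨f, g, h, h'⟩).isEquivalence_functor

/-- A homotopy equivalence of pairs. -/
structure PairEquiv (X₀ : Set X) (Y₀ : Set Y) where
  toFun : C(X, Y)
  invFun : C(Y, X)
  mapsTo : ∀ x ∈ X₀, toFun x ∈ Y₀
  invMapsTo : ∀ y ∈ Y₀, invFun y ∈ X₀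
  H : (invFun.comp toFun).Homotopy (ContinuousMap.id X)
  H_mem : ∀ t, ∀ x ∈ X₀, H (t, x) ∈ X₀
  K : (toFun.comp invFun).Homotopy (ContinuousMap.id Y)
  K_mem : ∀ t, ∀ y ∈ Y₀, K (t, y) ∈ Y₀

namespace PairEquiv

variable {X₀ : Set X} {Y₀ : Set Y}

/-- The restriction of the map of pairs. -/
def restr (e : PairEquiv X₀ Y₀) : C(X₀, Y₀) := ⟨fun x => ⟨e.toFun x, e.mapsTo x x.2⟩, by fun_prop⟩

theorem isEquivalence (e : PairEquiv X₀ Y₀) : (FundamentalGroupoid.map e.toFun).IsEquivalence :=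
  map_isEquivalence _ _ ⟨e.H⟩ ⟨e.K⟩

theorem isEquivalence_restr (e : PairEquiv X₀ Y₀) : (FundamentalGroupoid.map e.restr).IsEquivalence := by
  refine map_isEquivalence _ ⟨fun y => ⟨e.invFun y, e.invMapsTo y y.2⟩, by fun_prop⟩ ⟨?_⟩ ⟨?_⟩
  · refine ⟨⟨fun p => ⟨e.H (p.1, p.2), e.H_mem _ _ p.2.2⟩, by fun_prop⟩, fun x => ?_, fun x => ?_⟩
    · exact Subtype.ext (by simp [restr])
    · exact Subtype.ext (by simp)
  · refine ⟨⟨fun p => ⟨e.K (p.1, p.2), e.K_mem _ _ p.2.2⟩, by fun_prop⟩, fun x => ?_, fun x => ?_⟩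
    · exact Subtype.ext (by simp [restr])
    · exact Subtype.ext (by simp)

theorem square (e : PairEquiv X₀ Y₀) : inclF X₀ ⋙ FundamentalGroupoid.map e.toFun =
    FundamentalGroupoid.map e.restr ⋙ inclF Y₀ := by
  rw [← FundamentalGroupoid.map_comp, ← FundamentalGroupoid.map_comp]
  rfl

theorem essSurj (e : PairEquiv X₀ Y₀) (h : (inclF Y₀).EssSurj) : (inclF X₀).EssSurj := by
  have := e.isEquivalence
  have := e.isEquivalence_restr
  have h1 : (inclF X₀ ⋙ FundamentalGroupoid.map e.toFun).EssSurj := by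
    rw [e.square]; infer_instance
  refine ⟨fun x => ?_⟩
  obtain ⟨w, ⟨i⟩⟩ := h1.mem_essImage ((FundamentalGroupoid.map e.toFun).obj x)
  exact ⟨w, ⟨(FundamentalGroupoid.map e.toFun).preimageIso i⟩⟩

theorem full (e : PairEquiv X₀ Y₀) (h : (inclF Y₀).Full) : (inclF X₀).Full := by
  have := e.isEquivalence
  have := e.isEquivalence_restr
  have h1 : (inclF X₀ ⋙ FundamentalGroupoid.map e.toFun).Full := by
    rw [e.square]; infer_instance
  exact Functor.Full.of_comp_faithful _ (FundamentalGroupoid.map e.toFun)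

theorem faithful (e : PairEquiv X₀ Y₀) (h : (inclF Y₀).Faithful) : (inclF X₀).Faithful := by
  have := e.isEquivalence_restr
  have h1 : (inclF X₀ ⋙ FundamentalGroupoid.map e.toFun).Faithful := by
    rw [e.square]; infer_instance
  exact Functor.Faithful.of_comp _ (FundamentalGroupoid.map e.toFun)

end PairEquiv

end Transfer

section LocalToGlobal

variable {Z : Type*} [TopologicalSpace Z] {ι : Type*} {V : ι → Set Z} {Z₀ : Set Z}

theorem homIn_of_faithful
    (hI : ∀ i, ∀ x ∈ Z₀, ∀ γ : Path x x, (∀ t, γ t ∈ Z₀) → HomIn (V i) γ (Path.refl x) →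
      HomIn Z₀ γ (Path.refl x))
    {i : ι} {x y : Z} {γ γ' : Path x y} (h : ∀ t, γ t ∈ Z₀) (h' : ∀ t, γ' t ∈ Z₀)
    (e : HomIn (V i) γ γ') : HomIn Z₀ γ γ' := by
  have hx : x ∈ Z₀ := by simpa using h 0
  have hxV : x ∈ V i := by simpa using e.left 0
  have h1 : HomIn (V i) (γ.trans γ'.symm) (Path.refl x) := by
    refine (cl_eq_iff (trans_mem e.left (symm_mem e.right)) fun _ => hxV).1 ?_
    rw [cl_trans _ _ e.left (symm_mem e.right), cl_symm _ e.right, e.cl_eq, cl_refl hxV]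
    simp
  have h2 := (hI i x hx _ (trans_mem h (symm_mem h')) h1).cl_eq
  rw [cl_trans _ _ h (symm_mem h'), cl_symm _ h', cl_refl hx] at h2
  refine (cl_eq_iff h h').1 ?_
  have := congrArg (· ≫ cl Z₀ γ' h') h2
  simpa using this

/-- The concatenation of `p`, `γ` and the reverse of `q`. -/
def conjPath {a b x y : Z} (p : Path a x) (γ : Path x y) (q : Path b y) : Path a b :=
  (p.trans γ).trans q.symm

theorem conjPath_mem {S : Set Z} {a b x y : Z} {p : Path a x} {γ : Path x y} {q : Path b y}
    (hp : ∀ t, p t ∈ S) (hγ : ∀ t, γ t ∈ S) (hq : ∀ t, q t ∈ S) : ∀ t, conjPath p γ q t ∈ S :=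
  trans_mem (trans_mem hp hγ) (symm_mem hq)

theorem cl_conjPath {S : Set Z} {a b x y : Z} {p : Path a x} {γ : Path x y} {q : Path b y}
    (hp : ∀ t, p t ∈ S) (hγ : ∀ t, γ t ∈ S) (hq : ∀ t, q t ∈ S) :
    cl S (conjPath p γ q) (conjPath_mem hp hγ hq) =
      (cl S p hp ≫ cl S γ hγ) ≫ Groupoid.inv (cl S q hq) := by
  have h1 := cl_trans (p.trans γ) q.symm (trans_mem hp hγ) (symm_mem hq)
  rw [cl_symm _ hq, cl_trans _ _ hp hγ] at h1
  exact h1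

theorem homIn_cast_of_conjPath {S : Set Z} {a c x y : Z} (h1 : a = x) (h2 : c = y)
    {γ : Path x y} (hγ : ∀ t, γ t ∈ S) {δ : Path a c}
    (e : HomIn S (conjPath ((Path.refl x).cast h1 rfl) γ ((Path.refl y).cast h2 rfl)) δ) :
    HomIn S γ (δ.cast h1.symm h2.symm) := by
  subst h1 h2
  refine HomIn.trans ?_ e
  have hx : a ∈ S := by simpa using hγ 0
  have hy : c ∈ S := by simpa using hγ 1
  refine (cl_eq_iff hγ (conjPath_mem (fun _ => hx) hγ (fun _ => hy))).1 ?_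
  refine Eq.trans ?_ (cl_conjPath (fun _ => hx) hγ (fun _ => hy)).symm
  have r1 : cl S ((Path.refl a).cast rfl rfl) (fun _ => hx) = 𝟙 _ := rfl
  have r2 : cl S ((Path.refl c).cast rfl rfl) (fun _ => hy) = 𝟙 _ := rfl
  rw [r1, r2]
  simp

/-- If the inclusions `V i ∩ Z₀ → V i` are faithful, the inclusions `V i ∩ V j ∩ Z₀ → V i ∩ V j`
are full and those of all intersections are essentially surjective on fundamental groupoids,
then the inclusion of `Z₀` has these three properties. -/
theorem inclF_local_to_global (hV : ∀ i, IsOpen (V i)) (hc : ∀ z, ∃ i, z ∈ V i)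
    (hE : ∀ z, ∃ w ∈ Z₀, ∃ p : Path w z, ∀ i, z ∈ V i → ∀ t, p t ∈ V i)
    (hF : ∀ i j, ∀ x ∈ Z₀, ∀ y ∈ Z₀, ∀ γ : Path x y, (∀ t, γ t ∈ V i) → (∀ t, γ t ∈ V j) →
      ∃ δ : Path x y, (∀ t, δ t ∈ Z₀) ∧ HomIn (V i ∩ V j) γ δ)
    (hI : ∀ i, ∀ x ∈ Z₀, ∀ γ : Path x x, (∀ t, γ t ∈ Z₀) → HomIn (V i) γ (Path.refl x) →
      HomIn Z₀ γ (Path.refl x)) :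
    (inclF Z₀).EssSurj ∧ (inclF Z₀).Full ∧ (inclF Z₀).Faithful := by
  have hE' : ∀ z, ∃ w ∈ Z₀, ∃ p : Path w z, (∀ i, z ∈ V i → ∀ t, p t ∈ V i) ∧
      (z ∈ Z₀ → ∃ h : w = z, p = (Path.refl z).cast h rfl) := by
    intro z
    by_cases hz : z ∈ Z₀
    · exact ⟨z, hz, Path.refl z, fun i hi _ => hi, fun _ => ⟨rfl, rfl⟩⟩
    · obtain ⟨w, hw, p, hp⟩ := hE z
      exact ⟨w, hw, p, hp, fun h => absurd h hz⟩
  choose b hb p hp hp0 using hE'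
  have ptmem : ∀ {x y : Z} {S : Set Z} {γ : Path x y}, (∀ t, γ t ∈ S) → x ∈ S ∧ y ∈ S :=
    fun {x y S γ} h => ⟨by simpa using h 0, by simpa using h 1⟩
  have hlift : ∀ (i : ι) {x y : Z} (γ : Path x y), (∀ t, γ t ∈ V i) → ∃ δ : Path (b x) (b y),
      (∀ t, δ t ∈ Z₀) ∧ HomIn (V i) (conjPath (p x) γ (p y)) δ := by
    intro i x y γ h
    have := conjPath_mem (hp x i (ptmem h).1) h (hp y i (ptmem h).2)
    obtain ⟨δ, hδ, e⟩ := hF i i _ (hb x) _ (hb y) _ this this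
    exact ⟨δ, hδ, e.mono Set.inter_subset_left⟩
  refine ⟨?_, ?_, ?_⟩
  · exact inclF_essSurj_iff.2 fun z => ⟨b z, hb z, ⟨p z⟩⟩
  · rw [inclF_full_iff]
    have key : ∀ {x y : Z} (γ : Path x y), ∃ δ : Path (b x) (b y),
        (∀ t, δ t ∈ Z₀) ∧ (conjPath (p x) γ (p y)).Homotopic δ := by
      intro x y γ
      refine path_induction hV hc (P := fun {x y} γ => ∃ δ : Path (b x) (b y),
        (∀ t, δ t ∈ Z₀) ∧ (conjPath (p x) γ (p y)).Homotopic δ) ?_ ?_ ?_ γ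
      · intro x y γ i h
        obtain ⟨δ, hδ, e⟩ := hlift i γ h
        exact ⟨δ, hδ, e.homotopic⟩
      · rintro x y z γ γ' ⟨δ, hδ, e⟩ ⟨δ', hδ', e'⟩
        refine ⟨δ.trans δ', trans_mem hδ hδ', ?_⟩
        rw [← Path.Homotopic.Quotient.eq] at e e' ⊢
        rw [Path.Homotopic.Quotient.mk_trans, ← e, ← e']
        simp [conjPath, Path.Homotopic.Quotient.mk_trans, Path.Homotopic.Quotient.mk_symm]
        rw [← Path.Homotopic.Quotient.trans_assoc (Path.Homotopic.Quotient.symm _)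
          (Path.Homotopic.Quotient.mk (p y))]
        simp
      · rintro x y γ γ' e ⟨δ, hδ, e'⟩
        refine ⟨δ, hδ, Path.Homotopic.trans ?_ e'⟩
        exact Path.Homotopic.hcomp (Path.Homotopic.hcomp (.refl _) e.symm) (.refl _)
    intro x y hx hy γ
    obtain ⟨δ, hδ, e⟩ := key γ
    obtain ⟨h1, e1⟩ := hp0 x hx
    obtain ⟨h2, e2⟩ := hp0 y hy
    refine ⟨δ.cast h1.symm h2.symm, hδ, ?_⟩
    rw [e1, e2] at e
    exact (homIn_cast_of_conjPath h1 h2 (S := Set.univ) (by simp)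
      ⟨e.some, fun _ => trivial⟩).homotopic
  · rw [inclF_faithful_iff]
    intro x₀ hx₀ γ₀ hγ₀ hnull
    let o : FundamentalGroupoid Z₀ := ⟨⟨x₀, hx₀⟩⟩
    let ν : ∀ {x y : Z} (δ : Path x y), (∀ t, δ t ∈ Z₀) → (End o)ᵐᵒᵖ :=
      fun δ h => groupoidHolonomy o (cl Z₀ δ h)
    have ν_eq : ∀ {x y : Z} {δ δ' : Path x y} (h : ∀ t, δ t ∈ Z₀) (h' : ∀ t, δ' t ∈ Z₀) (i : ι),
        HomIn (V i) δ δ' → ν δ h = ν δ' h' := by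
      intro x y δ δ' h h' i e
      simp only [ν, (homIn_of_faithful hI h h' e).cl_eq]
    choose lift hlift0 hliftV using hlift
    let L : LocalHolonomy V (End o)ᵐᵒᵖ :=
      { map := fun i x y γ h => ν (lift i γ h) (hlift0 i γ h)
        map_homotopy := by
          intro i x y γ γ' F hF h h'
          refine ν_eq _ _ i ((hliftV i γ h).symm.trans (HomIn.trans ?_ (hliftV i γ' h')))
          have e : cl (V i) γ h = cl (V i) γ' h' := (cl_eq_iff h h').2 ⟨F, hF⟩
          have hx := hp x i (ptmem h).1
          have hy := hp y i (ptmem h).2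
          refine (cl_eq_iff (conjPath_mem hx h hy) (conjPath_mem hx h' hy)).1 ?_
          rw [cl_conjPath hx h hy, cl_conjPath hx h' hy, e]
        map_trans := by
          intro i x y z γ γ' h h' h''
          have hx := hp x i (ptmem h).1
          have hy := hp y i (ptmem h).2
          have hz := hp z i (ptmem h').2
          have e1 := (hliftV i γ h).cl_eq
          have e2 := (hliftV i γ' h').cl_eq
          rw [cl_conjPath hx h hy] at e1
          rw [cl_conjPath hy h' hz] at e2
          have : ν _ (hlift0 i (γ.trans γ') h'') =
              ν ((lift i γ h).trans (lift i γ' h')) (trans_mem (hlift0 i γ h) (hlift0 i γ' h')) := by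
            refine ν_eq _ _ i ((hliftV i _ h'').symm.trans ?_)
            refine (cl_eq_iff (conjPath_mem hx h'' hz)
              (trans_mem (hliftV i γ h).right (hliftV i γ' h').right)).1 ?_
            rw [cl_conjPath hx h'' hz, cl_trans _ _ h h',
              cl_trans _ _ (hliftV i γ h).right (hliftV i γ' h').right, ← e1, ← e2]
            simp
          rw [this]
          simp only [ν]
          rw [← groupoidHolonomy_comp, cl_trans]
        map_agree := by
          intro i j x y γ h h'
          have hxi := hp x i (ptmem h).1
          have hyi := hp y i (ptmem h).2
          have hxj := hp x j (ptmem h').1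
          have hyj := hp y j (ptmem h').2
          obtain ⟨δ, hδ, e⟩ := hF i j _ (hb x) _ (hb y) (conjPath (p x) γ (p y))
            (conjPath_mem hxi h hyi) (conjPath_mem hxj h' hyj)
          rw [ν_eq (hlift0 i γ h) hδ i ((hliftV i γ h).symm.trans (e.mono Set.inter_subset_left)),
            ν_eq (hlift0 j γ h') hδ j
              ((hliftV j γ h').symm.trans (e.mono Set.inter_subset_right))] }
    let U : ι → Set Z₀ := fun i => Subtype.val ⁻¹' V i
    have hval : Continuous (Subtype.val : Z₀ → Z) := continuous_subtype_val
    have small : ∀ {x y : Z} (δ : Path x y) (hδ : ∀ t, δ t ∈ Z₀) (i : ι) (h : ∀ t, δ t ∈ V i),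
        L.map i δ h = ν δ hδ := by
      intro x y δ hδ i h
      obtain ⟨h1, e1⟩ := hp0 x (ptmem hδ).1
      obtain ⟨h2, e2⟩ := hp0 y (ptmem hδ).2
      have e := hliftV i δ h
      rw [e1, e2] at e
      have hcast : ∀ {a c x y : Z} (h1 : a = x) (h2 : c = y) (δ : Path a c) (h : ∀ t, δ t ∈ Z₀),
          ν (δ.cast h1.symm h2.symm) h = ν δ h := by
        intro a c x y h1 h2 δ h
        subst h1 h2
        rfl
      exact (hcast h1 h2 _ (hlift0 i δ h)).symm.trans
        (ν_eq (δ := (lift i δ h).cast h1.symm h2.symm) (hlift0 i δ h) hδ i (homIn_cast_of_conjPath h1 h2 h e).symm)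
    have key : ∀ {x y : Z₀} (δ : Path x y), L.total hV hc (δ.map hval) =
        ν (δ.map hval) (fun t => (δ t).2) := by
      intro x y δ
      refine path_induction (V := U) (fun i => (hV i).preimage hval) (fun z => hc z)
        (P := fun {x y} δ => L.total hV hc (δ.map hval) = ν (δ.map hval) (fun t => (δ t).2))
        ?_ ?_ ?_ δ
      · intro x y δ i h
        exact (L.total_map hV hc _ i h).trans (small _ _ i h)
      · intro x y z δ δ' e e'
        have e3 : cl Z₀ ((δ.trans δ').map hval) (fun t => ((δ.trans δ') t).2) =
            cl Z₀ (δ.map hval) (fun t => (δ t).2) ≫ cl Z₀ (δ'.map hval) (fun t => (δ' t).2) := rfl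
        refine (congrArg (L.total hV hc) (Path.map_trans δ δ' hval)).trans ?_
        rw [L.total_trans, e, e']
        simp only [ν]
        rw [← groupoidHolonomy_comp, ← e3]
      · rintro x y δ δ' e h
        rw [← L.total_homotopic hV hc (e.map ⟨_, hval⟩), h]
        simp only [ν]
        congr 1
        exact Path.Homotopic.Quotient.eq.2 e
    have e1 := key (toSub Z₀ γ₀ hγ₀)
    have e2 := key (Path.refl (⟨x₀, hx₀⟩ : Z₀))
    have e5 : ν γ₀ hγ₀ = ν (Path.refl x₀) (fun _ => hx₀) := by
      exact e1.symm.trans ((L.total_homotopic hV hc hnull).trans e2)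
    simp only [ν] at e5
    rw [groupoidHolonomy_self o, groupoidHolonomy_self o] at e5
    exact (cl_eq_iff _ _).1 (MulOpposite.op_injective e5)

end LocalToGlobal

section Carry

variable {κ : Type*} [Fintype κ]

/-- A map of the plane moving each point `f j` to `g j`, supported near the points `f j`. -/
def pushMap (δ : ℝ) (f g : κ → ℂ) (x : ℂ) : ℂ :=
  x + ∑ j, (max 0 (1 - ‖x - f j‖ / δ) : ℝ) • (g j - f j)

theorem pushMap_self (δ : ℝ) (f : κ → ℂ) (x : ℂ) : pushMap δ f f x = x := by simp [pushMap]

theorem pushMap_apply {δ : ℝ} (hδ : 0 < δ) {f : κ → ℂ} (hf : ∀ i j, i ≠ j → δ ≤ ‖f i - f j‖)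
    (g : κ → ℂ) (i : κ) : pushMap δ f g (f i) = g i := by
  rw [pushMap, Finset.sum_eq_single i]
  · simp
  · intro j _ hj
    have : 1 ≤ ‖f i - f j‖ / δ := by rw [one_le_div hδ]; exact hf _ _ (Ne.symm hj)
    rw [max_eq_left (by linarith), zero_smul]
  · simp

theorem abs_max_zero_sub_le (a b : ℝ) : |max 0 a - max 0 b| ≤ |a - b| := by
  have e := abs_max_sub_max_le_max 0 a 0 b
  simp only [sub_self, abs_zero] at e
  rwa [max_eq_right (abs_nonneg (a - b))] at e

theorem pushMap_injective {δ : ℝ} (hδ : 0 < δ) {f g : κ → ℂ}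
    (h : ∀ j, ‖g j - f j‖ ≤ δ / (2 * (Fintype.card κ + 1))) :
    Function.Injective (pushMap δ f g) := by
  intro x y hxy
  by_contra hne
  have hpos : 0 < ‖x - y‖ := norm_pos_iff.2 (sub_ne_zero.2 hne)
  have e : x - y = ∑ j, ((max 0 (1 - ‖y - f j‖ / δ) : ℝ) - (max 0 (1 - ‖x - f j‖ / δ) : ℝ)) •
      (g j - f j) := by
    simp only [pushMap] at hxy
    simp only [sub_smul, Finset.sum_sub_distrib]
    linear_combination hxy
  have hc : (0 : ℝ) < 2 * (Fintype.card κ + 1) := by positivity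
  have hb : ∀ j, ‖((max 0 (1 - ‖y - f j‖ / δ) : ℝ) - (max 0 (1 - ‖x - f j‖ / δ) : ℝ)) •
      (g j - f j)‖ ≤ ‖x - y‖ / (2 * (Fintype.card κ + 1)) := by
    intro j
    rw [norm_smul]
    have h1 : ‖(max 0 (1 - ‖y - f j‖ / δ) : ℝ) - (max 0 (1 - ‖x - f j‖ / δ) : ℝ)‖ ≤ ‖x - y‖ / δ := by
      rw [Real.norm_eq_abs]
      refine (abs_max_zero_sub_le _ _).trans ?_
      have : (1 - ‖y - f j‖ / δ) - (1 - ‖x - f j‖ / δ) = (‖x - f j‖ - ‖y - f j‖) / δ := by ring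
      rw [this, abs_div, abs_of_pos hδ]
      gcongr
      refine (abs_norm_sub_norm_le _ _).trans_eq ?_
      congr 1; ring
    calc _ ≤ ‖x - y‖ / δ * (δ / (2 * (Fintype.card κ + 1))) := by gcongr; exact h j
      _ = _ := by field_simp
  have hs := norm_sum_le_of_le Finset.univ (fun j _ => hb j)
  rw [← e, Finset.sum_const, nsmul_eq_mul, Finset.card_univ] at hs
  have : (Fintype.card κ : ℝ) * (‖x - y‖ / (2 * (Fintype.card κ + 1))) < ‖x - y‖ := by
    rw [← mul_div_assoc, div_lt_iff₀ hc]
    nlinarith [(Nat.cast_nonneg (Fintype.card κ) : (0 : ℝ) ≤ _)]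
  linarith

/-- Composition of the maps `pushMap` along a subdivision of a motion of finitely many points. -/
def carryMap {K : Type*} (δ : ℝ) (N : ℕ) (F : K × ℝ → κ → ℂ) : ℕ → K → ℝ → ℂ → ℂ
  | 0, _, _, x => x
  | n + 1, k, t, x => pushMap δ (F (k, min t (n / N))) (F (k, min t ((n + 1) / N)))
      (carryMap δ N F n k t x)

/-- Isotopy extension in the plane: a motion of finitely many distinct points depending on a
parameter in a compact space extends to a motion of the plane through injective maps. -/
theorem exists_carry {K : Type*} [TopologicalSpace K] [CompactSpace K] (F : C(K × I, κ → ℂ))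
    (hF : ∀ p, Function.Injective (F p)) :
    ∃ Φ : C((K × I) × ℂ, ℂ), (∀ p, Function.Injective fun x => Φ (p, x)) ∧
      (∀ k t j, Φ ((k, t), F (k, 0) j) = F (k, t) j) ∧ (∀ k x, Φ ((k, 0), x) = x) ∧
      (∀ k, (∀ t, F (k, t) = F (k, 0)) → ∀ t x, Φ ((k, t), x) = x) := by
  classical
  obtain ⟨δ, δ0, hδ⟩ : ∃ δ > 0, ∀ p i j, i ≠ j → δ ≤ ‖F p i - F p j‖ := by
    have : ∀ i j, ∃ δ > 0, i ≠ j → ∀ p, δ ≤ ‖F p i - F p j‖ := by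
      intro i j
      by_cases hij : i = j
      · exact ⟨1, one_pos, fun h => absurd hij h⟩
      rcases isEmpty_or_nonempty (K × I) with hK | hK
      · exact ⟨1, one_pos, fun _ p => isEmptyElim p⟩
      obtain ⟨p₀, -, h⟩ := isCompact_univ.exists_isMinOn (Set.univ_nonempty (α := K × I))
        (f := fun p => ‖F p i - F p j‖) (by fun_prop)
      refine ⟨‖F p₀ i - F p₀ j‖, norm_pos_iff.2 (sub_ne_zero.2 fun e => hij (hF _ e)), fun _ p => ?_⟩
      exact h (Set.mem_univ p)
    choose d hd0 hd using this
    rcases isEmpty_or_nonempty κ with hκ | hκ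
    · exact ⟨1, one_pos, fun _ i => isEmptyElim i⟩
    refine ⟨Finset.univ.inf' Finset.univ_nonempty fun q : κ × κ => d q.1 q.2, ?_, ?_⟩
    · rw [gt_iff_lt, Finset.lt_inf'_iff]
      exact fun q _ => hd0 _ _
    · intro p i j hij
      exact (Finset.inf'_le _ (Finset.mem_univ (i, j))).trans (hd i j hij p)
  let ε := δ / (2 * (Fintype.card κ + 1))
  have hε : 0 < ε := by positivity
  obtain ⟨N, hN0, hN⟩ : ∃ N : ℕ, 0 < N ∧ ∀ k, ∀ s t : I, |(s : ℝ) - t| ≤ 1 / N →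
      ‖F (k, s) - F (k, t)‖ ≤ ε := by
    let G : C(K, C(I, κ → ℂ)) := F.curry
    obtain ⟨d, hd0, hd⟩ := Metric.uniformContinuous_iff.1
      (CompactSpace.uniformContinuous_of_continuous (f := (F.comp
        (ContinuousMap.prodSwap : C(I × K, K × I))).curry) (by fun_prop)) ε hε
    obtain ⟨N, hN⟩ := exists_nat_gt (1 / d)
    have hN0 : (0 : ℝ) < N := lt_trans (by positivity) hN
    refine ⟨N, by exact_mod_cast hN0, fun k s t hst => ?_⟩
    have h1 : dist s t < d := by
      rw [Subtype.dist_eq, Real.dist_eq]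
      refine hst.trans_lt ?_
      rw [div_lt_iff₀ hN0]; rw [div_lt_iff₀ hd0] at hN; linarith
    have := (ContinuousMap.dist_lt_iff hε).1 (hd h1) k
    rw [dist_eq_norm] at this
    exact this.le
  have hNr : (0 : ℝ) < N := by exact_mod_cast hN0
  let E : K × ℝ → κ → ℂ := fun q => F (q.1, Set.projIcc 0 1 zero_le_one q.2)
  have hE : Continuous E := by fun_prop
  have hstep : ∀ k t (n : ℕ), ∀ j, ‖E (k, min t ((n + 1) / N)) j - E (k, min t (n / N)) j‖ ≤ ε := by
    intro k t n j
    refine (norm_le_pi_norm (E (k, min t ((n + 1) / N)) - E (k, min t (n / N))) j).trans ?_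
    refine hN _ _ _ ?_
    rw [Set.coe_projIcc, Set.coe_projIcc]
    have h1 : |min t ((n + 1) / N) - min t (n / N)| ≤ 1 / (N : ℝ) := by
      have := abs_min_sub_min_le_max t ((n + 1) / N) t ((n : ℝ) / N)
      refine this.trans ?_
      rw [sub_self, abs_zero, ← sub_div, add_sub_cancel_left, abs_of_pos (by positivity)]
      exact max_le (by positivity) le_rfl
    have h2 : ∀ a b : ℝ, |max 0 (min 1 a) - max 0 (min 1 b)| ≤ |a - b| := by
      intro a b
      have e2 := abs_min_sub_min_le_max 1 a 1 b
      simp only [sub_self, abs_zero] at e2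
      rw [max_eq_right (abs_nonneg (a - b))] at e2
      exact (abs_max_zero_sub_le _ _).trans e2
    exact (h2 _ _).trans h1
  have cont : ∀ n, Continuous fun q : (K × I) × ℂ => carryMap δ N E n q.1.1 q.1.2 q.2 := by
    intro n
    induction n with
    | zero => exact continuous_snd
    | succ n ih =>
      simp only [carryMap, pushMap]
      fun_prop
  have inj : ∀ n k t, Function.Injective fun x => carryMap δ N E n k t x := by
    intro n k t
    induction n with
    | zero => exact fun _ _ h => h
    | succ n ih => exact (pushMap_injective δ0 (hstep k t n)).comp ih
  have mv : ∀ (n : ℕ) k (t : I) j, carryMap δ N E n k t (F (k, 0) j) = E (k, min (t : ℝ) (n / N)) j := by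
    intro n k t j
    induction n with
    | zero => simp [carryMap, E, t.2.1]
    | succ n ih =>
      rw [carryMap, ih, pushMap_apply δ0 (hδ _)]
      push_cast
      rfl
  refine ⟨⟨_, cont N⟩, fun p => inj N p.1 p.2, fun k t j => ?_, fun k x => ?_, fun k hk t x => ?_⟩
  · refine (mv N k t j).trans ?_
    rw [div_self hNr.ne', min_eq_left t.2.2]
    simp [E]
  · have : ∀ n, carryMap δ N E n k 0 x = x := by
      intro n
      induction n with
      | zero => rfl
      | succ n ih =>
        rw [carryMap, ih, min_eq_left (by positivity), min_eq_left (by positivity), pushMap_self]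
    exact this N
  · have : ∀ n, carryMap δ N E n k t x = x := by
      intro n
      induction n with
      | zero => rfl
      | succ n ih =>
        rw [carryMap, ih]
        simp only [E, hk]
        rw [pushMap_self]
    exact this N

end Carry

section MarkedConfigurations

/-- Disjointness of the wickets with centres `m, m'` and radius vectors `r, r'`. -/
def WDisj (m r m' r' : ℂ) : Prop :=
  ∀ t ∈ Set.Icc (-1 : ℝ) 1, ∀ t' ∈ Set.Icc (-1 : ℝ) 1, m + t * r = m' + t' * r' →
    (1 - t ^ 2) * ‖r‖ ^ 2 ≠ (1 - t' ^ 2) * ‖r'‖ ^ 2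

/-- Configurations of disjoint wickets labelled by `κ`, each given by its centre and a logarithm
of its radius vector. -/
def Conf (κ : Type*) : Set (κ → ℂ × ℂ) :=
  {X | ∀ i j, i ≠ j → WDisj (X i).1 (Complex.exp (X i).2) (X j).1 (Complex.exp (X j).2)}

/-- Configurations in which all radius vectors are positive reals. -/
def flat (κ : Type*) : Set (Conf κ) := {X | ∀ i, (X.1 i).2.im = 0}

/-- The endpoints of the wickets. -/
def feet {κ : Type*} (X : κ → ℂ × ℂ) (i : κ × Bool) : ℂ :=
  (X i.1).1 + (if i.2 then 1 else -1) * Complex.exp (X i.1).2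

theorem continuous_feet {κ : Type*} : Continuous (feet (κ := κ)) := by
  refine continuous_pi fun i => ?_
  unfold feet
  fun_prop

theorem feet_injective {κ : Type*} {X : κ → ℂ × ℂ} (hX : X ∈ Conf κ) :
    Function.Injective (feet X) := by
  rintro ⟨i, a⟩ ⟨j, b⟩ h
  have key : ∀ a : Bool, ∃ t ∈ Set.Icc (-1 : ℝ) 1, t ^ 2 = 1 ∧ (if a then (1 : ℂ) else -1) = t := by
    rintro (_ | _)
    · exact ⟨-1, by simp, by simp, by simp⟩
    · exact ⟨1, by simp, by simp, by simp⟩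
  obtain ⟨t, ht, ht2, et⟩ := key a
  obtain ⟨t', ht', ht2', et'⟩ := key b
  simp only [feet, et, et'] at h
  obtain rfl : i = j := by
    by_contra hij
    exact hX i j hij t ht t' ht' h (by rw [ht2, ht2']; ring)
  have : (t : ℂ) = t' := by
    have h1 := add_left_cancel h
    exact mul_right_cancel₀ (Complex.exp_ne_zero _) h1
  rw [← et, ← et'] at this
  have h2 : (1 : ℂ) ≠ -1 := by norm_num
  cases a <;> cases b
  · rfl
  · exact absurd this.symm h2
  · exact absurd this h2
  · rfl

/-- Configurations with additional distinct marked points, away from the feet. -/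
def Marked (κ J : Type*) : Set (Conf κ × (J → ℂ)) :=
  {q | Function.Injective q.2 ∧ ∀ j i, q.2 j ≠ feet q.1.1 i}

/-- Marked configurations whose underlying configuration is flat. -/
def markedFlat (κ J : Type*) : Set (Marked κ J) := {q | q.1.1 ∈ flat κ}

variable {κ J : Type*} [Fintype κ]

theorem exists_carry_marked {K : Type*} [TopologicalSpace K] [CompactSpace K]
    (B : C(K × I, Conf κ)) (M : C(K, J → ℂ)) (h : ∀ k, (B (k, 0), M k) ∈ Marked κ J) :
    ∃ M' : C(K × I, J → ℂ), (∀ p, (B p, M' p) ∈ Marked κ J) ∧ (∀ k, M' (k, 0) = M k) ∧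
      ∀ k, (∀ t, B (k, t) = B (k, 0)) → ∀ t, M' (k, t) = M k := by
  let F : C(K × I, κ × Bool → ℂ) := ⟨fun p => feet (B p).1, continuous_feet.comp (by fun_prop)⟩
  obtain ⟨Φ, h1, h2, h3, h4⟩ := exists_carry F fun p => feet_injective (B p).2
  refine ⟨⟨fun p j => Φ (p, M p.1 j), ?_⟩, fun p => ⟨?_, ?_⟩, fun k => ?_, fun k hk t => ?_⟩
  · fun_prop
  · exact (h1 p).comp (h p.1).1
  · intro j i e
    refine (h p.1).2 j i (h1 p ?_)
    exact e.trans (h2 p.1 p.2 i).symm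
  · ext j; exact h3 _ _
  · ext j
    exact h4 k (fun t => by simp only [F, ContinuousMap.coe_mk, hk t]) _ _

theorem markedFlat_essSurj (h : (inclF (flat κ)).EssSurj) : (inclF (markedFlat κ J)).EssSurj := by
  rw [inclF_essSurj_iff] at h ⊢
  rintro ⟨⟨X, m⟩, hq⟩
  obtain ⟨w, hw, ⟨p⟩⟩ := h X
  obtain ⟨M', h1, h2, -⟩ := exists_carry_marked (K := Unit) (J := J)
    ⟨fun q => p.symm q.2, by fun_prop⟩ (ContinuousMap.const Unit m) (fun k => by simp [hq])
  refine ⟨⟨(w, M' ((), 1)), by simpa using h1 ((), 1)⟩, hw, Joined.symm ⟨⟨⟨fun t =>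
    ⟨(p.symm t, M' ((), t)), h1 ((), t)⟩, by fun_prop⟩, ?_, ?_⟩⟩⟩
  · exact Subtype.ext (Prod.ext (by simp) (by simp [h2]))
  · exact Subtype.ext (Prod.ext (by simp) rfl)

theorem exists_homotopy_marked {q q' : Marked κ J} (γ : Path q q') {δ : Path q.1.1 q'.1.1}
    (h : (γ.map (continuous_fst.comp continuous_subtype_val)).Homotopy δ) :
    ∃ (γ' : Path q q') (H : γ.Homotopy γ'), (∀ t, (γ' t).1.1 = δ t) ∧ ∀ p, (H p).1.1 = h p := by
  obtain ⟨M', h1, h2, h3⟩ := exists_carry_marked (K := I) (J := J)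
    ⟨fun p => h (p.2, p.1), by fun_prop⟩ ⟨fun t => (γ t).1.2, by fun_prop⟩
    (fun t => by simp)
  have h0 : ∀ s, M' (0, s) = q.1.2 := fun s => by
    have := h3 0 (fun t => by simp) s
    simpa using this
  have h1' : ∀ s, M' (1, s) = q'.1.2 := fun s => by
    have := h3 1 (fun t => by simp) s
    simpa using this
  let γ' : Path q q' := ⟨⟨fun t => ⟨(δ t, M' (t, 1)), by simpa using h1 (t, 1)⟩, by fun_prop⟩,
    Subtype.ext (Prod.ext (by simp) (by simp [h0])), Subtype.ext (Prod.ext (by simp) (by simp [h1']))⟩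
  refine ⟨γ', ⟨⟨⟨fun p => ⟨(h p, M' (p.2, p.1)), h1 (p.2, p.1)⟩, by fun_prop⟩, ?_, ?_⟩, ?_⟩,
    fun _ => rfl, fun _ => rfl⟩
  · intro t
    exact Subtype.ext (Prod.ext (by simp) (by simp [h2]))
  · intro t
    exact Subtype.ext (Prod.ext (by simp [γ']) (by simp [γ']))
  · rintro s t (rfl | rfl)
    · exact Subtype.ext (Prod.ext (by simp) (by simp [h0]))
    · exact Subtype.ext (Prod.ext (by simp) (by simp [h1']))

theorem markedFlat_full (h : (inclF (flat κ)).Full) : (inclF (markedFlat κ J)).Full := by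
  rw [inclF_full_iff] at h ⊢
  intro q q' hq hq' γ
  obtain ⟨δ, hδ, ⟨e⟩⟩ := h _ _ hq hq' (γ.map (continuous_fst.comp continuous_subtype_val))
  obtain ⟨γ', H, h1, -⟩ := exists_homotopy_marked γ e
  refine ⟨γ', fun t => ?_, ⟨H⟩⟩
  rw [markedFlat, Set.mem_ofPred_eq, h1]
  exact hδ t

/-- A point different from all the feet. -/
def farPoint (X : κ → ℂ × ℂ) : ℂ := ((1 + ∑ i, ‖feet X i‖ : ℝ) : ℂ)

theorem continuous_farPoint : Continuous (farPoint (κ := κ)) := by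
  have h : ∀ i, Continuous fun X : κ → ℂ × ℂ => feet X i :=
    fun i => (continuous_apply i).comp continuous_feet
  unfold farPoint
  fun_prop

theorem farPoint_ne (X : κ → ℂ × ℂ) (i : κ × Bool) : farPoint X ≠ feet X i := by
  intro h
  have h1 : ‖feet X i‖ ≤ ∑ i, ‖feet X i‖ :=
    Finset.single_le_sum (f := fun i => ‖feet X i‖) (fun _ _ => norm_nonneg _) (Finset.mem_univ i)
  have h2 : ‖farPoint X‖ = 1 + ∑ i, ‖feet X i‖ := by
    rw [farPoint, Complex.norm_real, Real.norm_of_nonneg]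
    have := norm_nonneg (feet X i)
    linarith
  rw [h] at h2
  linarith

/-- The feet together with the far point. -/
def feetFar (X : κ → ℂ × ℂ) : Option (κ × Bool) → ℂ
  | none => farPoint X
  | some i => feet X i

theorem continuous_feetFar : Continuous (feetFar (κ := κ)) := by
  refine continuous_pi ?_
  rintro (_ | i)
  · exact continuous_farPoint
  · exact (continuous_apply i).comp continuous_feet

theorem feetFar_injective {X : κ → ℂ × ℂ} (hX : X ∈ Conf κ) : Function.Injective (feetFar X) := by
  rintro (_ | i) (_ | j) h
  · rfl
  · exact absurd h (farPoint_ne X j)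
  · exact absurd h.symm (farPoint_ne X i)
  · exact congrArg some (feet_injective hX h)

theorem marked_null_of_far [Unique J] {q : Marked κ J} (hq : q ∈ markedFlat κ J)
    (hfar : q.1.2 default = farPoint q.1.1.1) (γ : Path q q) (hγ : ∀ t, (γ t).1.1 = q.1.1)
    (h : γ.Homotopic (Path.refl q)) : HomIn (markedFlat κ J) γ (Path.refl q) := by
  obtain ⟨G⟩ := h
  let F : C((I × I) × I, Option (κ × Bool) → ℂ) :=
    ⟨fun p => feetFar (G (p.1.1 * unitInterval.symm p.2, p.1.2)).1.1.1,
      continuous_feetFar.comp (by fun_prop)⟩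
  obtain ⟨Φ, h1, h2, h3, h4⟩ := exists_carry F fun p => feetFar_injective (Subtype.prop _)
  have F1 : ∀ s t, F ((s, t), 1) = feetFar q.1.1.1 := by
    intro s t
    simp [F, hγ]
  have F0 : ∀ s t, F ((s, t), 0) = feetFar (G (s, t)).1.1.1 := by
    intro s t
    simp [F]
  let M : I × I → J → ℂ := fun p j => Φ ((p, 1), (G p).1.2 j)
  have hM : Continuous M := by fun_prop
  have mem : ∀ p, (q.1.1, M p) ∈ Marked κ J := by
    intro p
    refine ⟨Function.injective_of_subsingleton _, fun j i e => ?_⟩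
    refine (G p).2.2 j i (h1 (p, 1) ?_)
    refine e.trans ?_
    have := h2 p 1 (some i)
    rw [F1 p.1 p.2, F0 p.1 p.2] at this
    exact this.symm
  refine ⟨⟨⟨⟨fun p => ⟨(q.1.1, M p), mem p⟩, by fun_prop⟩, ?_, ?_⟩, ?_⟩, fun p => hq⟩
  · intro t
    refine Subtype.ext (Prod.ext (hγ t).symm ?_)
    funext j
    simp only [M]
    refine (h4 (0, t) (fun r => by simp [F]) 1 _).trans (by simp)
  · intro t
    refine Subtype.ext (Prod.ext rfl ?_)
    funext j
    obtain rfl := Subsingleton.elim j default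
    have := h2 (1, t) 1 none
    rw [F0, F1] at this
    have hG : G (1, t) = q := by simp
    simp only [hG, feetFar] at this
    simp only [M, hG, hfar, this]
    exact hfar.symm
  · have hend : ∀ s t, (∀ r, G (r, t) = q) → (⟨(q.1.1, M (s, t)), mem (s, t)⟩ : Marked κ J) = q := by
      intro s t hG
      refine Subtype.ext (Prod.ext rfl ?_)
      funext j
      simp only [M]
      refine (h4 (s, t) (fun r => by simp [F, hG]) 1 _).trans (by rw [hG])
    rintro s t (rfl | rfl)
    · exact (hend s 0 fun r => by simp).trans γ.source.symm
    · exact (hend s 1 fun r => by simp).trans γ.target.symm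

theorem markedFlat_faithful [Unique J] (h : (inclF (flat κ)).Faithful) :
    (inclF (markedFlat κ J)).Faithful := by
  rw [inclF_faithful_iff] at h ⊢
  intro q hq γ hγ hnull
  have hc : Continuous fun q : Marked κ J => q.1.1 := continuous_fst.comp continuous_subtype_val
  obtain ⟨e, he⟩ := h q.1.1 hq (γ.map hc) hγ (hnull.map ⟨_, hc⟩)
  obtain ⟨γ₁, H, h1, h2⟩ := exists_homotopy_marked γ e
  have hH : HomIn (markedFlat κ J) γ γ₁ :=
    ⟨H, fun p => by rw [markedFlat, Set.mem_ofPred_eq, h2]; exact he p⟩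
  have hb : ∀ t, (γ₁ t).1.1 = q.1.1 := fun t => h1 t
  let D : Set ℂ := (Set.range (feet q.1.1.1))ᶜ
  have hD : IsPathConnected D := by
    refine (Set.finite_range _).countable.isPathConnected_compl_of_one_lt_rank ?_
    rw [Complex.rank_real_complex]; norm_num
  obtain ⟨c, hcD⟩ := hD.joinedIn (q.1.2 default) (fun ⟨i, e⟩ => q.2.2 _ i e.symm)
    (farPoint q.1.1.1) (fun ⟨i, e⟩ => farPoint_ne _ i e.symm)
  have memc : ∀ z ∈ D, (q.1.1, fun _ : J => z) ∈ Marked κ J := fun z hz =>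
    ⟨Function.injective_of_subsingleton _, fun j i e => hz ⟨i, e.symm⟩⟩
  let qf : Marked κ J := ⟨(q.1.1, fun _ => farPoint q.1.1.1), memc _ (by simpa using hcD 1)⟩
  let C : Path q qf := ⟨⟨fun t => ⟨(q.1.1, fun _ => c t), memc _ (hcD t)⟩, by fun_prop⟩,
    Subtype.ext (Prod.ext rfl (by funext j; simp [Subsingleton.elim j default])),
    Subtype.ext (Prod.ext rfl (by funext j; simp [qf]))⟩
  have hC : ∀ t, C t ∈ markedFlat κ J := fun t => hq
  have hn : γ₁.Homotopic (Path.refl q) := Path.Homotopic.trans ⟨H.symm⟩ hnull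
  have key := marked_null_of_far (q := qf) hq rfl ((C.symm.trans γ₁).trans C) (by
    intro t
    have : ∀ t, ((C.symm.trans γ₁).trans C) t ∈ {p : Marked κ J | p.1.1 = q.1.1} := by
      refine trans_mem (trans_mem ?_ ?_) ?_
      · exact fun t => rfl
      · exact hb
      · exact fun t => rfl
    exact this t) (by
    rw [← Path.Homotopic.Quotient.eq] at hn ⊢
    simp [Path.Homotopic.Quotient.mk_trans, Path.Homotopic.Quotient.mk_symm, hn])
  have e1 := hH.right
  have e2 := key.cl_eq
  have e3 := cl_trans (C.symm.trans γ₁) C (trans_mem (symm_mem hC) e1) hC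
  have e4 := cl_trans C.symm γ₁ (symm_mem hC) e1
  rw [cl_symm _ hC] at e4
  have e5 : (Groupoid.inv (cl _ C hC) ≫ cl _ γ₁ e1) ≫ cl _ C hC = 𝟙 _ := by
    rw [← e4, ← e3]; exact e2
  refine hH.trans ((cl_eq_iff e1 (fun _ => hq)).1 ?_)
  have e6 := congrArg (fun f => cl _ C hC ≫ f ≫ Groupoid.inv (cl _ C hC)) e5
  simp at e6
  exact e6

end MarkedConfigurations

section Geometry

theorem norm_sub_mul_sq (z r : ℂ) (t : ℝ) : ‖z - t * r‖ ^ 2 =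
    (1 + t) / 2 * ‖z - r‖ ^ 2 + (1 - t) / 2 * ‖z + r‖ ^ 2 - (1 - t ^ 2) * ‖r‖ ^ 2 := by
  simp only [Complex.sq_norm, Complex.normSq_apply, Complex.sub_re, Complex.sub_im, Complex.add_re,
    Complex.add_im, Complex.mul_re, Complex.mul_im, Complex.ofReal_re, Complex.ofReal_im]
  ring

theorem WDisj.symm {m r m' r' : ℂ} (h : WDisj m r m' r') : WDisj m' r' m r :=
  fun t ht t' ht' e e' => h t' ht' t ht e.symm e'.symm

/-- The points of a wicket nearest to a point of the plane are its feet; hence a wicket of radius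
less than the distance of its centre to the feet of another is disjoint from it. -/
theorem wdisj_of_lt {m r m' r' : ℂ} (h : ‖r‖ < ‖m - (m' + r')‖) (h' : ‖r‖ < ‖m - (m' - r')‖) :
    WDisj m r m' r' := by
  intro t ht t' ht' e e'
  have e1 : m - m' - t' * r' = -(t * r) := by linear_combination e
  have h1 := norm_sub_mul_sq (m - m') r' t'
  rw [e1, norm_neg, norm_mul, mul_pow, Complex.norm_real, Real.norm_eq_abs, sq_abs] at h1
  have e2 : m - m' - r' = m - (m' + r') := by ring
  have e3 : m - m' + r' = m - (m' - r') := by ring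
  rw [e2, e3] at h1
  have h2 : ‖r‖ ^ 2 < ‖m - (m' + r')‖ ^ 2 := by gcongr
  have h3 : ‖r‖ ^ 2 < ‖m - (m' - r')‖ ^ 2 := by gcongr
  have := ht'.1
  have := ht'.2
  rcases eq_or_lt_of_le ht'.1 with h4 | h4
  · rw [← h4] at h1 e'; nlinarith
  · nlinarith

theorem WDisj.scale {m r m' r' : ℂ} (h : WDisj m r m' r') {c c' w : ℝ} (hc : 0 ≤ c) (hc1 : c ≤ 1)
    (hc' : 0 ≤ c') (hc1' : c' ≤ 1) (e : c ^ 2 * ‖r‖ ^ 2 = ‖r‖ ^ 2 - w)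
    (e' : c' ^ 2 * ‖r'‖ ^ 2 = ‖r'‖ ^ 2 - w) : WDisj m (c * r) m' (c' * r') := by
  intro t ht t' ht' h1 h2
  refine h (t * c) ⟨?_, ?_⟩ (t' * c') ⟨?_, ?_⟩ ?_ ?_
  · nlinarith [ht.1]
  · nlinarith [ht.2]
  · nlinarith [ht'.1]
  · nlinarith [ht'.2]
  · push_cast; linear_combination h1
  · simp only [norm_mul, Complex.norm_real, Real.norm_eq_abs, mul_pow, sq_abs] at h2
    nlinarith

/-- Raising the floor: the square of the radius decreases by `w`. -/
def raiseLog (w : ℝ) (l : ℂ) : ℂ := ⟨Real.log (Real.exp (2 * l.re) - w) / 2, l.im⟩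

theorem norm_exp_sq (l : ℂ) : ‖Complex.exp l‖ ^ 2 = Real.exp (2 * l.re) := by
  rw [Complex.norm_exp, ← Real.exp_nat_mul]; norm_num

theorem norm_exp_raiseLog {w : ℝ} {l : ℂ} (h : w < ‖Complex.exp l‖ ^ 2) :
    ‖Complex.exp (raiseLog w l)‖ ^ 2 = ‖Complex.exp l‖ ^ 2 - w := by
  rw [norm_exp_sq] at *
  simp only [raiseLog]
  rw [mul_div_cancel₀ _ two_ne_zero, Real.exp_log (by linarith), norm_exp_sq]

theorem raiseLog_zero (l : ℂ) : raiseLog 0 l = l := by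
  apply Complex.ext <;> simp [raiseLog]

theorem raiseLog_raiseLog {v w : ℝ} {l : ℂ} (h : w < ‖Complex.exp l‖ ^ 2) :
    raiseLog v (raiseLog w l) = raiseLog (w + v) l := by
  have := norm_exp_raiseLog h
  rw [norm_exp_sq, norm_exp_sq] at this
  apply Complex.ext
  · change Real.log (Real.exp (2 * (raiseLog w l).re) - v) / 2 = _
    rw [this, sub_sub]; rfl
  · rfl

theorem exp_raiseLog {w : ℝ} {l : ℂ} (h0 : 0 ≤ w) (h : w < ‖Complex.exp l‖ ^ 2) :
    ∃ c : ℝ, 0 < c ∧ c ≤ 1 ∧ Complex.exp (raiseLog w l) = c * Complex.exp l ∧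
      c ^ 2 * ‖Complex.exp l‖ ^ 2 = ‖Complex.exp l‖ ^ 2 - w := by
  have e : Complex.exp (raiseLog w l) =
      (Real.exp ((raiseLog w l).re - l.re) : ℝ) * Complex.exp l := by
    rw [Complex.ofReal_exp, ← Complex.exp_add]
    congr 1
    apply Complex.ext <;> simp [raiseLog]
  have e2 := norm_exp_raiseLog h
  have e3 := e2
  rw [e, norm_mul, mul_pow, Complex.norm_real, Real.norm_eq_abs, sq_abs] at e3
  refine ⟨_, Real.exp_pos _, ?_, e, e3⟩
  rw [Real.exp_le_one_iff]
  rw [norm_exp_sq, norm_exp_sq] at e2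
  have : Real.exp (2 * (raiseLog w l).re) ≤ Real.exp (2 * l.re) := by linarith
  rw [Real.exp_le_exp] at this
  linarith

variable {ι : Type*}

/-- Raising the floor in a configuration. -/
def raise (w : ℝ) (X : ι → ℂ × ℂ) : ι → ℂ × ℂ := fun i => ((X i).1, raiseLog w (X i).2)

/-- The floor is below the top of all wickets. -/
def Below (w : ℝ) (X : ι → ℂ × ℂ) : Prop := ∀ k, w < ‖Complex.exp (X k).2‖ ^ 2

theorem raise_zero (X : ι → ℂ × ℂ) : raise 0 X = X := by
  funext i; simp [raise, raiseLog_zero]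

theorem below_zero (X : ι → ℂ × ℂ) : Below 0 X :=
  fun k => by have := Complex.exp_ne_zero (X k).2; positivity

theorem raise_raise {v w : ℝ} {X : ι → ℂ × ℂ} (h : Below w X) :
    raise v (raise w X) = raise (w + v) X := by
  funext i; simp only [raise, raiseLog_raiseLog (h i)]

theorem below_raise {v w : ℝ} {X : ι → ℂ × ℂ} (h : Below w X) (h' : Below (w + v) X) :
    Below v (raise w X) := by
  intro k
  simp only [raise]
  rw [norm_exp_raiseLog (h k)]
  linarith [h' k]

theorem raise_mem_conf {w : ℝ} {X : ι → ℂ × ℂ} (hw : 0 ≤ w) (h : Below w X) (hX : X ∈ Conf ι) :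
    raise w X ∈ Conf ι := by
  intro i j hij
  obtain ⟨c, c0, c1, e, e'⟩ := exp_raiseLog hw (h i)
  obtain ⟨d, d0, d1, f, f'⟩ := exp_raiseLog hw (h j)
  simp only [raise, e, f]
  exact (hX i j hij).scale c0.le c1 d0.le d1 e' f'

/-- The wicket `i` is small compared to the distance of its centre to the other feet. -/
def TinyAt (i : ι) (X : ι → ℂ × ℂ) : Prop :=
  ∀ k, k ≠ i → ∀ b, 9 * ‖Complex.exp (X i).2‖ < ‖(X i).1 - feet X (k, b)‖

theorem feet_true (X : ι → ℂ × ℂ) (k : ι) : feet X (k, true) = (X k).1 + Complex.exp (X k).2 := by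
  simp [feet]

theorem feet_false (X : ι → ℂ × ℂ) (k : ι) : feet X (k, false) = (X k).1 - Complex.exp (X k).2 := by
  simp [feet, sub_eq_add_neg]

theorem TinyAt.wdisj {i k : ι} {X : ι → ℂ × ℂ} (h : TinyAt i X) (hk : k ≠ i) :
    WDisj (X i).1 (Complex.exp (X i).2) (X k).1 (Complex.exp (X k).2) := by
  have h1 := h k hk true
  have h2 := h k hk false
  have := norm_nonneg (Complex.exp (X i).2)
  rw [feet_true] at h1
  rw [feet_false] at h2
  exact wdisj_of_lt (by linarith) (by linarith)

theorem norm_sub_mul_sq_ge {z r : ℂ} {c w a : ℝ} (hc : 0 ≤ c) (hc1 : c ≤ 1)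
    (e : c ^ 2 * ‖r‖ ^ 2 = ‖r‖ ^ 2 - w) (h : a < ‖z - r‖ ^ 2) (h' : a < ‖z + r‖ ^ 2) :
    a - w < ‖z - c * r‖ ^ 2 := by
  rw [norm_sub_mul_sq]
  nlinarith

theorem TinyAt.raise {i : ι} {X : ι → ℂ × ℂ} (h : TinyAt i X) {w : ℝ} (hw : 0 ≤ w)
    (hb : Below w X) : TinyAt i (raise w X) := by
  intro k hk b
  obtain ⟨c, c0, c1, e, e'⟩ := exp_raiseLog hw (hb k)
  have h1 := h k hk true
  have h2 := h k hk false
  rw [feet_true] at h1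
  rw [feet_false] at h2
  have n0 := norm_nonneg (Complex.exp (X i).2)
  have g1 : 81 * ‖Complex.exp (X i).2‖ ^ 2 < ‖((X i).1 - (X k).1) - Complex.exp (X k).2‖ ^ 2 := by
    rw [sub_sub]; nlinarith
  have g2 : 81 * ‖Complex.exp (X i).2‖ ^ 2 < ‖((X i).1 - (X k).1) + Complex.exp (X k).2‖ ^ 2 := by
    have : (X i).1 - (X k).1 + Complex.exp (X k).2 = (X i).1 - ((X k).1 - Complex.exp (X k).2) := by
      ring
    rw [this]; nlinarith
  have key : 81 * ‖Complex.exp (X i).2‖ ^ 2 - w < ‖(X i).1 - feet (_root_.raise w X) (k, b)‖ ^ 2 := by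
    cases b
    · rw [feet_false]
      simp only [_root_.raise, e]
      have := norm_sub_mul_sq_ge (z := (X i).1 - (X k).1) (r := -Complex.exp (X k).2) c0.le c1
        (by simpa using e') (by simpa using g2) (by simpa [sub_eq_add_neg] using g1)
      convert! this using 3
      ring
    · rw [feet_true]
      simp only [_root_.raise, e]
      have := norm_sub_mul_sq_ge c0.le c1 e' g1 g2
      convert! this using 3
      ring
  have e3 : ‖Complex.exp (_root_.raise w X i).2‖ ^ 2 = ‖Complex.exp (X i).2‖ ^ 2 - w :=
    norm_exp_raiseLog (hb i)
  refine lt_of_pow_lt_pow_left₀ 2 (norm_nonneg _) ?_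
  have e4 : (_root_.raise w X i).1 = (X i).1 := rfl
  rw [mul_pow, e3, e4]
  linarith

theorem TinyAt.raise_mono {i : ι} {X : ι → ℂ × ℂ} {v w : ℝ} (hvw : v ≤ w)
    (hb : Below w X) (h : TinyAt i (_root_.raise v X)) : TinyAt i (_root_.raise w X) := by
  have hb' : Below v X := fun k => hvw.trans_lt (hb k)
  have := h.raise (sub_nonneg.2 hvw) (below_raise hb' (by simpa using hb))
  rwa [raise_raise hb', add_sub_cancel] at this

theorem TinyAt.four_lt {i j : ι} {X : ι → ℂ × ℂ} (hij : i ≠ j) (h : TinyAt i X) (h' : TinyAt j X) :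
    4 * (‖Complex.exp (X i).2‖ + ‖Complex.exp (X j).2‖) < ‖(X i).1 - (X j).1‖ := by
  have h1 := h j hij.symm true
  have h2 := h' i hij true
  rw [feet_true] at h1 h2
  have e1 : (X i).1 - ((X j).1 + Complex.exp (X j).2) = ((X i).1 - (X j).1) - Complex.exp (X j).2 := by
    ring
  have e2 : (X j).1 - ((X i).1 + Complex.exp (X i).2) =
      -(((X i).1 - (X j).1) + Complex.exp (X i).2) := by ring
  rw [e1] at h1
  rw [e2, norm_neg] at h2
  have := norm_sub_le ((X i).1 - (X j).1) (Complex.exp (X j).2)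
  have := norm_add_le ((X i).1 - (X j).1) (Complex.exp (X i).2)
  linarith

theorem isOpen_tinyAt [Finite ι] (i : ι) : IsOpen {X : ι → ℂ × ℂ | TinyAt i X} := by
  have : {X : ι → ℂ × ℂ | TinyAt i X} = ⋂ k : ι, ⋂ b : Bool,
      {X | k ≠ i → 9 * ‖Complex.exp (X i).2‖ < ‖(X i).1 - feet X (k, b)‖} := by
    ext X; simp only [TinyAt, Set.mem_ofPred_eq, Set.mem_iInter]
    exact ⟨fun h k b hk => h k hk b, fun h k hk b => h k b hk⟩
  rw [this]
  refine isOpen_iInter_of_finite fun k => isOpen_iInter_of_finite fun b => ?_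
  by_cases hk : k = i
  · simp [hk]
  · simp only [ne_eq, hk, not_false_eq_true, true_implies]
    have := (continuous_apply (k, b)).comp (continuous_feet (κ := ι))
    exact isOpen_lt (by fun_prop) (by fun_prop)

theorem isOpen_below [Finite ι] (w : ℝ) : IsOpen {X : ι → ℂ × ℂ | Below w X} := by
  have : {X : ι → ℂ × ℂ | Below w X} = ⋂ k : ι, {X | w < ‖Complex.exp (X k).2‖ ^ 2} := by
    ext X; simp [Below]
  rw [this]
  exact isOpen_iInter_of_finite fun k => isOpen_lt (by fun_prop) (by fun_prop)

theorem continuousOn_raise : ContinuousOn (fun p : ℝ × (ι → ℂ × ℂ) => raise p.1 p.2)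
    {p | Below p.1 p.2} := by
  have key : ∀ i, ContinuousOn (fun p : ℝ × (ι → ℂ × ℂ) =>
      Real.log (Real.exp (2 * (p.2 i).2.re) - p.1) / 2) {p | Below p.1 p.2} := by
    intro i
    refine ContinuousOn.div_const (ContinuousOn.log (by fun_prop) fun p hp => ?_) _
    have := hp i
    rw [norm_exp_sq] at this
    linarith
  refine continuousOn_pi.2 fun i => ContinuousOn.prodMk (by fun_prop) ?_
  have e : ∀ p : ℝ × (ι → ℂ × ℂ), raiseLog p.1 (p.2 i).2 =
      ((Real.log (Real.exp (2 * (p.2 i).2.re) - p.1) / 2 : ℝ) : ℂ) + ((p.2 i).2.im : ℂ) * Complex.I :=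
    fun p => by apply Complex.ext <;> simp [raiseLog]
  simp only [e]
  refine ContinuousOn.add (Complex.continuous_ofReal.comp_continuousOn (key i)) ?_
  fun_prop

theorem isOpen_tinyAt_raise [Finite ι] (i : ι) (w : ℝ) :
    IsOpen {X : ι → ℂ × ℂ | Below w X ∧ TinyAt i (raise w X)} := by
  have h : ContinuousOn (fun X : ι → ℂ × ℂ => raise w X) {X | Below w X} :=
    continuousOn_raise.comp (f := fun X : ι → ℂ × ℂ => (w, X)) (by fun_prop) fun X hX => hX
  exact h.isOpen_inter_preimage (isOpen_below w) (isOpen_tinyAt i)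

/-- Every configuration has a wicket that becomes small when the floor is raised. -/
theorem exists_tinyAt_raise [Finite ι] [Nonempty ι] {X : ι → ℂ × ℂ} (hX : X ∈ Conf ι) :
    ∃ i w, 0 ≤ w ∧ Below w X ∧ TinyAt i (raise w X) := by
  obtain ⟨i, hi⟩ := Finite.exists_min fun i => ‖Complex.exp (X i).2‖ ^ 2
  set s := ‖Complex.exp (X i).2‖ ^ 2 with hs
  have s0 : 0 < s := by have := Complex.exp_ne_zero (X i).2; positivity
  -- the limiting feet at height `√s`
  let c : ι → ℝ → ℝ := fun k w => √(1 - w / ‖Complex.exp (X k).2‖ ^ 2)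
  have hc : ∀ k, ∀ b : Bool, k ≠ i → ∀ᶠ w in nhdsWithin s (Set.Iio s),
      81 * (s - w) < ‖(X i).1 - ((X k).1 + (if b then 1 else -1) * (c k w * Complex.exp (X k).2))‖ ^ 2 := by
    intro k b hk
    have cont : Continuous fun w => ‖(X i).1 - ((X k).1 + (if b then 1 else -1) *
        (c k w * Complex.exp (X k).2))‖ ^ 2 - 81 * (s - w) := by
      have : Continuous (c k) := by
        refine Real.continuous_sqrt.comp ?_
        fun_prop
      fun_prop
    have pos : 0 < ‖(X i).1 - ((X k).1 + (if b then 1 else -1) *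
        (c k s * Complex.exp (X k).2))‖ ^ 2 - 81 * (s - s) := by
      rw [sub_self, mul_zero, sub_zero]
      refine pow_pos (norm_pos_iff.2 fun e => ?_) 2
      have sk0 : 0 < ‖Complex.exp (X k).2‖ ^ 2 := s0.trans_le (hi k)
      have hle : s / ‖Complex.exp (X k).2‖ ^ 2 ≤ 1 := by rw [div_le_one sk0]; exact hi k
      have hc2 : c k s ^ 2 = 1 - s / ‖Complex.exp (X k).2‖ ^ 2 := Real.sq_sqrt (by linarith)
      have c0 : 0 ≤ c k s := Real.sqrt_nonneg _
      have c1 : c k s ≤ 1 := by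
        have : 0 ≤ s / ‖Complex.exp (X k).2‖ ^ 2 := by positivity
        nlinarith
      refine hX i k (Ne.symm hk) 0 (by simp) (if b then c k s else -c k s) ?_ ?_ ?_
      · split_ifs
        · exact ⟨by linarith, c1⟩
        · exact ⟨by linarith, by linarith⟩
      · rw [sub_eq_zero] at e
        rw [e]
        cases b <;> simp
      · have : (if b then c k s else -c k s) ^ 2 = c k s ^ 2 := by cases b <;> simp
        rw [this, hc2, ← hs]
        field_simp
        ring
    have := (cont.tendsto s).eventually (lt_mem_nhds pos)
    refine (this.filter_mono nhdsWithin_le_nhds).mono fun w hw => ?_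
    linarith
  have hall : ∀ᶠ w in nhdsWithin s (Set.Iio s), ∀ k, ∀ b : Bool, k ≠ i →
      81 * (s - w) < ‖(X i).1 - ((X k).1 + (if b then 1 else -1) * (c k w * Complex.exp (X k).2))‖ ^ 2 := by
    rw [Filter.eventually_all]; intro k
    rw [Filter.eventually_all]; intro b
    by_cases hk : k = i
    · simp [hk]
    · exact (hc k b hk).mono fun w hw _ => hw
  have h0 : ∀ᶠ w in nhdsWithin s (Set.Iio s), 0 < w := nhdsWithin_le_nhds (lt_mem_nhds s0)
  obtain ⟨w, hw, w0, ws⟩ := (hall.and (h0.and self_mem_nhdsWithin)).exists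
  have hb : Below w X := fun k => lt_of_lt_of_le ws (hi k)
  refine ⟨i, w, w0.le, hb, fun k hk b => ?_⟩
  obtain ⟨d, d0, d1, e, e'⟩ := exp_raiseLog w0.le (hb k)
  have hd : d = c k w := by
    have sk0 : 0 < ‖Complex.exp (X k).2‖ ^ 2 := s0.trans_le (hi k)
    have : 1 - w / ‖Complex.exp (X k).2‖ ^ 2 = d ^ 2 := by field_simp; linarith
    simp only [c, this, Real.sqrt_sq d0.le]
  have h1 := hw k b hk
  refine lt_of_pow_lt_pow_left₀ 2 (norm_nonneg _) ?_
  have e3 : ‖Complex.exp (raise w X i).2‖ ^ 2 = ‖Complex.exp (X i).2‖ ^ 2 - w :=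
    norm_exp_raiseLog (hb i)
  have e4 : feet (raise w X) (k, b) = (X k).1 + (if b then 1 else -1) * (c k w * Complex.exp (X k).2) := by
    rw [← hd, ← e]; rfl
  rw [mul_pow, e3, e4, ← hs]
  have e5 : (9 : ℝ) ^ 2 = 81 := by norm_num
  rw [e5]
  exact h1

end Geometry

section Untwisting

variable {ι : Type*}

/-- The configurations with real radius vectors, in an arbitrary set of configurations. -/
def flatIn (S : Set (ι → ℂ × ℂ)) : Set S := {X | ∀ i, (X.1 i).2.im = 0}

/-- A deformation of `S` into a subset `T`, preserving `T` and flatness. -/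
def PairEquiv.ofDeformation {S T : Set (ι → ℂ × ℂ)} (hTS : T ⊆ S) (D : C(I × S, ι → ℂ × ℂ))
    (h0 : ∀ X, D (0, X) = X) (h1 : ∀ X, D (1, X) ∈ T) (hS : ∀ t X, D (t, X) ∈ S)
    (hT : ∀ t (X : S), X.1 ∈ T → D (t, X) ∈ T)
    (hflat : ∀ t (X : S), (∀ i, (X.1 i).2.im = 0) → ∀ i, (D (t, X) i).2.im = 0) :
    PairEquiv (flatIn S) (flatIn T) where
  toFun := ⟨fun X => ⟨D (1, X), h1 X⟩, by fun_prop⟩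
  invFun := ⟨fun X => ⟨X, hTS X.2⟩, by fun_prop⟩
  mapsTo := fun X hX => hflat 1 X hX
  invMapsTo := fun X hX => hX
  H := ContinuousMap.Homotopy.symm
    ⟨⟨fun p => ⟨D p, hS p.1 p.2⟩, by fun_prop⟩, fun X => Subtype.ext (h0 X), fun X => rfl⟩
  H_mem := fun t X hX => hflat _ X hX
  K := ContinuousMap.Homotopy.symm
    ⟨⟨fun p => ⟨D (p.1, ⟨p.2, hTS p.2.2⟩), hT _ _ p.2.2⟩, by fun_prop⟩,
      fun X => Subtype.ext (h0 _), fun X => rfl⟩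
  K_mem := fun t X hX => hflat _ ⟨X.1, hTS X.2⟩ hX

variable (J : Set ι)

/-- Configurations in which the wickets in `J` become tiny when the floor is raised. -/
def RaiseTiny : Set (ι → ℂ × ℂ) :=
  {X | X ∈ Conf ι ∧ ∀ i ∈ J, ∃ w, 0 ≤ w ∧ Below w X ∧ TinyAt i (raise w X)}

/-- Configurations in which the wickets in `J` are tiny. -/
def AllTiny : Set (ι → ℂ × ℂ) := {X | X ∈ Conf ι ∧ ∀ i ∈ J, TinyAt i X}

/-- Configurations in which the wickets in `J` can be shrunk independently. -/
def Shrinkable : Set (ι → ℂ × ℂ) :=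
  {X | X ∈ Conf ι ∧ (∀ i ∈ J, ∀ k ∉ J, ∀ b, 9 * ‖Complex.exp (X i).2‖ < ‖(X i).1 - feet X (k, b)‖) ∧
    ∀ i ∈ J, ∀ k ∈ J, i ≠ k → 20 * ‖Complex.exp (X i).2‖ < ‖(X i).1 - (X k).1‖}

variable {J}

theorem exists_common_raise [Finite ι] {X : ι → ℂ × ℂ} (hX : X ∈ RaiseTiny J) :
    ∃ w, 0 ≤ w ∧ Below w X ∧ ∀ i ∈ J, TinyAt i (raise w X) := by
  rcases J.eq_empty_or_nonempty with rfl | hJ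
  · exact ⟨0, le_rfl, below_zero X, by simp⟩
  choose! w h0 hb ht using hX.2
  obtain ⟨i, hi, hmax⟩ := J.toFinite.exists_maximalFor w J hJ
  refine ⟨w i, h0 i hi, hb i hi, fun j hj => (ht j hj).raise_mono ?_ (hb i hi)⟩
  rcases le_total (w j) (w i) with h | h
  · exact h
  · exact hmax hj h

theorem exists_raise_function [Fintype ι] : ∃ w : C(RaiseTiny J, ℝ), ∀ X, 0 ≤ w X ∧ Below (w X) X.1 ∧
    ∀ i ∈ J, TinyAt i (raise (w X) X.1) := by
  refine exists_continuous_forall_mem_convex_of_local_const (t := fun X : RaiseTiny J =>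
    {w : ℝ | 0 ≤ w ∧ Below w X.1 ∧ ∀ i ∈ J, TinyAt i (raise w X.1)}) ?_ ?_
  · intro X
    refine Set.OrdConnected.convex ⟨fun v hv w hw u hu => ?_⟩
    have hb : Below u X.1 := fun k => hu.2.trans_lt (hw.2.1 k)
    exact ⟨hv.1.trans hu.1, hb, fun i hi => (hv.2.2 i hi).raise_mono hu.1 hb⟩
  · intro X
    obtain ⟨w, h0, hb, ht⟩ := exists_common_raise X.2
    refine ⟨w, ?_⟩
    have hfin : ∀ i, ∀ᶠ Y in nhds X.1, i ∈ J → TinyAt i (raise w Y) := by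
      intro i
      by_cases hi : i ∈ J
      · exact ((isOpen_tinyAt_raise i w).eventually_mem ⟨hb, ht i hi⟩).mono fun Y hY _ => hY.2
      · exact Filter.Eventually.of_forall fun Y h => absurd h hi
    have h1 : ∀ᶠ Y in nhds X.1, Below w Y ∧ ∀ i, i ∈ J → TinyAt i (raise w Y) :=
      ((isOpen_below w).eventually_mem hb).and (Filter.eventually_all.2 hfin)
    exact ((continuous_subtype_val.tendsto X).eventually h1).mono fun Y hY => ⟨h0, hY.1, hY.2⟩

theorem nonempty_pairEquiv_allTiny [Fintype ι] :
    Nonempty (PairEquiv (flatIn (RaiseTiny J)) (flatIn (AllTiny J))) := by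
  obtain ⟨w, hw⟩ := exists_raise_function (J := J)
  have hb : ∀ (t : I) (X : RaiseTiny J), Below (t * w X) X.1 := fun t X k =>
    lt_of_le_of_lt (mul_le_of_le_one_left (hw X).1 t.2.2) ((hw X).2.1 k)
  have h0 : ∀ (t : I) (X : RaiseTiny J), 0 ≤ t * w X := fun t X => mul_nonneg t.2.1 (hw X).1
  refine ⟨PairEquiv.ofDeformation ?_ ⟨fun p => raise (p.1 * w p.2) p.2.1, ?_⟩ ?_ ?_ ?_ ?_ ?_⟩
  · rintro X ⟨hX, hT⟩
    exact ⟨hX, fun i hi => ⟨0, le_rfl, below_zero X, by rw [raise_zero]; exact hT i hi⟩⟩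
  · exact continuousOn_raise.comp_continuous (f := fun p : I × RaiseTiny J =>
      ((p.1 : ℝ) * w p.2, p.2.1)) (by fun_prop) fun p => hb p.1 p.2
  · intro X
    simp [raise_zero]
  · intro X
    simp only [ContinuousMap.coe_mk, Set.Icc.coe_one, one_mul]
    exact ⟨raise_mem_conf (hw X).1 (hw X).2.1 X.2.1, (hw X).2.2⟩
  · intro t X
    refine ⟨raise_mem_conf (h0 t X) (hb t X) X.2.1, fun i hi => ⟨w X - t * w X, ?_, ?_, ?_⟩⟩
    · exact sub_nonneg.2 (mul_le_of_le_one_left (hw X).1 t.2.2)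
    · exact below_raise (hb t X) (by simpa using (hw X).2.1)
    · simp only [ContinuousMap.coe_mk]
      rw [raise_raise (hb t X), add_sub_cancel]
      exact (hw X).2.2 i hi
  · rintro t X ⟨hX, hT⟩
    exact ⟨raise_mem_conf (h0 t X) (hb t X) hX, fun i hi => (hT i hi).raise (h0 t X) (hb t X)⟩
  · intro t X h i
    exact h i

open Classical in
/-- Shrink the wickets in `J` by the factor `5 ^ (-t)`. -/
def shrinkIn (J : Set ι) (t : ℝ) (X : ι → ℂ × ℂ) : ι → ℂ × ℂ :=
  fun i => if i ∈ J then ((X i).1, (X i).2 - ((t * Real.log 5 : ℝ) : ℂ)) else X i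

theorem shrinkIn_fst (t : ℝ) (X : ι → ℂ × ℂ) (i : ι) : (shrinkIn J t X i).1 = (X i).1 := by
  simp only [shrinkIn]; split_ifs <;> rfl

theorem shrinkIn_not_mem (t : ℝ) (X : ι → ℂ × ℂ) {i : ι} (hi : i ∉ J) : shrinkIn J t X i = X i := by
  simp [shrinkIn, hi]

theorem exp_shrinkIn (t : ℝ) (X : ι → ℂ × ℂ) {i : ι} (hi : i ∈ J) :
    Complex.exp (shrinkIn J t X i).2 =
      ((Real.exp (-(t * Real.log 5)) : ℝ) : ℂ) * Complex.exp (X i).2 := by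
  simp only [shrinkIn, hi, if_true]
  rw [Complex.ofReal_exp, ← Complex.exp_add]
  congr 1
  push_cast
  ring

theorem norm_mul_le_norm_sub_mul {z r : ℂ} (h : ‖r‖ ≤ ‖z‖) {c : ℝ} (h0 : 0 ≤ c) (h1 : c ≤ 1) :
    c * ‖z - r‖ ≤ ‖z - c * r‖ := by
  refine le_of_sq_le_sq ?_ (norm_nonneg _)
  have h2 := norm_sub_mul_sq z r c
  have h3 := parallelogram_law_with_norm ℝ z r
  have h4 : ‖r‖ ^ 2 ≤ ‖z‖ ^ 2 := by gcongr
  have h5 : ‖z + r‖ ^ 2 = 2 * ‖z‖ ^ 2 + 2 * ‖r‖ ^ 2 - ‖z - r‖ ^ 2 := by nlinarith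
  rw [h2, h5, mul_pow]
  have h6 : 0 ≤ (1 - c) * (c * ‖z - r‖ ^ 2 + ‖z‖ ^ 2 - c * ‖r‖ ^ 2) := by
    have : c * ‖r‖ ^ 2 ≤ 1 * ‖r‖ ^ 2 := by gcongr
    have : 0 ≤ c * ‖z - r‖ ^ 2 := by positivity
    exact mul_nonneg (by linarith) (by linarith)
  nlinarith

theorem exp_neg_mul_log_le {t : ℝ} (h0 : 0 ≤ t) : Real.exp (-(t * Real.log 5)) ≤ 1 := by
  rw [Real.exp_le_one_iff]
  have := Real.log_pos (by norm_num : (1 : ℝ) < 5)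
  nlinarith

theorem norm_exp_shrinkIn (t : ℝ) (X : ι → ℂ × ℂ) {i : ι} (hi : i ∈ J) :
    ‖Complex.exp (shrinkIn J t X i).2‖ = Real.exp (-(t * Real.log 5)) * ‖Complex.exp (X i).2‖ := by
  rw [exp_shrinkIn t X hi, norm_mul, Complex.norm_real, Real.norm_of_nonneg (Real.exp_pos _).le]

theorem feet_shrinkIn_not_mem (t : ℝ) (X : ι → ℂ × ℂ) {k : ι} (hk : k ∉ J) (b : Bool) :
    feet (shrinkIn J t X) (k, b) = feet X (k, b) := by
  simp only [feet, shrinkIn_not_mem t X hk]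

theorem tinyAt_shrinkIn {X : ι → ℂ × ℂ} (hX : ∀ i ∈ J, TinyAt i X) {t : ℝ} (ht : 0 ≤ t) {i : ι}
    (hi : i ∈ J) : TinyAt i (shrinkIn J t X) := by
  intro k hk b
  rw [norm_exp_shrinkIn t X hi, shrinkIn_fst]
  have c0 := Real.exp_pos (-(t * Real.log 5))
  have c1 := exp_neg_mul_log_le ht
  have h := hX i hi k hk b
  have n0 := norm_nonneg (Complex.exp (X i).2)
  by_cases hkJ : k ∈ J
  · have h4 := TinyAt.four_lt hk (hX k hkJ) (hX i hi)
    rw [norm_sub_rev] at h4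
    have n1 := norm_nonneg (Complex.exp (X k).2)
    have hle : ‖Complex.exp (X k).2‖ ≤ ‖(X i).1 - (X k).1‖ := by linarith
    have e : (X i).1 - feet (shrinkIn J t X) (k, b) = ((X i).1 - (X k).1) -
        (Real.exp (-(t * Real.log 5)) : ℝ) * ((if b then 1 else -1) * Complex.exp (X k).2) := by
      simp only [feet, shrinkIn_fst, exp_shrinkIn t X hkJ]; ring
    have e' : (X i).1 - feet X (k, b) = ((X i).1 - (X k).1) -
        ((if b then 1 else -1) * Complex.exp (X k).2) := by
      simp only [feet]; ring
    have := norm_mul_le_norm_sub_mul (z := (X i).1 - (X k).1)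
      (r := (if b then 1 else -1) * Complex.exp (X k).2) (by cases b <;> simpa using hle) c0.le c1
    rw [e' ] at h
    rw [e]
    nlinarith
  · rw [feet_shrinkIn_not_mem t X hkJ]
    nlinarith

theorem shrinkIn_mem_conf {X : ι → ℂ × ℂ} (hX : X ∈ AllTiny J) {t : ℝ} (ht : 0 ≤ t) :
    shrinkIn J t X ∈ Conf ι := by
  intro i j hij
  by_cases hi : i ∈ J
  · exact (tinyAt_shrinkIn hX.2 ht hi).wdisj hij.symm
  by_cases hj : j ∈ J
  · exact ((tinyAt_shrinkIn hX.2 ht hj).wdisj hij).symm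
  · rw [shrinkIn_not_mem t X hi, shrinkIn_not_mem t X hj]
    exact hX.1 i j hij

theorem continuous_shrinkIn : Continuous fun p : ℝ × (ι → ℂ × ℂ) => shrinkIn J p.1 p.2 := by
  refine continuous_pi fun i => ?_
  by_cases hi : i ∈ J
  · simp only [shrinkIn, hi, if_true]; fun_prop
  · simp only [shrinkIn, hi, if_false]; fun_prop

theorem shrinkable_subset_allTiny : Shrinkable J ⊆ AllTiny J := by
  rintro X ⟨hX, h1, h2⟩
  refine ⟨hX, fun i hi k hk b => ?_⟩
  by_cases hkJ : k ∈ J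
  · have g1 := h2 i hi k hkJ hk.symm
    have g2 := h2 k hkJ i hi hk
    rw [norm_sub_rev] at g2
    have e' : (X i).1 - feet X (k, b) = ((X i).1 - (X k).1) -
        ((if b then 1 else -1) * Complex.exp (X k).2) := by
      simp only [feet]; ring
    have g3 := norm_sub_norm_le ((X i).1 - (X k).1) ((if b then 1 else -1) * Complex.exp (X k).2)
    have g4 : ‖(if b then 1 else -1) * Complex.exp (X k).2‖ = ‖Complex.exp (X k).2‖ := by
      cases b <;> simp
    rw [e']
    have := norm_nonneg (Complex.exp (X i).2)
    have := norm_nonneg (Complex.exp (X k).2)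
    linarith
  · exact h1 i hi k hkJ b

theorem nonempty_pairEquiv_shrinkable :
    Nonempty (PairEquiv (flatIn (AllTiny J)) (flatIn (Shrinkable J))) := by
  refine ⟨PairEquiv.ofDeformation shrinkable_subset_allTiny
    ⟨fun p => shrinkIn J p.1 p.2.1, ?_⟩ ?_ ?_ ?_ ?_ ?_⟩
  · exact continuous_shrinkIn.comp (f := fun p : I × AllTiny J => ((p.1 : ℝ), p.2.1)) (by fun_prop)
  · intro X
    funext i
    by_cases hi : i ∈ J <;> simp [shrinkIn, hi]
  · intro X
    refine ⟨shrinkIn_mem_conf X.2 (by simp), fun i hi k hk b => ?_, fun i hi k hk hik => ?_⟩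
    · exact tinyAt_shrinkIn X.2.2 (by simp) hi k (fun e => hk (e ▸ hi)) b
    · simp only [ContinuousMap.coe_mk, Set.Icc.coe_one]
      rw [norm_exp_shrinkIn _ _ hi, shrinkIn_fst, shrinkIn_fst, one_mul, Real.exp_neg,
        Real.exp_log (by norm_num)]
      have := TinyAt.four_lt hik (X.2.2 i hi) (X.2.2 k hk)
      have := norm_nonneg (Complex.exp (X.1 k).2)
      linarith
  · intro t X
    exact ⟨shrinkIn_mem_conf X.2 t.2.1, fun i hi => tinyAt_shrinkIn X.2.2 t.2.1 hi⟩
  · intro t X hX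
    have c1 := exp_neg_mul_log_le t.2.1
    refine ⟨shrinkIn_mem_conf X.2 t.2.1, fun i hi k hk b => ?_, fun i hi k hk hik => ?_⟩
    · exact tinyAt_shrinkIn X.2.2 t.2.1 hi k (fun e => hk (e ▸ hi)) b
    · simp only [ContinuousMap.coe_mk]
      rw [norm_exp_shrinkIn _ _ hi, shrinkIn_fst, shrinkIn_fst]
      have := hX.2.2 i hi k hk hik
      have := norm_nonneg (Complex.exp (X.1 i).2)
      nlinarith
  · intro t X h i
    by_cases hi : i ∈ J
    · simp only [ContinuousMap.coe_mk, shrinkIn, hi, if_true, Complex.sub_im, h i,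
        Complex.ofReal_im, sub_zero]
    · simp [shrinkIn, hi, h i]

open Classical in
/-- Add wickets labelled by `J` to a configuration labelled by the complement of `J`. -/
def fillIn (J : Set ι) (X : {i // i ∉ J} → ℂ × ℂ) (m l : J → ℂ) : ι → ℂ × ℂ :=
  fun i => if h : i ∈ J then (m ⟨i, h⟩, l ⟨i, h⟩) else X ⟨i, h⟩

theorem fillIn_mem (X : {i // i ∉ J} → ℂ × ℂ) (m l : J → ℂ) {i : ι} (h : i ∈ J) :
    fillIn J X m l i = (m ⟨i, h⟩, l ⟨i, h⟩) := by simp [fillIn, h]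

theorem fillIn_not_mem (X : {i // i ∉ J} → ℂ × ℂ) (m l : J → ℂ) {i : ι} (h : i ∉ J) :
    fillIn J X m l i = X ⟨i, h⟩ := by simp [fillIn, h]

theorem fillIn_restrict (X : ι → ℂ × ℂ) :
    fillIn J (fun i => X i) (fun j => (X j).1) (fun j => (X j).2) = X := by
  funext i
  by_cases h : i ∈ J <;> simp [fillIn, h]

theorem continuous_fillIn : Continuous fun p : ({i // i ∉ J} → ℂ × ℂ) × (J → ℂ) × (J → ℂ) =>
    fillIn J p.1 p.2.1 p.2.2 := by
  refine continuous_pi fun i => ?_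
  by_cases h : i ∈ J
  · simp only [fillIn, h, dif_pos]; fun_prop
  · simp only [fillIn, h, dif_neg, not_false_iff]; fun_prop

/-- The bounds on the radii allowing to add small wickets at marked points. -/
def RadiusBound (X : {i // i ∉ J} → ℂ × ℂ) (m : J → ℂ) (j : J) (ρ : ℝ) : Prop :=
  (∀ k, 9 * ρ < ‖m j - feet X k‖) ∧ ∀ k, k ≠ j → 20 * ρ < ‖m j - m k‖

theorem fillIn_shrinkable {X : {i // i ∉ J} → ℂ × ℂ} (hX : X ∈ Conf _) {m l : J → ℂ}
    (h : ∀ j, RadiusBound X m j ‖Complex.exp (l j)‖) : fillIn J X m l ∈ Shrinkable J := by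
  have h1 : ∀ i ∈ J, ∀ k ∉ J, ∀ b, 9 * ‖Complex.exp (fillIn J X m l i).2‖ <
      ‖(fillIn J X m l i).1 - feet (fillIn J X m l) (k, b)‖ := by
    intro i hi k hk b
    have := (h ⟨i, hi⟩).1 (⟨k, hk⟩, b)
    simpa only [feet, fillIn_mem X m l hi, fillIn_not_mem X m l hk] using this
  have h2 : ∀ i ∈ J, ∀ k ∈ J, i ≠ k → 20 * ‖Complex.exp (fillIn J X m l i).2‖ <
      ‖(fillIn J X m l i).1 - (fillIn J X m l k).1‖ := by
    intro i hi k hk hik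
    have := (h ⟨i, hi⟩).2 ⟨k, hk⟩ (fun e => hik (congrArg Subtype.val e).symm)
    simpa only [fillIn_mem X m l hi, fillIn_mem X m l hk] using this
  refine ⟨?_, h1, h2⟩
  have key : ∀ i ∈ J, ∀ k, i ≠ k → WDisj (fillIn J X m l i).1 (Complex.exp (fillIn J X m l i).2)
      (fillIn J X m l k).1 (Complex.exp (fillIn J X m l k).2) := by
    intro i hi k hik
    have n1 := norm_nonneg (Complex.exp (fillIn J X m l i).2)
    have n2 := norm_nonneg (Complex.exp (fillIn J X m l k).2)
    by_cases hk : k ∈ J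
    · have g1 := h2 i hi k hk hik
      have g2 := h2 k hk i hi hik.symm
      rw [norm_sub_rev] at g2
      refine wdisj_of_lt ?_ ?_
      · have := norm_sub_norm_le ((fillIn J X m l i).1 - (fillIn J X m l k).1)
          (Complex.exp (fillIn J X m l k).2)
        rw [sub_sub] at this
        linarith
      · have := norm_sub_norm_le ((fillIn J X m l i).1 - (fillIn J X m l k).1)
          (-Complex.exp (fillIn J X m l k).2)
        rw [sub_sub, norm_neg, ← sub_eq_add_neg] at this
        linarith
    · have g1 := h1 i hi k hk true
      have g2 := h1 i hi k hk false
      rw [feet_true] at g1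
      rw [feet_false] at g2
      exact wdisj_of_lt (by linarith) (by linarith)
  intro i j hij
  by_cases hi : i ∈ J
  · exact key i hi j hij
  by_cases hj : j ∈ J
  · exact (key j hj i hij.symm).symm
  · rw [fillIn_not_mem X m l hi, fillIn_not_mem X m l hj]
    exact hX _ _ fun e => hij (congrArg Subtype.val e)

theorem radiusBound_of_shrinkable {X : ι → ℂ × ℂ} (hX : X ∈ Shrinkable J) (j : J) :
    RadiusBound (fun i : {i // i ∉ J} => X i) (fun j : J => (X j).1) j ‖Complex.exp (X j).2‖ :=
  ⟨fun k => hX.2.1 j j.2 k.1 k.1.2 k.2, fun k hk => hX.2.2 j j.2 k k.2 fun e => hk (Subtype.ext e.symm)⟩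

theorem RadiusBound.mono {X : {i // i ∉ J} → ℂ × ℂ} {m : J → ℂ} {j : J} {ρ ρ' ρ'' : ℝ}
    (h : RadiusBound X m j ρ) (h' : RadiusBound X m j ρ') (hm : ρ'' ≤ max ρ ρ') :
    RadiusBound X m j ρ'' := by
  rcases le_max_iff.1 hm with hm | hm
  · exact ⟨fun k => by linarith [h.1 k], fun k hk => by linarith [h.2 k hk]⟩
  · exact ⟨fun k => by linarith [h'.1 k], fun k hk => by linarith [h'.2 k hk]⟩

theorem exists_radius [Fintype ι] : ∃ η : C(Marked {i // i ∉ J} J, ℝ), ∀ q, 0 < η q ∧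
    ∀ j, RadiusBound q.1.1.1 q.1.2 j (η q) := by
  classical
  let S : Marked {i // i ∉ J} J → ℝ := fun q => (∑ j : J, ∑ k, ‖q.1.2 j - feet q.1.1.1 k‖⁻¹) +
    ∑ j : J, ∑ k : J, if k = j then 0 else ‖q.1.2 j - q.1.2 k‖⁻¹
  have hS : Continuous S := by
    refine Continuous.add (continuous_finsetSum _ fun j _ => continuous_finsetSum _ fun k _ => ?_)
      (continuous_finsetSum _ fun j _ => continuous_finsetSum _ fun k _ => ?_)
    · refine Continuous.inv₀ ?_ fun q => norm_ne_zero_iff.2 (sub_ne_zero.2 (q.2.2 j k))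
      have : Continuous fun q : Marked {i // i ∉ J} J => feet q.1.1.1 k :=
        ((continuous_apply k).comp continuous_feet).comp (by fun_prop)
      fun_prop
    · by_cases hk : k = j
      · simp only [hk, if_true]; fun_prop
      · simp only [hk, if_false]
        exact Continuous.inv₀ (by fun_prop) fun q =>
          norm_ne_zero_iff.2 (sub_ne_zero.2 fun e => hk (q.2.1 e).symm)
  have h1 : ∀ q : Marked {i // i ∉ J} J, 0 ≤ ∑ j : J, ∑ k, ‖q.1.2 j - feet q.1.1.1 k‖⁻¹ := fun q => by positivity
  have hnn : ∀ (q : Marked {i // i ∉ J} J) (j k : J),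
      0 ≤ if k = j then 0 else ‖q.1.2 j - q.1.2 k‖⁻¹ := fun q j k => by split_ifs <;> positivity
  have h2 : ∀ q : Marked {i // i ∉ J} J,
      0 ≤ ∑ j : J, ∑ k : J, if k = j then 0 else ‖q.1.2 j - q.1.2 k‖⁻¹ :=
    fun q => Finset.sum_nonneg fun j _ => Finset.sum_nonneg fun k _ => hnn q j k
  have hS0 : ∀ q, 0 ≤ S q := fun q => add_nonneg (h1 q) (h2 q)
  have hfin : ∀ q, ∀ d : ℝ, 0 < d → d⁻¹ ≤ S q → 20 * (40 * (1 + S q))⁻¹ < d := by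
    intro q d hd h
    have := hS0 q
    rw [inv_le_iff_one_le_mul₀ hd] at h
    rw [← div_eq_mul_inv, div_lt_iff₀ (by positivity)]
    nlinarith
  refine ⟨⟨fun q => (40 * (1 + S q))⁻¹, Continuous.inv₀ (by fun_prop) fun q => ?_⟩, fun q => ⟨?_, ?_⟩⟩
  · have := hS0 q; positivity
  · have := hS0 q; simp only [ContinuousMap.coe_mk]; positivity
  · intro j
    have hp : 0 < (40 * (1 + S q))⁻¹ := by have := hS0 q; positivity
    refine ⟨fun k => ?_, fun k hk => ?_⟩
    · have := hfin q _ (norm_pos_iff.2 (sub_ne_zero.2 (q.2.2 j k))) ?_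
      · simp only [ContinuousMap.coe_mk]; linarith
      · have a1 := Finset.single_le_sum (f := fun k => ‖q.1.2 j - feet q.1.1.1 k‖⁻¹)
          (fun _ _ => by positivity) (Finset.mem_univ k)
        have a2 := Finset.single_le_sum (f := fun j => ∑ k, ‖q.1.2 j - feet q.1.1.1 k‖⁻¹)
          (fun _ _ => by positivity) (Finset.mem_univ j)
        have := h2 q
        simp only [S]
        linarith
    · refine hfin q _ (norm_pos_iff.2 (sub_ne_zero.2 fun e => hk (q.2.1 e).symm)) ?_
      have a1 := Finset.single_le_sum (f := fun k => if k = j then 0 else ‖q.1.2 j - q.1.2 k‖⁻¹)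
        (fun k _ => hnn q j k) (Finset.mem_univ k)
      have a2 := Finset.single_le_sum
        (f := fun j => ∑ k : J, if k = j then 0 else ‖q.1.2 j - q.1.2 k‖⁻¹)
        (fun j _ => Finset.sum_nonneg fun k _ => hnn q j k) (Finset.mem_univ j)
      have := h1 q
      simp only [hk, if_false] at a1
      simp only [S]
      linarith

theorem nonempty_pairEquiv_marked [Fintype ι] :
    Nonempty (PairEquiv (flatIn (Shrinkable J)) (markedFlat {i // i ∉ J} J)) := by
  obtain ⟨η, hη⟩ := exists_radius (J := J)
  have hlog : Continuous fun q => Real.log (η q) :=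
    Continuous.log η.continuous fun q => (hη q).1.ne'
  have hexp : ∀ q, ‖Complex.exp ((Real.log (η q) : ℝ) : ℂ)‖ = η q := fun q => by
    rw [Complex.norm_exp, Complex.ofReal_re, Real.exp_log (hη q).1]
  have hconf : ∀ X : Shrinkable J, (fun i : {i // i ∉ J} => X.1 i) ∈ Conf {i // i ∉ J} :=
    fun X i j hij => X.2.1 i j fun e => hij (Subtype.ext e)
  let f : C(Shrinkable J, Marked {i // i ∉ J} J) :=
    ⟨fun X => ⟨(⟨fun i => X.1 i, hconf X⟩, fun j => (X.1 j).1), by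
      constructor
      · intro j k e
        by_contra hjk
        have := X.2.2.2 j j.2 k k.2 fun e => hjk (Subtype.ext e)
        have e' : (X.1 j).1 = (X.1 k).1 := e
        rw [e', sub_self, norm_zero] at this
        linarith [norm_nonneg (Complex.exp (X.1 j).2)]
      · intro j k e
        have := X.2.2.1 j j.2 k.1 k.1.2 k.2
        have e' : (X.1 j).1 = feet X.1 (k.1, k.2) := e
        rw [e', sub_self, norm_zero] at this
        linarith [norm_nonneg (Complex.exp (X.1 j).2)]⟩, by
      refine Continuous.subtype_mk (Continuous.prodMk (Continuous.subtype_mk ?_ _) ?_) _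
      · exact continuous_pi fun i => (continuous_apply i.1).comp continuous_subtype_val
      · exact continuous_pi fun i =>
          continuous_fst.comp ((continuous_apply i.1).comp continuous_subtype_val)⟩
  let g : C(Marked {i // i ∉ J} J, Shrinkable J) :=
    ⟨fun q => ⟨fillIn J q.1.1.1 q.1.2 fun _ => (Real.log (η q) : ℝ),
      fillIn_shrinkable q.1.1.2 fun j => by rw [hexp]; exact (hη q).2 j⟩,
      (continuous_fillIn.comp (f := fun q : Marked {i // i ∉ J} J =>
        (q.1.1.1, q.1.2, fun _ : J => ((Real.log (η q) : ℝ) : ℂ))) (by fun_prop)).subtype_mk _⟩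
  have hfg : f.comp g = ContinuousMap.id _ := by
    ext1 q
    refine Subtype.ext (Prod.ext (Subtype.ext (funext fun i => ?_)) (funext fun j => ?_))
    · simp [f, g, fillIn_not_mem _ _ _ i.2]
    · simp [f, g, fillIn_mem _ _ _ j.2]
  have hre : ∀ (s : I) (a : ℝ) (l : ℂ), ‖Complex.exp ((1 - (s : ℝ)) * (a : ℂ) + (s : ℝ) * l)‖ ≤
      max ‖Complex.exp (a : ℂ)‖ ‖Complex.exp l‖ := by
    intro s a l
    simp only [Complex.norm_exp]
    rw [← Real.exp_monotone.map_max, Real.exp_le_exp]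
    have : ((1 - (s : ℝ)) * (a : ℂ) + (s : ℝ) * l).re = (1 - s) * a + s * l.re := by simp
    rw [this, Complex.ofReal_re]
    have h1 := le_max_left a l.re
    have h2 := le_max_right a l.re
    have := s.2.1
    have := s.2.2
    nlinarith
  let L : I × Shrinkable J → ι → ℂ × ℂ := fun p => fillIn J (fun i => p.2.1 i)
    (fun j => (p.2.1 j).1) (fun j => (1 - ((p.1 : ℝ) : ℂ)) * (Real.log (η (f p.2)) : ℝ) +
      ((p.1 : ℝ) : ℂ) * (p.2.1 j).2)
  have happ : ∀ i, Continuous fun p : I × Shrinkable J => p.2.1 i := fun i =>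
    (continuous_apply i).comp (continuous_subtype_val.comp continuous_snd)
  have hη' : Continuous fun p : I × Shrinkable J => Real.log (η (f p.2)) :=
    hlog.comp (f.continuous.comp continuous_snd)
  have hL : Continuous L := by
    refine (continuous_fillIn (J := J)).comp (f := fun p : I × Shrinkable J =>
      ((fun i : {i // i ∉ J} => p.2.1 i.1), ((fun j : J => (p.2.1 j.1).1),
        (fun j : J => (1 - ((p.1 : ℝ) : ℂ)) * (Real.log (η (f p.2)) : ℝ) +
          ((p.1 : ℝ) : ℂ) * (p.2.1 j).2)))) (Continuous.prodMk (continuous_pi fun i => happ i.1)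
      (Continuous.prodMk (continuous_pi fun j => continuous_fst.comp (happ j.1))
        (continuous_pi fun j => ?_)))
    have := happ j.1
    fun_prop
  have hLm : ∀ p, L p ∈ Shrinkable J := by
    intro p
    refine fillIn_shrinkable (hconf p.2) fun j => ?_
    refine RadiusBound.mono ?_ (radiusBound_of_shrinkable p.2.2 j) (hre _ _ _)
    rw [hexp]
    exact (hη (f p.2)).2 j
  refine ⟨⟨f, g, fun X h i => h i, fun q h i => ?_, ⟨⟨fun p => ⟨L p, hLm p⟩, by fun_prop⟩, ?_, ?_⟩,
    fun t X h i => ?_, ⟨⟨fun p => p.2, by fun_prop⟩, fun q => ?_, fun q => rfl⟩, fun t q h => h⟩⟩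
  · simp only [g, ContinuousMap.coe_mk]
    by_cases hi : i ∈ J
    · rw [fillIn_mem _ _ _ hi]; simp
    · rw [fillIn_not_mem _ _ _ hi]; exact h ⟨i, hi⟩
  · intro X
    refine Subtype.ext ?_
    simp [L, g, f]
  · intro X
    refine Subtype.ext ?_
    simp [L, fillIn_restrict]
  · change ((fillIn J _ _ _) i).2.im = 0
    by_cases hi : i ∈ J
    · rw [fillIn_mem _ _ _ hi]
      simp [h i]
    · rw [fillIn_not_mem _ _ _ hi]; exact h i
  · exact (DFunLike.congr_fun hfg q).symm

end Untwisting

universe u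

section UntwistingTheorem

theorem inclF_of_eq_univ {X : Type*} [TopologicalSpace X] {S : Set X} (h : ∀ x, x ∈ S) :
    (inclF S).EssSurj ∧ (inclF S).Full ∧ (inclF S).Faithful := by
  refine ⟨inclF_essSurj_iff.2 fun z => ⟨z, h z, Joined.refl z⟩,
    inclF_full_iff.2 fun x y _ _ γ => ⟨γ, fun t => h _, .refl γ⟩,
    inclF_faithful_iff.2 fun x _ γ _ e => ?_⟩
  obtain ⟨F⟩ := e
  exact ⟨F, fun p => h _⟩

variable {ι : Type u}

theorem raiseTiny_subset (J : Set ι) : RaiseTiny J ⊆ Conf ι := fun _ h => h.1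

/-- A path of configurations in `RaiseTiny J`, as a path in that subspace. -/
def pathRaiseTiny {J : Set ι} {x y : Conf ι} (γ : Path x y) (h : ∀ t, (γ t).1 ∈ RaiseTiny J) :
    Path (⟨x.1, by simpa using h 0⟩ : RaiseTiny J) ⟨y.1, by simpa using h 1⟩ where
  toFun t := ⟨(γ t).1, h t⟩
  continuous_toFun := by fun_prop
  source' := by simp
  target' := by simp

/-- The inclusion of `RaiseTiny J` in the space of configurations. -/
def inclRaiseTiny (J : Set ι) : C(RaiseTiny J, Conf ι) :=
  ⟨Set.inclusion (raiseTiny_subset J), continuous_inclusion _⟩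

theorem mem_raiseTiny_singleton_iff {i : ι} {X : ι → ℂ × ℂ} :
    X ∈ RaiseTiny {i} ↔ X ∈ Conf ι ∧ ∃ w, 0 ≤ w ∧ Below w X ∧ TinyAt i (raise w X) := by
  simp [RaiseTiny]

theorem mem_raiseTiny_pair_iff {i j : ι} {X : ι → ℂ × ℂ} :
    X ∈ RaiseTiny {i, j} ↔ X ∈ RaiseTiny {i} ∧ X ∈ RaiseTiny {j} := by
  simp only [RaiseTiny, Set.mem_insert_iff, Set.mem_singleton_iff, Set.mem_ofPred_eq]
  constructor
  · rintro ⟨h, h'⟩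
    exact ⟨⟨h, fun k hk => h' k (Or.inl hk)⟩, ⟨h, fun k hk => h' k (Or.inr hk)⟩⟩
  · rintro ⟨⟨h, h1⟩, ⟨-, h2⟩⟩
    exact ⟨h, fun k hk => hk.elim (h1 k) (h2 k)⟩

theorem isOpen_raiseTiny_singleton [Finite ι] (i : ι) :
    IsOpen {X : Conf ι | X.1 ∈ RaiseTiny {i}} := by
  have : {X : Conf ι | X.1 ∈ RaiseTiny {i}} = ⋃ w : ℝ, ⋃ _ : 0 ≤ w,
      Subtype.val ⁻¹' {X : ι → ℂ × ℂ | Below w X ∧ TinyAt i (raise w X)} := by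
    ext X
    simp [mem_raiseTiny_singleton_iff, and_left_comm]
  rw [this]
  exact isOpen_iUnion fun w => isOpen_iUnion fun _ =>
    (isOpen_tinyAt_raise i w).preimage continuous_subtype_val

/-- On fundamental groupoids, the inclusion of the flat configurations in all configurations is
essentially surjective, full and faithful. -/
theorem inclF_flat (ι : Type u) [Fintype ι] :
    (inclF (flat ι)).EssSurj ∧ (inclF (flat ι)).Full ∧ (inclF (flat ι)).Faithful := by
  classical
  induction hn : Fintype.card ι using Nat.strong_induction_on generalizing ι with
  | _ n ih =>
  rcases isEmpty_or_nonempty ι with hι | hι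
  · exact inclF_of_eq_univ fun x i => isEmptyElim i
  have IH : ∀ J : Set ι, J.Nonempty → (inclF (flat {i // i ∉ J})).EssSurj ∧
      (inclF (flat {i // i ∉ J})).Full ∧ (inclF (flat {i // i ∉ J})).Faithful := by
    rintro J ⟨j, hj⟩
    refine ih _ ?_ {i // i ∉ J} rfl
    rw [← hn]
    exact Fintype.card_subtype_lt (x := j) (by simpa using hj)
  have hess : ∀ J : Set ι, J.Nonempty → (inclF (flatIn (RaiseTiny J))).EssSurj := fun J hJ =>
    nonempty_pairEquiv_allTiny.some.essSurj <| nonempty_pairEquiv_shrinkable.some.essSurj <|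
      nonempty_pairEquiv_marked.some.essSurj <| markedFlat_essSurj (IH J hJ).1
  have hfull : ∀ J : Set ι, J.Nonempty → (inclF (flatIn (RaiseTiny J))).Full := fun J hJ =>
    nonempty_pairEquiv_allTiny.some.full <| nonempty_pairEquiv_shrinkable.some.full <|
      nonempty_pairEquiv_marked.some.full <| markedFlat_full (IH J hJ).2.1
  have hfaith : ∀ i : ι, (inclF (flatIn (RaiseTiny {i}))).Faithful := fun i =>
    nonempty_pairEquiv_allTiny.some.faithful <| nonempty_pairEquiv_shrinkable.some.faithful <|
      nonempty_pairEquiv_marked.some.faithful <|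
        markedFlat_faithful (IH {i} (Set.singleton_nonempty i)).2.2
  refine inclF_local_to_global (V := fun i => {X : Conf ι | X.1 ∈ RaiseTiny {i}})
    isOpen_raiseTiny_singleton ?_ ?_ ?_ ?_
  · intro X
    obtain ⟨i, w, h⟩ := exists_tinyAt_raise X.2
    exact ⟨i, mem_raiseTiny_singleton_iff.2 ⟨X.2, w, h⟩⟩
  · intro X
    let J : Set ι := {i | X.1 ∈ RaiseTiny {i}}
    have hJ : J.Nonempty := by
      obtain ⟨i, w, h⟩ := exists_tinyAt_raise X.2
      exact ⟨i, mem_raiseTiny_singleton_iff.2 ⟨X.2, w, h⟩⟩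
    have hX : X.1 ∈ RaiseTiny J := ⟨X.2, fun i hi => (mem_raiseTiny_singleton_iff.1 hi).2⟩
    obtain ⟨w, hw, ⟨p⟩⟩ := inclF_essSurj_iff.1 (hess J hJ) ⟨X.1, hX⟩
    refine ⟨inclRaiseTiny J w, hw, p.map (inclRaiseTiny J).continuous, fun i hi t => ?_⟩
    exact mem_raiseTiny_singleton_iff.2 ⟨(p t).2.1, (p t).2.2 i hi⟩
  · intro i j x hx y hy γ hi hj
    have hγ : ∀ t, (γ t).1 ∈ RaiseTiny {i, j} := fun t => mem_raiseTiny_pair_iff.2 ⟨hi t, hj t⟩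
    obtain ⟨δ, hδ, ⟨F⟩⟩ := inclF_full_iff.1 (hfull {i, j} (by simp)) _ _ hx hy
      (pathRaiseTiny γ hγ)
    exact ⟨δ.map (inclRaiseTiny _).continuous, hδ, (F.map (inclRaiseTiny _)).cast rfl rfl,
      fun p => mem_raiseTiny_pair_iff.1 (F p).2⟩
  · rintro i x hx γ hγ ⟨F, hF⟩
    have h0 : HomIn {X : Conf ι | X.1 ∈ RaiseTiny {i}} γ (Path.refl x) := ⟨F, hF⟩
    have hγ' : ∀ t, (γ t).1 ∈ RaiseTiny {i} := h0.left
    have hx' : x.1 ∈ RaiseTiny {i} := by simpa using hγ' 0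
    have hom : (pathRaiseTiny γ hγ').Homotopic (Path.refl (⟨x.1, hx'⟩ : RaiseTiny {i})) := by
      refine ⟨⟨⟨⟨fun p => ⟨(F p).1, hF p⟩, by fun_prop⟩, fun t => ?_, fun t => ?_⟩,
        fun t p hp => ?_⟩⟩
      · refine Subtype.ext ?_
        simp [pathRaiseTiny]
      · exact Subtype.ext (by simp)
      · have h : F (t, p) = γ p := F.prop' t p hp
        refine Subtype.ext ?_
        change (F (t, p)).1 = (γ p).1
        rw [h]
    obtain ⟨G, hG⟩ := inclF_faithful_iff.1 (hfaith i) _ hx (pathRaiseTiny γ hγ') hγ hom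
    exact ⟨(G.map (inclRaiseTiny _)).cast rfl rfl, fun p => hG p⟩

end UntwistingTheorem

section Reordering

variable {α H : Type*} [Group H] (A : ℕ → α → α → H)

/-- The product of the elements `A j y x` moving `x` down through the list `u`, to position `k`. -/
def moveDown (x : α) : ℕ → List α → H
  | _, [] => 1
  | k, y :: u => moveDown x (k + 1) u * A k y x

theorem moveDown_append (x : α) (k : ℕ) (u v : List α) :
    moveDown A x k (u ++ v) = moveDown A x (k + u.length) v * moveDown A x k u := by
  induction u generalizing k with
  | nil => simp [moveDown]
  | cons y u ih =>
    rw [List.cons_append, moveDown, ih, moveDown, List.length_cons, mul_assoc]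
    congr 2
    omega

theorem moveDown_singleton (x y : α) (k : ℕ) : moveDown A x k [y] = A k y x := by
  simp [moveDown]

theorem moveDown_commute {x : α} {k : ℕ} {u : List α} {g : H}
    (h : ∀ j y, k ≤ j → j < k + u.length → Commute g (A j y x)) :
    Commute g (moveDown A x k u) := by
  induction u generalizing k with
  | nil => exact Commute.one_right g
  | cons y u ih =>
    rw [moveDown]
    refine Commute.mul_right (ih fun j z h1 h2 => h j z (by omega) ?_) (h k y le_rfl ?_)
    · rw [List.length_cons]; omega
    · rw [List.length_cons]; omega

theorem moveDown_congr {A A' : ℕ → α → α → H} {x : α} {u : List α}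
    (h : ∀ k, ∀ y ∈ u, A k y x = A' k y x) (k : ℕ) : moveDown A x k u = moveDown A' x k u := by
  induction u generalizing k with
  | nil => rfl
  | cons y u ih =>
    rw [moveDown, moveDown, h k y (by simp), ih fun k y hy => h k y (by simp [hy])]

variable [DecidableEq α]

/-- The product of the elements `A` reordering `l` to `r`, moving the entries of `r` to their
place one after the other. -/
def reorder : ℕ → List α → List α → H
  | _, _, [] => 1
  | k, l, x :: r => moveDown A x k (l.takeWhile (· ≠ x)) * reorder (k + 1) (l.erase x) r

theorem reorder_cons {x : α} {u : List α} (hx : x ∉ u) (k : ℕ) (w r : List α) :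
    reorder A k (u ++ x :: w) (x :: r) = moveDown A x k u * reorder A (k + 1) (u ++ w) r := by
  rw [reorder]
  congr 2
  · rw [List.takeWhile_append_of_pos (by intro y hy; simp; rintro rfl; exact hx hy)]
    simp
  · rw [List.erase_append_right _ hx]
    simp

variable {A} {R : α → α → Prop} {N : ℕ}

/-- The relations between the elements `A` used in reordering. -/
structure ReorderRels (A : ℕ → α → α → H) (R : α → α → Prop) (N : ℕ) : Prop where
  inv : ∀ k x y, x ≠ y → R x y → R y x → A k x y * A k y x = 1
  far : ∀ j k x y z w, j + 2 ≤ k → Commute (A j x y) (A k z w)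
  hex : ∀ k x y z, k + 2 < N → x ≠ y → x ≠ z → y ≠ z → R x y → R y x → R x z → R z x → R y z →
    R z y → A k x y * A (k + 1) x z * A k y z = A (k + 1) y z * A k x z * A (k + 1) x y

theorem reorder_swap (hA : ReorderRels A R N) {k : ℕ} {u w r : List α} {a b : α}
    (hp : (u ++ a :: b :: w).Perm r) (hnd : r.Nodup) (hN : k + r.length ≤ N)
    (hl : (u ++ a :: b :: w).Pairwise R) (hr : r.Pairwise R) (hba : R b a) :
    reorder A k (u ++ a :: b :: w) r = A (k + u.length) a b * reorder A k (u ++ b :: a :: w) r := by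
  have hab : R a b := by
    have := (List.pairwise_append.1 hl).2.1
    exact (List.pairwise_cons.1 this).1 b (by simp)
  have hnd' : (u ++ a :: b :: w).Nodup := hp.nodup_iff.2 hnd
  have hne : a ≠ b := by
    rintro rfl
    simp [List.nodup_append] at hnd'
  induction r generalizing k u w with
  | nil => simp at hp
  | cons x r ih =>
    have hx : x ∈ u ++ a :: b :: w := hp.symm.subset (by simp)
    have hlen : (u ++ a :: b :: w).length = r.length + 1 := by simpa using hp.length_eq
    have hrR := List.pairwise_cons.1 hr
    have hndr := List.nodup_cons.1 hnd
    rw [List.length_cons] at hN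
    rcases List.mem_append.1 hx with hxu | hx'
    · obtain ⟨u₁, u₂, rfl⟩ := List.append_of_mem hxu
      have hxu₁ : x ∉ u₁ := by
        intro h
        simp only [List.append_assoc, List.cons_append] at hnd'
        exact (List.nodup_append.1 hnd').2.2 x h x (by simp) rfl
      have e1 : ∀ v, (u₁ ++ x :: u₂) ++ v = u₁ ++ x :: (u₂ ++ v) := by simp
      rw [e1, e1, reorder_cons A hxu₁, reorder_cons A hxu₁]
      have hp' : ((u₁ ++ u₂) ++ a :: b :: w).Perm r := by
        rw [e1] at hp
        have := (List.perm_middle.symm.trans hp)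
        simpa using this.cons_inv
      have hsub : ((u₁ ++ u₂) ++ a :: b :: w).Sublist ((u₁ ++ x :: u₂) ++ a :: b :: w) := by
        refine List.Sublist.append (List.Sublist.append (List.Sublist.refl _) ?_) (List.Sublist.refl _)
        exact List.sublist_cons_self x u₂
      have := ih hp' hndr.2 (k := k + 1) (by omega) (hl.sublist hsub) hrR.2 (hnd'.sublist hsub)
      rw [← List.append_assoc, ← List.append_assoc, this, ← mul_assoc, ← mul_assoc]
      congr 1
      have e2 : k + 1 + (u₁ ++ u₂).length = k + (u₁ ++ x :: u₂).length := by simp; omega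
      rw [e2]
      refine (moveDown_commute A fun j y h1 h2 => (hA.far _ _ _ _ _ _ ?_).symm).eq.symm
      simp; omega
    rw [List.mem_cons, List.mem_cons] at hx'
    rcases hx' with rfl | rfl | hxw
    · have hxu : x ∉ u := fun h => (List.nodup_append.1 hnd').2.2 x h x (by simp) rfl
      have hxu' : x ∉ u ++ [b] := by simp [hxu, hne]
      have e1 : u ++ b :: x :: w = (u ++ [b]) ++ x :: w := by simp
      rw [e1, reorder_cons A hxu, reorder_cons A hxu', moveDown_append, moveDown_singleton,
        ← mul_assoc, ← mul_assoc, hA.inv _ _ _ hne hab hba, one_mul]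
      simp
    · have hxu : x ∉ u := fun h => (List.nodup_append.1 hnd').2.2 x h x (by simp) rfl
      have hxu' : x ∉ u ++ [a] := by simp [hxu, hne.symm]
      have e1 : u ++ a :: x :: w = (u ++ [a]) ++ x :: w := by simp
      rw [e1, reorder_cons A hxu, reorder_cons A hxu', moveDown_append, moveDown_singleton,
        ← mul_assoc]
      simp
    · obtain ⟨w₁, w₂, rfl⟩ := List.append_of_mem hxw
      have hxn : x ∉ u ++ a :: b :: w₁ := by
        have e : u ++ a :: b :: (w₁ ++ x :: w₂) = (u ++ a :: b :: w₁) ++ x :: w₂ := by simp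
        rw [e] at hnd'
        intro h
        exact (List.nodup_append.1 hnd').2.2 x h x (by simp) rfl
      have hxn' : x ∉ u ++ b :: a :: w₁ := by
        simpa [or_left_comm, and_left_comm] using hxn
      have e1 : u ++ a :: b :: (w₁ ++ x :: w₂) = (u ++ a :: b :: w₁) ++ x :: w₂ := by simp
      have e2 : u ++ b :: a :: (w₁ ++ x :: w₂) = (u ++ b :: a :: w₁) ++ x :: w₂ := by simp
      have hsub : (u ++ a :: b :: (w₁ ++ w₂)).Sublist (u ++ a :: b :: (w₁ ++ x :: w₂)) := by
        refine List.Sublist.append (List.Sublist.refl _) (List.Sublist.cons_cons _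
          (List.Sublist.cons_cons _ (List.Sublist.append (List.Sublist.refl _) ?_)))
        exact List.sublist_cons_self x w₂
      have hp' : (u ++ a :: b :: (w₁ ++ w₂)).Perm r := by
        rw [e1] at hp
        have := (List.perm_middle.symm.trans hp).cons_inv
        simpa using this
      have hIH := ih hp' hndr.2 (k := k + 1) (by omega) (hl.sublist hsub) hrR.2 (hnd'.sublist hsub)
      have hxa : x ≠ a := by rintro rfl; simp at hxn
      have hxb : x ≠ b := by rintro rfl; simp at hxn
      have hax : R a x := by
        have := (List.pairwise_append.1 hl).2.1
        exact (List.pairwise_cons.1 this).1 x (by simp)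
      have hbx : R b x := by
        have := (List.pairwise_cons.1 (List.pairwise_append.1 hl).2.1).2
        exact (List.pairwise_cons.1 this).1 x (by simp)
      have har : a ∈ r := hp'.subset (by simp)
      have hbr : b ∈ r := hp'.subset (by simp)
      have hxa' : R x a := hrR.1 a har
      have hxb' : R x b := hrR.1 b hbr
      have s1 : ∀ c d : α, moveDown A x k (u ++ c :: d :: w₁) =
          moveDown A x (k + u.length + 2) w₁ * A (k + u.length + 1) d x * A (k + u.length) c x *
            moveDown A x k u := by
        intro c d
        rw [moveDown_append, moveDown, moveDown]
      rw [e1, e2, reorder_cons A hxn, reorder_cons A hxn', s1, s1]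
      have e3 : ∀ c d : α, (u ++ c :: d :: w₁) ++ w₂ = u ++ c :: d :: (w₁ ++ w₂) := by simp
      rw [e3, e3, hIH]
      have c1 : Commute (A (k + 1 + u.length) a b) (moveDown A x k u) :=
        moveDown_commute A fun j y h1 h2 => (hA.far _ _ _ _ _ _ (by omega)).symm
      have c2 : Commute (A (k + u.length) a b) (moveDown A x (k + u.length + 2) w₁) :=
        moveDown_commute A fun j y h1 h2 => hA.far _ _ _ _ _ _ (by omega)
      have hlen' : u.length + 3 ≤ r.length + 1 := by
        simp at hlen; omega
      have hx' := hA.hex (k + u.length) a b x (by omega) hne hxa.symm hxb.symm hab hba hax hxa' hbx hxb'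
      have e4 : k + 1 + u.length = k + u.length + 1 := by omega
      rw [e4] at c1 ⊢
      set M₁ := moveDown A x (k + u.length + 2) w₁
      set M₂ := moveDown A x k u
      set Q := reorder A (k + 1) (u ++ b :: a :: (w₁ ++ w₂)) r
      calc M₁ * A (k + u.length + 1) b x * A (k + u.length) a x * M₂ *
            (A (k + u.length + 1) a b * Q)
          = M₁ * A (k + u.length + 1) b x * A (k + u.length) a x *
            (M₂ * A (k + u.length + 1) a b) * Q := by simp only [mul_assoc]
        _ = M₁ * (A (k + u.length + 1) b x * A (k + u.length) a x *
            A (k + u.length + 1) a b) * M₂ * Q := by rw [← c1.eq]; simp only [mul_assoc]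
        _ = M₁ * A (k + u.length) a b * (A (k + u.length + 1) a x * A (k + u.length) b x) * M₂ * Q := by
            rw [← hx']; simp only [mul_assoc]
        _ = _ := by rw [← c2.eq]; simp only [mul_assoc]

/-- A function on orderings which changes by `A` under transpositions changes by `reorder`. -/
theorem eq_reorder_mul {f : List α → H} {base : List α} (hbase : base.Nodup)
    (hf : ∀ u a b w, (u ++ a :: b :: w).Perm base → (u ++ a :: b :: w).Pairwise R → R b a →
      f (u ++ a :: b :: w) = A u.length a b * f (u ++ b :: a :: w))
    {l l' : List α} (g : List α) (hp : (g ++ l).Perm base) (hll' : l.Perm l')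
    (hl : (g ++ l).Pairwise R) (hl' : (g ++ l').Pairwise R) :
    f (g ++ l) = reorder A g.length l l' * f (g ++ l') := by
  have key : ∀ (g u : List α) (x : α) (w : List α), (g ++ (u ++ x :: w)).Perm base →
      (g ++ (u ++ x :: w)).Pairwise R → (∀ y ∈ u, R x y) →
      f (g ++ (u ++ x :: w)) = moveDown A x g.length u * f (g ++ x :: (u ++ w)) := by
    intro g u x
    induction u using List.reverseRecOn with
    | nil => intro w _ _ _; simp [moveDown]
    | append_singleton u y ih =>
      intro w hp hR hx
      have e1 : g ++ (u ++ [y] ++ x :: w) = (g ++ u) ++ y :: x :: w := by simp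
      have e2 : (g ++ u) ++ x :: y :: w = g ++ (u ++ x :: (y :: w)) := by simp
      rw [e1] at hp hR ⊢
      have hyx : R y x := by
        have := (List.pairwise_append.1 hR).2.1
        exact (List.pairwise_cons.1 this).1 x (by simp)
      have hp2 : ((g ++ u) ++ x :: y :: w).Perm base :=
        (List.Perm.append_left _ (List.Perm.swap y x w)).trans hp
      have hR2 : ((g ++ u) ++ x :: y :: w).Pairwise R := by
        rw [List.pairwise_append] at hR ⊢
        refine ⟨hR.1, ?_, fun p hp q hq => hR.2.2 p hp q (by simp at hq ⊢; tauto)⟩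
        have h1 := List.pairwise_cons.1 hR.2.1
        have h2 := List.pairwise_cons.1 h1.2
        refine List.pairwise_cons.2 ⟨?_, List.pairwise_cons.2 ⟨fun q hq => h1.1 q (by simp [hq]), h2.2⟩⟩
        intro q hq
        rcases List.mem_cons.1 hq with rfl | hq
        · exact hx q (by simp)
        · exact h2.1 q hq
      rw [hf _ _ _ _ hp hR (hx y (by simp)), e2, ih (y :: w) (by rw [← e2]; exact hp2)
        (by rw [← e2]; exact hR2) (fun z hz => hx z (by simp [hz])), ← mul_assoc, moveDown_append,
        moveDown_singleton]
      simp
  induction l' generalizing g l with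
  | nil => simp [reorder, hll'.eq_nil]
  | cons x r ih =>
    have hxl : x ∈ l := hll'.symm.subset (by simp)
    obtain ⟨u, w, rfl⟩ := List.append_of_mem hxl
    have hnd : (u ++ x :: w).Nodup :=
      (hp.nodup_iff.2 hbase).sublist (List.sublist_append_right _ _)
    have hxu : x ∉ u := fun h => (List.nodup_append.1 hnd).2.2 x h x (by simp) rfl
    have hR' := List.pairwise_cons.1 (List.pairwise_append.1 hl').2.1
    have hpr : (u ++ w).Perm r := (List.perm_middle.symm.trans hll').cons_inv
    have hxy : ∀ y ∈ u, R x y := fun y hy => hR'.1 y (hpr.subset (by simp [hy]))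
    have e1 : ∀ v, g ++ x :: v = (g ++ [x]) ++ v := by simp
    have hp2 : (g ++ x :: (u ++ w)).Perm base :=
      (List.Perm.append_left _ List.perm_middle.symm).trans hp
    have hR2 : (g ++ x :: (u ++ w)).Pairwise R := by
      have hs : (u ++ w).Sublist (u ++ x :: w) :=
        List.Sublist.append (List.Sublist.refl _) (List.sublist_cons_self _ _)
      have h1 := List.pairwise_append.1 hl
      rw [List.pairwise_append]
      refine ⟨h1.1, List.pairwise_cons.2 ⟨?_, h1.2.1.sublist hs⟩, ?_⟩
      · intro y hy
        exact hR'.1 y (hpr.subset hy)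
      · intro p hp q hq
        refine h1.2.2 p hp q ?_
        simp at hq ⊢; tauto
    rw [key g u x w hp hl hxy, reorder_cons A hxu, e1 (u ++ w), e1 r, ih (g ++ [x]) (by rw [← e1]; exact hp2) hpr
      (by rw [← e1]; exact hR2) (by rw [← e1]; exact hl'), mul_assoc]
    simp

theorem reorder_self (l : List α) (k : ℕ) : reorder A k l l = 1 := by
  induction l generalizing k with
  | nil => rfl
  | cons x l ih =>
    have := reorder_cons A (x := x) (u := []) (by simp) k l l
    simp only [List.nil_append] at this
    rw [this, ih, moveDown, mul_one]

theorem reorder_trans (hA : ReorderRels A R N) {l l' r : List α} (hr : r.Nodup)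
    (hN : r.length ≤ N) (hlr : l.Perm r) (hlr' : l'.Perm r) (hl : l.Pairwise R) (hl' : l'.Pairwise R)
    (hrR : r.Pairwise R) : reorder A 0 l r = reorder A 0 l l' * reorder A 0 l' r := by
  have := eq_reorder_mul (A := A) (R := R) (f := fun l => reorder A 0 l r) hr
    (fun u a b w hp hR hba => by
      have := reorder_swap hA (k := 0) hp hr (by simpa using hN) hR hrR hba
      simpa using this) [] hlr (hlr.trans hlr'.symm) hl hl'
  simpa using this

theorem reorder_congr {A' : ℕ → α → α → H} (h : ∀ k x y, x ≠ y → R x y → R y x → A k x y = A' k x y)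
    {l l' : List α} (hll' : l.Perm l') (hnd : l.Nodup) (hl : l.Pairwise R) (hl' : l'.Pairwise R)
    (k : ℕ) : reorder A k l l' = reorder A' k l l' := by
  induction l' generalizing k l with
  | nil => rfl
  | cons x r ih =>
    have hxl : x ∈ l := hll'.symm.subset (by simp)
    obtain ⟨u, w, rfl⟩ := List.append_of_mem hxl
    have hxu : x ∉ u := fun h => (List.nodup_append.1 hnd).2.2 x h x (by simp) rfl
    have hpr : (u ++ w).Perm r := (List.perm_middle.symm.trans hll').cons_inv
    have hs : (u ++ w).Sublist (u ++ x :: w) :=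
      List.Sublist.append (List.Sublist.refl _) (List.sublist_cons_self _ _)
    have hR' := List.pairwise_cons.1 hl'
    rw [reorder_cons A hxu, reorder_cons A' hxu, ih hpr (hnd.sublist hs) (hl.sublist hs) hR'.2]
    congr 1
    refine moveDown_congr (fun k y hy => h k y x (fun e => hxu (e ▸ hy)) ?_ ?_) k
    · exact (List.pairwise_append.1 hl).2.2 y hy x (by simp)
    · exact hR'.1 y (hpr.subset (by simp [hy]))

theorem map_reorder {H' : Type*} [Group H'] (φ : H →* H') (k : ℕ) (l l' : List α) :
    φ (reorder A k l l') = reorder (fun k x y => φ (A k x y)) k l l' := by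
  have hmd : ∀ x k u, φ (moveDown A x k u) = moveDown (fun k x y => φ (A k x y)) x k u := by
    intro x k u
    induction u generalizing k with
    | nil => simp [moveDown]
    | cons y u ih => simp [moveDown, ih]
  induction l' generalizing k l with
  | nil => simp [reorder]
  | cons x r ih => rw [reorder, reorder, map_mul, hmd, ih]

end Reordering

section IntervalBraiding

variable {H : Type*} [Group H]

/-- The relations between the generators `ρ` and `ς`, for indices less than `N - 1`. -/
structure BraidRels (ρ ς : ℕ → H) (N : ℕ) : Prop where
  ρρ_far : ∀ i j, i + 2 ≤ j → Commute (ρ i) (ρ j)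
  ςς_far : ∀ i j, i + 2 ≤ j → Commute (ς i) (ς j)
  ρς_far : ∀ i j, i + 2 ≤ j → Commute (ρ i) (ς j)
  ςρ_far : ∀ i j, i + 2 ≤ j → Commute (ς i) (ρ j)
  ρρρ : ∀ i, i + 2 < N → ρ i * ρ (i + 1) * ρ i = ρ (i + 1) * ρ i * ρ (i + 1)
  ςςς : ∀ i, i + 2 < N → ς i * ς (i + 1) * ς i = ς (i + 1) * ς i * ς (i + 1)
  ρςς : ∀ i, i + 2 < N → ρ i * ς (i + 1) * ς i = ς (i + 1) * ς i * ρ (i + 1)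
  ςςρ : ∀ i, i + 2 < N → ς i * ς (i + 1) * ρ i = ρ (i + 1) * ς i * ς (i + 1)
  ςρρ : ∀ i, i + 2 < N → ς i * ρ (i + 1) * ρ i = ρ (i + 1) * ρ i * ς (i + 1)

open Classical in
/-- The generator by which the interval `[a x, b x]` at position `k` passes the interval
`[a y, b y]` at position `k + 1`. -/
def passGen {α : Type*} (ρ ς : ℕ → H) (a b : α → ℝ) (k : ℕ) (x y : α) : H :=
  if a y < a x ∧ b x < b y then ρ k else if a x < a y ∧ b y < b x then (ρ k)⁻¹
  else if b y < a x then ς k else (ς k)⁻¹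

/-- The intervals are disjoint or nested. -/
def NonCrossing {α : Type*} (a b : α → ℝ) (x y : α) : Prop :=
  (a y < a x ∧ b x < b y) ∨ (a x < a y ∧ b y < b x) ∨ b y < a x ∨ b x < a y

theorem NonCrossing.symm {α : Type*} {a b : α → ℝ} {x y : α} (h : NonCrossing a b x y) :
    NonCrossing a b y x := by
  rcases h with h | h | h | h
  · exact Or.inr (Or.inl h)
  · exact Or.inl h
  · exact Or.inr (Or.inr (Or.inr h))
  · exact Or.inr (Or.inr (Or.inl h))

/-- The identity between the six passes of three strands. -/
def Hexagon (p p' q q' r r' : H) : Prop := p * q' * r = r' * q * p'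

theorem Hexagon.swap_left {p p' q q' r r' : H} (h : Hexagon p p' q q' r r') :
    Hexagon p⁻¹ p'⁻¹ r r' q q' := by
  unfold Hexagon at *
  rw [eq_mul_inv_iff_mul_eq, mul_assoc, mul_assoc, ← mul_assoc r', ← h]; group

theorem Hexagon.swap_right {p p' q q' r r' : H} (h : Hexagon p p' q q' r r') :
    Hexagon q q' p p' r⁻¹ r'⁻¹ := by
  unfold Hexagon at *
  rw [mul_inv_eq_iff_eq_mul, mul_assoc, mul_assoc, ← mul_assoc p, h]; group

variable {α : Type*} {ρ ς : ℕ → H} {a b : α → ℝ} {x y z : α} {k N : ℕ}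

theorem passGen_inside (h : a y < a x ∧ b x < b y) : passGen ρ ς a b k x y = ρ k := by
  simp [passGen, h]

theorem passGen_outside (h : a x < a y ∧ b y < b x) : passGen ρ ς a b k x y = (ρ k)⁻¹ := by
  have : ¬ a y < a x := by linarith [h.1]
  simp [passGen, h, this]

theorem passGen_right (hx : a x < b x) (hy : a y < b y) (h : b y < a x) :
    passGen ρ ς a b k x y = ς k := by
  have h1 : ¬ b x < b y := by linarith
  have h2 : ¬ a x < a y := by linarith
  simp [passGen, h, h1, h2]

theorem passGen_left (hx : a x < b x) (hy : a y < b y) (h : b x < a y) :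
    passGen ρ ς a b k x y = (ς k)⁻¹ := by
  have h1 : ¬ a y < a x := by linarith
  have h2 : ¬ b y < b x := by linarith
  have h3 : ¬ b y < a x := by linarith
  simp [passGen, h1, h2, h3]

theorem passGen_cases (hx : a x < b x) (hy : a y < b y) (h : NonCrossing a b x y) :
    ((a y < a x ∧ b x < b y) ∧ ∀ k, passGen ρ ς a b k x y = ρ k) ∨
    ((a x < a y ∧ b y < b x) ∧ ∀ k, passGen ρ ς a b k x y = (ρ k)⁻¹) ∨
    (b y < a x ∧ ∀ k, passGen ρ ς a b k x y = ς k) ∨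
    (b x < a y ∧ ∀ k, passGen ρ ς a b k x y = (ς k)⁻¹) := by
  rcases h with h | h | h | h
  · exact Or.inl ⟨h, fun k => passGen_inside h⟩
  · exact Or.inr (Or.inl ⟨h, fun k => passGen_outside h⟩)
  · exact Or.inr (Or.inr (Or.inl ⟨h, fun k => passGen_right hx hy h⟩))
  · exact Or.inr (Or.inr (Or.inr ⟨h, fun k => passGen_left hx hy h⟩))

theorem passGen_mul_passGen (hx : a x < b x) (hy : a y < b y) (h : NonCrossing a b x y) :
    passGen ρ ς a b k x y * passGen ρ ς a b k y x = 1 := by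
  rcases h with h | h | h | h
  · rw [passGen_inside h, passGen_outside h, mul_inv_cancel]
  · rw [passGen_outside h, passGen_inside h, inv_mul_cancel]
  · rw [passGen_right hx hy h, passGen_left hy hx h, mul_inv_cancel]
  · rw [passGen_left hx hy h, passGen_right hy hx h, inv_mul_cancel]

theorem passGen_commute (hρς : BraidRels ρ ς N) {j : ℕ} (hjk : j + 2 ≤ k) (x y z w : α) :
    Commute (passGen ρ ς a b j x y) (passGen ρ ς a b k z w) := by
  have h1 := hρς.ρρ_far j k hjk
  have h2 := hρς.ςς_far j k hjk
  have h3 := hρς.ρς_far j k hjk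
  have h4 := hρς.ςρ_far j k hjk
  unfold passGen
  split_ifs <;> simp only [Commute.inv_left_iff, Commute.inv_right_iff, h1, h2, h3, h4]

theorem passGen_hexagon (hρς : BraidRels ρ ς N) (hk : k + 2 < N) (hx : a x < b x) (hy : a y < b y)
    (hz : a z < b z) (hxy : NonCrossing a b x y) (hxz : NonCrossing a b x z)
    (hyz : NonCrossing a b y z) :
    passGen ρ ς a b k x y * passGen ρ ς a b (k + 1) x z * passGen ρ ς a b k y z =
      passGen ρ ς a b (k + 1) y z * passGen ρ ς a b k x z * passGen ρ ς a b (k + 1) x y := by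
  have h1 : Hexagon (ρ k) (ρ (k + 1)) (ρ k) (ρ (k + 1)) (ρ k) (ρ (k + 1)) := hρς.ρρρ k hk
  have h2 : Hexagon (ς k) (ς (k + 1)) (ς k) (ς (k + 1)) (ς k) (ς (k + 1)) := hρς.ςςς k hk
  have h3 : Hexagon (ρ k) (ρ (k + 1)) (ς k) (ς (k + 1)) (ς k) (ς (k + 1)) := hρς.ρςς k hk
  have h4 : Hexagon (ς k) (ς (k + 1)) (ς k) (ς (k + 1)) (ρ k) (ρ (k + 1)) := hρς.ςςρ k hk
  have h5 : Hexagon (ς k) (ς (k + 1)) (ρ k) (ρ (k + 1)) (ρ k) (ρ (k + 1)) := hρς.ςρρ k hk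
  have fin : ∀ {p p' q q' r r' : H}, Hexagon p p' q q' r r' →
      Hexagon p p' q q' r r' ∧ Hexagon p⁻¹ p'⁻¹ r r' q q' ∧ Hexagon q q' p p' r⁻¹ r'⁻¹ ∧
      Hexagon r r' p⁻¹ p'⁻¹ q⁻¹ q'⁻¹ ∧ Hexagon q⁻¹ q'⁻¹ r⁻¹ r'⁻¹ p p' ∧
      Hexagon r⁻¹ r'⁻¹ q⁻¹ q'⁻¹ p⁻¹ p'⁻¹ := fun h =>
    ⟨h, h.swap_left, h.swap_right, h.swap_left.swap_right, h.swap_right.swap_left,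
      h.swap_left.swap_right.swap_left⟩
  change Hexagon _ _ _ _ _ _
  have g1 := fin h1
  have g2 := fin h2
  have g3 := fin h3
  have g4 := fin h4
  have g5 := fin h5
  rcases passGen_cases (ρ := ρ) (ς := ς) hx hy hxy with ⟨h, e⟩ | ⟨h, e⟩ | ⟨h, e⟩ | ⟨h, e⟩ <;>
  rcases passGen_cases (ρ := ρ) (ς := ς) hx hz hxz with ⟨h', e'⟩ | ⟨h', e'⟩ | ⟨h', e'⟩ | ⟨h', e'⟩ <;>
  rcases passGen_cases (ρ := ρ) (ς := ς) hy hz hyz with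
    ⟨h'', e''⟩ | ⟨h'', e''⟩ | ⟨h'', e''⟩ | ⟨h'', e''⟩ <;>
  first
  | (exfalso; linarith [h.1, h.2, h'.1, h'.2, h''.1, h''.2])
  | (exfalso; linarith [h.1, h.2, h'.1, h'.2])
  | (exfalso; linarith [h.1, h.2, h''.1, h''.2])
  | (exfalso; linarith [h'.1, h'.2, h''.1, h''.2])
  | (exfalso; linarith [h.1, h.2])
  | (exfalso; linarith [h'.1, h'.2])
  | (exfalso; linarith [h''.1, h''.2])
  | (exfalso; linarith)
  | (simp only [e, e', e'']
     tauto)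

end IntervalBraiding

section IntervalConfigurations

/-- Families of intervals `[a, b]` at heights `y`, in the form `(y, a, b)`. -/
abbrev Ivl (n : ℕ) : Type := Fin n → ℝ × ℝ × ℝ

/-- The height of an interval. -/
abbrev Ivl.y {n : ℕ} (u : Ivl n) (i : Fin n) : ℝ := (u i).1

/-- The left end of an interval. -/
abbrev Ivl.a {n : ℕ} (u : Ivl n) (i : Fin n) : ℝ := (u i).2.1

/-- The right end of an interval. -/
abbrev Ivl.b {n : ℕ} (u : Ivl n) (i : Fin n) : ℝ := (u i).2.2

/-- Families in which intervals at the same height are disjoint or nested. -/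
def IvlConf (n : ℕ) : Set (Ivl n) :=
  {u | (∀ i, u.a i < u.b i) ∧ ∀ i j, i ≠ j → u.y i = u.y j → NonCrossing u.a u.b i j}

variable {n : ℕ}

/-- The families keeping the strict inequalities between the heights of `s` and the position of
the intervals at the same height in `s`. -/
def chamber (s : Ivl n) : Set (Ivl n) :=
  {u | (∀ i, u.a i < u.b i) ∧ (∀ i j, s.y i < s.y j → u.y i < u.y j) ∧
    (∀ i j, s.y i = s.y j → s.a j < s.a i → s.b i < s.b j → u.a j < u.a i) ∧
    (∀ i j, s.y i = s.y j → s.a j < s.a i → s.b i < s.b j → u.b i < u.b j) ∧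
    ∀ i j, s.y i = s.y j → s.b j < s.a i → u.b j < u.a i}

theorem self_mem_chamber {s : Ivl n} (hs : s ∈ IvlConf n) : s ∈ chamber s :=
  ⟨hs.1, fun _ _ h => h, fun _ _ _ h _ => h, fun _ _ _ _ h => h, fun _ _ _ h => h⟩

theorem isOpen_chamber (s : Ivl n) : IsOpen (chamber s) := by
  have hlt : ∀ f g : Ivl n → ℝ, Continuous f → Continuous g → IsOpen {u | f u < g u} :=
    fun f g hf hg => isOpen_lt hf hg
  unfold chamber
  simp only [Set.ofPred_and, Set.ofPred_forall]
  refine IsOpen.inter (isOpen_iInter_of_finite fun i => hlt _ _ (by fun_prop) (by fun_prop)) ?_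
  refine IsOpen.inter ?_ (IsOpen.inter ?_ (IsOpen.inter ?_ ?_)) <;>
    refine isOpen_iInter_of_finite fun i => isOpen_iInter_of_finite fun j => ?_
  · exact isOpen_iInter_of_finite fun _ => hlt _ _ (by fun_prop) (by fun_prop)
  · exact isOpen_iInter_of_finite fun _ => isOpen_iInter_of_finite fun _ =>
      isOpen_iInter_of_finite fun _ => hlt _ _ (by fun_prop) (by fun_prop)
  · exact isOpen_iInter_of_finite fun _ => isOpen_iInter_of_finite fun _ =>
      isOpen_iInter_of_finite fun _ => hlt _ _ (by fun_prop) (by fun_prop)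
  · exact isOpen_iInter_of_finite fun _ => isOpen_iInter_of_finite fun _ =>
      hlt _ _ (by fun_prop) (by fun_prop)

theorem combo_lt_combo {c d x y x' y' : ℝ} (hc : 0 ≤ c) (hd : 0 ≤ d) (hcd : c + d = 1) (h : x < y)
    (h' : x' < y') : c * x + d * x' < c * y + d * y' := by
  rcases hc.eq_or_lt with rfl | hc
  · have : d = 1 := by linarith
    simpa [this] using h'
  · nlinarith [mul_le_mul_of_nonneg_left h'.le hd, mul_lt_mul_of_pos_left h hc]

theorem convex_chamber (s : Ivl n) : Convex ℝ (chamber s) := by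
  intro u hu v hv c d hc hd hcd
  have key : ∀ {x y x' y' : ℝ}, x < y → x' < y' → c * x + d * x' < c * y + d * y' :=
    fun h h' => combo_lt_combo hc hd hcd h h'
  refine ⟨fun i => ?_, fun i j h => ?_, fun i j h h' h'' => ?_, fun i j h h' h'' => ?_,
    fun i j h h' => ?_⟩
  · exact key (hu.1 i) (hv.1 i)
  · exact key (hu.2.1 i j h) (hv.2.1 i j h)
  · exact key (hu.2.2.1 i j h h' h'') (hv.2.2.1 i j h h' h'')
  · exact key (hu.2.2.2.1 i j h h' h'') (hv.2.2.2.1 i j h h' h'')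
  · exact key (hu.2.2.2.2 i j h h') (hv.2.2.2.2 i j h h')

theorem nonCrossing_of_mem_chamber {s u : Ivl n} (hs : s ∈ IvlConf n) (hu : u ∈ chamber s)
    {i j : Fin n} (hij : i ≠ j) (h : s.y i = s.y j) : NonCrossing u.a u.b i j := by
  rcases hs.2 i j hij h with h' | h' | h' | h'
  · exact Or.inl ⟨hu.2.2.1 i j h h'.1 h'.2, hu.2.2.2.1 i j h h'.1 h'.2⟩
  · exact Or.inr (Or.inl ⟨hu.2.2.1 j i h.symm h'.1 h'.2, hu.2.2.2.1 j i h.symm h'.1 h'.2⟩)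
  · exact Or.inr (Or.inr (Or.inl (hu.2.2.2.2 i j h h')))
  · exact Or.inr (Or.inr (Or.inr (hu.2.2.2.2 j i h.symm h')))

theorem chamber_subset {s : Ivl n} (hs : s ∈ IvlConf n) : chamber s ⊆ IvlConf n := by
  intro u hu
  refine ⟨hu.1, fun i j hij h => ?_⟩
  rcases lt_trichotomy (s.y i) (s.y j) with h' | h' | h'
  · exact absurd h (hu.2.1 i j h').ne
  · exact nonCrossing_of_mem_chamber hs hu hij h'
  · exact absurd h (hu.2.1 j i h').ne'

/-- The labels sorted by height. -/
def Ivl.order (u : Ivl n) : List (Fin n) :=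
  (List.finRange n).mergeSort (fun i j => decide (u.y i ≤ u.y j))

theorem Ivl.order_perm (u : Ivl n) : u.order.Perm (List.finRange n) := List.mergeSort_perm _ _

theorem Ivl.order_nodup (u : Ivl n) : u.order.Nodup :=
  u.order_perm.nodup_iff.2 (List.nodup_finRange n)

theorem Ivl.order_pairwise (u : Ivl n) : u.order.Pairwise fun i j => u.y i ≤ u.y j := by
  have := List.pairwise_mergeSort (le := fun i j => decide (u.y i ≤ u.y j))
    (fun a b c h1 h2 => by simp only [decide_eq_true_eq] at *; exact h1.trans h2)
    (fun a b => by simp only [Bool.or_eq_true, decide_eq_true_eq]; exact le_total _ _)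
    (List.finRange n)
  simpa [Ivl.order] using this

theorem order_pairwise_of_mem {s u : Ivl n} (hu : u ∈ chamber s) :
    u.order.Pairwise fun i j => s.y i ≤ s.y j := by
  refine u.order_pairwise.imp fun {i j} h => ?_
  by_contra h'
  exact absurd h (not_le.2 (hu.2.1 j i (not_le.1 h')))

theorem Ivl.order_eq {u : Ivl n} {l : List (Fin n)} (hl : l.Perm (List.finRange n))
    (h : l.Pairwise fun i j => u.y i < u.y j) : u.order = l := by
  refine List.Perm.eq_of_pairwise (le := fun i j => u.y i ≤ u.y j) ?_ u.order_pairwise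
    (h.imp fun h => h.le) (u.order_perm.trans hl.symm)
  intro i j hi hj h1 h2
  by_contra hij
  have h3 : l.Pairwise fun i j => u.y i ≠ u.y j := h.imp fun h => h.ne
  have : Std.Symm fun i j : Fin n => u.y i ≠ u.y j := ⟨fun _ _ h => h.symm⟩
  exact h3.forall (hl.symm.subset (List.mem_finRange i)) hj hij (le_antisymm h1 h2)

variable {H : Type*} [Group H] {ρ ς : ℕ → H}

theorem reorderRels_passGen (h : BraidRels ρ ς n) {s : Ivl n} (hs : s ∈ IvlConf n) :
    ReorderRels (passGen ρ ς s.a s.b) (fun i j => s.y i ≤ s.y j) n where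
  inv _ x y hxy h1 h2 := passGen_mul_passGen (hs.1 x) (hs.1 y) (hs.2 x y hxy (le_antisymm h1 h2))
  far _ _ x y z w hjk := passGen_commute h hjk x y z w
  hex _ x y z hk hxy hxz hyz h1 h2 h3 h4 h5 h6 := passGen_hexagon h hk (hs.1 x) (hs.1 y) (hs.1 z)
    (hs.2 x y hxy (le_antisymm h1 h2)) (hs.2 x z hxz (le_antisymm h3 h4))
    (hs.2 y z hyz (le_antisymm h5 h6))

theorem passGen_eq_of_mem {s u : Ivl n} (hs : s ∈ IvlConf n) (hu : u ∈ chamber s) {i j : Fin n}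
    (hij : i ≠ j) (h : s.y i = s.y j) (k : ℕ) :
    passGen ρ ς s.a s.b k i j = passGen ρ ς u.a u.b k i j := by
  have hu1 := chamber_subset hs hu
  rcases hs.2 i j hij h with h' | h' | h' | h'
  · rw [passGen_inside h', passGen_inside ⟨hu.2.2.1 i j h h'.1 h'.2, hu.2.2.2.1 i j h h'.1 h'.2⟩]
  · rw [passGen_outside h', passGen_outside
      ⟨hu.2.2.1 j i h.symm h'.1 h'.2, hu.2.2.2.1 j i h.symm h'.1 h'.2⟩]
  · rw [passGen_right (hs.1 i) (hs.1 j) h', passGen_right (hu1.1 i) (hu1.1 j) (hu.2.2.2.2 i j h h')]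
  · rw [passGen_left (hs.1 i) (hs.1 j) h',
      passGen_left (hu1.1 i) (hu1.1 j) (hu.2.2.2.2 j i h.symm h')]

/-- The holonomy recording how the intervals pass each other along a path. -/
def ivlHolonomy (h : BraidRels ρ ς n) :
    LocalHolonomy (fun s : IvlConf n => {u : IvlConf n | u.1 ∈ chamber s.1}) H where
  map s x y γ _ := reorder (passGen ρ ς s.1.a s.1.b) 0 x.1.order y.1.order
  map_homotopy _ _ _ _ _ _ _ _ _ := rfl
  map_trans s x y z γ γ' h1 h2 _ := by
    refine reorder_trans (reorderRels_passGen h s.2) z.1.order_nodup ?_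
      (x.1.order_perm.trans z.1.order_perm.symm) (y.1.order_perm.trans z.1.order_perm.symm)
      (order_pairwise_of_mem ?_) (order_pairwise_of_mem ?_) (order_pairwise_of_mem ?_)
    · rw [z.1.order_perm.length_eq, List.length_finRange]
    · simpa using h1 0
    · simpa using h1 1
    · simpa using h2 1
  map_agree s s' x y γ h1 h2 := by
    have m1 : x.1 ∈ chamber s.1 := by simpa using h1 0
    have m2 : x.1 ∈ chamber s'.1 := by simpa using h2 0
    have m3 : y.1 ∈ chamber s.1 := by simpa using h1 1
    have m4 : y.1 ∈ chamber s'.1 := by simpa using h2 1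
    refine reorder_congr (R := fun i j => s.1.y i ≤ s.1.y j ∧ s'.1.y i ≤ s'.1.y j) ?_
      (x.1.order_perm.trans y.1.order_perm.symm) x.1.order_nodup
      ((order_pairwise_of_mem m1).imp₂ (fun _ _ h h' => ⟨h, h'⟩) (order_pairwise_of_mem m2))
      ((order_pairwise_of_mem m3).imp₂ (fun _ _ h h' => ⟨h, h'⟩) (order_pairwise_of_mem m4)) 0
    intro k i j hij h h'
    rw [passGen_eq_of_mem s.2 m1 hij (le_antisymm h.1 h'.1),
      passGen_eq_of_mem s'.2 m2 hij (le_antisymm h.2 h'.2)]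

theorem isOpen_ivlChamber (s : IvlConf n) : IsOpen {u : IvlConf n | u.1 ∈ chamber s.1} :=
  (isOpen_chamber s.1).preimage continuous_subtype_val

/-- The product of generators recording how the intervals pass each other along a path. -/
def ivlWord (h : BraidRels ρ ς n) {x y : IvlConf n} (γ : Path x y) : H :=
  (ivlHolonomy h).total isOpen_ivlChamber (fun s => ⟨s, self_mem_chamber s.2⟩) γ

end IntervalConfigurations

section Flat

theorem exists_crossing {a b a' b' : ℝ} (h1 : a ≤ a') (h2 : b ≤ b') (h3 : a' ≤ b) :
    ∃ x, a ≤ x ∧ x ≤ b ∧ a' ≤ x ∧ x ≤ b' ∧ (x - a) * (b - x) = (x - a') * (b' - x) := by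
  have hc : ContinuousOn (fun x : ℝ => (x - a) * (b - x) - (x - a') * (b' - x)) (Set.Icc a' b) := by
    fun_prop
  obtain ⟨x, hx, e⟩ := intermediate_value_Icc' h3 hc (show (0 : ℝ) ∈ _ from ⟨by nlinarith, by nlinarith⟩)
  exact ⟨x, h1.trans hx.1, hx.2, hx.1, hx.2.trans h2, by linarith⟩

theorem wicket_height {a b t : ℝ} :
    (1 - t ^ 2) * ((b - a) / 2) ^ 2 =
      ((a + b) / 2 + t * ((b - a) / 2) - a) * (b - ((a + b) / 2 + t * ((b - a) / 2))) := by ring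

theorem wdisj_ivl_iff {y a b y' a' b' : ℝ} (hab : a < b) (hab' : a' < b') :
    WDisj ⟨(a + b) / 2, y⟩ (((b - a) / 2 : ℝ) : ℂ) ⟨(a' + b') / 2, y'⟩ (((b' - a') / 2 : ℝ) : ℂ) ↔
      (y = y' → (a' < a ∧ b < b') ∨ (a < a' ∧ b' < b) ∨ b' < a ∨ b < a') := by
  have eqv : ∀ t t' : ℝ, ((⟨(a + b) / 2, y⟩ : ℂ) + t * (((b - a) / 2 : ℝ) : ℂ) =
      (⟨(a' + b') / 2, y'⟩ : ℂ) + t' * (((b' - a') / 2 : ℝ) : ℂ)) ↔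
      (a + b) / 2 + t * ((b - a) / 2) = (a' + b') / 2 + t' * ((b' - a') / 2) ∧ y = y' := by
    intro t t'
    rw [Complex.ext_iff, ← Complex.ofReal_mul, ← Complex.ofReal_mul]
    simp only [Complex.add_re, Complex.add_im, Complex.ofReal_re, Complex.ofReal_im, add_zero]
  have nrm : ∀ r : ℝ, ‖(r : ℂ)‖ ^ 2 = r ^ 2 := by intro r; rw [Complex.norm_real]; simp
  unfold WDisj
  simp only [eqv, nrm, wicket_height]
  constructor
  · intro h hy
    by_contra hc
    push Not at hc
    obtain ⟨c1, c2, c3, c4⟩ := hc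
    have hx : ∃ x, a ≤ x ∧ x ≤ b ∧ a' ≤ x ∧ x ≤ b' ∧ (x - a) * (b - x) = (x - a') * (b' - x) := by
      rcases le_total a a' with h1 | h1 <;> rcases le_total b b' with h2 | h2
      · exact exists_crossing h1 h2 c4
      · rcases h1.eq_or_lt with rfl | h1
        · exact ⟨a, le_rfl, hab.le, le_rfl, hab'.le, by ring⟩
        · obtain rfl : b' = b := le_antisymm h2 (c2 h1)
          exact ⟨b', hab.le, le_rfl, hab'.le, le_rfl, by ring⟩
      · rcases h1.eq_or_lt with rfl | h1
        · exact ⟨a', le_rfl, hab.le, le_rfl, hab'.le, by ring⟩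
        · obtain rfl : b' = b := le_antisymm (c1 h1) h2
          exact ⟨b', hab.le, le_rfl, hab'.le, le_rfl, by ring⟩
      · obtain ⟨x, g1, g2, g3, g4, g5⟩ := exists_crossing h1 h2 c3
        exact ⟨x, g3, g4, g1, g2, g5.symm⟩
    obtain ⟨x, x1, x2, x3, x4, x5⟩ := hx
    have par : ∀ a b : ℝ, a < b → a ≤ x → x ≤ b → ∃ t ∈ Set.Icc (-1 : ℝ) 1,
        (a + b) / 2 + t * ((b - a) / 2) = x := by
      intro a b hab h1 h2
      have hd : 0 < b - a := by linarith
      refine ⟨(2 * x - a - b) / (b - a), ⟨?_, ?_⟩, by field_simp; ring⟩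
      · rw [le_div_iff₀ hd]; linarith
      · rw [div_le_iff₀ hd]; linarith
    obtain ⟨t, ht, et⟩ := par a b hab x1 x2
    obtain ⟨t', ht', et'⟩ := par a' b' hab' x3 x4
    refine h t ht t' ht' ⟨by rw [et, et'], hy⟩ ?_
    rw [et, et', x5]
  · rintro h t ht t' ht' ⟨e, hy⟩ e'
    have k1 : a ≤ (a + b) / 2 + t * ((b - a) / 2) := by nlinarith [ht.1]
    have k2 : (a + b) / 2 + t * ((b - a) / 2) ≤ b := by nlinarith [ht.2]
    have k3 : a' ≤ (a' + b') / 2 + t' * ((b' - a') / 2) := by nlinarith [ht'.1]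
    have k4 : (a' + b') / 2 + t' * ((b' - a') / 2) ≤ b' := by nlinarith [ht'.2]
    rw [← e] at k3 k4 e'
    set x := (a + b) / 2 + t * ((b - a) / 2)
    rcases h hy with c | c | c | c
    · nlinarith [mul_pos (sub_pos.2 c.1) (sub_pos.2 c.2), mul_nonneg (sub_nonneg.2 k1) (sub_pos.2 c.2).le,
        mul_nonneg (sub_nonneg.2 k2) (sub_pos.2 c.1).le]
    · nlinarith [mul_pos (sub_pos.2 c.1) (sub_pos.2 c.2), mul_nonneg (sub_nonneg.2 k3) (sub_pos.2 c.2).le,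
        mul_nonneg (sub_nonneg.2 k4) (sub_pos.2 c.1).le]
    · linarith
    · linarith

variable {n : ℕ}

/-- The wickets over a family of intervals. -/
def overIvl (u : Ivl n) (i : Fin n) : ℂ × ℂ :=
  (⟨(u.a i + u.b i) / 2, u.y i⟩, (Real.log ((u.b i - u.a i) / 2) : ℂ))

theorem exp_overIvl {u : Ivl n} {i : Fin n} (h : u.a i < u.b i) :
    Complex.exp (overIvl u i).2 = (((u.b i - u.a i) / 2 : ℝ) : ℂ) := by
  rw [overIvl, ← Complex.ofReal_exp, Real.exp_log (by linarith)]

theorem overIvl_mem {u : Ivl n} (hu : u ∈ IvlConf n) : overIvl u ∈ Conf (Fin n) := by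
  intro i j hij
  rw [exp_overIvl (hu.1 i), exp_overIvl (hu.1 j)]
  exact (wdisj_ivl_iff (hu.1 i) (hu.1 j)).2 (hu.2 i j hij)

theorem continuous_mk {X : Type*} [TopologicalSpace X] {f g : X → ℝ} (hf : Continuous f)
    (hg : Continuous g) : Continuous fun x => (⟨f x, g x⟩ : ℂ) := by
  have : (fun x => (⟨f x, g x⟩ : ℂ)) = fun x => (f x : ℂ) + g x * Complex.I := by
    funext x; exact Complex.mk_eq_add_mul_I _ _
  rw [this]
  fun_prop

/-- The configuration of wickets over a family of intervals. -/
def ivlToConf : C(IvlConf n, Conf (Fin n)) where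
  toFun u := ⟨overIvl u.1, overIvl_mem u.2⟩
  continuous_toFun := by
    refine Continuous.subtype_mk (continuous_pi fun i => ?_) _
    have hi : Continuous fun u : IvlConf n => u.1 i :=
      (continuous_apply i).comp continuous_subtype_val
    refine Continuous.prodMk (continuous_mk ?_ hi.fst) ?_
    · exact (hi.snd.fst.add hi.snd.snd).div_const 2
    · refine Complex.continuous_ofReal.comp
        (Continuous.log ((hi.snd.snd.sub hi.snd.fst).div_const 2) fun u => ?_)
      have := u.2.1 i
      exact (by linarith : 0 < (u.1.b i - u.1.a i) / 2).ne'

theorem ivlToConf_mem_flat (u : IvlConf n) : ivlToConf u ∈ flat (Fin n) := by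
  intro i
  simp [ivlToConf, overIvl]

/-- The intervals under a flat configuration. -/
def underConf (X : Conf (Fin n)) : Ivl n := fun i =>
  ((X.1 i).1.im, (X.1 i).1.re - Real.exp (X.1 i).2.re, (X.1 i).1.re + Real.exp (X.1 i).2.re)

theorem continuous_underConf : Continuous (underConf (n := n)) := by
  refine continuous_pi fun i => ?_
  have hi : Continuous fun X : Conf (Fin n) => X.1 i :=
    (continuous_apply i).comp continuous_subtype_val
  exact (Complex.continuous_im.comp hi.fst).prodMk
    (((Complex.continuous_re.comp hi.fst).sub (Real.continuous_exp.comp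
      (Complex.continuous_re.comp hi.snd))).prodMk
    ((Complex.continuous_re.comp hi.fst).add (Real.continuous_exp.comp
      (Complex.continuous_re.comp hi.snd))))

theorem underConf_ivlToConf (u : IvlConf n) : underConf (ivlToConf u) = u.1 := by
  funext i
  have h := u.2.1 i
  simp only [underConf, ivlToConf, overIvl, ContinuousMap.coe_mk, Complex.ofReal_re]
  rw [Real.exp_log (by linarith)]
  refine Prod.ext rfl (Prod.ext ?_ ?_) <;> simp only [Ivl.a, Ivl.b] <;> ring

theorem overIvl_underConf {X : Conf (Fin n)} (hX : X ∈ flat (Fin n)) :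
    overIvl (underConf X) = X.1 := by
  funext i
  have h := hX i
  have h1 : (X.1 i).1.re + Real.exp (X.1 i).2.re - ((X.1 i).1.re - Real.exp (X.1 i).2.re) =
    2 * Real.exp (X.1 i).2.re := by ring
  simp only [overIvl, underConf, Ivl.a, Ivl.b, Ivl.y]
  rw [h1, mul_div_cancel_left₀ _ two_ne_zero, Real.log_exp]
  refine Prod.ext (Complex.ext ?_ rfl) (Complex.ext (by simp) (by simp [h]))
  simp only
  ring

theorem underConf_mem {X : Conf (Fin n)} (hX : X ∈ flat (Fin n)) : underConf X ∈ IvlConf n := by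
  have h1 : ∀ i, (underConf X).a i < (underConf X).b i := fun i => by
    have := Real.exp_pos (X.1 i).2.re
    simp only [underConf, Ivl.a, Ivl.b]
    linarith
  refine ⟨h1, fun i j hij => ?_⟩
  have := X.2 i j hij
  rw [← overIvl_underConf hX, exp_overIvl (h1 i), exp_overIvl (h1 j)] at this
  exact (wdisj_ivl_iff (h1 i) (h1 j)).1 this

end Flat

section Wickets

/-- The identification of the complex numbers with the Euclidean plane. -/
def toE2 : ℂ ≃ₗᵢ[ℝ] E2 := Complex.orthonormalBasisOneI.repr

@[simp]
theorem toE2_zero (z : ℂ) : toE2 z 0 = z.re := rfl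

@[simp]
theorem toE2_one (z : ℂ) : toE2 z 1 = z.im := rfl

/-- A point of the wicket with centre `m` and radius vector `r`. -/
def wicketPoint (m r : ℂ) (t : ℝ) : E3 :=
  e3mk (m + t * r).re (m + t * r).im (√(1 - t ^ 2) * ‖r‖)

@[simp]
theorem e3mk_zero (x y z : ℝ) : e3mk x y z 0 = x := rfl

@[simp]
theorem e3mk_one (x y z : ℝ) : e3mk x y z 1 = y := rfl

@[simp]
theorem e3mk_two (x y z : ℝ) : e3mk x y z 2 = z := rfl

theorem e3_ext {x y : E3} (h0 : x 0 = y 0) (h1 : x 1 = y 1) (h2 : x 2 = y 2) : x = y := by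
  ext i
  fin_cases i
  · exact h0
  · exact h1
  · exact h2

theorem mem_wicket_iff {m r : ℂ} (hr : r ≠ 0) {x : E3} :
    x ∈ wicket (toE2 (m + r)) (toE2 (m - r)) ↔
      ∃ t ∈ Set.Icc (-1 : ℝ) 1, x = wicketPoint m r t := by
  have hr2 : ‖r‖ ^ 2 = r.re ^ 2 + r.im ^ 2 := by
    rw [← Complex.normSq_eq_norm_sq, Complex.normSq_apply]; ring
  have hr0 : 0 < ‖r‖ := norm_pos_iff.2 hr
  have hd : dist (toE2 (m + r)) (toE2 (m - r)) / 2 = ‖r‖ := by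
    rw [toE2.dist_map, dist_eq_norm, show m + r - (m - r) = 2 * r by ring, norm_mul]
    simp
  have hc : e3mk ((toE2 (m + r) 0 + toE2 (m - r) 0) / 2) ((toE2 (m + r) 1 + toE2 (m - r) 1) / 2) 0 =
      e3mk m.re m.im 0 := by
    simp
  have hdist : ∀ x : E3, dist x (e3mk m.re m.im 0) = ‖r‖ ↔
      (x 0 - m.re) ^ 2 + (x 1 - m.im) ^ 2 + x 2 ^ 2 = r.re ^ 2 + r.im ^ 2 := by
    intro x
    rw [EuclideanSpace.dist_eq, Real.sqrt_eq_iff_eq_sq (by positivity) (norm_nonneg _), hr2,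
      Fin.sum_univ_three]
    simp [Real.dist_eq, sq_abs]
  rw [wicket, Set.mem_ofPred_eq, hd, hc, hdist]
  simp only [toE2_zero, toE2_one, Complex.add_re, Complex.sub_re, Complex.add_im, Complex.sub_im]
  constructor
  · rintro ⟨h0, h1, s, h2, h3⟩
    have e0 : x 0 = m.re + (1 - 2 * s) * r.re := by rw [h2]; ring
    have e1 : x 1 = m.im + (1 - 2 * s) * r.im := by rw [h3]; ring
    rw [e0, e1] at h1
    have h4 : x 2 ^ 2 = (1 - (1 - 2 * s) ^ 2) * ‖r‖ ^ 2 := by rw [hr2]; linarith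
    have h5 : 0 ≤ 1 - (1 - 2 * s) ^ 2 := by
      by_contra hneg
      have := mul_neg_of_neg_of_pos (not_le.1 hneg) (pow_pos hr0 2)
      rw [← h4] at this
      exact absurd this (not_lt.2 (sq_nonneg _))
    refine ⟨1 - 2 * s, ?_, e3_ext ?_ ?_ ?_⟩
    · exact abs_le.1 ((sq_le_one_iff_abs_le_one _).1 (by linarith))
    · simp [wicketPoint, e0]
    · simp [wicketPoint, e1]
    · simp only [wicketPoint, e3mk_two]
      rw [← Real.sqrt_sq h0, h4, Real.sqrt_mul h5, Real.sqrt_sq hr0.le]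
  · rintro ⟨t, ht, rfl⟩
    have h5 : 0 ≤ 1 - t ^ 2 := by nlinarith [ht.1, ht.2]
    refine ⟨by simp only [wicketPoint, e3mk_two]; positivity, ?_, (1 - t) / 2, ?_, ?_⟩
    · simp only [wicketPoint, e3mk_zero, e3mk_one, e3mk_two, mul_pow, Real.sq_sqrt h5, hr2]
      simp
      ring
    · simp [wicketPoint]; ring
    · simp [wicketPoint]; ring

theorem wicketPoint_eq_iff {m r m' r' : ℂ} {t t' : ℝ} (ht : t ∈ Set.Icc (-1 : ℝ) 1)
    (ht' : t' ∈ Set.Icc (-1 : ℝ) 1) : wicketPoint m r t = wicketPoint m' r' t' ↔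
      m + t * r = m' + t' * r' ∧ (1 - t ^ 2) * ‖r‖ ^ 2 = (1 - t' ^ 2) * ‖r'‖ ^ 2 := by
  have h5 : ∀ s ∈ Set.Icc (-1 : ℝ) 1, 0 ≤ 1 - s ^ 2 := fun s hs => by nlinarith [hs.1, hs.2]
  have key : √(1 - t ^ 2) * ‖r‖ = √(1 - t' ^ 2) * ‖r'‖ ↔
      (1 - t ^ 2) * ‖r‖ ^ 2 = (1 - t' ^ 2) * ‖r'‖ ^ 2 := by
    rw [← sq_eq_sq₀ (by positivity) (by positivity), mul_pow, mul_pow, Real.sq_sqrt (h5 t ht),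
      Real.sq_sqrt (h5 t' ht')]
  rw [← key]
  constructor
  · intro h
    exact ⟨Complex.ext (by simpa [wicketPoint] using congrArg (fun x : E3 => x 0) h)
      (by simpa [wicketPoint] using congrArg (fun x : E3 => x 1) h),
      by simpa [wicketPoint] using congrArg (fun x : E3 => x 2) h⟩
  · rintro ⟨h1, h2⟩
    rw [wicketPoint, h1, h2, wicketPoint]

theorem disjoint_wicket_iff {m r m' r' : ℂ} (hr : r ≠ 0) (hr' : r' ≠ 0) :
    Disjoint (wicket (toE2 (m + r)) (toE2 (m - r))) (wicket (toE2 (m' + r')) (toE2 (m' - r'))) ↔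
      WDisj m r m' r' := by
  rw [Set.disjoint_left]
  constructor
  · intro h t ht t' ht' e e'
    exact h ((mem_wicket_iff hr).2 ⟨t, ht, rfl⟩) ((mem_wicket_iff hr').2
      ⟨t', ht', (wicketPoint_eq_iff ht ht').2 ⟨e, e'⟩⟩)
  · intro h x hx hx'
    obtain ⟨t, ht, rfl⟩ := (mem_wicket_iff hr).1 hx
    obtain ⟨t', ht', e⟩ := (mem_wicket_iff hr').1 hx'
    have := (wicketPoint_eq_iff ht ht').1 e
    exact h t ht t' ht' this.1 this.2

theorem wicket_neg (m r : ℂ) : wicket (toE2 (m + -r)) (toE2 (m - -r)) =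
    wicket (toE2 (m + r)) (toE2 (m - r)) := by
  rcases eq_or_ne r 0 with rfl | hr
  · simp
  · ext x
    rw [mem_wicket_iff hr, mem_wicket_iff (neg_ne_zero.2 hr)]
    have : ∀ t, wicketPoint m (-r) (-t) = wicketPoint m r t := by
      intro t; simp [wicketPoint]
    constructor
    · rintro ⟨t, ht, rfl⟩
      exact ⟨-t, ⟨by linarith [ht.2], by linarith [ht.1]⟩, by rw [← this, neg_neg]⟩
    · rintro ⟨t, ht, rfl⟩
      exact ⟨-t, ⟨by linarith [ht.2], by linarith [ht.1]⟩, (this t).symm⟩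

theorem wicket_eq_iff {m r m' r' : ℂ} (hr : r ≠ 0) (hr' : r' ≠ 0) :
    wicket (toE2 (m + r)) (toE2 (m - r)) = wicket (toE2 (m' + r')) (toE2 (m' - r')) ↔
      m = m' ∧ (r = r' ∨ r = -r') := by
  constructor
  · intro h
    have key : ∀ s : ℝ, s ^ 2 = 1 → m + s * r = m' + r' ∨ m + s * r = m' - r' := by
      intro s hs
      have hs' : s ∈ Set.Icc (-1 : ℝ) 1 :=
        abs_le.1 ((sq_le_one_iff_abs_le_one _).1 hs.le)
      have : wicketPoint m r s ∈ wicket (toE2 (m + r)) (toE2 (m - r)) :=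
        (mem_wicket_iff hr).2 ⟨s, hs', rfl⟩
      rw [h] at this
      obtain ⟨t, ht, e⟩ := (mem_wicket_iff hr').1 this
      obtain ⟨e1, e2⟩ := (wicketPoint_eq_iff hs' ht).1 e
      have : t ^ 2 = 1 := by
        have h0 : ‖r'‖ ^ 2 ≠ 0 := by simpa using hr'
        rw [hs, sub_self, zero_mul] at e2
        have := (mul_eq_zero.1 e2.symm).resolve_right h0
        linarith
      rw [pow_two, mul_self_eq_one_iff] at this
      rcases this with rfl | rfl
      · left; simpa using e1
      · right; rw [e1]; push_cast; ring
    have k1 := key 1 (by norm_num)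
    have k2 := key (-1) (by norm_num)
    push_cast at k1 k2
    have two : (2 : ℂ) ≠ 0 := two_ne_zero
    rcases k1 with k1 | k1 <;> rcases k2 with k2 | k2
    · exact absurd (mul_left_cancel₀ two (by linear_combination k1 - k2 : 2 * r = 2 * 0)) hr
    · exact ⟨mul_left_cancel₀ two (by linear_combination k1 + k2),
        Or.inl (mul_left_cancel₀ two (by linear_combination k1 - k2))⟩
    · exact ⟨mul_left_cancel₀ two (by linear_combination k1 + k2),
        Or.inr (mul_left_cancel₀ two (by linear_combination k1 - k2))⟩
    · exact absurd (mul_left_cancel₀ two (by linear_combination k1 - k2 : 2 * r = 2 * 0)) hr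
  · rintro ⟨rfl, rfl | rfl⟩
    · rfl
    · exact wicket_neg m r'

theorem exp_eq_or_eq_neg_iff {z w : ℂ} : (Complex.exp z = Complex.exp w ∨
    Complex.exp z = -Complex.exp w) ↔ ∃ k : ℤ, z = w + k * (Real.pi * Complex.I) := by
  constructor
  · rintro (h | h)
    · obtain ⟨k, hk⟩ := Complex.exp_eq_exp_iff_exists_int.1 h
      exact ⟨2 * k, by rw [hk]; push_cast; ring⟩
    · have : Complex.exp z = Complex.exp (w + Real.pi * Complex.I) := by
        rw [Complex.exp_add, Complex.exp_pi_mul_I, h]; ring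
      obtain ⟨k, hk⟩ := Complex.exp_eq_exp_iff_exists_int.1 this
      exact ⟨2 * k + 1, by rw [hk]; push_cast; ring⟩
  · rintro ⟨k, rfl⟩
    rw [Complex.exp_add, Complex.exp_int_mul, Complex.exp_pi_mul_I]
    rcases Int.even_or_odd k with h | h
    · left; rw [h.neg_one_zpow, mul_one]
    · right; rw [h.neg_one_zpow]; ring

end Wickets

section DeckGroup

variable {n : ℕ}

/-- The wicket with the given centre and logarithm of the radius vector. -/
def wicketAt (z : ℂ × ℂ) : Set E3 :=
  wicket (toE2 (z.1 + Complex.exp z.2)) (toE2 (z.1 - Complex.exp z.2))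

theorem wicketAt_eq_iff {z w : ℂ × ℂ} : wicketAt z = wicketAt w ↔
    ∃ k : ℤ, z = (w.1, w.2 + k * (Real.pi * Complex.I)) := by
  rw [wicketAt, wicketAt, wicket_eq_iff (Complex.exp_ne_zero _) (Complex.exp_ne_zero _),
    exp_eq_or_eq_neg_iff]
  constructor
  · rintro ⟨h, k, hk⟩; exact ⟨k, Prod.ext h hk⟩
  · rintro ⟨k, hk⟩; exact ⟨by rw [hk], k, by rw [hk]⟩

theorem mem_conf_iff {κ : Type*} {X : κ → ℂ × ℂ} : X ∈ Conf κ ↔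
    ∀ i j, i ≠ j → Disjoint (wicketAt (X i)) (wicketAt (X j)) := by
  simp only [Conf, Set.mem_ofPred_eq, wicketAt,
    disjoint_wicket_iff (Complex.exp_ne_zero _) (Complex.exp_ne_zero _)]

theorem wicketAt_nonempty (z : ℂ × ℂ) : (wicketAt z).Nonempty :=
  ⟨_, (mem_wicket_iff (Complex.exp_ne_zero _)).2 ⟨0, by simp, rfl⟩⟩

theorem wicketAt_injective {κ : Type*} {X : κ → ℂ × ℂ} (hX : X ∈ Conf κ) :
    Function.Injective fun i => wicketAt (X i) := by
  intro i j h
  by_contra hij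
  have := mem_conf_iff.1 hX i j hij
  simp only at h
  rw [h, disjoint_self] at this
  exact (wicketAt_nonempty _).ne_empty this

/-- The pairs of endpoints of a wicket. -/
def endpoints (z : ℂ × ℂ) : E2 × E2 := (toE2 (z.1 + Complex.exp z.2), toE2 (z.1 - Complex.exp z.2))

theorem isWicketTuple_iff {X : Fin n → ℂ × ℂ} :
    IsWicketTuple (fun i => endpoints (X i)) ↔ X ∈ Conf (Fin n) := by
  rw [mem_conf_iff]
  refine ⟨fun h => h.2, fun h => ⟨fun i e => ?_, h⟩⟩
  have h1 := toE2.injective e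
  have h2 : Complex.exp (X i).2 = 0 := by linear_combination h1 / 2
  exact Complex.exp_ne_zero _ h2

/-- The sum and difference of two complex numbers. -/
def sumDiff : ℂ × ℂ ≃ₜ ℂ × ℂ where
  toFun z := (z.1 + z.2, z.1 - z.2)
  invFun z := ((z.1 + z.2) / 2, (z.1 - z.2) / 2)
  left_inv z := Prod.ext (by simp) (by simp)
  right_inv z := Prod.ext (by simp; ring) (by simp; ring)
  continuous_toFun := by fun_prop
  continuous_invFun := by fun_prop

theorem isOpenMap_endpoints : IsOpenMap endpoints := by
  have h1 : IsOpenMap (Prod.map id Complex.exp : ℂ × ℂ → ℂ × ℂ) :=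
    IsOpenMap.id.prodMap Complex.isOpenMap_exp
  have h2 : IsOpenMap (Prod.map toE2 toE2) :=
    toE2.toHomeomorph.isOpenMap.prodMap toE2.toHomeomorph.isOpenMap
  have e : endpoints = Prod.map toE2 toE2 ∘ (sumDiff ∘ Prod.map id Complex.exp) := by
    funext z
    rfl
  rw [e]
  exact h2.comp (sumDiff.isOpenMap.comp h1)

theorem continuous_endpoints : Continuous endpoints := by
  unfold endpoints
  fun_prop

theorem exists_endpoints {p : E2 × E2} (hp : p.1 ≠ p.2) : ∃ z, endpoints z = p := by
  obtain ⟨v, hv⟩ := toE2.surjective p.1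
  obtain ⟨w, hw⟩ := toE2.surjective p.2
  have h : (v - w) / 2 ≠ 0 := by
    intro h
    have : v = w := by linear_combination 2 * h
    exact hp (by rw [← hv, ← hw, this])
  refine ⟨((v + w) / 2, Complex.log ((v - w) / 2)), Prod.ext ?_ ?_⟩
  · simp only [endpoints]
    rw [Complex.exp_log h, ← hv]; congr 1; ring
  · simp only [endpoints]
    rw [Complex.exp_log h, ← hw]; congr 1; ring

/-- The projection of labelled configurations to the wicket space. -/
def confToWConf (X : Conf (Fin n)) : WConf n :=
  Quotient.mk (wicketSetoid n) ⟨fun i => endpoints (X.1 i), isWicketTuple_iff.2 X.2⟩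

theorem isQuotientMap_confToWConf : Topology.IsQuotientMap (confToWConf (n := n)) := by
  let q : Conf (Fin n) → WicketTuple n :=
    fun X => ⟨fun i => endpoints (X.1 i), isWicketTuple_iff.2 X.2⟩
  have hq : Continuous q := by
    refine Continuous.subtype_mk (continuous_pi fun i => ?_) _
    exact continuous_endpoints.comp ((continuous_apply i).comp continuous_subtype_val)
  have hs : Function.Surjective q := by
    intro f
    choose z hz using fun i => exists_endpoints (f.2.1 i)
    have e : (fun i => endpoints (z i)) = f.1 := funext hz
    exact ⟨⟨z, isWicketTuple_iff.1 (by rw [e]; exact f.2)⟩, Subtype.ext e⟩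
  have ho : IsOpenMap q := by
    have h1 : IsOpenMap (Pi.map fun _ : Fin n => endpoints) :=
      IsOpenMap.piMap (fun _ => isOpenMap_endpoints) (by simp [Filter.cofinite_eq_bot])
    have h2 := h1.restrictPreimage {f | IsWicketTuple f}
    have e : (Pi.map fun _ : Fin n => endpoints) ⁻¹' {f | IsWicketTuple f} = Conf (Fin n) := by
      ext X; exact isWicketTuple_iff
    intro V hV
    have h3 := h2 ((Homeomorph.setCongr e).symm '' V) ((Homeomorph.setCongr e).symm.isOpenMap V hV)
    rw [Set.image_image] at h3
    exact h3
  exact isQuotientMap_quotient_mk'.comp (ho.isQuotientMap hq hs)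

theorem continuous_confToWConf : Continuous (confToWConf (n := n)) :=
  isQuotientMap_confToWConf.continuous

/-- The group permuting wickets and rotating them by multiples of `π`. -/
abbrev Deck (n : ℕ) : Type :=
  (Fin n → Multiplicative ℤ) ⋊[mulAutArrow (G := Equiv.Perm (Fin n))] Equiv.Perm (Fin n)

/-- The action of the deck group on families. -/
def deckAct (g : Deck n) (X : Fin n → ℂ × ℂ) (i : Fin n) : ℂ × ℂ :=
  ((X (g.right⁻¹ i)).1, (X (g.right⁻¹ i)).2 + (g.left i).toAdd * (Real.pi * Complex.I))

theorem wicketAt_deckAct (g : Deck n) (X : Fin n → ℂ × ℂ) (i : Fin n) :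
    wicketAt (deckAct g X i) = wicketAt (X (g.right⁻¹ i)) :=
  wicketAt_eq_iff.2 ⟨_, rfl⟩

instance : MulAction (Deck n) (Conf (Fin n)) where
  smul g X := ⟨deckAct g X.1, by
    rw [mem_conf_iff]
    intro i j hij
    rw [wicketAt_deckAct, wicketAt_deckAct]
    exact mem_conf_iff.1 X.2 _ _ (g.right⁻¹.injective.ne hij)⟩
  one_smul X := Subtype.ext (by
    funext i
    change deckAct 1 X.1 i = _
    simp [deckAct])
  mul_smul g h X := Subtype.ext (by
    funext i
    change deckAct (g * h) X.1 i = deckAct g (deckAct h X.1) i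
    simp only [deckAct, SemidirectProduct.mul_right, SemidirectProduct.mul_left, mul_inv_rev,
      Equiv.Perm.coe_mul, Function.comp_apply]
    refine Prod.ext rfl ?_
    have : (mulAutArrow g.right h.left) i = h.left (g.right⁻¹ i) := rfl
    simp only [Pi.mul_apply, toAdd_mul, this, Int.cast_add]
    ring)

theorem smul_conf_apply (g : Deck n) (X : Conf (Fin n)) (i : Fin n) :
    (g • X).1 i = ((X.1 (g.right⁻¹ i)).1,
      (X.1 (g.right⁻¹ i)).2 + (g.left i).toAdd * (Real.pi * Complex.I)) := rfl

theorem isQuotientCoveringMap_confToWConf :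
    IsQuotientCoveringMap (confToWConf (n := n)) (Deck n) where
  __ := isQuotientMap_confToWConf
  continuous_const_smul g := by
    refine Continuous.subtype_mk (continuous_pi fun i => ?_) _
    have : Continuous fun X : Conf (Fin n) => X.1 (g.right⁻¹ i) :=
      (continuous_apply _).comp continuous_subtype_val
    exact this.fst.prodMk (this.snd.add continuous_const)
  apply_eq_iff_mem_orbit {X Y} := by
    have e : confToWConf X = confToWConf Y ↔
        (Set.range fun i => wicketAt (X.1 i)) = Set.range fun i => wicketAt (Y.1 i) := Quotient.eq
    rw [e]
    constructor
    · intro h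
      have h1 : ∀ i, ∃ j, wicketAt (X.1 i) = wicketAt (Y.1 j) := fun i => by
        have : wicketAt (X.1 i) ∈ Set.range fun i => wicketAt (Y.1 i) := h ▸ ⟨i, rfl⟩
        obtain ⟨j, hj⟩ := this
        exact ⟨j, hj.symm⟩
      choose f hf using h1
      have hinj : Function.Injective f := by
        intro i j hij
        refine wicketAt_injective X.2 ?_
        simp only [hf, hij]
      choose k hk using fun i => wicketAt_eq_iff.1 (hf i)
      let π : Equiv.Perm (Fin n) := Equiv.ofBijective f hinj.bijective_of_finite
      refine ⟨⟨fun i => Multiplicative.ofAdd (k i), π⁻¹⟩, Subtype.ext (funext fun i => ?_)⟩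
      rw [hk i]
      change ((⟨fun i => Multiplicative.ofAdd (k i), π⁻¹⟩ : Deck n) • Y).1 i = _
      rw [smul_conf_apply]
      simp [π]
    · rintro ⟨g, rfl⟩
      have : (fun i => wicketAt ((g • Y).1 i)) = (fun i => wicketAt (Y.1 i)) ∘ ⇑(g.right⁻¹) := by
        funext i; exact wicketAt_deckAct g Y.1 i
      change Set.range (fun i => wicketAt ((g • Y).1 i)) = _
      rw [this]
      exact g.right⁻¹.surjective.range_comp _
  disjoint X := by
    let ζ : ℂ × ℂ → ℂ × ℂ := fun z => (z.1, Complex.exp (2 * z.2))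
    have hζ : Continuous ζ := by fun_prop
    have hinv : ∀ (z : ℂ × ℂ) (k : ℤ), ζ (z.1, z.2 + k * (Real.pi * Complex.I)) = ζ z := by
      intro z k
      refine Prod.ext rfl ?_
      exact Complex.exp_eq_exp_iff_exists_int.2 ⟨k, by ring⟩
    have hinj : Function.Injective fun i => ζ (X.1 i) := by
      intro i j h
      refine wicketAt_injective X.2 (wicketAt_eq_iff.2 ?_)
      obtain ⟨k, hk⟩ := Complex.exp_eq_exp_iff_exists_int.1 (Prod.ext_iff.1 h).2
      exact ⟨k, Prod.ext (Prod.ext_iff.1 h).1 (by linear_combination hk / 2)⟩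
    obtain ⟨N, hN, hd⟩ := (Set.finite_range fun i => ζ (X.1 i)).t2_separation
    let V : Set (Conf (Fin n)) := ⋂ i, {Y | ζ (Y.1 i) ∈ N (ζ (X.1 i)) ∧
      dist (Y.1 i).2 (X.1 i).2 < 1}
    have hV : IsOpen V := by
      refine isOpen_iInter_of_finite fun i => ?_
      have hi : Continuous fun Y : Conf (Fin n) => Y.1 i :=
        (continuous_apply i).comp continuous_subtype_val
      exact ((hN _).2.preimage (hζ.comp hi)).inter
        (isOpen_lt (hi.snd.dist continuous_const) continuous_const)
    refine ⟨V, hV.mem_nhds (Set.mem_iInter.2 fun i => ⟨(hN _).1, by simp⟩), ?_⟩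
    rintro g ⟨_, ⟨Y, hY, rfl⟩, hgY⟩
    have hY' := Set.mem_iInter.1 hY
    have hgY' := Set.mem_iInter.1 hgY
    have hr : ∀ i, g.right⁻¹ i = i := by
      intro i
      have h1 := (hgY' i).1
      simp only [smul_conf_apply, hinv] at h1
      have h2 := (hY' (g.right⁻¹ i)).1
      by_contra hne
      exact Set.disjoint_left.1 (hd ⟨_, rfl⟩ ⟨_, rfl⟩ (hinj.ne hne)) h2 h1
    have hl : ∀ i, g.left i = 1 := by
      intro i
      have h1 := (hgY' i).2
      have h2 := (hY' i).2
      rw [smul_conf_apply, hr] at h1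
      have h3 : dist ((Y.1 i).2 + (g.left i).toAdd * (Real.pi * Complex.I)) (Y.1 i).2 < 2 := by
        refine (dist_triangle_right _ _ (X.1 i).2).trans_lt ?_
        simp only at h1
        linarith
      rw [dist_eq_norm, add_sub_cancel_left, norm_mul, Complex.norm_intCast, norm_mul,
        Complex.norm_I, Complex.norm_real, Real.norm_of_nonneg Real.pi_pos.le, mul_one] at h3
      have h4 : |((g.left i).toAdd : ℝ)| < 1 := by
        nlinarith [Real.pi_gt_three, abs_nonneg ((g.left i).toAdd : ℝ)]
      have h5 : (g.left i).toAdd = 0 := by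
        rw [← Int.abs_lt_one_iff]; exact_mod_cast h4
      exact Multiplicative.toAdd.injective h5
    have hr' : g.right = 1 := by
      rw [← inv_inj, inv_one]; ext i; simp [hr]
    exact SemidirectProduct.ext (funext hl) hr'

theorem isCoveringMap_confToWConf : IsCoveringMap (confToWConf (n := n)) :=
  isQuotientCoveringMap_confToWConf.isCoveringMap

end DeckGroup

section Evaluations

variable {n : ℕ} {Γ : Type*} [Group Γ]

/-- A multiplicative homotopy invariant of paths in the wicket space, evaluated on labelled
configurations. -/
structure Evaluation (n : ℕ) (Γ : Type*) [Group Γ] where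
  map : ∀ {X Y : Conf (Fin n)}, Path X Y → Γ
  map_trans : ∀ {X Y Z : Conf (Fin n)} (γ : Path X Y) (γ' : Path Y Z),
    map (γ.trans γ') = map γ * map γ'
  map_homotopic : ∀ {X Y : Conf (Fin n)} {γ γ' : Path X Y}, γ.Homotopic γ' → map γ = map γ'
  map_congr : ∀ {X Y X' Y' : Conf (Fin n)} {γ : Path X Y} {γ' : Path X' Y'},
    (∀ t, confToWConf (γ t) = confToWConf (γ' t)) → map γ = map γ'

namespace Evaluation

variable (E : Evaluation n Γ) {A B : Type*} [TopologicalSpace A] [SimplyConnectedSpace A]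
  [TopologicalSpace B] [SimplyConnectedSpace B]

/-- The value on the image of any path from `a` to `b` in a simply connected space. -/
def val (f : C(A, Conf (Fin n))) (a b : A) : Γ :=
  E.map ((PathConnectedSpace.somePath a b).map f.continuous)

theorem val_eq (f : C(A, Conf (Fin n))) {a b : A} (γ : Path a b) :
    E.val f a b = E.map (γ.map f.continuous) :=
  E.map_homotopic ((SimplyConnectedSpace.paths_homotopic _ γ).map f)

theorem val_mul (f : C(A, Conf (Fin n))) (a b c : A) :
    E.val f a b * E.val f b c = E.val f a c := by
  rw [E.val_eq f ((PathConnectedSpace.somePath a b).trans (PathConnectedSpace.somePath b c)),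
    Path.map_trans, E.map_trans, val, val]

theorem val_self (f : C(A, Conf (Fin n))) (a : A) : E.val f a a = 1 := by
  simpa using E.val_mul f a a a

theorem val_symm (f : C(A, Conf (Fin n))) (a b : A) : E.val f b a = (E.val f a b)⁻¹ := by
  rw [eq_inv_iff_mul_eq_one, E.val_mul, E.val_self]

theorem val_transfer {A' : Type*} [TopologicalSpace A'] [SimplyConnectedSpace A']
    {f : C(A, Conf (Fin n))} {g : C(A', Conf (Fin n))} (i : C(B, A)) (j : C(B, A'))
    (h : ∀ b, confToWConf (f (i b)) = confToWConf (g (j b))) (b b' : B) :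
    E.val f (i b) (i b') = E.val g (j b) (j b') := by
  let γ := PathConnectedSpace.somePath b b'
  rw [E.val_eq f (γ.map i.continuous), E.val_eq g (γ.map j.continuous)]
  exact E.map_congr fun t => h _

variable {K : Set (Ivl n)}

/-- The configurations of wickets over a set of families of intervals. -/
def ivlOn (K : Set (Ivl n)) (hK : K ⊆ IvlConf n) : C(K, Conf (Fin n)) :=
  ivlToConf.comp ⟨Set.inclusion hK, continuous_inclusion hK⟩

theorem simplyConnectedSpace_of_convex {W : Type*} [AddCommGroup W] [Module ℝ W]
    [TopologicalSpace W] [IsTopologicalAddGroup W] [ContinuousSMul ℝ W] {K : Set W}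
    (hK : Convex ℝ K) (hne : K.Nonempty) : SimplyConnectedSpace K :=
  have := hK.contractibleSpace hne
  inferInstance

theorem simplyConnectedSpace_segment (u v : Ivl n) : SimplyConnectedSpace (segment ℝ u v) :=
  simplyConnectedSpace_of_convex (convex_segment u v) ⟨u, left_mem_segment ℝ u v⟩

open Classical in
/-- The value on the straight path between two families of intervals. -/
def seg (u v : Ivl n) : Γ :=
  have := simplyConnectedSpace_segment u v
  if h : segment ℝ u v ⊆ IvlConf n then
    E.val (ivlOn _ h) ⟨u, left_mem_segment ℝ u v⟩ ⟨v, right_mem_segment ℝ u v⟩ else 1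

theorem seg_eq [SimplyConnectedSpace K] (hK : Convex ℝ K) (hs : K ⊆ IvlConf n) {u v : Ivl n}
    (hu : u ∈ K) (hv : v ∈ K) : E.seg u v = E.val (ivlOn K hs) ⟨u, hu⟩ ⟨v, hv⟩ := by
  have := simplyConnectedSpace_segment u v
  have h1 : segment ℝ u v ⊆ K := hK.segment_subset hu hv
  rw [seg, dif_pos (h1.trans hs)]
  exact E.val_transfer (f := ivlOn _ (h1.trans hs)) (g := ivlOn K hs) (ContinuousMap.id _)
    ⟨Set.inclusion h1, continuous_inclusion h1⟩ (fun _ => rfl) ⟨u, left_mem_segment ℝ u v⟩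
    ⟨v, right_mem_segment ℝ u v⟩

theorem seg_mul (hK : Convex ℝ K) (hs : K ⊆ IvlConf n) {u v w : Ivl n} (hu : u ∈ K) (hv : v ∈ K)
    (hw : w ∈ K) : E.seg u v * E.seg v w = E.seg u w := by
  have := simplyConnectedSpace_of_convex hK ⟨u, hu⟩
  rw [E.seg_eq hK hs hu hv, E.seg_eq hK hs hv hw, E.seg_eq hK hs hu hw, E.val_mul]

theorem seg_symm (hK : Convex ℝ K) (hs : K ⊆ IvlConf n) {u v : Ivl n} (hu : u ∈ K) (hv : v ∈ K) :
    E.seg v u = (E.seg u v)⁻¹ := by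
  have := simplyConnectedSpace_of_convex hK ⟨u, hu⟩
  rw [E.seg_eq hK hs hu hv, E.seg_eq hK hs hv hu, E.val_symm]

theorem map_eq_seg (hK : Convex ℝ K) (hs : K ⊆ IvlConf n) {u v : IvlConf n} (γ : Path u v)
    (h : ∀ t, (γ t).1 ∈ K) : E.map (γ.map ivlToConf.continuous) = E.seg u.1 v.1 := by
  have hu : u.1 ∈ K := by simpa using h 0
  have hv : v.1 ∈ K := by simpa using h 1
  have := simplyConnectedSpace_of_convex hK ⟨_, hu⟩
  let γ' : Path (⟨u.1, hu⟩ : K) ⟨v.1, hv⟩ :=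
    ⟨⟨fun t => ⟨(γ t).1, h t⟩, by fun_prop⟩, Subtype.ext (by simp), Subtype.ext (by simp)⟩
  rw [E.seg_eq hK hs hu hv, E.val_eq _ γ']
  exact E.map_congr fun t => rfl

theorem comp_mem_ivlConf {u : Ivl n} (hu : u ∈ IvlConf n) (π : Equiv.Perm (Fin n)) :
    u ∘ π ∈ IvlConf n :=
  ⟨fun i => hu.1 (π i), fun i j hij h => hu.2 (π i) (π j) (π.injective.ne hij) h⟩

theorem confToWConf_relabel (X Y : Conf (Fin n)) (π : Equiv.Perm (Fin n))
    (h : ∀ i, Y.1 i = X.1 (π i)) : confToWConf Y = confToWConf X := by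
  refine isQuotientCoveringMap_confToWConf.apply_eq_iff_mem_orbit.2 ⟨⟨1, π⁻¹⟩, Subtype.ext ?_⟩
  funext i
  rw [h]
  change ((⟨1, π⁻¹⟩ : Deck n) • X).1 i = _
  rw [smul_conf_apply]
  simp

theorem seg_relabel (hK : Convex ℝ K) (hs : K ⊆ IvlConf n) {u v : Ivl n} (hu : u ∈ K) (hv : v ∈ K)
    (π : Equiv.Perm (Fin n)) : E.seg (u ∘ π) (v ∘ π) = E.seg u v := by
  have := simplyConnectedSpace_of_convex hK ⟨u, hu⟩
  let K' : Set (Ivl n) := (fun w : Ivl n => w ∘ π) '' K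
  have hK' : Convex ℝ K' := by
    rintro _ ⟨w, hw, rfl⟩ _ ⟨w', hw', rfl⟩ c d hc hd hcd
    exact ⟨_, hK hw hw' hc hd hcd, rfl⟩
  have hs' : K' ⊆ IvlConf n := by
    rintro _ ⟨w, hw, rfl⟩
    exact comp_mem_ivlConf (hs hw) π
  have hu' : u ∘ π ∈ K' := ⟨u, hu, rfl⟩
  have hv' : v ∘ π ∈ K' := ⟨v, hv, rfl⟩
  have := simplyConnectedSpace_of_convex hK' ⟨_, hu'⟩
  rw [E.seg_eq hK hs hu hv, E.seg_eq hK' hs' hu' hv']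
  refine E.val_transfer (B := K) (f := ivlOn K' hs') (g := ivlOn K hs)
    ⟨fun w => ⟨w.1 ∘ π, w.1, w.2, rfl⟩, ?_⟩ (ContinuousMap.id _) (fun w => ?_) ⟨u, hu⟩ ⟨v, hv⟩
  · refine Continuous.subtype_mk (continuous_pi fun i => ?_) _
    exact (continuous_apply (π i)).comp continuous_subtype_val
  · exact confToWConf_relabel _ _ π fun i => rfl

/-- The intervals `J` at the heights given by a permutation. -/
def stack (q : Equiv.Perm (Fin n)) (J : Fin n → ℝ × ℝ) : Ivl n := fun i => ((q i : ℕ), J i)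

/-- The short intervals of the base configuration. -/
def short : Fin n → ℝ × ℝ := fun _ => (-1 / 20, 1 / 20)

theorem stack_comp (q π : Equiv.Perm (Fin n)) (J : Fin n → ℝ × ℝ) :
    stack q J ∘ π = stack (q * π) (J ∘ π) := rfl

theorem stack_y_lt_iff {q : Equiv.Perm (Fin n)} {J : Fin n → ℝ × ℝ} {i j : Fin n} :
    (stack q J).y i < (stack q J).y j ↔ q i < q j := by
  rw [Fin.lt_def]
  exact Nat.cast_lt

theorem stack_mem {q : Equiv.Perm (Fin n)} {J : Fin n → ℝ × ℝ} (hJ : ∀ i, (J i).1 < (J i).2) :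
    stack q J ∈ IvlConf n := by
  refine ⟨hJ, fun i j hij h => absurd ?_ hij⟩
  simp only [stack, Ivl.y, Nat.cast_inj] at h
  exact q.injective (Fin.ext h)

theorem short_lt (i : Fin n) : (short i).1 < (short i).2 := by
  simp only [short]; norm_num

theorem mem_chamber_stack_short {q : Equiv.Perm (Fin n)} {u : Ivl n} (h : ∀ i, u.a i < u.b i)
    (h' : ∀ i j, q i < q j → u.y i < u.y j) : u ∈ chamber (stack q short) := by
  have key : ∀ i j, (stack q short).y i = (stack q short).y j → i = j := by
    intro i j e
    simp only [stack, Ivl.y, Nat.cast_inj] at e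
    exact q.injective (Fin.ext e)
  refine ⟨h, fun i j e => h' i j (stack_y_lt_iff.1 e), fun i j e e' => ?_, fun i j e e' => ?_, fun i j e e' => ?_⟩
  · obtain rfl := key i j e
    exact absurd e' (lt_irrefl _)
  · obtain rfl := key i j e
    exact absurd e' (lt_irrefl _)
  · obtain rfl := key i j e
    exact absurd e' (not_lt.2 (short_lt i).le)

theorem stack_mem_chamber_short {q : Equiv.Perm (Fin n)} {J : Fin n → ℝ × ℝ}
    (hJ : ∀ i, (J i).1 < (J i).2) : stack q J ∈ chamber (stack q short) :=
  mem_chamber_stack_short hJ fun _ _ h => stack_y_lt_iff.2 h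

/-- Two stacks with intervals as in `u`, in orders compatible with the heights of `s`. -/
theorem stack_mem_chamber {s u : Ivl n} (hu : u ∈ chamber s) {q : Equiv.Perm (Fin n)}
    (hq : ∀ i j, s.y i < s.y j → q i < q j) : stack q (fun i => (u i).2) ∈ chamber s :=
  ⟨hu.1, fun i j h => stack_y_lt_iff.2 (hq i j h), hu.2.2⟩

theorem seg_mul_chamber {s u v w : Ivl n} (hs : s ∈ IvlConf n) (hu : u ∈ chamber s)
    (hv : v ∈ chamber s) (hw : w ∈ chamber s) : E.seg u v * E.seg v w = E.seg u w :=
  E.seg_mul (convex_chamber s) (chamber_subset hs) hu hv hw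

theorem seg_symm_chamber {s u v : Ivl n} (hs : s ∈ IvlConf n) (hu : u ∈ chamber s)
    (hv : v ∈ chamber s) : E.seg v u = (E.seg u v)⁻¹ :=
  E.seg_symm (convex_chamber s) (chamber_subset hs) hu hv

/-- The loop at the base configuration passing from one order of the intervals `J` to another. -/
def wall (q q' : Equiv.Perm (Fin n)) (J : Fin n → ℝ × ℝ) : Γ :=
  E.seg (stack q short) (stack q J) * E.seg (stack q J) (stack q' J) *
    E.seg (stack q' J) (stack q' short)

variable {q q' q'' : Equiv.Perm (Fin n)} {J J' : Fin n → ℝ × ℝ} {s : Ivl n}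

theorem stack_short_mem : stack q short ∈ IvlConf n := stack_mem short_lt

theorem wall_mul (hs : s ∈ IvlConf n) (hq : stack q J ∈ chamber s) (hq' : stack q' J ∈ chamber s)
    (hq'' : stack q'' J ∈ chamber s) : E.wall q q' J * E.wall q' q'' J = E.wall q q'' J := by
  have h1 := E.seg_symm_chamber stack_short_mem (stack_mem_chamber_short (q := q') short_lt)
    (stack_mem_chamber_short (J := J) hq.1)
  rw [wall, wall, wall, ← E.seg_mul_chamber hs hq hq' hq'', h1]
  group

theorem wall_symm (hs : s ∈ IvlConf n) (hq : stack q J ∈ chamber s) (hq' : stack q' J ∈ chamber s) :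
    E.wall q' q J = (E.wall q q' J)⁻¹ := by
  have h : ∀ q : Equiv.Perm (Fin n), E.seg (stack q J) (stack q short) =
    (E.seg (stack q short) (stack q J))⁻¹ := fun q => E.seg_symm_chamber stack_short_mem
      (stack_mem_chamber_short short_lt) (stack_mem_chamber_short (J := J) hq.1)
  rw [wall, wall, h, h, E.seg_symm_chamber hs hq hq']
  group

theorem wall_eq_of_between {v w : Ivl n} (hs : s ∈ IvlConf n)
    (hq : stack q J ∈ chamber s) (hq' : stack q' J ∈ chamber s) (hv : v ∈ chamber s)
    (hw : w ∈ chamber s) (hvq : v ∈ chamber (stack q short)) (hwq : w ∈ chamber (stack q' short)) :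
    E.seg (stack q short) v * E.seg v w * E.seg w (stack q' short) = E.wall q q' J := by
  have m := fun q : Equiv.Perm (Fin n) => stack_mem_chamber_short (q := q) short_lt
  have mJ := fun q : Equiv.Perm (Fin n) => stack_mem_chamber_short (q := q) (J := J) hq.1
  rw [wall, ← E.seg_mul_chamber stack_short_mem (m q) hvq (mJ q),
    ← E.seg_mul_chamber stack_short_mem (mJ q') hwq (m q'),
    ← E.seg_mul_chamber hs hq hw hq', ← E.seg_mul_chamber hs hq hv hw]
  rw [E.seg_symm_chamber hs hq hv, E.seg_symm_chamber hs hq' hw]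
  group

theorem wall_congr (hs : s ∈ IvlConf n) (hq : stack q J ∈ chamber s) (hq' : stack q' J ∈ chamber s)
    (hJq : stack q J' ∈ chamber s) (hJq' : stack q' J' ∈ chamber s) :
    E.wall q q' J' = E.wall q q' J :=
  E.wall_eq_of_between hs hq hq' hJq hJq' (stack_mem_chamber_short hJq.1)
    (stack_mem_chamber_short hJq.1)

theorem wall_relabel (hs : s ∈ IvlConf n) (hq : stack q J ∈ chamber s)
    (hq' : stack q' J ∈ chamber s) (π : Equiv.Perm (Fin n)) :
    E.wall (q * π) (q' * π) (J ∘ π) = E.wall q q' J := by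
  have h : ∀ q : Equiv.Perm (Fin n), stack (q * π) short = stack q short ∘ π := fun q => rfl
  have m := fun q : Equiv.Perm (Fin n) => stack_mem_chamber_short (q := q) short_lt
  have mJ := fun q : Equiv.Perm (Fin n) => stack_mem_chamber_short (q := q) (J := J) hq.1
  have hc := fun q : Equiv.Perm (Fin n) => convex_chamber (stack q short)
  have hcs := fun q : Equiv.Perm (Fin n) => chamber_subset (stack_short_mem (q := q))
  rw [wall, wall, h, h, ← stack_comp, ← stack_comp, E.seg_relabel (hc q) (hcs q) (m q) (mJ q),
    E.seg_relabel (hc q') (hcs q') (mJ q') (m q'),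
    E.seg_relabel (convex_chamber s) (chamber_subset hs) hq hq']

end Evaluation

end Evaluations

section Generators

variable {n : ℕ} {Γ : Type*} [Group Γ]

namespace Evaluation

variable (E : Evaluation n Γ)

/-- The intervals `J` at the heights `t`. -/
def tie (t : Fin n → ℕ) (J : Fin n → ℝ × ℝ) : Ivl n := fun i => (t i, J i)

variable {t : Fin n → ℕ} {q : Equiv.Perm (Fin n)} {J J' : Fin n → ℝ × ℝ} {k : ℕ}

theorem tie_y_eq_iff {i j : Fin n} : (tie t J).y i = (tie t J).y j ↔ t i = t j := Nat.cast_inj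

theorem tie_y_lt_iff {i j : Fin n} : (tie t J).y i < (tie t J).y j ↔ t i < t j := Nat.cast_lt

theorem tie_mem (hJ : ∀ i, (J i).1 < (J i).2)
    (hc : ∀ i j, i ≠ j → t i = t j → NonCrossing (fun i => (J i).1) (fun i => (J i).2) i j) :
    tie t J ∈ IvlConf n :=
  ⟨hJ, fun i j hij h => hc i j hij (tie_y_eq_iff.1 h)⟩

theorem stack_mem_tie (ht : Monotone t) (hq : ∀ i, t (q i) = t i) (hJ : ∀ i, (J i).1 < (J i).2)
    (hJ' : ∀ i, (J' i).1 < (J' i).2) (h : ∀ i j, i ≠ j → t i = t j →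
      ((J j).1 < (J i).1 → (J i).2 < (J j).2 → (J' j).1 < (J' i).1 ∧ (J' i).2 < (J' j).2) ∧
      ((J j).2 < (J i).1 → (J' j).2 < (J' i).1)) : stack q J' ∈ chamber (tie t J) := by
  have key : ∀ i j, (tie t J).y i = (tie t J).y j → t i = t j := fun i j => tie_y_eq_iff.1
  refine ⟨hJ', fun i j e => ?_, fun i j e e1 e2 => ?_, fun i j e e1 e2 => ?_, fun i j e e1 => ?_⟩
  · have e' : t i < t j := tie_y_lt_iff.1 e
    rw [stack_y_lt_iff]
    by_contra hlt
    have := ht (not_lt.1 hlt)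
    rw [hq, hq] at this
    omega
  · have hij : i ≠ j := fun hij => by rw [hij] at e1; exact lt_irrefl _ e1
    exact ((h i j hij (key i j e)).1 e1 e2).1
  · have hij : i ≠ j := fun hij => by rw [hij] at e1; exact lt_irrefl _ e1
    exact ((h i j hij (key i j e)).1 e1 e2).2
  · have hij : i ≠ j := fun hij => by
      rw [hij] at e1; exact lt_irrefl _ ((hJ j).trans e1)
    exact (h i j hij (key i j e)).2 e1

theorem stack_mem_tie_self (ht : Monotone t) (hq : ∀ i, t (q i) = t i)
    (hJ : ∀ i, (J i).1 < (J i).2) : stack q J ∈ chamber (tie t J) :=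
  stack_mem_tie ht hq hJ hJ fun _ _ _ _ => ⟨fun h h' => ⟨h, h'⟩, fun h => h⟩

theorem eq_of_swap {x y : Fin n} (h : t x = t y) (i : Fin n) : t (Equiv.swap x y i) = t i := by
  rw [Equiv.swap_apply_def]
  split_ifs with h1 h2
  · rw [h1, h]
  · rw [h2, h]
  · rfl

/-- The heights with the position `k + 1` brought down to `k`. -/
def tieTwo (k : ℕ) (i : Fin n) : ℕ := if (i : ℕ) = k + 1 then k else i

theorem monotone_tieTwo : Monotone (tieTwo (n := n) k) := by
  intro i j h
  rw [Fin.le_def] at h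
  unfold tieTwo
  split_ifs <;> omega

theorem tieTwo_eq {i j : Fin n} (hij : i ≠ j) (h : tieTwo k i = tieTwo k j) :
    ((i : ℕ) = k ∧ (j : ℕ) = k + 1) ∨ ((i : ℕ) = k + 1 ∧ (j : ℕ) = k) := by
  rw [Ne, Fin.ext_iff] at hij
  unfold tieTwo at h
  split_ifs at h <;> omega

/-- The first of the positions exchanged by the `k`-th generator. -/
abbrev lo (hk : k + 1 < n) : Fin n := ⟨k, by omega⟩

/-- The second of the positions exchanged by the `k`-th generator. -/
abbrev hi (hk : k + 1 < n) : Fin n := ⟨k + 1, hk⟩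

/-- The adjacent transposition of positions. -/
abbrev sw (hk : k + 1 < n) : Equiv.Perm (Fin n) := Equiv.swap (lo hk) (hi hk)

theorem lo_ne_hi (hk : k + 1 < n) : lo hk ≠ hi hk := by simp [lo, hi]

theorem tieTwo_sw (hk : k + 1 < n) (i : Fin n) : tieTwo k (sw hk i) = tieTwo k i :=
  eq_of_swap (by simp [tieTwo]) i

/-- The intervals for the generator `ρ`. -/
def ringIvl (y : Fin n) : Fin n → ℝ × ℝ := Function.update short y (-1, 1)

/-- The intervals for the generator `σ`. -/
def sideIvl (x : Fin n) : Fin n → ℝ × ℝ := Function.update short x (19 / 20, 21 / 20)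

theorem ringIvl_lt (y i : Fin n) : (ringIvl y i).1 < (ringIvl y i).2 := by
  rcases eq_or_ne i y with rfl | h
  · simp [ringIvl]
  · simpa [ringIvl, h] using short_lt i

theorem sideIvl_lt (x i : Fin n) : (sideIvl x i).1 < (sideIvl x i).2 := by
  rcases eq_or_ne i x with rfl | h
  · simp [sideIvl]; norm_num
  · simpa [sideIvl, h] using short_lt i

/-- The value of the generator `ρ`. -/
def rho (k : ℕ) : Γ := if hk : k + 1 < n then E.wall 1 (sw hk) (ringIvl (hi hk)) else 1

/-- The value of the generator `σ`. -/
def sig (k : ℕ) : Γ := if hk : k + 1 < n then E.wall 1 (sw hk) (sideIvl (lo hk)) else 1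

theorem two_mem (hk : k + 1 < n) (hJ : ∀ i, (J i).1 < (J i).2)
    (hc : NonCrossing (fun i => (J i).1) (fun i => (J i).2) (lo hk) (hi hk)) :
    tie (tieTwo k) J ∈ IvlConf n := by
  refine tie_mem hJ fun i j hij h => ?_
  rcases tieTwo_eq hij h with ⟨h1, h2⟩ | ⟨h1, h2⟩
  · obtain rfl : i = lo hk := Fin.ext h1
    obtain rfl : j = hi hk := Fin.ext h2
    exact hc
  · obtain rfl : i = hi hk := Fin.ext h1
    obtain rfl : j = lo hk := Fin.ext h2
    exact hc.symm

theorem wall_inside (hk : k + 1 < n) (hJ : ∀ i, (J i).1 < (J i).2)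
    (h : (J (hi hk)).1 < (J (lo hk)).1 ∧ (J (lo hk)).2 < (J (hi hk)).2) :
    E.wall 1 (sw hk) J = E.rho k := by
  rw [rho, dif_pos hk]
  have hm := two_mem (J := J) hk hJ (Or.inl h)
  have h1 : ringIvl (hi hk) (lo hk) = (-1 / 20, 1 / 20) := by
    rw [ringIvl, Function.update_of_ne (lo_ne_hi hk)]; rfl
  have h2 : ringIvl (hi hk) (hi hk) = (-1, 1) := by simp [ringIvl]
  have key : ∀ q : Equiv.Perm (Fin n), (∀ i, tieTwo k (q i) = tieTwo k i) →
      stack q (ringIvl (hi hk)) ∈ chamber (tie (tieTwo k) J) := by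
    intro q hq
    refine stack_mem_tie monotone_tieTwo hq hJ (ringIvl_lt _) fun i j hij e => ?_
    rcases tieTwo_eq hij e with ⟨e1, e2⟩ | ⟨e1, e2⟩
    · obtain rfl : i = lo hk := Fin.ext e1
      obtain rfl : j = hi hk := Fin.ext e2
      rw [h1, h2]
      refine ⟨fun _ _ => by norm_num, fun h' => ?_⟩
      have := hJ (lo hk)
      linarith [h.1, h.2]
    · obtain rfl : i = hi hk := Fin.ext e1
      obtain rfl : j = lo hk := Fin.ext e2
      refine ⟨fun h' => ?_, fun h' => ?_⟩
      · linarith [h.1, h.2]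
      · have := hJ (lo hk)
        linarith [h.1, h.2]
  exact (E.wall_congr hm (stack_mem_tie_self monotone_tieTwo (fun _ => rfl) hJ)
    (stack_mem_tie_self monotone_tieTwo (tieTwo_sw hk) hJ) (key 1 fun _ => rfl)
    (key _ (tieTwo_sw hk))).symm

theorem wall_right (hk : k + 1 < n) (hJ : ∀ i, (J i).1 < (J i).2)
    (h : (J (hi hk)).2 < (J (lo hk)).1) : E.wall 1 (sw hk) J = E.sig k := by
  rw [sig, dif_pos hk]
  have hm := two_mem (J := J) hk hJ (Or.inr (Or.inr (Or.inl h)))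
  have h1 : sideIvl (lo hk) (hi hk) = (-1 / 20, 1 / 20) := by
    rw [sideIvl, Function.update_of_ne (lo_ne_hi hk).symm]; rfl
  have h2 : sideIvl (lo hk) (lo hk) = (19 / 20, 21 / 20) := by simp [sideIvl]
  have j1 := hJ (lo hk)
  have j2 := hJ (hi hk)
  have key : ∀ q : Equiv.Perm (Fin n), (∀ i, tieTwo k (q i) = tieTwo k i) →
      stack q (sideIvl (lo hk)) ∈ chamber (tie (tieTwo k) J) := by
    intro q hq
    refine stack_mem_tie monotone_tieTwo hq hJ (sideIvl_lt _) fun i j hij e => ?_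
    rcases tieTwo_eq hij e with ⟨e1, e2⟩ | ⟨e1, e2⟩
    · obtain rfl : i = lo hk := Fin.ext e1
      obtain rfl : j = hi hk := Fin.ext e2
      rw [h1, h2]
      refine ⟨fun h' h'' => ?_, fun h' => by norm_num⟩
      linarith
    · obtain rfl : i = hi hk := Fin.ext e1
      obtain rfl : j = lo hk := Fin.ext e2
      refine ⟨fun h' h'' => ?_, fun h' => ?_⟩ <;> linarith
  exact (E.wall_congr hm (stack_mem_tie_self monotone_tieTwo (fun _ => rfl) hJ)
    (stack_mem_tie_self monotone_tieTwo (tieTwo_sw hk) hJ) (key 1 fun _ => rfl)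
    (key _ (tieTwo_sw hk))).symm

theorem wall_one_sw_symm (hk : k + 1 < n) (hJ : ∀ i, (J i).1 < (J i).2)
    (hc : NonCrossing (fun i => (J i).1) (fun i => (J i).2) (lo hk) (hi hk)) :
    E.wall 1 (sw hk) J = (E.wall 1 (sw hk) (J ∘ sw hk))⁻¹ := by
  have hm := two_mem (J := J) hk hJ hc
  have m1 := stack_mem_tie_self (q := 1) (monotone_tieTwo (n := n) (k := k)) (fun _ => rfl) hJ
  have m2 := stack_mem_tie_self (q := sw hk) (monotone_tieTwo (n := n) (k := k)) (tieTwo_sw hk) hJ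
  have h := E.wall_relabel hm m2 m1 (sw hk)
  rw [Equiv.swap_mul_self, one_mul] at h
  rw [h, E.wall_symm hm m2 m1]

theorem wall_one_sw (hk : k + 1 < n) (hJ : ∀ i, (J i).1 < (J i).2)
    (hc : NonCrossing (fun i => (J i).1) (fun i => (J i).2) (lo hk) (hi hk)) :
    E.wall 1 (sw hk) J =
      passGen E.rho E.sig (fun i => (J i).1) (fun i => (J i).2) k (lo hk) (hi hk) := by
  have hJ' : ∀ i, ((J ∘ sw hk) i).1 < ((J ∘ sw hk) i).2 := fun i => hJ _
  let a : Fin n → ℝ := fun i => (J i).1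
  let b : Fin n → ℝ := fun i => (J i).2
  rcases hc with h | h | h | h
  · rw [passGen_inside (a := a) (b := b) h, E.wall_inside hk hJ h]
  · rw [passGen_outside (a := a) (b := b) h, E.wall_one_sw_symm hk hJ (Or.inr (Or.inl h)),
      E.wall_inside hk hJ']
    simpa using h
  · rw [passGen_right (a := a) (b := b) (hJ _) (hJ _) h, E.wall_right hk hJ h]
  · rw [passGen_left (a := a) (b := b) (hJ _) (hJ _) h,
      E.wall_one_sw_symm hk hJ (Or.inr (Or.inr (Or.inr h))), E.wall_right hk hJ']
    simpa using h

/-- The value of the loop exchanging the intervals at positions `k` and `k + 1`. -/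
theorem wall_sw (hk : k + 1 < n) (hJ : ∀ i, (J i).1 < (J i).2)
    (hc : NonCrossing (fun i => (J i).1) (fun i => (J i).2) (q.symm (lo hk)) (q.symm (hi hk))) :
    E.wall q (sw hk * q) J = passGen E.rho E.sig (fun i => (J i).1) (fun i => (J i).2) k
      (q.symm (lo hk)) (q.symm (hi hk)) := by
  let J₁ : Fin n → ℝ × ℝ := J ∘ q.symm
  have hJ₁ : ∀ i, (J₁ i).1 < (J₁ i).2 := fun i => hJ _
  have hm := two_mem (J := J₁) hk hJ₁ hc
  have h := E.wall_relabel hm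
    (stack_mem_tie_self (q := 1) (monotone_tieTwo (n := n) (k := k)) (fun _ => rfl) hJ₁)
    (stack_mem_tie_self (q := sw hk) (monotone_tieTwo (n := n) (k := k)) (tieTwo_sw hk) hJ₁) q
  have e : J₁ ∘ q = J := by funext i; simp [J₁]
  rw [e, one_mul] at h
  rw [h, E.wall_one_sw hk hJ₁ hc]
  rfl

/-- The heights with the positions `k + 1` and `k + 2` brought down to `k`. -/
def tieThree (k : ℕ) (i : Fin n) : ℕ := if (i : ℕ) = k + 1 ∨ (i : ℕ) = k + 2 then k else i

theorem monotone_tieThree : Monotone (tieThree (n := n) k) := by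
  intro i j h
  rw [Fin.le_def] at h
  unfold tieThree
  split_ifs <;> omega

theorem hexagon_wall (hk : k + 2 < n) (hJ : ∀ i, (J i).1 < (J i).2)
    (h01 : NonCrossing (fun i => (J i).1) (fun i => (J i).2) ⟨k, by omega⟩ ⟨k + 1, by omega⟩)
    (h02 : NonCrossing (fun i => (J i).1) (fun i => (J i).2) ⟨k, by omega⟩ ⟨k + 2, hk⟩)
    (h12 : NonCrossing (fun i => (J i).1) (fun i => (J i).2) ⟨k + 1, by omega⟩ ⟨k + 2, hk⟩) :
    Hexagon
      (passGen E.rho E.sig (fun i => (J i).1) (fun i => (J i).2) k (⟨k, by omega⟩ : Fin n)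
        ⟨k + 1, by omega⟩)
      (passGen E.rho E.sig (fun i => (J i).1) (fun i => (J i).2) (k + 1) (⟨k, by omega⟩ : Fin n)
        ⟨k + 1, by omega⟩)
      (passGen E.rho E.sig (fun i => (J i).1) (fun i => (J i).2) k (⟨k, by omega⟩ : Fin n)
        ⟨k + 2, hk⟩)
      (passGen E.rho E.sig (fun i => (J i).1) (fun i => (J i).2) (k + 1) (⟨k, by omega⟩ : Fin n)
        ⟨k + 2, hk⟩)
      (passGen E.rho E.sig (fun i => (J i).1) (fun i => (J i).2) k (⟨k + 1, by omega⟩ : Fin n)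
        ⟨k + 2, hk⟩)
      (passGen E.rho E.sig (fun i => (J i).1) (fun i => (J i).2) (k + 1) (⟨k + 1, by omega⟩ : Fin n)
        ⟨k + 2, hk⟩) := by
  have hm : tie (tieThree k) J ∈ IvlConf n := by
    refine tie_mem hJ fun i j hij h => ?_
    have h' : ((i : ℕ) = k ∨ (i : ℕ) = k + 1 ∨ (i : ℕ) = k + 2) ∧
        ((j : ℕ) = k ∨ (j : ℕ) = k + 1 ∨ (j : ℕ) = k + 2) := by
      rw [Ne, Fin.ext_iff] at hij
      unfold tieThree at h
      split_ifs at h <;> omega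
    obtain ⟨i, hi⟩ := i
    obtain ⟨j, hj⟩ := j
    simp only at h'
    rcases h' with ⟨rfl | rfl | rfl, rfl | rfl | rfl⟩
    · exact absurd rfl hij
    · exact h01
    · exact h02
    · exact h01.symm
    · exact absurd rfl hij
    · exact h12
    · exact h02.symm
    · exact h12.symm
    · exact absurd rfl hij
  have hk1 : k + 1 < n := by omega
  have hk2 : k + 1 + 1 < n := hk
  set a := sw hk1
  set b := sw hk2
  have ta : ∀ i, tieThree k (a i) = tieThree k i := eq_of_swap (by simp [tieThree])
  have tb : ∀ i, tieThree k (b i) = tieThree k i := eq_of_swap (by simp [tieThree])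
  have st : ∀ q : Equiv.Perm (Fin n), (∀ i, tieThree k (q i) = tieThree k i) →
      stack q J ∈ chamber (tie (tieThree k) J) := fun q hq =>
    stack_mem_tie_self monotone_tieThree hq hJ
  have n01 : (⟨k, by omega⟩ : Fin n) ≠ ⟨k + 1, by omega⟩ := by simp
  have n02 : (⟨k, by omega⟩ : Fin n) ≠ ⟨k + 2, by omega⟩ := by simp
  have n12 : (⟨k + 1, by omega⟩ : Fin n) ≠ ⟨k + 2, by omega⟩ := by simp
  have a0 : a ⟨k, by omega⟩ = ⟨k + 1, by omega⟩ := Equiv.swap_apply_left _ _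
  have a1 : a ⟨k + 1, by omega⟩ = ⟨k, by omega⟩ := Equiv.swap_apply_right _ _
  have a2 : a ⟨k + 2, by omega⟩ = ⟨k + 2, by omega⟩ :=
    Equiv.swap_apply_of_ne_of_ne n02.symm n12.symm
  have b0 : b ⟨k, by omega⟩ = ⟨k, by omega⟩ := Equiv.swap_apply_of_ne_of_ne n01 n02
  have b1 : b ⟨k + 1, by omega⟩ = ⟨k + 2, by omega⟩ := Equiv.swap_apply_left _ _
  have b2 : b ⟨k + 2, by omega⟩ = ⟨k + 1, by omega⟩ := Equiv.swap_apply_right _ _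
  have sa : a.symm = a := Equiv.symm_swap _ _
  have sb : b.symm = b := Equiv.symm_swap _ _
  have hab : a * (b * a) = b * (a * b) := by
    ext i
    rcases eq_or_ne i ⟨k, by omega⟩ with rfl | h0
    · simp [a0, a2, b0, b1]
    rcases eq_or_ne i ⟨k + 1, by omega⟩ with rfl | h1
    · simp [a0, a1, a2, b0, b1, b2]
    rcases eq_or_ne i ⟨k + 2, by omega⟩ with rfl | h2
    · simp [a1, a2, b0, b2]
    · have ha : a i = i := Equiv.swap_apply_of_ne_of_ne h0 h1
      have hb : b i = i := Equiv.swap_apply_of_ne_of_ne h1 h2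
      simp [ha, hb]
  have w1 := E.wall_sw (q := 1) (J := J) hk1 hJ h01
  have w2 := E.wall_sw (q := a) (J := J) hk2 hJ (by rw [sa, a1, a2]; exact h02)
  have w3 := E.wall_sw (q := b * a) (J := J) hk1 hJ (by
    change NonCrossing _ _ (a.symm (b.symm _)) (a.symm (b.symm _))
    rw [sa, sb, b0, b1, a0, a2]; exact h12)
  have w4 := E.wall_sw (q := 1) (J := J) hk2 hJ h12
  have w5 := E.wall_sw (q := b) (J := J) hk1 hJ (by rw [sb, b0, b1]; exact h02)
  have w6 := E.wall_sw (q := a * b) (J := J) hk2 hJ (by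
    change NonCrossing _ _ (b.symm (a.symm _)) (b.symm (a.symm _))
    rw [sa, sb, a1, a2, b0, b2]; exact h01)
  have e3 : ∀ i, (b * a).symm i = a.symm (b.symm i) := fun _ => rfl
  have e6 : ∀ i, (a * b).symm i = b.symm (a.symm i) := fun _ => rfl
  rw [sa, a1, a2] at w2
  rw [e3, e3, sa, sb, b0, b1, a0, a2] at w3
  rw [sb, b0, b1] at w5
  rw [e6, e6, sa, sb, a1, a2, b0, b2] at w6
  have m1 := st 1 fun _ => rfl
  have ma := st a ta
  have mb := st b tb
  have mba := st (b * a) fun i => (tb _).trans (ta i)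
  have mab := st (a * b) fun i => (ta _).trans (tb i)
  have maba := st (a * (b * a)) fun i => (ta _).trans ((tb _).trans (ta i))
  have maba' := maba
  rw [hab] at maba'
  have c1 : E.wall 1 a J * E.wall a (b * a) J * E.wall (b * a) (a * (b * a)) J =
      E.wall 1 (a * (b * a)) J := by
    rw [E.wall_mul hm m1 ma mba, E.wall_mul hm m1 mba maba]
  have c2 : E.wall 1 b J * E.wall b (a * b) J * E.wall (a * b) (b * (a * b)) J =
      E.wall 1 (b * (a * b)) J := by
    rw [E.wall_mul hm m1 mb mab, E.wall_mul hm m1 mab maba']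
  rw [← hab, ← c1] at c2
  have w6' := w6
  rw [← hab] at w6'
  rw [mul_one] at w1 w4
  rw [w1, w2, w3, w4, w5, w6'] at c2
  exact c2.symm

/-- The heights with the positions `j + 1` and `k + 1` brought down to `j` and `k`. -/
def tieFar (j k : ℕ) (i : Fin n) : ℕ :=
  if (i : ℕ) = j + 1 then j else if (i : ℕ) = k + 1 then k else i

theorem monotone_tieFar {j : ℕ} (hjk : j + 2 ≤ k) : Monotone (tieFar (n := n) j k) := by
  intro i j h
  rw [Fin.le_def] at h
  unfold tieFar
  split_ifs <;> omega

theorem commute_wall {j : ℕ} (hjk : j + 2 ≤ k) (hj : j + 1 < n) (hk : k + 1 < n)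
    (hJ : ∀ i, (J i).1 < (J i).2)
    (h1 : NonCrossing (fun i => (J i).1) (fun i => (J i).2) (lo hj) (hi hj))
    (h2 : NonCrossing (fun i => (J i).1) (fun i => (J i).2) (lo hk) (hi hk)) :
    Commute (passGen E.rho E.sig (fun i => (J i).1) (fun i => (J i).2) j (lo hj) (hi hj))
      (passGen E.rho E.sig (fun i => (J i).1) (fun i => (J i).2) k (lo hk) (hi hk)) := by
  have hm : tie (tieFar j k) J ∈ IvlConf n := by
    refine tie_mem hJ fun x y hxy h => ?_
    have h' : ((x : ℕ) = j ∧ (y : ℕ) = j + 1) ∨ ((x : ℕ) = j + 1 ∧ (y : ℕ) = j) ∨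
        ((x : ℕ) = k ∧ (y : ℕ) = k + 1) ∨ ((x : ℕ) = k + 1 ∧ (y : ℕ) = k) := by
      rw [Ne, Fin.ext_iff] at hxy
      unfold tieFar at h
      split_ifs at h <;> omega
    obtain ⟨x, hx⟩ := x
    obtain ⟨y, hy⟩ := y
    simp only at h'
    rcases h' with ⟨rfl, rfl⟩ | ⟨rfl, rfl⟩ | ⟨rfl, rfl⟩ | ⟨rfl, rfl⟩
    · exact h1
    · exact h1.symm
    · exact h2
    · exact h2.symm
  set a := sw hj
  set b := sw hk
  have ta : ∀ i, tieFar j k (a i) = tieFar j k i := by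
    refine eq_of_swap ?_
    unfold tieFar
    simp only
    split_ifs <;> omega
  have tb : ∀ i, tieFar j k (b i) = tieFar j k i := by
    refine eq_of_swap ?_
    unfold tieFar
    simp only
    split_ifs <;> omega
  have st : ∀ q : Equiv.Perm (Fin n), (∀ i, tieFar j k (q i) = tieFar j k i) →
      stack q J ∈ chamber (tie (tieFar j k) J) := fun q hq =>
    stack_mem_tie_self (monotone_tieFar hjk) hq hJ
  have ne : ∀ {x y : ℕ} {hx : x < n} {hy : y < n}, x ≠ y → (⟨x, hx⟩ : Fin n) ≠ ⟨y, hy⟩ :=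
    fun h e => h (Fin.ext_iff.1 e)
  have a0 : a (lo hk) = lo hk := Equiv.swap_apply_of_ne_of_ne (ne (by omega)) (ne (by omega))
  have a1 : a (hi hk) = hi hk := Equiv.swap_apply_of_ne_of_ne (ne (by omega)) (ne (by omega))
  have b0 : b (lo hj) = lo hj := Equiv.swap_apply_of_ne_of_ne (ne (by omega)) (ne (by omega))
  have b1 : b (hi hj) = hi hj := Equiv.swap_apply_of_ne_of_ne (ne (by omega)) (ne (by omega))
  have sa : a.symm = a := Equiv.symm_swap _ _
  have sb : b.symm = b := Equiv.symm_swap _ _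
  have hab : a * b = b * a := by
    have := Equiv.swap_mul_eq_mul_swap a (lo hk) (hi hk)
    have ia : a⁻¹ = a := Equiv.symm_swap _ _
    rw [ia, a0, a1] at this
    exact this.symm
  have w1 := E.wall_sw (q := 1) (J := J) hj hJ h1
  have w2 := E.wall_sw (q := a) (J := J) hk hJ (by rw [sa, a0, a1]; exact h2)
  have w3 := E.wall_sw (q := 1) (J := J) hk hJ h2
  have w4 := E.wall_sw (q := b) (J := J) hj hJ (by rw [sb, b0, b1]; exact h1)
  rw [sa, a0, a1] at w2
  rw [sb, b0, b1] at w4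
  have m1 := st 1 fun _ => rfl
  have ma := st a ta
  have mb := st b tb
  have mba := st (b * a) fun i => (tb _).trans (ta i)
  have c1 := E.wall_mul hm m1 ma mba
  have c2 := E.wall_mul hm m1 mb (hab ▸ mba)
  change E.wall a (b * a) J = _ at w2
  change E.wall b (a * b) J = _ at w4
  rw [hab] at c2 w4
  rw [mul_one] at w1 w3
  rw [← c1, w1, w2, w3, w4] at c2
  exact c2.symm

theorem rho_of_le (h : ¬ k + 1 < n) : E.rho k = 1 := dif_neg h

theorem sig_of_le (h : ¬ k + 1 < n) : E.sig k = 1 := dif_neg h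

theorem braidRels : BraidRels E.rho E.sig n := by
  have far : ∀ j k, j + 2 ≤ k → k + 1 < n → ∀ p₁ p₂ p₃ p₄ : ℝ × ℝ, p₁.1 < p₁.2 → p₂.1 < p₂.2 →
      p₃.1 < p₃.2 → p₄.1 < p₄.2 → ∃ J : Fin n → ℝ × ℝ, (∀ i, (J i).1 < (J i).2) ∧
      (∀ i : Fin n, (i : ℕ) = j → J i = p₁) ∧ (∀ i : Fin n, (i : ℕ) = j + 1 → J i = p₂) ∧
      (∀ i : Fin n, (i : ℕ) = k → J i = p₃) ∧ ∀ i : Fin n, (i : ℕ) = k + 1 → J i = p₄ := by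
    intro j k hjk hk p₁ p₂ p₃ p₄ h1 h2 h3 h4
    refine ⟨fun i => if (i : ℕ) = j then p₁ else if (i : ℕ) = j + 1 then p₂ else
      if (i : ℕ) = k then p₃ else p₄, fun i => ?_, fun i e => ?_, fun i e => ?_, fun i e => ?_,
      fun i e => ?_⟩
    · dsimp only
      split_ifs <;> assumption
    · simp [e]
    · simp [e]
    · have h5 : k ≠ j := by omega
      have h6 : k ≠ j + 1 := by omega
      simp [e, h5, h6]
    · have h5 : k + 1 ≠ j := by omega
      have h6 : k ≠ j := by omega
      simp [e, h5, h6]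
  have three : ∀ k, k + 2 < n → ∀ p₁ p₂ p₃ : ℝ × ℝ, p₁.1 < p₁.2 → p₂.1 < p₂.2 →
      p₃.1 < p₃.2 → ∃ J : Fin n → ℝ × ℝ, (∀ i, (J i).1 < (J i).2) ∧
      (∀ i : Fin n, (i : ℕ) = k → J i = p₁) ∧ (∀ i : Fin n, (i : ℕ) = k + 1 → J i = p₂) ∧
      (∀ i : Fin n, (i : ℕ) = k + 2 → J i = p₃) := by
    intro k hk p₁ p₂ p₃ h1 h2 h3
    refine ⟨fun i => if (i : ℕ) = k then p₁ else if (i : ℕ) = k + 1 then p₂ else p₃,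
      fun i => ?_, fun i e => ?_, fun i e => ?_, fun i e => ?_⟩
    · dsimp only
      split_ifs <;> assumption
    · simp [e]
    · simp [e]
    · simp [e]
  have gin : ∀ (J : Fin n → ℝ × ℝ) (k : ℕ) (x y : Fin n), (J y).1 < (J x).1 ∧ (J x).2 < (J y).2 →
      passGen E.rho E.sig (fun i => (J i).1) (fun i => (J i).2) k x y = E.rho k :=
    fun J k x y h => passGen_inside h
  have gright : ∀ (J : Fin n → ℝ × ℝ) (k : ℕ) (x y : Fin n), (∀ i, (J i).1 < (J i).2) →
      (J y).2 < (J x).1 →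
      passGen E.rho E.sig (fun i => (J i).1) (fun i => (J i).2) k x y = E.sig k :=
    fun J k x y hJ h => passGen_right (hJ x) (hJ y) h
  have farA : ∀ j k, j + 2 ≤ k → Commute (E.rho j) (E.rho k) ∧ Commute (E.sig j) (E.sig k) ∧
      Commute (E.rho j) (E.sig k) ∧ Commute (E.sig j) (E.rho k) := by
    intro j k hjk
    by_cases hk : k + 1 < n
    swap
    · simp [E.rho_of_le hk, E.sig_of_le hk]
    have hj : j + 1 < n := by omega
    have inn : ((-2 : ℝ), (2 : ℝ)).1 < ((-1 : ℝ), (1 : ℝ)).1 ∧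
        ((-1 : ℝ), (1 : ℝ)).2 < ((-2 : ℝ), (2 : ℝ)).2 := by norm_num
    have rgt : ((-1 : ℝ), (1 : ℝ)).2 < ((2 : ℝ), (3 : ℝ)).1 := by norm_num
    refine ⟨?_, ?_, ?_, ?_⟩
    · obtain ⟨J, hJ, e1, e2, e3, e4⟩ := far j k hjk hk (-1, 1) (-2, 2) (-1, 1) (-2, 2)
        (by norm_num) (by norm_num) (by norm_num) (by norm_num)
      have c1 : (J (hi hj)).1 < (J (lo hj)).1 ∧ (J (lo hj)).2 < (J (hi hj)).2 := by
        rw [e1 (lo hj) rfl, e2 (hi hj) rfl]; exact inn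
      have c2 : (J (hi hk)).1 < (J (lo hk)).1 ∧ (J (lo hk)).2 < (J (hi hk)).2 := by
        rw [e3 (lo hk) rfl, e4 (hi hk) rfl]; exact inn
      have := E.commute_wall hjk hj hk hJ (Or.inl c1) (Or.inl c2)
      rwa [gin J j _ _ c1, gin J k _ _ c2] at this
    · obtain ⟨J, hJ, e1, e2, e3, e4⟩ := far j k hjk hk (2, 3) (-1, 1) (2, 3) (-1, 1)
        (by norm_num) (by norm_num) (by norm_num) (by norm_num)
      have c1 : (J (hi hj)).2 < (J (lo hj)).1 := by
        rw [e1 (lo hj) rfl, e2 (hi hj) rfl]; exact rgt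
      have c2 : (J (hi hk)).2 < (J (lo hk)).1 := by rw [e3 (lo hk) rfl, e4 (hi hk) rfl]; exact rgt
      have := E.commute_wall hjk hj hk hJ (Or.inr (Or.inr (Or.inl c1))) (Or.inr (Or.inr (Or.inl c2)))
      rwa [gright J j _ _ hJ c1, gright J k _ _ hJ c2] at this
    · obtain ⟨J, hJ, e1, e2, e3, e4⟩ := far j k hjk hk (-1, 1) (-2, 2) (2, 3) (-1, 1)
        (by norm_num) (by norm_num) (by norm_num) (by norm_num)
      have c1 : (J (hi hj)).1 < (J (lo hj)).1 ∧ (J (lo hj)).2 < (J (hi hj)).2 := by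
        rw [e1 (lo hj) rfl, e2 (hi hj) rfl]; exact inn
      have c2 : (J (hi hk)).2 < (J (lo hk)).1 := by rw [e3 (lo hk) rfl, e4 (hi hk) rfl]; exact rgt
      have := E.commute_wall hjk hj hk hJ (Or.inl c1) (Or.inr (Or.inr (Or.inl c2)))
      rwa [gin J j _ _ c1, gright J k _ _ hJ c2] at this
    · obtain ⟨J, hJ, e1, e2, e3, e4⟩ := far j k hjk hk (2, 3) (-1, 1) (-1, 1) (-2, 2)
        (by norm_num) (by norm_num) (by norm_num) (by norm_num)
      have c1 : (J (hi hj)).2 < (J (lo hj)).1 := by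
        rw [e1 (lo hj) rfl, e2 (hi hj) rfl]; exact rgt
      have c2 : (J (hi hk)).1 < (J (lo hk)).1 ∧ (J (lo hk)).2 < (J (hi hk)).2 := by
        rw [e3 (lo hk) rfl, e4 (hi hk) rfl]; exact inn
      have := E.commute_wall hjk hj hk hJ (Or.inr (Or.inr (Or.inl c1))) (Or.inl c2)
      rwa [gright J j _ _ hJ c1, gin J k _ _ c2] at this
  refine ⟨fun i j h => (farA i j h).1, fun i j h => (farA i j h).2.1,
    fun i j h => (farA i j h).2.2.1, fun i j h => (farA i j h).2.2.2, ?_, ?_, ?_, ?_, ?_⟩ <;>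
    intro k hk
  · obtain ⟨J, hJ, e0, e1, e2⟩ := three k hk (-1, 1) (-2, 2) (-3, 3) (by norm_num) (by norm_num)
      (by norm_num)
    replace e0 := e0 ⟨k, by omega⟩ rfl
    replace e1 := e1 ⟨k + 1, by omega⟩ rfl
    replace e2 := e2 ⟨k + 2, by omega⟩ rfl
    have c1 : (J ⟨k + 1, by omega⟩).1 < (J ⟨k, by omega⟩).1 ∧
        (J ⟨k, by omega⟩).2 < (J ⟨k + 1, by omega⟩).2 := by rw [e0, e1]; norm_num
    have c2 : (J ⟨k + 2, by omega⟩).1 < (J ⟨k, by omega⟩).1 ∧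
        (J ⟨k, by omega⟩).2 < (J ⟨k + 2, by omega⟩).2 := by rw [e0, e2]; norm_num
    have c3 : (J ⟨k + 2, by omega⟩).1 < (J ⟨k + 1, by omega⟩).1 ∧
        (J ⟨k + 1, by omega⟩).2 < (J ⟨k + 2, by omega⟩).2 := by rw [e1, e2]; norm_num
    have := E.hexagon_wall hk hJ (Or.inl c1) (Or.inl c2) (Or.inl c3)
    rwa [gin J _ _ _ c1, gin J _ _ _ c1, gin J _ _ _ c2, gin J _ _ _ c2, gin J _ _ _ c3,
      gin J _ _ _ c3] at this
  · obtain ⟨J, hJ, e0, e1, e2⟩ := three k hk (4, 5) (2, 3) (0, 1) (by norm_num) (by norm_num)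
      (by norm_num)
    replace e0 := e0 ⟨k, by omega⟩ rfl
    replace e1 := e1 ⟨k + 1, by omega⟩ rfl
    replace e2 := e2 ⟨k + 2, by omega⟩ rfl
    have c1 : (J ⟨k + 1, by omega⟩).2 < (J ⟨k, by omega⟩).1 := by rw [e0, e1]; norm_num
    have c2 : (J ⟨k + 2, by omega⟩).2 < (J ⟨k, by omega⟩).1 := by rw [e0, e2]; norm_num
    have c3 : (J ⟨k + 2, by omega⟩).2 < (J ⟨k + 1, by omega⟩).1 := by rw [e1, e2]; norm_num
    have := E.hexagon_wall hk hJ (Or.inr (Or.inr (Or.inl c1))) (Or.inr (Or.inr (Or.inl c2)))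
      (Or.inr (Or.inr (Or.inl c3)))
    rwa [gright J _ _ _ hJ c1, gright J _ _ _ hJ c1, gright J _ _ _ hJ c2, gright J _ _ _ hJ c2,
      gright J _ _ _ hJ c3, gright J _ _ _ hJ c3] at this
  · obtain ⟨J, hJ, e0, e1, e2⟩ := three k hk (4, 5) (3, 6) (0, 1) (by norm_num) (by norm_num)
      (by norm_num)
    replace e0 := e0 ⟨k, by omega⟩ rfl
    replace e1 := e1 ⟨k + 1, by omega⟩ rfl
    replace e2 := e2 ⟨k + 2, by omega⟩ rfl
    have c1 : (J ⟨k + 1, by omega⟩).1 < (J ⟨k, by omega⟩).1 ∧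
        (J ⟨k, by omega⟩).2 < (J ⟨k + 1, by omega⟩).2 := by rw [e0, e1]; norm_num
    have c2 : (J ⟨k + 2, by omega⟩).2 < (J ⟨k, by omega⟩).1 := by rw [e0, e2]; norm_num
    have c3 : (J ⟨k + 2, by omega⟩).2 < (J ⟨k + 1, by omega⟩).1 := by rw [e1, e2]; norm_num
    have := E.hexagon_wall hk hJ (Or.inl c1) (Or.inr (Or.inr (Or.inl c2)))
      (Or.inr (Or.inr (Or.inl c3)))
    rwa [gin J _ _ _ c1, gin J _ _ _ c1, gright J _ _ _ hJ c2, gright J _ _ _ hJ c2,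
      gright J _ _ _ hJ c3, gright J _ _ _ hJ c3] at this
  · obtain ⟨J, hJ, e0, e1, e2⟩ := three k hk (4, 5) (1, 2) (0, 3) (by norm_num) (by norm_num)
      (by norm_num)
    replace e0 := e0 ⟨k, by omega⟩ rfl
    replace e1 := e1 ⟨k + 1, by omega⟩ rfl
    replace e2 := e2 ⟨k + 2, by omega⟩ rfl
    have c1 : (J ⟨k + 1, by omega⟩).2 < (J ⟨k, by omega⟩).1 := by rw [e0, e1]; norm_num
    have c2 : (J ⟨k + 2, by omega⟩).2 < (J ⟨k, by omega⟩).1 := by rw [e0, e2]; norm_num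
    have c3 : (J ⟨k + 2, by omega⟩).1 < (J ⟨k + 1, by omega⟩).1 ∧
        (J ⟨k + 1, by omega⟩).2 < (J ⟨k + 2, by omega⟩).2 := by rw [e1, e2]; norm_num
    have := E.hexagon_wall hk hJ (Or.inr (Or.inr (Or.inl c1))) (Or.inr (Or.inr (Or.inl c2)))
      (Or.inl c3)
    rwa [gright J _ _ _ hJ c1, gright J _ _ _ hJ c1, gright J _ _ _ hJ c2, gright J _ _ _ hJ c2,
      gin J _ _ _ c3, gin J _ _ _ c3] at this
  · obtain ⟨J, hJ, e0, e1, e2⟩ := three k hk (4, 5) (1, 2) (0, 6) (by norm_num) (by norm_num)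
      (by norm_num)
    replace e0 := e0 ⟨k, by omega⟩ rfl
    replace e1 := e1 ⟨k + 1, by omega⟩ rfl
    replace e2 := e2 ⟨k + 2, by omega⟩ rfl
    have c1 : (J ⟨k + 1, by omega⟩).2 < (J ⟨k, by omega⟩).1 := by rw [e0, e1]; norm_num
    have c2 : (J ⟨k + 2, by omega⟩).1 < (J ⟨k, by omega⟩).1 ∧
        (J ⟨k, by omega⟩).2 < (J ⟨k + 2, by omega⟩).2 := by rw [e0, e2]; norm_num
    have c3 : (J ⟨k + 2, by omega⟩).1 < (J ⟨k + 1, by omega⟩).1 ∧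
        (J ⟨k + 1, by omega⟩).2 < (J ⟨k + 2, by omega⟩).2 := by rw [e1, e2]; norm_num
    have := E.hexagon_wall hk hJ (Or.inr (Or.inr (Or.inl c1))) (Or.inl c2) (Or.inl c3)
    rwa [gright J _ _ _ hJ c1, gright J _ _ _ hJ c1, gin J _ _ _ c2, gin J _ _ _ c2,
      gin J _ _ _ c3, gin J _ _ _ c3] at this

end Evaluation

end Generators

section Turns

variable {n : ℕ} {Γ : Type*} [Group Γ]

/-- The family with the `i`-th wicket turned by the angle `π * v i`. -/
def turn (v : Fin n → ℝ) (X : Fin n → ℂ × ℂ) (i : Fin n) : ℂ × ℂ :=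
  ((X i).1, (X i).2 + v i * (Real.pi * Complex.I))

theorem turn_zero (X : Fin n → ℂ × ℂ) : turn 0 X = X := by
  funext i; simp [turn]

theorem turn_turn (v w : Fin n → ℝ) (X : Fin n → ℂ × ℂ) : turn v (turn w X) = turn (w + v) X := by
  funext i
  refine Prod.ext rfl ?_
  simp only [turn, Pi.add_apply, Complex.ofReal_add]
  ring

theorem continuous_turn : Continuous fun p : (Fin n → ℝ) × (Fin n → ℂ × ℂ) => turn p.1 p.2 := by
  unfold turn
  fun_prop

theorem norm_exp_turn (v : Fin n → ℝ) (X : Fin n → ℂ × ℂ) (i : Fin n) :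
    ‖Complex.exp (turn v X i).2‖ = ‖Complex.exp (X i).2‖ := by
  simp [turn, Complex.norm_exp]

theorem confToWConf_turn {v : Fin n → ℝ} {X : Fin n → ℂ × ℂ} (k : Fin n → ℤ) (hv : ∀ i, v i = k i)
    (hX : X ∈ Conf (Fin n)) (h : turn v X ∈ Conf (Fin n)) :
    confToWConf ⟨turn v X, h⟩ = confToWConf ⟨X, hX⟩ := by
  refine isQuotientCoveringMap_confToWConf.apply_eq_iff_mem_orbit.2
    ⟨⟨fun i => Multiplicative.ofAdd (k i), 1⟩, Subtype.ext (funext fun i => ?_)⟩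
  change ((⟨fun i => Multiplicative.ofAdd (k i), 1⟩ : Deck n) • (⟨X, hX⟩ : Conf (Fin n))).1 i = _
  rw [smul_conf_apply]
  simp [turn, hv]

/-- The radius of the wicket `x` is less than the distance of its centre to the feet of the other
wickets. -/
def Lone (x : Fin n) (X : Fin n → ℂ × ℂ) : Prop :=
  ∀ i, i ≠ x → ‖Complex.exp (X x).2‖ < ‖(X x).1 - ((X i).1 + Complex.exp (X i).2)‖ ∧
    ‖Complex.exp (X x).2‖ < ‖(X x).1 - ((X i).1 - Complex.exp (X i).2)‖

theorem Lone.wdisj {x i : Fin n} {X : Fin n → ℂ × ℂ} (h : Lone x X) (hi : i ≠ x) :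
    WDisj (X x).1 (Complex.exp (X x).2) (X i).1 (Complex.exp (X i).2) :=
  wdisj_of_lt (h i hi).1 (h i hi).2

theorem turn_single_of_ne {x i : Fin n} (h : i ≠ x) (θ : ℝ) (X : Fin n → ℂ × ℂ) :
    turn (Pi.single x θ) X i = X i := by
  simp [turn, h]

theorem Lone.turn {x : Fin n} {X : Fin n → ℂ × ℂ} (h : Lone x X) (θ : ℝ) :
    Lone x (turn (Pi.single x θ) X) := by
  intro i hi
  rw [norm_exp_turn, turn_single_of_ne hi]
  exact h i hi

theorem Lone.turn_mem {x : Fin n} {X : Fin n → ℂ × ℂ} (h : Lone x X) (hX : X ∈ Conf (Fin n))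
    (θ : ℝ) : _root_.turn (Pi.single x θ) X ∈ Conf (Fin n) := by
  intro i j hij
  rcases eq_or_ne i x with rfl | hi
  · exact (h.turn θ).wdisj hij.symm
  rcases eq_or_ne j x with rfl | hj
  · exact ((h.turn θ).wdisj hij).symm
  rw [turn_single_of_ne hi, turn_single_of_ne hj]
  exact hX i j hij

namespace Evaluation

variable (E : Evaluation n Γ)

/-- The path turning the wicket `x`. -/
def turnPath (x : Fin n) (X : Fin n → ℂ × ℂ) (hX : X ∈ Conf (Fin n)) (h : Lone x X) :
    C(ℝ, Conf (Fin n)) where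
  toFun θ := ⟨turn (Pi.single x θ) X, h.turn_mem hX θ⟩
  continuous_toFun := by
    refine Continuous.subtype_mk (continuous_turn.comp (Continuous.prodMk ?_ continuous_const)) _
    exact continuous_single (A := fun _ : Fin n => ℝ) x

open Classical in
/-- The value on the half turn of the wicket `x`. -/
def turnVal (x : Fin n) (X : Fin n → ℂ × ℂ) : Γ :=
  if h : X ∈ Conf (Fin n) ∧ Lone x X then E.val (turnPath x X h.1 h.2) 0 1 else 1

theorem turnVal_eq {x : Fin n} {X : Fin n → ℂ × ℂ} (hX : X ∈ Conf (Fin n)) (h : Lone x X) :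
    E.turnVal x X = E.val (turnPath x X hX h) 0 1 := dif_pos ⟨hX, h⟩

theorem turnVal_mul_val {A : Type*} [TopologicalSpace A] [ContractibleSpace A] {x : Fin n}
    (f : C(A, Conf (Fin n))) (hf : ∀ a, Lone x (f a).1) (a b : A) :
    E.turnVal x (f a).1 * E.val f a b = E.val f a b * E.turnVal x (f b).1 := by
  let F : C(A × ℝ, Conf (Fin n)) :=
    ⟨fun p => ⟨turn (Pi.single x p.2) (f p.1).1, (hf p.1).turn_mem (f p.1).2 p.2⟩, by
      refine Continuous.subtype_mk (continuous_turn.comp (Continuous.prodMk ?_ ?_)) _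
      · exact (continuous_single (A := fun _ : Fin n => ℝ) x).comp continuous_snd
      · exact continuous_subtype_val.comp (f.continuous.comp continuous_fst)⟩
  have h1 : ∀ c, E.turnVal x (f c).1 = E.val F (c, 0) (c, 1) := fun c => by
    rw [E.turnVal_eq (f c).2 (hf c)]
    exact E.val_transfer (f := turnPath x (f c).1 (f c).2 (hf c)) (g := F) (ContinuousMap.id ℝ)
      ⟨fun θ => (c, θ), by fun_prop⟩ (fun _ => rfl) 0 1
  have h2 : E.val f a b = E.val F (a, 0) (b, 0) := by
    refine E.val_transfer (f := f) (g := F) (ContinuousMap.id A)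
      ⟨fun c => (c, 0), by fun_prop⟩ (fun c => ?_) a b
    refine congrArg confToWConf (Subtype.ext ?_)
    change (f c).1 = turn (Pi.single x 0) (f c).1
    rw [Pi.single_zero, turn_zero]
  have h3 : E.val f a b = E.val F (a, 1) (b, 1) := by
    refine E.val_transfer (f := f) (g := F) (ContinuousMap.id A)
      ⟨fun c => (c, 1), by fun_prop⟩ (fun c => ?_) a b
    refine (confToWConf_turn (Pi.single x 1) (fun i => ?_) (f c).2 _).symm
    rcases eq_or_ne i x with rfl | h
    · simp
    · simp [h]
  rw [h1, h1, h3, E.val_mul, ← h3, h2, E.val_mul]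

theorem turnVal_congr {x y : Fin n} {X Y : Fin n → ℂ × ℂ} (hX : X ∈ Conf (Fin n)) (h : Lone x X)
    (hY : Y ∈ Conf (Fin n)) (h' : Lone y Y)
    (e : ∀ θ, confToWConf (turnPath x X hX h θ) = confToWConf (turnPath y Y hY h' θ)) :
    E.turnVal x X = E.turnVal y Y := by
  rw [E.turnVal_eq hX h, E.turnVal_eq hY h']
  exact E.val_transfer (ContinuousMap.id ℝ) (ContinuousMap.id ℝ) e 0 1

theorem turnVal_relabel {x : Fin n} {X : Fin n → ℂ × ℂ} (hX : X ∈ Conf (Fin n))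
    (π : Equiv.Perm (Fin n)) (h : Lone (π x) X) (hXπ : X ∘ π ∈ Conf (Fin n)) :
    E.turnVal x (X ∘ π) = E.turnVal (π x) X := by
  have h' : Lone x (X ∘ π) := fun i hi => h (π i) (π.injective.ne hi)
  refine E.turnVal_congr hXπ h' hX h fun θ => confToWConf_relabel _ _ π fun i => ?_
  change turn (Pi.single x θ) (X ∘ π) i = turn (Pi.single (π x) θ) X (π i)
  rcases eq_or_ne i x with rfl | hi
  · simp [turn]
  · simp [turn, hi]

/-- A criterion for the wicket over an interval to be far from the feet of the others. -/
theorem lone_of {u : Ivl n} (hu : ∀ i, u.a i < u.b i) {x : Fin n}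
    (h : ∀ i, i ≠ x → (u.b x - u.a x) / 2 < |u.y x - u.y i| ∨
      ((u.b x - u.a x) / 2 < |(u.a x + u.b x) / 2 - u.a i| ∧
      (u.b x - u.a x) / 2 < |(u.a x + u.b x) / 2 - u.b i|)) : Lone x (overIvl u) := by
  intro i hi
  rw [exp_overIvl (hu x), exp_overIvl (hu i), Complex.norm_real,
    Real.norm_of_nonneg (by linarith [hu x])]
  set z₁ := (overIvl u x).1 - ((overIvl u i).1 + (((u.b i - u.a i) / 2 : ℝ) : ℂ)) with hz₁
  set z₂ := (overIvl u x).1 - ((overIvl u i).1 - (((u.b i - u.a i) / 2 : ℝ) : ℂ)) with hz₂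
  have i1 : z₁.im = u.y x - u.y i := by
    rw [hz₁, Complex.sub_im, Complex.add_im, Complex.ofReal_im, add_zero]; rfl
  have i2 : z₂.im = u.y x - u.y i := by
    rw [hz₂, Complex.sub_im, Complex.sub_im, Complex.ofReal_im, sub_zero]; rfl
  have r1 : z₁.re = (u.a x + u.b x) / 2 - u.b i := by
    rw [hz₁, Complex.sub_re, Complex.add_re, Complex.ofReal_re]
    change (u.a x + u.b x) / 2 - ((u.a i + u.b i) / 2 + _) = _
    ring
  have r2 : z₂.re = (u.a x + u.b x) / 2 - u.a i := by
    rw [hz₂, Complex.sub_re, Complex.sub_re, Complex.ofReal_re]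
    change (u.a x + u.b x) / 2 - ((u.a i + u.b i) / 2 - _) = _
    ring
  rcases h i hi with h | ⟨h, h'⟩
  · exact ⟨(i1 ▸ h).trans_le (Complex.abs_im_le_norm _), (i2 ▸ h).trans_le (Complex.abs_im_le_norm _)⟩
  · exact ⟨(r1 ▸ h').trans_le (Complex.abs_re_le_norm _), (r2 ▸ h).trans_le (Complex.abs_re_le_norm _)⟩

theorem turnVal_mul_seg {x : Fin n} {u v : Ivl n} (hs : segment ℝ u v ⊆ IvlConf n)
    (hl : ∀ w ∈ segment ℝ u v, Lone x (overIvl w)) :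
    E.turnVal x (overIvl u) * E.seg u v = E.seg u v * E.turnVal x (overIvl v) := by
  have := simplyConnectedSpace_segment u v
  have := (convex_segment (𝕜 := ℝ) u v).contractibleSpace ⟨u, left_mem_segment ℝ u v⟩
  rw [E.seg_eq (convex_segment u v) hs (left_mem_segment ℝ u v) (right_mem_segment ℝ u v)]
  exact E.turnVal_mul_val (ivlOn _ hs) (fun w => hl w.1 w.2) ⟨u, left_mem_segment ℝ u v⟩
    ⟨v, right_mem_segment ℝ u v⟩

/-- The base configuration. -/
def baseConf : Fin n → ℂ × ℂ := overIvl (stack 1 short)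

theorem lone_stack {q : Equiv.Perm (Fin n)} {J : Fin n → ℝ × ℝ} (hJ : ∀ i, (J i).1 < (J i).2)
    {x : Fin n} (hx : ((J x).2 - (J x).1) / 2 < 1) : Lone x (overIvl (stack q J)) := by
  refine lone_of hJ fun i hi => Or.inl (hx.trans_le ?_)
  have h1 : ((q x : ℕ) : ℤ) - (q i : ℕ) ≠ 0 := by
    intro h
    exact hi (q.injective (Fin.ext (by omega))).symm
  have h2 : (1 : ℤ) ≤ |((q x : ℕ) : ℤ) - (q i : ℕ)| := Int.one_le_abs h1
  have h3 : ((1 : ℤ) : ℝ) ≤ ((|((q x : ℕ) : ℤ) - (q i : ℕ)| : ℤ) : ℝ) := Int.cast_le.2 h2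
  push_cast at h3
  exact h3

theorem short_radius (x : Fin n) : ((short x).2 - (short x).1) / 2 < 1 := by
  simp only [short]; norm_num

theorem turn_base_mem (v : Fin n → ℝ) : turn v (baseConf (n := n)) ∈ Conf (Fin n) := by
  have hm := stack_short_mem (n := n) (q := 1)
  have key : ∀ i j : Fin n, i ≠ j → ∀ z : ℂ, ‖z‖ = 1 / 20 →
      1 / 20 < ‖(baseConf i).1 - ((baseConf j).1 + z)‖ := by
    intro i j hij z hz
    have h1 : ((i : ℕ) : ℤ) - (j : ℕ) ≠ 0 := fun h => hij (Fin.ext (by omega))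
    have h2 : (1 : ℤ) ≤ |((i : ℕ) : ℤ) - (j : ℕ)| := Int.one_le_abs h1
    have h3 : ((1 : ℤ) : ℝ) ≤ ((|((i : ℕ) : ℤ) - (j : ℕ)| : ℤ) : ℝ) := Int.cast_le.2 h2
    have h4 : ((baseConf i).1 - (baseConf j).1).im = ((i : ℕ) : ℝ) - (j : ℕ) := rfl
    have h5 := Complex.abs_im_le_norm ((baseConf i).1 - (baseConf j).1)
    rw [h4] at h5
    push_cast at h3
    have h6 := norm_sub_norm_le ((baseConf i).1 - (baseConf j).1) z
    rw [sub_sub, hz] at h6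
    linarith
  have hr : ∀ i : Fin n, ‖Complex.exp (turn v baseConf i).2‖ = 1 / 20 := by
    intro i
    rw [norm_exp_turn, baseConf, exp_overIvl (hm.1 i), Complex.norm_real]
    change ‖((1 / 20 - -1 / 20) / 2 : ℝ)‖ = 1 / 20
    norm_num
  intro i j hij
  refine wdisj_of_lt ?_ ?_
  · rw [hr]
    exact key i j hij _ (hr j)
  · rw [hr, sub_eq_add_neg]
    exact key i j hij _ (by rw [norm_neg]; exact hr j)

theorem baseConf_mem : baseConf ∈ Conf (Fin n) := overIvl_mem stack_short_mem

/-- The configurations obtained by turning the wickets of the base configuration. -/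
def torus : C(Fin n → ℝ, Conf (Fin n)) where
  toFun v := ⟨turn v baseConf, turn_base_mem v⟩
  continuous_toFun :=
    Continuous.subtype_mk (continuous_turn.comp (Continuous.prodMk continuous_id continuous_const)) _

/-- The values on the turns of the base configuration. -/
def turnHom : (Fin n → Multiplicative ℤ) →* Γ where
  toFun k := E.val torus 0 (fun i => ((k i).toAdd : ℝ))
  map_one' := by
    have : (fun i : Fin n => (((1 : Fin n → Multiplicative ℤ) i).toAdd : ℝ)) = 0 := by
      funext i; simp
    rw [this]
    exact E.val_self _ _
  map_mul' k l := by
    have h : (fun i => (((k * l) i).toAdd : ℝ)) =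
        fun i => ((k i).toAdd : ℝ) + ((l i).toAdd : ℝ) := by
      funext i; simp
    rw [h, ← E.val_mul torus 0 (fun i => ((k i).toAdd : ℝ))]
    congr 1
    have := E.val_transfer (f := torus) (g := torus)
      ⟨fun v : Fin n → ℝ => (fun i => ((k i).toAdd : ℝ)) + v, by fun_prop⟩
      (ContinuousMap.id (Fin n → ℝ)) (fun v => ?_) 0 (fun i => ((l i).toAdd : ℝ))
    · simp only [ContinuousMap.coe_mk, add_zero, ContinuousMap.id_apply] at this
      exact this
    · have e : torus ((fun i => ((k i).toAdd : ℝ)) + v) =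
          ⟨turn (fun i => ((k i).toAdd : ℝ)) (turn v baseConf), by
            rw [turn_turn]; exact turn_base_mem _⟩ := by
        refine Subtype.ext ?_
        change turn _ baseConf = turn _ (turn v baseConf)
        rw [turn_turn, add_comm]
      change confToWConf (torus ((fun i => ((k i).toAdd : ℝ)) + v)) = confToWConf (torus v)
      rw [e]
      exact confToWConf_turn (fun i => (k i).toAdd) (fun i => rfl) _ _

/-- The value of the generator `τ`. -/
def tau (i : Fin n) : Γ := E.turnHom (Pi.mulSingle i (Multiplicative.ofAdd 1))

theorem tau_commute (i j : Fin n) : Commute (E.tau i) (E.tau j) := by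
  rw [Commute, SemiconjBy, tau, tau, ← map_mul, ← map_mul, mul_comm]

theorem tau_eq (x : Fin n) : E.tau x = E.turnVal x baseConf := by
  have hl : Lone x (baseConf (n := n)) := lone_stack short_lt (short_radius x)
  rw [E.turnVal_eq baseConf_mem hl]
  have h := E.val_transfer (f := torus) (g := turnPath x baseConf baseConf_mem hl)
    ⟨fun θ : ℝ => Pi.single x θ, continuous_single (A := fun _ : Fin n => ℝ) x⟩ (ContinuousMap.id ℝ) (fun _ => rfl) 0 1
  simp only [ContinuousMap.coe_mk, Pi.single_zero, ContinuousMap.id_apply] at h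
  rw [← h]
  change E.val torus 0 _ = _
  congr 1
  funext i
  rcases eq_or_ne i x with rfl | hi
  · simp
  · simp [hi]

theorem turnVal_stack (x : Fin n) (q : Equiv.Perm (Fin n)) :
    E.turnVal x (overIvl (stack q short)) = E.tau (q x) := by
  rw [tau_eq]
  have e : overIvl (stack q short) = baseConf ∘ q := rfl
  rw [e]
  refine E.turnVal_relabel baseConf_mem q (lone_stack short_lt (short_radius _)) ?_
  rw [← e]
  exact overIvl_mem stack_short_mem

theorem mem_segment_iff {u v w : Ivl n} : w ∈ segment ℝ u v ↔
    ∃ c d : ℝ, 0 ≤ c ∧ 0 ≤ d ∧ c + d = 1 ∧ c • u + d • v = w := Iff.rfl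

theorem segment_subset_chamber {s u v : Ivl n} (hu : u ∈ chamber s) (hv : v ∈ chamber s) :
    segment ℝ u v ⊆ chamber s := (convex_chamber s).segment_subset hu hv

variable {k : ℕ} {J : Fin n → ℝ × ℝ}

theorem one_le_abs_combo {c d : ℝ} {x i x' i' : ℕ} (hc : 0 ≤ c) (hd : 0 ≤ d) (hcd : c + d = 1)
    (h : (x < i ∧ x' < i') ∨ (i < x ∧ i' < x')) :
    1 ≤ |(c * x + d * x') - (c * i + d * i')| := by
  rcases h with ⟨h, h'⟩ | ⟨h, h'⟩
  · have h1 : (x : ℝ) + 1 ≤ i := by exact_mod_cast h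
    have h2 : (x' : ℝ) + 1 ≤ i' := by exact_mod_cast h'
    rw [abs_sub_comm]
    refine le_trans ?_ (le_abs_self _)
    nlinarith [mul_le_mul_of_nonneg_left h1 hc, mul_le_mul_of_nonneg_left h2 hd]
  · have h1 : (i : ℝ) + 1 ≤ x := by exact_mod_cast h
    have h2 : (i' : ℝ) + 1 ≤ x' := by exact_mod_cast h'
    refine le_trans ?_ (le_abs_self _)
    nlinarith [mul_le_mul_of_nonneg_left h1 hc, mul_le_mul_of_nonneg_left h2 hd]

theorem sw_val (hk : k + 1 < n) (i : Fin n) :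
    ((sw hk i : Fin n) : ℕ) = if (i : ℕ) = k then k + 1 else if (i : ℕ) = k + 1 then k else i := by
  rw [Equiv.swap_apply_def]
  simp only [Fin.ext_iff]
  split_ifs <;> rfl

theorem tau_mul_wall (hk : k + 1 < n) (hJ : ∀ i, (J i).1 < (J i).2)
    (hc : NonCrossing (fun i => (J i).1) (fun i => (J i).2) (lo hk) (hi hk)) {x : Fin n}
    (hx : (J x).2 - (J x).1 = 1 / 10)
    (hsep : ∀ i : Fin n, ((x : ℕ) = k ∧ (i : ℕ) = k + 1) ∨ ((x : ℕ) = k + 1 ∧ (i : ℕ) = k) →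
      1 / 20 < |((J x).1 + (J x).2) / 2 - (J i).1| ∧ 1 / 20 < |((J x).1 + (J x).2) / 2 - (J i).2|) :
    E.tau x * E.wall 1 (sw hk) J = E.wall 1 (sw hk) J * E.tau (sw hk x) := by
  have hm := two_mem (J := J) hk hJ hc
  have m1 := stack_mem_tie_self (q := 1) (monotone_tieTwo (n := n) (k := k)) (fun _ => rfl) hJ
  have m2 := stack_mem_tie_self (q := sw hk) (monotone_tieTwo (n := n) (k := k)) (tieTwo_sw hk) hJ
  have ms := fun q : Equiv.Perm (Fin n) => stack_mem_chamber_short (q := q) short_lt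
  have mJ := fun q : Equiv.Perm (Fin n) => stack_mem_chamber_short (q := q) (J := J) hJ
  have sub := fun q : Equiv.Perm (Fin n) => chamber_subset (stack_short_mem (q := q))
  have same : ∀ (q : Equiv.Perm (Fin n)) (J₁ J₂ : Fin n → ℝ × ℝ), (∀ i, (J₁ i).1 < (J₁ i).2) →
      (∀ i, (J₂ i).1 < (J₂ i).2) → ((J₁ x).2 - (J₁ x).1 = 1 / 10) →
      ((J₂ x).2 - (J₂ x).1 = 1 / 10) → ∀ w ∈ segment ℝ (stack q J₁) (stack q J₂),
      Lone x (overIvl w) := by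
    intro q J₁ J₂ h₁ h₂ r₁ r₂ w hw
    obtain ⟨c, d, h0, h0', hcd, rfl⟩ := mem_segment_iff.1 hw
    have e : c • stack q J₁ + d • stack q J₂ = stack q (c • J₁ + d • J₂) := by
      funext i
      refine Prod.ext ?_ rfl
      change c * ((q i : ℕ) : ℝ) + d * ((q i : ℕ) : ℝ) = ((q i : ℕ) : ℝ)
      rw [← add_mul, hcd, one_mul]
    rw [e]
    refine lone_stack (fun i => ?_) ?_
    · exact combo_lt_combo h0 h0' hcd (h₁ i) (h₂ i)
    · change ((c * (J₁ x).2 + d * (J₂ x).2) - (c * (J₁ x).1 + d * (J₂ x).1)) / 2 < 1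
      have : (c * (J₁ x).2 + d * (J₂ x).2) - (c * (J₁ x).1 + d * (J₂ x).1) = 1 / 10 := by
        linear_combination c * r₁ + d * r₂ + hcd / 10
      rw [this]
      norm_num
  have hs : (short x).2 - (short x).1 = 1 / 10 := by simp only [short]; norm_num
  have l1 := E.turnVal_mul_seg ((segment_subset_chamber (ms 1) (mJ 1)).trans (sub 1))
    (same 1 short J short_lt hJ hs hx)
  have l3 := E.turnVal_mul_seg ((segment_subset_chamber (mJ (sw hk)) (ms (sw hk))).trans (sub _))
    (same (sw hk) J short hJ short_lt hx hs)
  have l2 := E.turnVal_mul_seg (x := x) ((segment_subset_chamber m1 m2).trans (chamber_subset hm))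
    (by
      intro w hw
      have hw1 := (segment_subset_chamber m1 m2 hw).1
      obtain ⟨c, d, h0, h0', hcd, rfl⟩ := mem_segment_iff.1 hw
      have e : ∀ i, (c • stack 1 J + d • stack (sw hk) J) i =
          (c * ((i : ℕ) : ℝ) + d * ((sw hk i : ℕ) : ℝ), J i) := by
        intro i
        refine Prod.ext rfl ?_
        change c • J i + d • J i = J i
        rw [← add_smul, hcd, one_smul]
      refine lone_of hw1 fun i hi => ?_
      simp only [Ivl.a, Ivl.b, Ivl.y, e]
      rw [hx]
      by_cases hxi : ((x : ℕ) = k ∧ (i : ℕ) = k + 1) ∨ ((x : ℕ) = k + 1 ∧ (i : ℕ) = k)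
      · right
        have := hsep i hxi
        norm_num at this ⊢
        exact this
      · left
        refine lt_of_lt_of_le (by norm_num) (one_le_abs_combo h0 h0' hcd ?_)
        have hne : (i : ℕ) ≠ x := fun h => hi (Fin.ext h)
        rw [sw_val, sw_val]
        split_ifs <;> omega)
  rw [turnVal_stack] at l1 l3
  rw [wall]
  calc E.tau x * (E.seg (stack 1 short) (stack 1 J) * E.seg (stack 1 J) (stack (sw hk) J) *
        E.seg (stack (sw hk) J) (stack (sw hk) short))
      = (E.tau x * E.seg (stack 1 short) (stack 1 J)) * E.seg (stack 1 J) (stack (sw hk) J) *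
        E.seg (stack (sw hk) J) (stack (sw hk) short) := by simp only [mul_assoc]
    _ = E.seg (stack 1 short) (stack 1 J) * (E.turnVal x (overIvl (stack 1 J)) *
        E.seg (stack 1 J) (stack (sw hk) J)) * E.seg (stack (sw hk) J) (stack (sw hk) short) := by
        rw [show E.tau x = E.tau ((1 : Equiv.Perm (Fin n)) x) from rfl, l1]; simp only [mul_assoc]
    _ = E.seg (stack 1 short) (stack 1 J) * E.seg (stack 1 J) (stack (sw hk) J) *
        (E.turnVal x (overIvl (stack (sw hk) J)) *
          E.seg (stack (sw hk) J) (stack (sw hk) short)) := by rw [l2]; simp only [mul_assoc]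
    _ = _ := by rw [l3]; simp only [mul_assoc]

theorem rho_eq (hk : k + 1 < n) : E.rho k = E.wall 1 (sw hk) (ringIvl (hi hk)) := dif_pos hk

theorem sig_eq (hk : k + 1 < n) : E.sig k = E.wall 1 (sw hk) (sideIvl (lo hk)) := dif_pos hk

theorem ringIvl_of_ne {x y : Fin n} (h : x ≠ y) : ringIvl y x = (-1 / 20, 1 / 20) :=
  Function.update_of_ne h _ _

theorem sideIvl_of_ne {x y : Fin n} (h : y ≠ x) : sideIvl x y = (-1 / 20, 1 / 20) :=
  Function.update_of_ne h _ _

theorem ringIvl_self (y : Fin n) : ringIvl y y = (-1, 1) := Function.update_self _ _ _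

theorem sideIvl_self (x : Fin n) : sideIvl x x = (19 / 20, 21 / 20) := Function.update_self _ _ _

theorem tau_mul_rho (hk : k + 1 < n) {x : Fin n} (hx : x ≠ hi hk) :
    E.tau x * E.rho k = E.rho k * E.tau (sw hk x) := by
  rw [E.rho_eq hk]
  refine E.tau_mul_wall hk (ringIvl_lt _) (Or.inl ?_) ?_ fun i h => ?_
  · simp only [ringIvl_self, ringIvl_of_ne (lo_ne_hi hk)]; norm_num
  · rw [ringIvl_of_ne hx]; norm_num
  · rcases h with ⟨h1, h2⟩ | ⟨h1, h2⟩
    · obtain rfl : i = hi hk := Fin.ext h2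
      rw [ringIvl_self, ringIvl_of_ne hx]
      norm_num
    · exact absurd (Fin.ext h1) hx

theorem tau_mul_sig (hk : k + 1 < n) (x : Fin n) :
    E.tau x * E.sig k = E.sig k * E.tau (sw hk x) := by
  rw [E.sig_eq hk]
  refine E.tau_mul_wall hk (sideIvl_lt _) (Or.inr (Or.inr (Or.inl ?_))) ?_ fun i h => ?_
  · simp only [sideIvl_self, sideIvl_of_ne (lo_ne_hi hk).symm]; norm_num
  · rcases eq_or_ne x (lo hk) with rfl | h
    · rw [sideIvl_self]; norm_num
    · rw [sideIvl_of_ne h]; norm_num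
  · rcases h with ⟨h1, h2⟩ | ⟨h1, h2⟩
    · obtain rfl : x = lo hk := Fin.ext h1
      obtain rfl : i = hi hk := Fin.ext h2
      rw [sideIvl_self, sideIvl_of_ne (lo_ne_hi hk).symm]
      norm_num
    · obtain rfl : x = hi hk := Fin.ext h1
      obtain rfl : i = lo hk := Fin.ext h2
      rw [sideIvl_self, sideIvl_of_ne (lo_ne_hi hk).symm]
      norm_num

end Evaluation

end Turns

section Threading

variable {n : ℕ} {Γ : Type*} [Group Γ]

namespace Evaluation

variable (E : Evaluation n Γ) {k : ℕ} (hk : k + 1 < n)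

/-- A wicket of radius `1/4` and angle `α` at height `k + 1/2`, and a wicket of radius `1/40`
displaced from it by `z`. -/
def pair (z : ℂ) (α : ℝ) (i : Fin n) : ℂ × ℂ :=
  if i = lo hk then (⟨0, k + 1 / 2⟩ + z, (Real.log (1 / 40) : ℂ))
  else if i = hi hk then (⟨0, k + 1 / 2⟩, (Real.log (1 / 4) : ℂ) + α * Complex.I)
  else baseConf i

theorem pair_lo (z : ℂ) (α : ℝ) :
    pair hk z α (lo hk) = (⟨0, k + 1 / 2⟩ + z, (Real.log (1 / 40) : ℂ)) := if_pos rfl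

theorem pair_hi (z : ℂ) (α : ℝ) :
    pair hk z α (hi hk) = (⟨0, k + 1 / 2⟩, (Real.log (1 / 4) : ℂ) + α * Complex.I) := by
  rw [pair, if_neg (lo_ne_hi hk).symm, if_pos rfl]

theorem pair_of_ne (z : ℂ) (α : ℝ) {i : Fin n} (h : i ≠ lo hk) (h' : i ≠ hi hk) :
    pair hk z α i = baseConf i := by
  rw [pair, if_neg h, if_neg h']

/-- The displacements and angles for which the two wickets are disjoint. -/
def pairDom : Set (ℂ × ℝ) :=
  {p | |p.1.im| ≤ 1 / 2 ∧ 1 / 40 < ‖p.1 - Complex.exp (p.2 * Complex.I) / 4‖ ∧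
    1 / 40 < ‖p.1 + Complex.exp (p.2 * Complex.I) / 4‖}

theorem exp_ofReal_log {r : ℝ} (hr : 0 < r) : Complex.exp (Real.log r : ℂ) = r := by
  rw [← Complex.ofReal_exp, Real.exp_log hr]

theorem baseConf_foot_im (i : Fin n) : ((baseConf i).1 + Complex.exp (baseConf i).2).im = (i : ℕ) ∧
    ((baseConf i).1 - Complex.exp (baseConf i).2).im = (i : ℕ) := by
  rw [baseConf, exp_overIvl (stack_short_mem.1 i), Complex.add_im, Complex.sub_im,
    Complex.ofReal_im, add_zero, sub_zero]
  exact ⟨rfl, rfl⟩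

theorem one_le_abs_height {i : Fin n} (h : i ≠ lo hk) (h' : i ≠ hi hk) {y : ℝ} (hy : |y| ≤ 1 / 2) :
    1 ≤ |(k : ℝ) + 1 / 2 + y - (i : ℕ)| := by
  have h1 : (i : ℕ) ≠ k := fun e => h (Fin.ext e)
  have h2 : (i : ℕ) ≠ k + 1 := fun e => h' (Fin.ext e)
  obtain ⟨y1, y2⟩ := abs_le.1 hy
  rcases Nat.lt_or_ge i k with h3 | h3
  · have h4 : ((i : ℕ) : ℝ) + 1 ≤ k := by exact_mod_cast h3
    exact le_trans (by linarith) (le_abs_self _)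
  · have h4 : (k : ℝ) + 2 ≤ (i : ℕ) := by
      have : k + 2 ≤ (i : ℕ) := by omega
      exact_mod_cast this
    rw [abs_sub_comm]
    exact le_trans (by linarith) (le_abs_self _)

theorem pair_mem {z : ℂ} {α : ℝ} (h : (z, α) ∈ pairDom) : pair hk z α ∈ Conf (Fin n) := by
  obtain ⟨h0, h1, h2⟩ := h
  have e1 : Complex.exp (Real.log (1 / 40) : ℂ) = ((1 / 40 : ℝ) : ℂ) := exp_ofReal_log (by norm_num)
  have e2 : Complex.exp ((Real.log (1 / 4) : ℂ) + α * Complex.I) =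
      Complex.exp (α * Complex.I) / 4 := by
    rw [Complex.exp_add, exp_ofReal_log (by norm_num)]; push_cast; ring
  have n1 : ‖((1 / 40 : ℝ) : ℂ)‖ = 1 / 40 := by rw [Complex.norm_real]; norm_num
  have n2 : ‖Complex.exp (α * Complex.I) / 4‖ = 1 / 4 := by
    rw [norm_div, Complex.norm_exp_ofReal_mul_I]; norm_num
  have far : ∀ (c : ℂ) (r : ℝ), r < 1 → |c.im - (k + 1 / 2)| ≤ 1 / 2 → ∀ i, i ≠ lo hk →
      i ≠ hi hk → r < ‖c - ((baseConf i).1 + Complex.exp (baseConf i).2)‖ ∧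
        r < ‖c - ((baseConf i).1 - Complex.exp (baseConf i).2)‖ := by
    intro c r hr hc i hi1 hi2
    have hf := baseConf_foot_im i
    have := one_le_abs_height hk hi1 hi2 hc
    rw [add_sub_cancel] at this
    constructor
    · refine hr.trans_le (this.trans ?_)
      have := Complex.abs_im_le_norm (c - ((baseConf i).1 + Complex.exp (baseConf i).2))
      rwa [Complex.sub_im, hf.1] at this
    · refine hr.trans_le (this.trans ?_)
      have := Complex.abs_im_le_norm (c - ((baseConf i).1 - Complex.exp (baseConf i).2))
      rwa [Complex.sub_im, hf.2] at this
  have lohi : WDisj (pair hk z α (lo hk)).1 (Complex.exp (pair hk z α (lo hk)).2)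
      (pair hk z α (hi hk)).1 (Complex.exp (pair hk z α (hi hk)).2) := by
    rw [pair_lo, pair_hi, e1, e2]
    refine wdisj_of_lt ?_ ?_
    · rw [n1]; convert h1 using 2; ring
    · rw [n1]; convert h2 using 2; ring
  have loi : ∀ i, i ≠ lo hk → i ≠ hi hk → WDisj (pair hk z α (lo hk)).1
      (Complex.exp (pair hk z α (lo hk)).2) (pair hk z α i).1 (Complex.exp (pair hk z α i).2) := by
    intro i hi1 hi2
    rw [pair_lo, pair_of_ne hk z α hi1 hi2, e1]
    have := far (⟨0, k + 1 / 2⟩ + z) (1 / 40) (by norm_num) (by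
      rw [Complex.add_im, add_sub_cancel_left]; exact h0) i hi1 hi2
    exact wdisj_of_lt (by rw [n1]; exact this.1) (by rw [n1]; exact this.2)
  have hii : ∀ i, i ≠ lo hk → i ≠ hi hk → WDisj (pair hk z α (hi hk)).1
      (Complex.exp (pair hk z α (hi hk)).2) (pair hk z α i).1 (Complex.exp (pair hk z α i).2) := by
    intro i hi1 hi2
    rw [pair_hi, pair_of_ne hk z α hi1 hi2, e2]
    have := far ⟨0, k + 1 / 2⟩ (1 / 4) (by norm_num) (by simp) i hi1 hi2
    exact wdisj_of_lt (by rw [n2]; exact this.1) (by rw [n2]; exact this.2)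
  intro i j hij
  rcases eq_or_ne i (lo hk) with rfl | hi1
  · rcases eq_or_ne j (hi hk) with rfl | hj2
    · exact lohi
    · exact loi j hij.symm hj2
  rcases eq_or_ne i (hi hk) with rfl | hi2
  · rcases eq_or_ne j (lo hk) with rfl | hj1
    · exact lohi.symm
    · exact hii j hj1 hij.symm
  rcases eq_or_ne j (lo hk) with rfl | hj1
  · exact (loi i hi1 hi2).symm
  rcases eq_or_ne j (hi hk) with rfl | hj2
  · exact (hii i hi1 hi2).symm
  rw [pair_of_ne hk z α hi1 hi2, pair_of_ne hk z α hj1 hj2]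
  exact baseConf_mem i j hij

/-- The configurations containing the two wickets. -/
def pairConf : C(pairDom, Conf (Fin n)) where
  toFun p := ⟨pair hk p.1.1 p.1.2, pair_mem hk p.2⟩
  continuous_toFun := by
    refine Continuous.subtype_mk (continuous_pi fun i => ?_) _
    unfold pair
    split_ifs
    · fun_prop
    · fun_prop
    · fun_prop

theorem confToWConf_pair {z : ℂ} {α β : ℝ} (hβ : β = α + Real.pi) (h : (z, α) ∈ pairDom)
    (h' : (z, β) ∈ pairDom) :
    confToWConf (pairConf hk ⟨(z, β), h'⟩) = confToWConf (pairConf hk ⟨(z, α), h⟩) := by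
  have e : pair hk z β = turn (Pi.single (hi hk) 1) (pair hk z α) := by
    funext i
    rcases eq_or_ne i (hi hk) with rfl | h2
    · rw [pair_hi, turn, pair_hi, hβ, Pi.single_eq_same]
      refine Prod.ext rfl ?_
      simp only
      push_cast
      ring
    · rw [turn_single_of_ne h2]
      simp [pair, h2]
  have e' : pairConf hk ⟨(z, β), h'⟩ = ⟨turn (Pi.single (hi hk) 1) (pair hk z α), by
      rw [← e]; exact pair_mem hk h'⟩ := Subtype.ext e
  rw [e']
  refine confToWConf_turn (Pi.single (hi hk) 1) (fun i => ?_) _ _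
  rcases eq_or_ne i (hi hk) with rfl | h2
  · simp
  · simp [h2]

/-- The intervals under the two wickets when the angle is `0`. -/
def pairIvl (z : ℂ) (i : Fin n) : ℝ × ℝ × ℝ :=
  if i = lo hk then (k + 1 / 2 + z.im, z.re - 1 / 40, z.re + 1 / 40)
  else if i = hi hk then (k + 1 / 2, -1 / 4, 1 / 4) else stack 1 short i

theorem pairIvl_lo (z : ℂ) :
    pairIvl hk z (lo hk) = (k + 1 / 2 + z.im, z.re - 1 / 40, z.re + 1 / 40) := if_pos rfl

theorem pairIvl_hi (z : ℂ) : pairIvl hk z (hi hk) = ((k : ℝ) + 1 / 2, -1 / 4, 1 / 4) := by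
  rw [pairIvl, if_neg (lo_ne_hi hk).symm, if_pos rfl]

theorem pairIvl_of_ne (z : ℂ) {i : Fin n} (h : i ≠ lo hk) (h' : i ≠ hi hk) :
    pairIvl hk z i = (((i : ℕ) : ℝ), -1 / 20, 1 / 20) := by
  rw [pairIvl, if_neg h, if_neg h']
  rfl

theorem continuous_pairIvl : Continuous (pairIvl hk) := by
  refine continuous_pi fun i => ?_
  unfold pairIvl
  split_ifs
  · fun_prop
  · fun_prop
  · fun_prop

theorem overIvl_pairIvl (z : ℂ) : overIvl (pairIvl hk z) = pair hk z 0 := by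
  funext i
  rcases eq_or_ne i (lo hk) with rfl | h1
  · rw [pair_lo, overIvl]
    simp only [Ivl.a, Ivl.b, Ivl.y, pairIvl_lo]
    refine Prod.ext (Complex.ext ?_ ?_) ?_
    · simp
    · simp
    · simp only
      congr 2
      ring
  rcases eq_or_ne i (hi hk) with rfl | h2
  · rw [pair_hi, overIvl]
    simp only [Ivl.a, Ivl.b, Ivl.y, pairIvl_hi]
    refine Prod.ext (Complex.ext ?_ ?_) ?_
    · norm_num
    · simp
    · norm_num
  · rw [pair_of_ne hk z 0 h1 h2, baseConf, overIvl, overIvl]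
    have : pairIvl hk z i = stack 1 short i := by rw [pairIvl_of_ne hk z h1 h2]; rfl
    simp only [Ivl.a, Ivl.b, Ivl.y, this]

theorem pairIvl_lt (z : ℂ) (i : Fin n) : (pairIvl hk z i).2.1 < (pairIvl hk z i).2.2 := by
  unfold pairIvl
  split_ifs
  · simp only; linarith
  · norm_num
  · exact short_lt i

theorem pairIvl_y_lt {z : ℂ} (hz : |z.im| ≤ 1 / 2) {i j : Fin n}
    (h : tieTwo k i < tieTwo k j) : (pairIvl hk z i).1 < (pairIvl hk z j).1 := by
  obtain ⟨z1, z2⟩ := abs_le.1 hz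
  have hlow : ∀ i : Fin n, tieTwo k i < k → (pairIvl hk z i).1 = (i : ℕ) ∧ (i : ℕ) + 1 ≤ k := by
    intro i h'
    have h1 : (i : ℕ) + 1 ≤ k := by unfold tieTwo at h'; split_ifs at h' <;> omega
    refine ⟨?_, h1⟩
    rw [pairIvl_of_ne hk z (Fin.ne_of_val_ne ?_) (Fin.ne_of_val_ne ?_)] <;> simp only <;> omega
  have hhigh : ∀ i : Fin n, k < tieTwo k i → (pairIvl hk z i).1 = (i : ℕ) ∧ k + 2 ≤ (i : ℕ) := by
    intro i h'
    have h1 : k + 2 ≤ (i : ℕ) := by unfold tieTwo at h'; split_ifs at h' <;> omega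
    refine ⟨?_, h1⟩
    rw [pairIvl_of_ne hk z (Fin.ne_of_val_ne ?_) (Fin.ne_of_val_ne ?_)] <;> simp only <;> omega
  have hmid : ∀ i : Fin n, tieTwo k i = k →
      (k : ℝ) ≤ (pairIvl hk z i).1 ∧ (pairIvl hk z i).1 ≤ k + 1 := by
    intro i h'
    have h1 : (i : ℕ) = k ∨ (i : ℕ) = k + 1 := by
      unfold tieTwo at h'; split_ifs at h' <;> omega
    rcases h1 with h1 | h1
    · obtain rfl : i = lo hk := Fin.ext h1
      rw [pairIvl_lo]
      constructor <;> simp only <;> linarith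
    · obtain rfl : i = hi hk := Fin.ext h1
      rw [pairIvl_hi]
      constructor <;> simp only <;> linarith
  have hval : ∀ i : Fin n, tieTwo k i ≠ k → tieTwo k i = i := by
    intro i h'
    unfold tieTwo at h' ⊢
    split_ifs at h' ⊢ <;> omega
  rcases lt_trichotomy (tieTwo k i) k with a1 | a1 | a1 <;>
    rcases lt_trichotomy (tieTwo k j) k with b1 | b1 | b1
  · rw [(hlow i a1).1, (hlow j b1).1]
    rw [hval i a1.ne, hval j b1.ne] at h
    exact_mod_cast h
  · rw [(hlow i a1).1]
    have : ((i : ℕ) : ℝ) + 1 ≤ k := by exact_mod_cast (hlow i a1).2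
    linarith [(hmid j b1).1]
  · rw [(hlow i a1).1, (hhigh j b1).1]
    have := (hlow i a1).2
    have := (hhigh j b1).2
    have h' : (i : ℕ) < (j : ℕ) := by omega
    exact_mod_cast h'
  · omega
  · omega
  · rw [(hhigh j b1).1]
    have : (k : ℝ) + 2 ≤ (j : ℕ) := by exact_mod_cast (hhigh j b1).2
    linarith [(hmid i a1).2]
  · omega
  · omega
  · rw [(hhigh i a1).1, (hhigh j b1).1]
    rw [hval i a1.ne', hval j b1.ne'] at h
    exact_mod_cast h

theorem pairIvl_mem_short {z : ℂ} (hz : |z.im| ≤ 1 / 2) {q : Equiv.Perm (Fin n)}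
    (hq : ∀ i, tieTwo k (q i) = tieTwo k i) (h1 : q (lo hk) < q (hi hk) → z.im < 0)
    (h2 : q (hi hk) < q (lo hk) → 0 < z.im) : pairIvl hk z ∈ chamber (stack q short) := by
  refine mem_chamber_stack_short (pairIvl_lt hk z) fun i j hij => ?_
  have hle := monotone_tieTwo (k := k) hij.le
  rw [hq, hq] at hle
  rcases hle.lt_or_eq with h | h
  · exact pairIvl_y_lt hk hz h
  · have hne : i ≠ j := fun e => by rw [e] at hij; exact lt_irrefl _ hij
    rcases tieTwo_eq hne h with ⟨e1, e2⟩ | ⟨e1, e2⟩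
    · obtain rfl : i = lo hk := Fin.ext e1
      obtain rfl : j = hi hk := Fin.ext e2
      simp only [Ivl.y, pairIvl_lo, pairIvl_hi]
      linarith [h1 hij]
    · obtain rfl : i = hi hk := Fin.ext e1
      obtain rfl : j = lo hk := Fin.ext e2
      simp only [Ivl.y, pairIvl_lo, pairIvl_hi]
      linarith [h2 hij]

theorem pairIvl_mem_one {z : ℂ} (hz : |z.im| ≤ 1 / 2) (h : z.im < 0) :
    pairIvl hk z ∈ chamber (stack 1 short) := by
  refine pairIvl_mem_short hk hz (fun _ => rfl) (fun _ => h) fun h' => ?_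
  rw [Equiv.Perm.one_apply, Equiv.Perm.one_apply, Fin.lt_def] at h'
  simp at h'

theorem pairIvl_mem_sw {z : ℂ} (hz : |z.im| ≤ 1 / 2) (h : 0 < z.im) :
    pairIvl hk z ∈ chamber (stack (sw hk) short) := by
  refine pairIvl_mem_short hk hz (tieTwo_sw hk) (fun h' => ?_) fun _ => h
  rw [Equiv.swap_apply_left, Equiv.swap_apply_right, Fin.lt_def] at h'
  simp at h'

theorem pairIvl_mem_tie {z : ℂ} (hz : |z.im| ≤ 1 / 2) {J : Fin n → ℝ × ℝ}
    (hJ : ∀ i, (J i).1 < (J i).2)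
    (h1 : (J (hi hk)).1 < (J (lo hk)).1 → (J (lo hk)).2 < (J (hi hk)).2 →
      -1 / 4 < z.re - 1 / 40 ∧ z.re + 1 / 40 < 1 / 4)
    (h2 : (J (lo hk)).1 < (J (hi hk)).1 → (J (hi hk)).2 < (J (lo hk)).2 → False)
    (h3 : (J (hi hk)).2 < (J (lo hk)).1 → 1 / 4 < z.re - 1 / 40)
    (h4 : (J (lo hk)).2 < (J (hi hk)).1 → z.re + 1 / 40 < -1 / 4) :
    pairIvl hk z ∈ chamber (tie (tieTwo k) J) := by
  have cases : ∀ i j : Fin n, i ≠ j → (tie (tieTwo k) J).y i = (tie (tieTwo k) J).y j →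
      (i = lo hk ∧ j = hi hk) ∨ (i = hi hk ∧ j = lo hk) := by
    intro i j hij e
    rcases tieTwo_eq hij (tie_y_eq_iff.1 e) with ⟨e1, e2⟩ | ⟨e1, e2⟩
    · exact Or.inl ⟨Fin.ext e1, Fin.ext e2⟩
    · exact Or.inr ⟨Fin.ext e1, Fin.ext e2⟩
  refine ⟨pairIvl_lt hk z, fun i j h => pairIvl_y_lt hk hz (tie_y_lt_iff.1 h), ?_, ?_, ?_⟩
  · intro i j e e1 e2
    have hij : i ≠ j := fun hij => by rw [hij] at e1; exact lt_irrefl _ e1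
    rcases cases i j hij e with ⟨rfl, rfl⟩ | ⟨rfl, rfl⟩
    · simp only [Ivl.a, pairIvl_lo, pairIvl_hi]
      exact (h1 e1 e2).1
    · exact (h2 e1 e2).elim
  · intro i j e e1 e2
    have hij : i ≠ j := fun hij => by rw [hij] at e1; exact lt_irrefl _ e1
    rcases cases i j hij e with ⟨rfl, rfl⟩ | ⟨rfl, rfl⟩
    · simp only [Ivl.b, pairIvl_lo, pairIvl_hi]
      exact (h1 e1 e2).2
    · exact (h2 e1 e2).elim
  · intro i j e e1
    have hij : i ≠ j := fun hij => by
      rw [hij] at e1; exact lt_irrefl _ ((hJ j).trans e1)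
    rcases cases i j hij e with ⟨rfl, rfl⟩ | ⟨rfl, rfl⟩
    · simp only [Ivl.a, Ivl.b, pairIvl_lo, pairIvl_hi]
      exact h3 e1
    · simp only [Ivl.a, Ivl.b, pairIvl_lo, pairIvl_hi]
      exact h4 e1

theorem val_eq_seg {A B : Type*} [TopologicalSpace A] [SimplyConnectedSpace A] [TopologicalSpace B]
    [SimplyConnectedSpace B] {K : Set (Ivl n)} (hK : Convex ℝ K) (hs : K ⊆ IvlConf n)
    {f : C(A, Conf (Fin n))} (i : C(B, A)) (g : C(B, ℂ)) (hg : ∀ b, pairIvl hk (g b) ∈ K)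
    (h0 : ∀ b, (g b, 0) ∈ pairDom)
    (hf : ∀ b, confToWConf (f (i b)) = confToWConf (pairConf hk ⟨(g b, 0), h0 b⟩)) (b b' : B) :
    E.val f (i b) (i b') = E.seg (pairIvl hk (g b)) (pairIvl hk (g b')) := by
  have := simplyConnectedSpace_of_convex hK ⟨_, hg b⟩
  rw [E.seg_eq hK hs (hg b) (hg b')]
  refine E.val_transfer (g := ivlOn K hs) i
    ⟨fun c => ⟨pairIvl hk (g c), hg c⟩, ?_⟩ (fun c => ?_) b b'
  · exact Continuous.subtype_mk ((continuous_pairIvl hk).comp g.continuous) _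
  · rw [hf c]
    exact congrArg confToWConf (Subtype.ext (overIvl_pairIvl hk (g c)).symm)

theorem norm_expI (t : ℝ) (z : ℂ) : ‖Complex.exp (t * Complex.I) * z‖ = ‖z‖ := by
  rw [norm_mul, Complex.norm_exp_ofReal_mul_I, one_mul]

theorem mem_pairDom_of_norm {z : ℂ} {α : ℝ} (h : |z.im| ≤ 1 / 2) (hz : 1 / 2 ≤ ‖z‖) :
    (z, α) ∈ pairDom := by
  have n2 : ‖Complex.exp (α * Complex.I) / 4‖ = 1 / 4 := by
    rw [norm_div, Complex.norm_exp_ofReal_mul_I]; norm_num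
  refine ⟨h, ?_, ?_⟩
  · have := norm_sub_norm_le z (Complex.exp (α * Complex.I) / 4)
    simp only
    linarith
  · have := norm_sub_norm_le z (-(Complex.exp (α * Complex.I) / 4))
    rw [norm_neg, sub_neg_eq_add] at this
    simp only
    linarith

theorem mem_pairDom_thread {w : ℝ} (α : ℝ) (hw : |w| ≤ 1 / 2) :
    (Complex.exp (α * Complex.I) * (Complex.I * w), α) ∈ pairDom := by
  have hn : ∀ s : ℝ, 1 / 4 ≤ |s| → 1 / 40 < ‖Complex.I * w + s‖ := by
    intro s hs
    have h1 := Complex.abs_re_le_norm (Complex.I * w + s)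
    have h2 : (Complex.I * w + s).re = s := by simp
    rw [h2] at h1
    linarith
  refine ⟨?_, ?_, ?_⟩
  · refine (Complex.abs_im_le_norm _).trans ?_
    simp only
    rw [norm_expI, norm_mul, Complex.norm_I, one_mul, Complex.norm_real]
    exact hw
  · have e : Complex.exp (α * Complex.I) * (Complex.I * w) - Complex.exp (α * Complex.I) / 4 =
        Complex.exp (α * Complex.I) * (Complex.I * w + ((-1 / 4 : ℝ) : ℂ)) := by push_cast; ring
    simp only
    rw [e, norm_expI]
    exact hn _ (by norm_num [abs_of_neg])
  · have e : Complex.exp (α * Complex.I) * (Complex.I * w) + Complex.exp (α * Complex.I) / 4 =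
        Complex.exp (α * Complex.I) * (Complex.I * w + ((1 / 4 : ℝ) : ℂ)) := by push_cast; ring
    simp only
    rw [e, norm_expI]
    exact hn _ (by norm_num)

theorem mem_pairDom_circle {w : ℝ} (α β : ℝ) (hw : |w| = 1 / 2) :
    (Complex.exp (β * Complex.I) * (Complex.I * w), α) ∈ pairDom := by
  have hn : ‖Complex.exp (β * Complex.I) * (Complex.I * w)‖ = 1 / 2 := by
    rw [norm_expI, norm_mul, Complex.norm_I, one_mul, Complex.norm_real, Real.norm_eq_abs, hw]
  exact mem_pairDom_of_norm ((Complex.abs_im_le_norm _).trans hn.le) hn.ge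

/-- The displacements along a half circle, moved away from the centre by `s`. -/
def shifted (δ : ℝ) (p : ℝ × ℝ) : ℂ :=
  δ * (Complex.exp (p.1 * Complex.I) * (-Complex.I / 2) + p.2)

theorem shifted_re (δ : ℝ) (p : ℝ × ℝ) : (shifted δ p).re = δ * (Real.sin p.1 / 2 + p.2) := by
  rw [shifted, Complex.re_ofReal_mul, Complex.exp_mul_I]
  simp [Complex.cos_ofReal_re, Complex.sin_ofReal_re]
  ring_nf
  simp

theorem shifted_im (δ : ℝ) (p : ℝ × ℝ) : (shifted δ p).im = -(δ * Real.cos p.1 / 2) := by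
  rw [shifted, Complex.im_ofReal_mul, Complex.exp_mul_I]
  simp [Complex.cos_ofReal_re, Complex.sin_ofReal_re]
  ring

theorem shifted_im_le {δ : ℝ} (hδ : |δ| = 1) (p : ℝ × ℝ) : |(shifted δ p).im| ≤ 1 / 2 := by
  rw [shifted_im, abs_neg, abs_div, abs_mul, hδ, one_mul, abs_two]
  have := Real.abs_cos_le_one p.1
  linarith

theorem mem_pairDom_shifted {δ : ℝ} (hδ : |δ| = 1) {p : ℝ × ℝ}
    (hp : p ∈ Set.Icc 0 Real.pi ×ˢ Set.Icc (0 : ℝ) 1) : (shifted δ p, 0) ∈ pairDom := by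
  refine mem_pairDom_of_norm (shifted_im_le hδ p) ?_
  have h1 := Real.sin_nonneg_of_nonneg_of_le_pi hp.1.1 hp.1.2
  have hδ2 : δ ^ 2 = 1 := by rw [← sq_abs, hδ]; norm_num
  refine abs_le_of_sq_le_sq' ?_ (norm_nonneg _) |>.2
  rw [← Complex.normSq_eq_norm_sq, Complex.normSq_apply, shifted_re, shifted_im]
  have h2 := Real.sin_sq_add_cos_sq p.1
  have h3 := hp.2.1
  have e : δ * (Real.sin p.1 / 2 + p.2) * (δ * (Real.sin p.1 / 2 + p.2)) +
      -(δ * Real.cos p.1 / 2) * -(δ * Real.cos p.1 / 2) =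
      (Real.sin p.1 / 2 + p.2) ^ 2 + Real.cos p.1 ^ 2 / 4 := by
    linear_combination ((Real.sin p.1 / 2 + p.2) ^ 2 + Real.cos p.1 ^ 2 / 4) * hδ2
  rw [e]
  nlinarith [mul_nonneg h1 h3, sq_nonneg p.2]

/-- The intervals with the small wicket displaced vertically by `w`. -/
abbrev threadIvl (w : ℝ) : Ivl n := pairIvl hk (Complex.I * w)

theorem simplyConnectedSpace_Icc {a b : ℝ} (h : a ≤ b) : SimplyConnectedSpace (Set.Icc a b) :=
  simplyConnectedSpace_of_convex (convex_Icc a b) ⟨a, le_rfl, h⟩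

theorem val_half_circle {δ : ℝ} (hδ : |δ| = 1) {K₁ K₂ K₃ : Set (Ivl n)} (c₁ : Convex ℝ K₁)
    (c₂ : Convex ℝ K₂) (c₃ : Convex ℝ K₃) (s₁ : K₁ ⊆ IvlConf n) (s₂ : K₂ ⊆ IvlConf n)
    (s₃ : K₃ ⊆ IvlConf n) (h₁ : ∀ s ∈ Set.Icc (0 : ℝ) 1, pairIvl hk (shifted δ (0, s)) ∈ K₁)
    (h₂ : ∀ β ∈ Set.Icc 0 Real.pi, pairIvl hk (shifted δ (β, 1)) ∈ K₂)
    (h₃ : ∀ s ∈ Set.Icc (0 : ℝ) 1, pairIvl hk (shifted δ (Real.pi, s)) ∈ K₃)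
    {f : C(ℝ × ℝ, Conf (Fin n))}
    (hf : ∀ β (hβ : β ∈ Set.Icc 0 Real.pi), confToWConf (f (Real.pi, β)) =
      confToWConf (pairConf hk ⟨(shifted δ (β, 0), 0),
        mem_pairDom_shifted hδ ⟨hβ, le_rfl, zero_le_one⟩⟩)) :
    E.val f (Real.pi, 0) (Real.pi, Real.pi) =
      E.seg (pairIvl hk (shifted δ (0, 0))) (pairIvl hk (shifted δ (0, 1))) *
      E.seg (pairIvl hk (shifted δ (0, 1))) (pairIvl hk (shifted δ (Real.pi, 1))) *
      E.seg (pairIvl hk (shifted δ (Real.pi, 1))) (pairIvl hk (shifted δ (Real.pi, 0))) := by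
  let A : Set (ℝ × ℝ) := Set.Icc 0 Real.pi ×ˢ Set.Icc (0 : ℝ) 1
  have hpi := Real.pi_pos.le
  have z1 : (0 : ℝ) ∈ Set.Icc (0 : ℝ) 1 := by simp
  have o1 : (1 : ℝ) ∈ Set.Icc (0 : ℝ) 1 := by simp
  have z2 : (0 : ℝ) ∈ Set.Icc 0 Real.pi := ⟨le_rfl, hpi⟩
  have o2 : Real.pi ∈ Set.Icc 0 Real.pi := ⟨hpi, le_rfl⟩
  have := simplyConnectedSpace_of_convex
    ((convex_Icc 0 Real.pi).prod (convex_Icc (0 : ℝ) 1)) ⟨((0 : ℝ), (0 : ℝ)), z2, z1⟩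
  have i1 := simplyConnectedSpace_Icc (zero_le_one (α := ℝ))
  have i2 := simplyConnectedSpace_Icc hpi
  have hsc : ∀ (g : ℝ → ℝ × ℝ), Continuous g → Continuous fun t => shifted δ (g t) := by
    intro g hg
    unfold shifted
    fun_prop
  let F : C(A, Conf (Fin n)) := (pairConf hk).comp
    ⟨fun p => ⟨(shifted δ p.1, 0), mem_pairDom_shifted hδ p.2⟩, by
      unfold shifted
      fun_prop⟩
  have e0 : E.val f (Real.pi, 0) (Real.pi, Real.pi) =
      E.val F ⟨(0, 0), z2, z1⟩ ⟨(Real.pi, 0), o2, z1⟩ :=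
    E.val_transfer (B := Set.Icc 0 Real.pi) (f := f) (g := F)
      ⟨fun β => (Real.pi, β.1), by fun_prop⟩ ⟨fun β => ⟨(β.1, 0), β.2, z1⟩, by fun_prop⟩
      (fun β => hf β.1 β.2) ⟨0, z2⟩ ⟨Real.pi, o2⟩
  have e1 : E.val F ⟨(0, 0), z2, z1⟩ ⟨(0, 1), z2, o1⟩ =
      E.seg (pairIvl hk (shifted δ (0, 0))) (pairIvl hk (shifted δ (0, 1))) :=
    E.val_eq_seg hk (B := Set.Icc (0 : ℝ) 1) c₁ s₁ (f := F)
      ⟨fun s => ⟨(0, s.1), z2, s.2⟩, by fun_prop⟩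
      ⟨fun s => shifted δ (0, s.1), (hsc (fun s => (0, s)) (by fun_prop)).comp continuous_subtype_val⟩
      (fun s => h₁ s.1 s.2) (fun s => mem_pairDom_shifted hδ ⟨z2, s.2⟩) (fun s => rfl) ⟨0, z1⟩ ⟨1, o1⟩
  have e2 : E.val F ⟨(0, 1), z2, o1⟩ ⟨(Real.pi, 1), o2, o1⟩ =
      E.seg (pairIvl hk (shifted δ (0, 1))) (pairIvl hk (shifted δ (Real.pi, 1))) :=
    E.val_eq_seg hk (B := Set.Icc 0 Real.pi) c₂ s₂ (f := F)
      ⟨fun β => ⟨(β.1, 1), β.2, o1⟩, by fun_prop⟩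
      ⟨fun β => shifted δ (β.1, 1), (hsc (fun β => (β, 1)) (by fun_prop)).comp continuous_subtype_val⟩
      (fun β => h₂ β.1 β.2) (fun β => mem_pairDom_shifted hδ ⟨β.2, o1⟩) (fun β => rfl)
      ⟨0, z2⟩ ⟨Real.pi, o2⟩
  have e3 : E.val F ⟨(Real.pi, 1), o2, o1⟩ ⟨(Real.pi, 0), o2, z1⟩ =
      E.seg (pairIvl hk (shifted δ (Real.pi, 1))) (pairIvl hk (shifted δ (Real.pi, 0))) :=
    E.val_eq_seg hk (B := Set.Icc (0 : ℝ) 1) c₃ s₃ (f := F)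
      ⟨fun s => ⟨(Real.pi, s.1), o2, s.2⟩, by fun_prop⟩
      ⟨fun s => shifted δ (Real.pi, s.1),
        (hsc (fun s => (Real.pi, s)) (by fun_prop)).comp continuous_subtype_val⟩
      (fun s => h₃ s.1 s.2) (fun s => mem_pairDom_shifted hδ ⟨o2, s.2⟩) (fun s => rfl) ⟨1, o1⟩ ⟨0, z1⟩
  rw [e0, ← e1, ← e2, ← e3, E.val_mul, E.val_mul]

end Evaluation

end Threading

section Threading

variable {n : ℕ} {Γ : Type*} [Group Γ]

namespace Evaluation

variable (E : Evaluation n Γ) {k : ℕ} (hk : k + 1 < n)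

/-- The large wicket has angle `α` and the small wicket is at angle `β` on a circle. -/
def circleConf {w : ℝ} (hw : |w| = 1 / 2) : C(ℝ × ℝ, Conf (Fin n)) :=
  (pairConf hk).comp ⟨fun p => ⟨(Complex.exp (p.2 * Complex.I) * (Complex.I * w), p.1),
    mem_pairDom_circle p.1 p.2 hw⟩, by fun_prop⟩

/-- The angles of the large wicket and the positions of the small wicket on its axis. -/
def threadDom : Set (ℝ × ℝ) := Set.univ ×ˢ Set.Icc (-1 / 2) (1 / 2)

theorem abs_le_of_mem_threadDom {p : ℝ × ℝ} (hp : p ∈ threadDom) : |p.2| ≤ 1 / 2 :=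
  abs_le.2 ⟨by linarith [hp.2.1], hp.2.2⟩

theorem mem_threadDom {α w : ℝ} (hw : |w| ≤ 1 / 2) : (α, w) ∈ threadDom :=
  ⟨trivial, by linarith [(abs_le.1 hw).1], (abs_le.1 hw).2⟩

instance : SimplyConnectedSpace threadDom :=
  simplyConnectedSpace_of_convex (convex_univ.prod (convex_Icc _ _))
    ⟨(0, 0), mem_threadDom (by norm_num)⟩

/-- The large wicket has angle `α` and the small wicket is on its axis. -/
def threadConf : C(threadDom, Conf (Fin n)) :=
  (pairConf hk).comp ⟨fun p => ⟨(Complex.exp (p.1.1 * Complex.I) * (Complex.I * p.1.2), p.1.1),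
    mem_pairDom_thread p.1.1 (abs_le_of_mem_threadDom p.2)⟩, by fun_prop⟩

theorem threadIvl_y (w : ℝ) : (threadIvl hk w).y (lo hk) = k + 1 / 2 + w := by
  simp [threadIvl, Ivl.y, pairIvl_lo]

theorem threadIvl_mem_tie {w : ℝ} (hw : |w| ≤ 1 / 2) :
    threadIvl hk w ∈ chamber (tie (tieTwo k) (ringIvl (hi hk))) := by
  refine pairIvl_mem_tie hk (by simpa using hw) (ringIvl_lt _) ?_ ?_ ?_ ?_ <;>
    simp only [ringIvl_self, ringIvl_of_ne (lo_ne_hi hk)] <;> intros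
  · simp; norm_num
  · linarith
  · linarith
  · linarith

theorem ring_mem : tie (tieTwo k) (ringIvl (hi hk)) ∈ IvlConf n := by
  refine two_mem hk (ringIvl_lt _) (Or.inl ?_)
  simp only [ringIvl_self, ringIvl_of_ne (lo_ne_hi hk)]; norm_num

theorem threadIvl_mem_one : threadIvl hk (-1 / 2) ∈ chamber (stack 1 short) :=
  pairIvl_mem_one hk (by norm_num [abs_le]) (by norm_num)

theorem threadIvl_mem_sw : threadIvl hk (1 / 2) ∈ chamber (stack (sw hk) short) :=
  pairIvl_mem_sw hk (by norm_num [abs_le]) (by norm_num)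

theorem rho_eq_thread : E.seg (stack 1 short) (threadIvl hk (-1 / 2)) *
    E.seg (threadIvl hk (-1 / 2)) (threadIvl hk (1 / 2)) *
    E.seg (threadIvl hk (1 / 2)) (stack (sw hk) short) = E.rho k := by
  rw [E.rho_eq hk]
  exact E.wall_eq_of_between (ring_mem hk)
    (stack_mem_tie_self monotone_tieTwo (fun _ => rfl) (ringIvl_lt _))
    (stack_mem_tie_self monotone_tieTwo (tieTwo_sw hk) (ringIvl_lt _))
    (threadIvl_mem_tie hk (by norm_num [abs_le])) (threadIvl_mem_tie hk (by norm_num [abs_le]))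
    (threadIvl_mem_one hk) (threadIvl_mem_sw hk)

theorem val_thread_zero : E.val (threadConf hk) ⟨(0, -1 / 2), mem_threadDom (by norm_num [abs_le])⟩
      ⟨(0, 1 / 2), mem_threadDom (by norm_num [abs_le])⟩ =
    E.seg (threadIvl hk (-1 / 2)) (threadIvl hk (1 / 2)) := by
  have := simplyConnectedSpace_Icc (show (-1 / 2 : ℝ) ≤ 1 / 2 by norm_num)
  have hB : ∀ w : Set.Icc (-1 / 2 : ℝ) (1 / 2), |w.1| ≤ 1 / 2 := fun w =>
    abs_le.2 ⟨by linarith [w.2.1], w.2.2⟩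
  have h := E.val_eq_seg hk (B := Set.Icc (-1 / 2 : ℝ) (1 / 2)) (convex_chamber _)
    (chamber_subset (ring_mem hk)) (f := threadConf hk)
    ⟨fun w => ⟨(0, w.1), mem_threadDom (hB w)⟩, by fun_prop⟩
    ⟨fun w => Complex.I * w.1, by fun_prop⟩ (fun w => threadIvl_mem_tie hk (hB w))
    (fun w => by simpa using mem_pairDom_thread 0 (hB w))
    (fun w => congrArg confToWConf (by
      simp [threadConf])) ⟨-1 / 2, by norm_num⟩ ⟨1 / 2, by norm_num⟩
  exact h

theorem val_thread_pi : E.val (threadConf hk)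
      ⟨(Real.pi, -1 / 2), mem_threadDom (by norm_num [abs_le])⟩
      ⟨(Real.pi, 1 / 2), mem_threadDom (by norm_num [abs_le])⟩ =
    (E.seg (threadIvl hk (-1 / 2)) (threadIvl hk (1 / 2)))⁻¹ := by
  have := simplyConnectedSpace_Icc (show (-1 / 2 : ℝ) ≤ 1 / 2 by norm_num)
  have hB : ∀ w : Set.Icc (-1 / 2 : ℝ) (1 / 2), |w.1| ≤ 1 / 2 := fun w =>
    abs_le.2 ⟨by linarith [w.2.1], w.2.2⟩
  rw [← E.val_thread_zero hk, ← E.val_symm]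
  have h := E.val_transfer (B := Set.Icc (-1 / 2 : ℝ) (1 / 2)) (f := threadConf hk)
    (g := threadConf hk) ⟨fun w => ⟨(Real.pi, w.1), mem_threadDom (hB w)⟩, by fun_prop⟩
    ⟨fun w => ⟨(0, -w.1), mem_threadDom (by rw [abs_neg]; exact hB w)⟩, by fun_prop⟩
    (fun w => ?_) ⟨-1 / 2, by norm_num⟩ ⟨1 / 2, by norm_num⟩
  · simp only [ContinuousMap.coe_mk] at h
    convert h using 3 <;> norm_num
  · have e : threadConf hk ⟨(Real.pi, w.1), mem_threadDom (hB w)⟩ =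
        pairConf hk ⟨(Complex.I * (-w.1 : ℝ), Real.pi), by
          simpa [Complex.exp_pi_mul_I] using mem_pairDom_thread Real.pi (hB w)⟩ := by
      simp [threadConf, Complex.exp_pi_mul_I]
    have e' : threadConf hk ⟨(0, -w.1), mem_threadDom (by rw [abs_neg]; exact hB w)⟩ =
        pairConf hk ⟨(Complex.I * (-w.1 : ℝ), 0), by
          simpa using mem_pairDom_thread (w := -w.1) 0 (by rw [abs_neg]; exact hB w)⟩ := by
      simp [threadConf]
    exact (congrArg confToWConf e).trans
      ((confToWConf_pair hk (zero_add _).symm _ _).trans (congrArg confToWConf e').symm)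

theorem lone_threadIvl {w : ℝ} (hw : |w| = 1 / 2) : Lone (hi hk) (overIvl (threadIvl hk w)) := by
  refine lone_of (pairIvl_lt hk _) fun i hi1 => Or.inl ?_
  simp only [Ivl.a, Ivl.b, Ivl.y, pairIvl_hi]
  rcases eq_or_ne i (lo hk) with rfl | h1
  · rw [pairIvl_lo]
    simp only [Complex.mul_im, Complex.I_re, Complex.I_im, Complex.ofReal_re, Complex.ofReal_im]
    have : (k : ℝ) + 1 / 2 - (k + 1 / 2 + (0 * 0 + 1 * w)) = -w := by ring
    rw [this, abs_neg, hw]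
    norm_num
  · rw [pairIvl_of_ne hk _ h1 hi1]
    have := one_le_abs_height hk h1 hi1 (y := 0) (by norm_num)
    rw [add_zero] at this
    refine lt_of_lt_of_le ?_ this
    norm_num

theorem val_thread_edge {w : ℝ} (hw : |w| = 1 / 2) :
    E.val (threadConf hk) ⟨(0, w), mem_threadDom hw.le⟩ ⟨(Real.pi, w), mem_threadDom hw.le⟩ =
      E.turnVal (hi hk) (overIvl (threadIvl hk w)) *
        E.val (circleConf hk hw) (Real.pi, 0) (Real.pi, Real.pi) := by
  have h1 : E.val (threadConf hk) ⟨(0, w), mem_threadDom hw.le⟩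
      ⟨(Real.pi, w), mem_threadDom hw.le⟩ = E.val (circleConf hk hw) (0, 0) (Real.pi, Real.pi) :=
    E.val_transfer (B := ℝ) (f := threadConf hk) (g := circleConf hk hw)
      ⟨fun α => ⟨(α, w), mem_threadDom hw.le⟩, by fun_prop⟩ ⟨fun α => (α, α), by fun_prop⟩
      (fun α => rfl) 0 Real.pi
  have hm : overIvl (threadIvl hk w) ∈ Conf (Fin n) :=
    overIvl_mem (chamber_subset (ring_mem hk) (threadIvl_mem_tie hk hw.le))
  have h2 : E.turnVal (hi hk) (overIvl (threadIvl hk w)) =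
      E.val (circleConf hk hw) (0, 0) (Real.pi, 0) := by
    rw [E.turnVal_eq hm (lone_threadIvl hk hw)]
    have h := E.val_transfer (B := ℝ) (f := turnPath _ _ hm (lone_threadIvl hk hw))
      (g := circleConf hk hw) (ContinuousMap.id ℝ) ⟨fun θ => (Real.pi * θ, 0), by fun_prop⟩
      (fun θ => congrArg confToWConf (Subtype.ext (funext fun i => ?_))) 0 1
    · simpa using h
    · change turn (Pi.single (hi hk) θ) (overIvl (threadIvl hk w)) i =
        pair hk (Complex.exp ((0 : ℝ) * Complex.I) * (Complex.I * w)) (Real.pi * θ) i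
      rw [overIvl_pairIvl]
      rcases eq_or_ne i (hi hk) with rfl | h2
      · simp only [turn, pair_hi, Pi.single_eq_same]
        refine Prod.ext rfl ?_
        simp only
        push_cast
        ring
      · rw [turn_single_of_ne h2]
        simp [pair, h2]
  rw [h1, h2, E.val_mul]

theorem thread_square :
    E.seg (threadIvl hk (-1 / 2)) (threadIvl hk (1 / 2)) *
      (E.turnVal (hi hk) (overIvl (threadIvl hk (1 / 2))) *
        E.val (circleConf hk (w := 1 / 2) (by norm_num)) (Real.pi, 0) (Real.pi, Real.pi)) =
    E.turnVal (hi hk) (overIvl (threadIvl hk (-1 / 2))) *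
        E.val (circleConf hk (w := -1 / 2) (by norm_num [abs_of_neg])) (Real.pi, 0)
          (Real.pi, Real.pi) *
      (E.seg (threadIvl hk (-1 / 2)) (threadIvl hk (1 / 2)))⁻¹ := by
  rw [← E.val_thread_edge hk (by norm_num), ← E.val_thread_edge hk (by norm_num [abs_of_neg]),
    ← E.val_thread_pi hk, ← E.val_thread_zero hk, E.val_mul, E.val_mul]

theorem half_circle_eq_wall {w δ : ℝ} (hw : |w| = 1 / 2) (hδw : δ = -2 * w)
    {q q' : Equiv.Perm (Fin n)} {J : Fin n → ℝ × ℝ} (hJ : ∀ i, (J i).1 < (J i).2)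
    (hc : NonCrossing (fun i => (J i).1) (fun i => (J i).2) (lo hk) (hi hk))
    (hq : ∀ i, tieTwo k (q i) = tieTwo k i) (hq' : ∀ i, tieTwo k (q' i) = tieTwo k i)
    (h₁ : ∀ s ∈ Set.Icc (0 : ℝ) 1, pairIvl hk (shifted δ (0, s)) ∈ chamber (stack q short))
    (h₂ : ∀ β ∈ Set.Icc 0 Real.pi, pairIvl hk (shifted δ (β, 1)) ∈ chamber (tie (tieTwo k) J))
    (h₃ : ∀ s ∈ Set.Icc (0 : ℝ) 1, pairIvl hk (shifted δ (Real.pi, s)) ∈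
      chamber (stack q' short)) :
    E.seg (stack q short) (threadIvl hk w) *
      E.val (circleConf hk hw) (Real.pi, 0) (Real.pi, Real.pi) *
      E.seg (threadIvl hk (-w)) (stack q' short) = E.wall q q' J := by
  have hδ : |δ| = 1 := by rw [hδw, abs_mul, hw]; norm_num
  have hm := two_mem hk hJ hc
  have z : (0 : ℝ) ∈ Set.Icc (0 : ℝ) 1 := by simp
  have o : (1 : ℝ) ∈ Set.Icc (0 : ℝ) 1 := by simp
  have hs : ∀ β : ℝ, Complex.exp (β * Complex.I) * (Complex.I * w) = shifted δ (β, 0) := by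
    intro β
    rw [shifted, hδw]
    push_cast
    ring
  have e0 : threadIvl hk w = pairIvl hk (shifted δ (0, 0)) := by rw [← hs]; simp [threadIvl]
  have e1 : threadIvl hk (-w) = pairIvl hk (shifted δ (Real.pi, 0)) := by
    rw [← hs]; simp [threadIvl, Complex.exp_pi_mul_I]
  rw [E.val_half_circle hk hδ (convex_chamber _) (convex_chamber _) (convex_chamber _)
    (chamber_subset stack_short_mem) (chamber_subset hm) (chamber_subset stack_short_mem) h₁ h₂ h₃
    (f := circleConf hk hw) (fun β hβ => ?_), e0, e1]
  · rw [← E.wall_eq_of_between hm (stack_mem_tie_self monotone_tieTwo hq hJ)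
      (stack_mem_tie_self monotone_tieTwo hq' hJ) (h₂ 0 ⟨le_rfl, Real.pi_pos.le⟩)
      (h₂ Real.pi ⟨Real.pi_pos.le, le_rfl⟩) (h₁ 1 o) (h₃ 1 o),
      ← E.seg_mul_chamber stack_short_mem (stack_mem_chamber_short short_lt) (h₁ 0 z) (h₁ 1 o),
      ← E.seg_mul_chamber stack_short_mem (h₃ 1 o) (h₃ 0 z) (stack_mem_chamber_short short_lt)]
    simp only [mul_assoc]
  · have e : circleConf hk hw (Real.pi, β) = pairConf hk ⟨(shifted δ (β, 0), Real.pi), by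
        rw [← hs]; exact mem_pairDom_circle _ _ hw⟩ := by
      refine Subtype.ext ?_
      exact congrArg (fun z => pair hk z Real.pi) (hs β)
    rw [e]
    exact confToWConf_pair hk (zero_add _).symm _ _

theorem sig_eq_half_circle : E.seg (stack 1 short) (threadIvl hk (-1 / 2)) *
      E.val (circleConf hk (w := -1 / 2) (by norm_num [abs_of_neg])) (Real.pi, 0)
        (Real.pi, Real.pi) *
      E.seg (threadIvl hk (1 / 2)) (stack (sw hk) short) = E.sig k := by
  have hd : |(1 : ℝ)| = 1 := abs_one
  rw [E.sig_eq hk]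
  have h := E.half_circle_eq_wall hk (w := -1 / 2) (δ := 1) (by norm_num [abs_of_neg]) (by norm_num)
    (q := 1) (q' := sw hk) (sideIvl_lt (lo hk)) ?_ (fun _ => rfl) (tieTwo_sw hk)
    (fun s hs => ?_) (fun β hβ => ?_) (fun s hs => ?_)
  · rw [show -(-1 / 2 : ℝ) = 1 / 2 by norm_num] at h
    exact h
  · refine Or.inr (Or.inr (Or.inl ?_))
    simp only [sideIvl_self, sideIvl_of_ne (lo_ne_hi hk).symm]; norm_num
  · refine pairIvl_mem_one hk (shifted_im_le hd _) ?_
    rw [shifted_im]; norm_num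
  · have := Real.sin_nonneg_of_nonneg_of_le_pi hβ.1 hβ.2
    refine pairIvl_mem_tie hk (shifted_im_le hd _) (sideIvl_lt _) ?_ ?_ ?_ ?_ <;>
      simp only [sideIvl_self, sideIvl_of_ne (lo_ne_hi hk).symm, shifted_re] <;> intros <;> linarith
  · refine pairIvl_mem_sw hk (shifted_im_le hd _) ?_
    rw [shifted_im]; norm_num

theorem sig_eq_half_circle' : E.seg (stack (sw hk) short) (threadIvl hk (1 / 2)) *
      E.val (circleConf hk (w := 1 / 2) (by norm_num)) (Real.pi, 0) (Real.pi, Real.pi) *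
      E.seg (threadIvl hk (-1 / 2)) (stack 1 short) = E.sig k := by
  have hd : |(-1 : ℝ)| = 1 := by norm_num
  have hJ := sideIvl_lt (hi hk)
  have hleft : (sideIvl (hi hk) (lo hk)).2 < (sideIvl (hi hk) (hi hk)).1 := by
    simp only [sideIvl_self, sideIvl_of_ne (lo_ne_hi hk)]; norm_num
  have hc : NonCrossing (fun i => (sideIvl (hi hk) i).1) (fun i => (sideIvl (hi hk) i).2) (lo hk)
      (hi hk) := Or.inr (Or.inr (Or.inr hleft))
  have h := E.half_circle_eq_wall hk (w := 1 / 2) (δ := -1) (by norm_num) (by norm_num)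
    (q := sw hk) (q' := 1) hJ hc (tieTwo_sw hk) (fun _ => rfl)
    (fun s hs => ?_) (fun β hβ => ?_) (fun s hs => ?_)
  · rw [show -(1 / 2 : ℝ) = -1 / 2 by norm_num, E.wall_symm (two_mem hk hJ hc)
      (stack_mem_tie_self monotone_tieTwo (fun _ => rfl) hJ)
      (stack_mem_tie_self monotone_tieTwo (tieTwo_sw hk) hJ), E.wall_one_sw hk hJ hc,
      passGen_left (a := fun i => (sideIvl (hi hk) i).1) (b := fun i => (sideIvl (hi hk) i).2)
        (hJ _) (hJ _) hleft, inv_inv] at h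
    exact h
  · refine pairIvl_mem_sw hk (shifted_im_le hd _) ?_
    rw [shifted_im]; norm_num
  · have := Real.sin_nonneg_of_nonneg_of_le_pi hβ.1 hβ.2
    refine pairIvl_mem_tie hk (shifted_im_le hd _) (sideIvl_lt _) ?_ ?_ ?_ ?_ <;>
      simp only [sideIvl_self, sideIvl_of_ne (lo_ne_hi hk), shifted_re] <;> intros <;> linarith
  · refine pairIvl_mem_one hk (shifted_im_le hd _) ?_
    rw [shifted_im]; norm_num

theorem tau_mul_seg_threadIvl {w : ℝ} (hw : |w| = 1 / 2) {q : Equiv.Perm (Fin n)}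
    (hq : ∀ i, tieTwo k (q i) = tieTwo k i)
    (hy : ((q (lo hk) : ℕ) : ℝ) = k + 1 / 2 + w) (hy' : ((q (hi hk) : ℕ) : ℝ) = k + 1 / 2 - w)
    (hm : threadIvl hk w ∈ chamber (stack q short)) :
    E.tau (q (hi hk)) * E.seg (stack q short) (threadIvl hk w) =
      E.seg (stack q short) (threadIvl hk w) * E.turnVal (hi hk) (overIvl (threadIvl hk w)) := by
  rw [← E.turnVal_stack]
  have hms := stack_mem_chamber_short (q := q) short_lt
  have hsub := segment_subset_chamber hms hm
  refine E.turnVal_mul_seg (hsub.trans (chamber_subset stack_short_mem)) fun u hu => ?_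
  have hu1 := (hsub hu).1
  obtain ⟨c, d, h0, h0', hcd, rfl⟩ := mem_segment_iff.1 hu
  refine lone_of hu1 fun i hi1 => Or.inl ?_
  have eh : (c • stack q short + d • threadIvl hk w) (hi hk) =
      (c * ((q (hi hk) : ℕ) : ℝ) + d * (k + 1 / 2), c * (-1 / 20) + d * (-1 / 4),
        c * (1 / 20) + d * (1 / 4)) := by
    change c • stack q short (hi hk) + d • threadIvl hk w (hi hk) = _
    rw [threadIvl, pairIvl_hi]; rfl
  have hr : (c * (1 / 20) + d * (1 / 4) - (c * (-1 / 20) + d * (-1 / 4))) / 2 ≤ 1 / 4 := by linarith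
  rcases eq_or_ne i (lo hk) with rfl | h1
  · have el : (c • stack q short + d • threadIvl hk w).y (lo hk) =
        c * ((q (lo hk) : ℕ) : ℝ) + d * (k + 1 / 2 + w) := by
      change c * ((q (lo hk) : ℕ) : ℝ) + d * (threadIvl hk w).y (lo hk) = _
      rw [threadIvl_y]
    rw [el]
    simp only [Ivl.a, Ivl.b, Ivl.y, eh]
    have : c * ((q (hi hk) : ℕ) : ℝ) + d * (k + 1 / 2) -
        (c * ((q (lo hk) : ℕ) : ℝ) + d * (k + 1 / 2 + w)) = -(1 + c) * w := by
      rw [hy, hy']; linear_combination (-w) * hcd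
    rw [this, abs_mul, hw, abs_neg, abs_of_nonneg (by linarith)]
    linarith
  · have hqi : (q i : ℕ) = (i : ℕ) := by
      have h2 := hq i
      have hne1 : (i : ℕ) ≠ k := fun e => h1 (Fin.ext e)
      have hne2 : (i : ℕ) ≠ k + 1 := fun e => hi1 (Fin.ext e)
      unfold tieTwo at h2
      split_ifs at h2 <;> omega
    have el : (c • stack q short + d • threadIvl hk w).y i = ((i : ℕ) : ℝ) := by
      change c * ((q i : ℕ) : ℝ) + d * (threadIvl hk w).y i = _
      rw [threadIvl, Ivl.y, pairIvl_of_ne hk _ h1 hi1, hqi, ← add_mul, hcd, one_mul]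
    rw [el]
    simp only [Ivl.a, Ivl.b, Ivl.y, eh]
    have := one_le_abs_height hk h1 hi1 (y := -(c * w)) (by
      rw [abs_neg, abs_mul, hw, abs_of_nonneg h0]; linarith)
    have e : c * ((q (hi hk) : ℕ) : ℝ) + d * (k + 1 / 2) = k + 1 / 2 + -(c * w) := by
      rw [hy']; linear_combination ((k : ℝ) + 1 / 2) * hcd
    rw [e]
    linarith

/-- The relation obtained by turning a wicket while another one passes through it. -/
theorem rho_mul_tau_mul_sig :
    E.rho k * E.tau (lo hk) * E.sig k = E.tau (hi hk) * E.sig k * (E.rho k)⁻¹ := by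
  have t1 : E.tau (hi hk) * E.seg (stack 1 short) (threadIvl hk (-1 / 2)) = _ :=
    E.tau_mul_seg_threadIvl hk (w := -1 / 2) (by norm_num [abs_of_neg]) (q := 1) (fun _ => rfl)
      (by simp; ring) (by simp; ring) (threadIvl_mem_one hk)
  have t2 := E.tau_mul_seg_threadIvl hk (w := 1 / 2) (by norm_num) (q := sw hk) (tieTwo_sw hk)
      (by simp; ring) (by simp) (threadIvl_mem_sw hk)
  rw [Equiv.swap_apply_right] at t2
  have s1 := E.sig_eq_half_circle hk
  have s2 := E.sig_eq_half_circle' hk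
  have r := E.rho_eq_thread hk
  have sq := E.thread_square hk
  have ms := fun q : Equiv.Perm (Fin n) => stack_mem_chamber_short (q := q) short_lt
  rw [E.seg_symm_chamber stack_short_mem (ms _) (threadIvl_mem_sw hk)] at s1 r
  rw [E.seg_symm_chamber stack_short_mem (ms _) (threadIvl_mem_one hk)] at s2
  generalize E.seg (stack 1 short) (threadIvl hk (-1 / 2)) = c₁ at *
  generalize E.seg (stack (sw hk) short) (threadIvl hk (1 / 2)) = c₂ at *
  generalize E.seg (threadIvl hk (-1 / 2)) (threadIvl hk (1 / 2)) = A at *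
  generalize E.turnVal (hi hk) (overIvl (threadIvl hk (1 / 2))) = T₂ at *
  generalize E.turnVal (hi hk) (overIvl (threadIvl hk (-1 / 2))) = T₁ at *
  generalize E.val (circleConf hk (w := 1 / 2) _) (Real.pi, 0) (Real.pi, Real.pi) = H₂ at *
  generalize E.val (circleConf hk (w := -1 / 2) _) (Real.pi, 0) (Real.pi, Real.pi) = H₁ at *
  calc E.rho k * E.tau (lo hk) * E.sig k = c₁ * A * c₂⁻¹ * (E.tau (lo hk) * c₂) * H₂ * c₁⁻¹ := by
        rw [← r, ← s2]; group
    _ = c₁ * (A * (T₂ * H₂)) * c₁⁻¹ := by rw [t2]; group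
    _ = (c₁ * T₁) * H₁ * A⁻¹ * c₁⁻¹ := by rw [sq]; group
    _ = E.tau (hi hk) * E.sig k * (E.rho k)⁻¹ := by rw [← t1, ← r, ← s1]; group

end Evaluation

end Threading

section Ranks

open Evaluation

variable {n : ℕ} {l : List (Fin n)}

open Classical in
/-- The permutation taking each label to its position in the list. -/
def rank (l : List (Fin n)) : Equiv.Perm (Fin n) :=
  if h : l.Perm (List.finRange n) then
    ((finCongr (by rw [h.length_eq, List.length_finRange])).symm.trans
      (List.Nodup.getEquivOfForallMemList l (h.nodup_iff.2 (List.nodup_finRange n))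
        fun i => h.symm.subset (List.mem_finRange i))).symm
  else 1

theorem rank_val (h : l.Perm (List.finRange n)) (i : Fin n) : (rank l i : ℕ) = l.idxOf i := by
  rw [rank, dif_pos h]
  rfl

theorem rank_eq_of_pairwise {q : Equiv.Perm (Fin n)} (h : l.Perm (List.finRange n))
    (hq : l.Pairwise fun i j => q i < q j) : rank l = q := by
  have hnd : l.Nodup := h.nodup_iff.2 (List.nodup_finRange n)
  have hlt : ∀ i j, rank l i < rank l j → q i < q j := by
    intro i j hij
    rw [Fin.lt_def, rank_val h, rank_val h] at hij
    have hi := List.idxOf_lt_length_of_mem (h.symm.subset (List.mem_finRange i))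
    have hj := List.idxOf_lt_length_of_mem (h.symm.subset (List.mem_finRange j))
    have := List.pairwise_iff_getElem.1 hq _ _ hi hj hij
    simpa using this
  have hmono : StrictMono (q * (rank l)⁻¹) := by
    intro i j hij
    exact hlt _ _ (by simpa using hij)
  have : q * (rank l)⁻¹ = 1 := by
    have hs : ⇑(q * (rank l)⁻¹) = id :=
      (hmono.range_inj strictMono_id).1 (by simp)
    exact Equiv.ext fun i => congrFun hs i
  exact (mul_inv_eq_one.1 this).symm

theorem rank_lt_of_lt {y : Fin n → ℝ} (h : l.Perm (List.finRange n))
    (hl : l.Pairwise fun i j => y i ≤ y j) {i j : Fin n} (hij : y i < y j) :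
    rank l i < rank l j := by
  rw [Fin.lt_def, rank_val h, rank_val h]
  by_contra hc
  have hi := List.idxOf_lt_length_of_mem (h.symm.subset (List.mem_finRange i))
  have hj := List.idxOf_lt_length_of_mem (h.symm.subset (List.mem_finRange j))
  rcases (not_lt.1 hc).lt_or_eq with h' | h'
  · have := List.pairwise_iff_getElem.1 hl _ _ hj hi h'
    simp only [List.getElem_idxOf] at this
    linarith
  · have : j = i := (List.idxOf_inj (h.symm.subset (List.mem_finRange j))).1 h'
    rw [this] at hij
    exact lt_irrefl _ hij

theorem length_add_one_lt {u w : List (Fin n)} {a b : Fin n}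
    (h : (u ++ a :: b :: w).Perm (List.finRange n)) : u.length + 1 < n := by
  have := h.length_eq
  simp at this
  omega

theorem rank_swap {u w : List (Fin n)} {a b : Fin n}
    (h : (u ++ a :: b :: w).Perm (List.finRange n)) :
    rank (u ++ b :: a :: w) = sw (length_add_one_lt h) * rank (u ++ a :: b :: w) := by
  have h' : (u ++ b :: a :: w).Perm (List.finRange n) :=
    ((List.Perm.swap a b w).append_left u).trans h
  have hnd : (u ++ a :: b :: w).Nodup := h.nodup_iff.2 (List.nodup_finRange n)
  have hab : a ≠ b := by
    have := (List.nodup_append.1 hnd).2.1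
    simp at this
    exact fun e => this.1.1 e
  refine Equiv.ext fun x => Fin.ext ?_
  rw [Equiv.Perm.mul_apply, sw_val, rank_val h, rank_val h', List.idxOf_append, List.idxOf_append]
  by_cases hx : x ∈ u
  · have := List.idxOf_lt_length_of_mem hx
    rw [if_pos hx, if_pos hx]
    split_ifs <;> omega
  · rw [if_neg hx, if_neg hx]
    rcases eq_or_ne a x with rfl | hax
    · rw [List.idxOf_cons_self, List.idxOf_cons_ne _ hab.symm, List.idxOf_cons_self]
      split_ifs <;> omega
    rcases eq_or_ne b x with rfl | hbx
    · rw [List.idxOf_cons_self, List.idxOf_cons_ne _ hab, List.idxOf_cons_self]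
      split_ifs <;> omega
    · rw [List.idxOf_cons_ne _ hax, List.idxOf_cons_ne _ hbx, List.idxOf_cons_ne _ hax,
        List.idxOf_cons_ne _ hbx]
      split_ifs <;> omega

theorem rank_symm_lo {u w : List (Fin n)} {a b : Fin n}
    (h : (u ++ a :: b :: w).Perm (List.finRange n)) :
    (rank (u ++ a :: b :: w)).symm (lo (length_add_one_lt h)) = a := by
  have hnd : (u ++ a :: b :: w).Nodup := h.nodup_iff.2 (List.nodup_finRange n)
  have ha : a ∉ u := fun ha => (List.nodup_append.1 hnd).2.2 a ha a (by simp) rfl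
  rw [Equiv.symm_apply_eq]
  refine Fin.ext ?_
  rw [rank_val h, List.idxOf_append, if_neg ha]
  simp

theorem rank_symm_hi {u w : List (Fin n)} {a b : Fin n}
    (h : (u ++ a :: b :: w).Perm (List.finRange n)) :
    (rank (u ++ a :: b :: w)).symm (hi (length_add_one_lt h)) = b := by
  have hnd : (u ++ a :: b :: w).Nodup := h.nodup_iff.2 (List.nodup_finRange n)
  have hb : b ∉ u := fun hb => (List.nodup_append.1 hnd).2.2 b hb b (by simp) rfl
  have hab : a ≠ b := by
    have := (List.nodup_append.1 hnd).2.1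
    simp at this
    exact fun e => this.1.1 e
  rw [Equiv.symm_apply_eq]
  refine Fin.ext ?_
  rw [rank_val h, List.idxOf_append, if_neg hb]
  simp [hab]
  omega

theorem pairwise_swap {α : Type*} {R : α → α → Prop} {u w : List α} {a b : α}
    (h : (u ++ a :: b :: w).Pairwise R) (hba : R b a) : (u ++ b :: a :: w).Pairwise R := by
  simp only [List.pairwise_append, List.pairwise_cons, List.mem_cons, forall_eq_or_imp] at h ⊢
  obtain ⟨h1, ⟨⟨h2, h3⟩, h4, h5⟩, h6⟩ := h
  exact ⟨h1, ⟨⟨hba, h4⟩, h3, h5⟩, fun x hx => ⟨(h6 x hx).2.1, (h6 x hx).1, (h6 x hx).2.2⟩⟩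

end Ranks

section IntervalPaths

variable {n : ℕ} {Γ : Type*} [Group Γ]

namespace Evaluation

variable (E : Evaluation n Γ)

/-- The permutation ordering the labels by height. -/
abbrev pos (u : Ivl n) : Equiv.Perm (Fin n) := rank u.order

/-- The value on a path from a family of intervals to the stack with the same order. -/
def toStack (u : Ivl n) : Γ :=
  E.seg u (stack (pos u) fun i => (u i).2) *
    E.seg (stack (pos u) fun i => (u i).2) (stack (pos u) short)

theorem stack_rank_mem {s u : Ivl n} (hu : u ∈ chamber s) {l : List (Fin n)}
    (hl : l.Perm (List.finRange n)) (hp : l.Pairwise fun i j => s.y i ≤ s.y j) :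
    stack (rank l) (fun i => (u i).2) ∈ chamber s :=
  stack_mem_chamber hu fun _ _ h => rank_lt_of_lt hl hp h

theorem toStack_eq {s u : Ivl n} (hs : s ∈ IvlConf n) (hu : u ∈ chamber s) :
    E.toStack u = E.seg u (stack (pos u) fun i => (s i).2) *
      E.seg (stack (pos u) fun i => (s i).2) (stack (pos u) short) := by
  have h1 := stack_rank_mem hu u.order_perm (order_pairwise_of_mem hu)
  have h2 := stack_rank_mem (self_mem_chamber hs) u.order_perm (order_pairwise_of_mem hu)
  rw [toStack, ← E.seg_mul_chamber hs hu h2 h1, mul_assoc,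
    E.seg_mul_chamber stack_short_mem (stack_mem_chamber_short (J := fun i => (s i).2) h2.1)
      (stack_mem_chamber_short (J := fun i => (u i).2) h1.1) (stack_mem_chamber_short short_lt)]

/-- The value on a path from a stack to the intervals `s`. -/
def fromStack (s : Ivl n) (l : List (Fin n)) : Γ :=
  E.seg (stack (rank l) short) (stack (rank l) fun i => (s i).2) *
    E.seg (stack (rank l) fun i => (s i).2) s

theorem fromStack_mul_seg {s u : Ivl n} (hs : s ∈ IvlConf n) (hu : u ∈ chamber s) :
    E.fromStack s u.order * E.seg s u = (E.toStack u)⁻¹ := by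
  have h2 := stack_rank_mem (self_mem_chamber hs) u.order_perm (order_pairwise_of_mem hu)
  rw [E.toStack_eq hs hu, fromStack, mul_assoc, E.seg_mul_chamber hs h2 (self_mem_chamber hs) hu,
    mul_inv_rev, ← E.seg_symm_chamber hs hu h2, ← E.seg_symm_chamber stack_short_mem
      (stack_mem_chamber_short (J := fun i => (s i).2) h2.1) (stack_mem_chamber_short short_lt)]

theorem fromStack_swap {s : Ivl n} (hs : s ∈ IvlConf n) {u w : List (Fin n)} {a b : Fin n}
    (hp : (u ++ a :: b :: w).Perm (List.finRange n))
    (hR : (u ++ a :: b :: w).Pairwise fun i j => s.y i ≤ s.y j) (hba : s.y b ≤ s.y a) :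
    E.fromStack s (u ++ a :: b :: w) = passGen E.rho E.sig s.a s.b u.length a b *
      E.fromStack s (u ++ b :: a :: w) := by
  have hk := length_add_one_lt hp
  have hp' : (u ++ b :: a :: w).Perm (List.finRange n) :=
    ((List.Perm.swap a b w).append_left u).trans hp
  have hR2 := pairwise_swap hR hba
  have hnd : (u ++ a :: b :: w).Nodup := hp.nodup_iff.2 (List.nodup_finRange n)
  have hab : a ≠ b := by
    have := (List.nodup_append.1 hnd).2.1
    simp at this
    exact fun e => this.1.1 e
  have hy : s.y a = s.y b := le_antisymm (by
    have := (List.pairwise_append.1 hR).2.1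
    simp at this
    exact this.1.1) hba
  have m1 := stack_rank_mem (self_mem_chamber hs) hp hR
  have m2 := stack_rank_mem (self_mem_chamber hs) hp' hR2
  have hw := E.wall_sw (q := rank (u ++ a :: b :: w)) hk (J := fun i => (s i).2) hs.1 (by
    rw [rank_symm_lo hp, rank_symm_hi hp]
    exact hs.2 a b hab hy)
  rw [rank_symm_lo hp, rank_symm_hi hp, ← rank_swap hp] at hw
  have hw' : passGen E.rho E.sig s.a s.b u.length a b = _ := hw.symm
  rw [hw', wall, fromStack, fromStack, ← E.seg_mul_chamber hs m1 m2 (self_mem_chamber hs),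
    E.seg_symm_chamber stack_short_mem (stack_mem_chamber_short short_lt)
      (stack_mem_chamber_short (J := fun i => (s i).2) m2.1)]
  group

theorem seg_eq_reorder {s u v : Ivl n} (hs : s ∈ IvlConf n) (hu : u ∈ chamber s)
    (hv : v ∈ chamber s) : E.seg u v = E.toStack u *
      reorder (passGen E.rho E.sig s.a s.b) 0 u.order v.order * (E.toStack v)⁻¹ := by
  have h := eq_reorder_mul (A := passGen E.rho E.sig s.a s.b) (R := fun i j => s.y i ≤ s.y j)
    (f := E.fromStack s) (base := List.finRange n) (List.nodup_finRange n)
    (fun _ _ _ _ hp hR hba => E.fromStack_swap hs hp hR hba) [] (l := u.order) (l' := v.order)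
    u.order_perm (u.order_perm.trans v.order_perm.symm) (order_pairwise_of_mem hu)
    (order_pairwise_of_mem hv)
  simp only [List.nil_append, List.length_nil] at h
  have hu' := E.fromStack_mul_seg hs hu
  have hv' := E.fromStack_mul_seg hs hv
  rw [← E.seg_mul_chamber hs hu (self_mem_chamber hs) hv, ← hv',
    E.seg_symm_chamber hs (self_mem_chamber hs) hu, ← inv_inj.2 hu' |>.trans (inv_inv _), h]
  group

variable {H : Type*} [Group H] {ρ ς : ℕ → H}

theorem map_passGen (φ : H →* Γ) (hρ : ∀ k, φ (ρ k) = E.rho k) (hς : ∀ k, φ (ς k) = E.sig k)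
    (a b : Fin n → ℝ) (k : ℕ) (x y : Fin n) :
    φ (passGen ρ ς a b k x y) = passGen E.rho E.sig a b k x y := by
  unfold passGen
  split_ifs <;> simp [hρ, hς]

/-- The value on a path of intervals. -/
theorem map_ivlToConf (h : BraidRels ρ ς n) (φ : H →* Γ) (hρ : ∀ k, φ (ρ k) = E.rho k)
    (hς : ∀ k, φ (ς k) = E.sig k) {x y : IvlConf n} (γ : Path x y) :
    E.map (γ.map ivlToConf.continuous) =
      E.toStack x.1 * φ (ivlWord h γ) * (E.toStack y.1)⁻¹ := by
  refine path_induction (P := fun {x y} γ => E.map (γ.map ivlToConf.continuous) =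
      E.toStack x.1 * φ (ivlWord h γ) * (E.toStack y.1)⁻¹) isOpen_ivlChamber
    (fun s => ⟨s, self_mem_chamber s.2⟩) ?_ ?_ ?_ γ
  · intro x y γ s hγ
    have hx : x.1 ∈ chamber s.1 := by simpa using hγ 0
    have hy : y.1 ∈ chamber s.1 := by simpa using hγ 1
    rw [E.map_eq_seg (convex_chamber s.1) (chamber_subset s.2) γ hγ, E.seg_eq_reorder s.2 hx hy,
      ivlWord, (ivlHolonomy h).total_map _ _ γ s hγ]
    congr 2
    change _ = φ (reorder (passGen ρ ς s.1.a s.1.b) 0 x.1.order y.1.order)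
    rw [map_reorder]
    simp only [E.map_passGen φ hρ hς]
  · intro x y z γ γ' h1 h2
    rw [Path.map_trans, E.map_trans, h1, h2, ivlWord, ivlWord, ivlWord,
      (ivlHolonomy h).total_trans, map_mul]
    group
  · intro x y γ γ' hγ h1
    rw [← E.map_homotopic (hγ.map ivlToConf), h1, ivlWord, ivlWord,
      (ivlHolonomy h).total_homotopic _ _ hγ]

theorem order_stack (q : Equiv.Perm (Fin n)) (J : Fin n → ℝ × ℝ) :
    (stack q J).order = (List.finRange n).map q.symm := by
  refine Ivl.order_eq ?_ ?_
  · refine (List.perm_ext_iff_of_nodup ((List.nodup_finRange n).map q.symm.injective)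
      (List.nodup_finRange n)).2 fun i => ?_
    simp only [List.mem_map, List.mem_finRange, true_and, iff_true]
    exact ⟨q i, by simp⟩
  · rw [List.pairwise_map]
    refine (List.pairwise_lt_finRange n).imp fun {i j} h => ?_
    rw [stack_y_lt_iff]
    simpa using h

theorem pos_stack (q : Equiv.Perm (Fin n)) (J : Fin n → ℝ × ℝ) : pos (stack q J) = q := by
  refine rank_eq_of_pairwise (Ivl.order_perm _) ?_
  rw [order_stack, List.pairwise_map]
  refine (List.pairwise_lt_finRange n).imp fun {i j} h => ?_
  simpa using h

theorem toStack_stack (q : Equiv.Perm (Fin n)) : E.toStack (stack q short) = 1 := by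
  rw [toStack, pos_stack]
  have m := stack_mem_chamber_short (q := q) short_lt
  have h := E.seg_mul_chamber stack_short_mem m m m
  rw [mul_eq_left] at h
  exact (congrArg₂ (· * ·) h h).trans (one_mul 1)

end Evaluation

end IntervalPaths

section Presentation

open Evaluation

variable {n : ℕ} {H : Type*} [Group H]

/-- A minimal list of relations defining the wicket group. -/
structure WicketRels (ρ ς : ℕ → H) (τ : Fin n → H) : Prop where
  braid : BraidRels ρ ς n
  τ_commute : ∀ i j, Commute (τ i) (τ j)
  τ_ς : ∀ {k} (hk : k + 1 < n) (x : Fin n), τ x * ς k = ς k * τ (sw hk x)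
  τ_ρ : ∀ {k} (hk : k + 1 < n) {x : Fin n}, x ≠ hi hk → τ x * ρ k = ρ k * τ (sw hk x)
  ρ_τ_ς : ∀ {k} (hk : k + 1 < n), ρ k * τ (lo hk) * ς k = τ (hi hk) * ς k * (ρ k)⁻¹

theorem Evaluation.wicketRels {Γ : Type*} [Group Γ] (E : Evaluation n Γ) :
    WicketRels E.rho E.sig E.tau :=
  ⟨E.braidRels, E.tau_commute, E.tau_mul_sig, E.tau_mul_rho, E.rho_mul_tau_mul_sig⟩

namespace WicketRels

variable {ρ ς : ℕ → H} {τ : Fin n → H} {k : ℕ} (hk : k + 1 < n)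

theorem semiconj_ς (h : WicketRels ρ ς τ) (x : Fin n) (ε η : ℤ) (hη : η = 1 ∨ η = -1) :
    τ x ^ ε * ς k ^ η = ς k ^ η * τ (sw hk x) ^ ε := by
  have h1 : ∀ x, SemiconjBy (ς k) (τ (sw hk x)) (τ x) := fun x => (h.τ_ς hk x).symm
  have h2 : SemiconjBy (ς k)⁻¹ (τ (sw hk x)) (τ x) := by
    have := (h1 (sw hk x)).inv_symm_left
    rwa [Equiv.swap_apply_self] at this
  rcases hη with rfl | rfl
  · rw [zpow_one]; exact ((h1 x).zpow_right ε).eq.symm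
  · rw [zpow_neg_one]; exact (h2.zpow_right ε).eq.symm

theorem semiconj_ρ (h : WicketRels ρ ς τ) {x : Fin n} (hx : x ≠ hi hk) (ε : ℤ) :
    τ x ^ ε * ρ k = ρ k * τ (sw hk x) ^ ε :=
  ((show SemiconjBy (ρ k) (τ (sw hk x)) (τ x) from (h.τ_ρ hk hx).symm).zpow_right ε).eq.symm

theorem semiconj_ρ_inv (h : WicketRels ρ ς τ) {x : Fin n} (hx : x ≠ lo hk) (ε : ℤ) :
    τ x ^ ε * (ρ k)⁻¹ = (ρ k)⁻¹ * τ (sw hk x) ^ ε := by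
  have h1 : sw hk x ≠ hi hk := fun e => hx (by
    rw [← Equiv.swap_apply_self (lo hk) (hi hk) x, e, Equiv.swap_apply_right])
  have := h.semiconj_ρ hk h1 ε
  rw [Equiv.swap_apply_self] at this
  rw [eq_inv_mul_iff_mul_eq, ← mul_assoc, ← this, mul_inv_cancel_right]

theorem τ_hi_ρ (h : WicketRels ρ ς τ) (ε : ℤ) (hε : ε = 1 ∨ ε = -1) :
    τ (hi hk) ^ ε * ρ k = ς k ^ (-ε) * (ρ k)⁻¹ * ς k ^ ε * τ (lo hk) ^ ε := by
  have h1 := h.ρ_τ_ς hk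
  have h2 := h.τ_ς hk (lo hk)
  have h3 := h.τ_ς hk (hi hk)
  rw [Equiv.swap_apply_left] at h2
  rw [Equiv.swap_apply_right] at h3
  generalize τ (lo hk) = a at *
  generalize τ (hi hk) = b at *
  rcases hε with rfl | rfl
  · rw [zpow_one, zpow_neg_one, zpow_one, zpow_one]
    calc b * ρ k = (ς k)⁻¹ * (ρ k)⁻¹ * (ρ k * (ς k * b)) * ρ k := by group
      _ = (ς k)⁻¹ * (ρ k)⁻¹ * (b * ς k * (ρ k)⁻¹) * ρ k := by rw [← h2, ← h1]; group
      _ = _ := by rw [h3]; group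
  · rw [neg_neg, zpow_one, zpow_neg_one, zpow_neg_one, zpow_neg_one]
    calc b⁻¹ * ρ k = b⁻¹ * (ρ k * a * ς k) * (ς k)⁻¹ * a⁻¹ := by group
      _ = _ := by rw [h1]; group

theorem τ_lo_ρ_inv (h : WicketRels ρ ς τ) (ε : ℤ) (hε : ε = 1 ∨ ε = -1) :
    τ (lo hk) ^ ε * (ρ k)⁻¹ = ς k ^ (-ε) * ρ k * ς k ^ ε * τ (hi hk) ^ ε := by
  have h1 := h.τ_hi_ρ hk ε hε
  calc τ (lo hk) ^ ε * (ρ k)⁻¹ = ς k ^ (-ε) * ρ k * ς k ^ ε *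
        (ς k ^ (-ε) * (ρ k)⁻¹ * ς k ^ ε * τ (lo hk) ^ ε) * (ρ k)⁻¹ := by group
    _ = _ := by rw [← h1]; group

/-- The images of the generators. -/
def genMap (ρ ς : ℕ → H) (τ : Fin n → H) : WGen n → H :=
  Sum.elim (fun i => ρ i) (Sum.elim (fun i => ς i) τ)

theorem lift_eq_one (h : WicketRels ρ ς τ) : ∀ r ∈ wickRels n,
    FreeGroup.lift (genMap ρ ς τ) r = 1 := by
  have lρ : ∀ i : Fin (n - 1), FreeGroup.lift (genMap ρ ς τ) (wρ i) = ρ i :=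
    fun i => FreeGroup.lift_apply_of
  have lς : ∀ i : Fin (n - 1), FreeGroup.lift (genMap ρ ς τ) (wσ i) = ς i :=
    fun i => FreeGroup.lift_apply_of
  have lτ : ∀ i : Fin n, FreeGroup.lift (genMap ρ ς τ) (wτ i) = τ i :=
    fun i => FreeGroup.lift_apply_of
  intro r hr
  simp only [wickRels, Set.mem_union, Set.mem_iUnion, Set.mem_insert_iff, Set.mem_singleton_iff,
    exists_prop] at hr
  rcases hr with ((((⟨i, j, hij, hr⟩ | ⟨i, j, hij, hr⟩) | ⟨i, j, hij, hr⟩) | ⟨i, j, hij, hr⟩) |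
    ⟨i, j, j', hj, hj', ε, hε, η, hη, hr⟩) | ⟨i, j, j', hj, hj', ε, hε, hr⟩
  · have c1 : Commute (ρ i) (ρ j) := hij.elim (h.braid.ρρ_far _ _)
      fun e => (h.braid.ρρ_far _ _ e).symm
    have c2 : Commute (ς i) (ς j) := hij.elim (h.braid.ςς_far _ _)
      fun e => (h.braid.ςς_far _ _ e).symm
    have c3 : Commute (ρ i) (ς j) := hij.elim (h.braid.ρς_far _ _)
      fun e => (h.braid.ςρ_far _ _ e).symm
    rcases hr with rfl | rfl | rfl <;>
      simp only [map_mul, map_inv, lρ, lς] <;> rw [mul_inv_eq_one]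
    exacts [c1, c2, c3]
  · have hi2 : (i : ℕ) + 2 < n := by have := j.2; omega
    rcases hr with rfl | rfl | rfl | rfl | rfl <;>
      simp only [map_mul, map_inv, lρ, lς, hij] <;> rw [mul_inv_eq_one]
    exacts [h.braid.ρρρ _ hi2, h.braid.ςςς _ hi2, h.braid.ρςς _ hi2, h.braid.ςςρ _ hi2,
      h.braid.ςρρ _ hi2]
  · subst hr
    simp only [map_mul, map_inv, lτ]
    rw [mul_inv_eq_one]
    exact h.τ_commute i j
  · have hk : (i : ℕ) + 1 < n := by have := i.2; omega
    have hl : j ≠ lo hk := fun e => hij.1 (congrArg Fin.val e)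
    have hh : j ≠ hi hk := fun e => hij.2 (congrArg Fin.val e)
    have e := Equiv.swap_apply_of_ne_of_ne hl hh
    have c1 := h.τ_ρ hk hh
    have c2 := h.τ_ς hk j
    rw [e] at c1 c2
    rcases hr with rfl | rfl <;> simp only [map_mul, map_inv, lρ, lς, lτ] <;> rw [mul_inv_eq_one]
    exacts [c1.symm, c2.symm]
  · have hk : (i : ℕ) + 1 < n := by have := i.2; omega
    obtain rfl : j = lo hk := Fin.ext hj
    obtain rfl : j' = hi hk := Fin.ext hj'
    have c1 := h.semiconj_ς hk (lo hk) ε η hη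
    have c2 := h.semiconj_ς hk (hi hk) ε η hη
    rw [Equiv.swap_apply_left] at c1
    rw [Equiv.swap_apply_right] at c2
    rcases hr with rfl | rfl <;> simp only [map_mul, map_inv, map_zpow, lς, lτ] <;>
      rw [mul_inv_eq_one]
    exacts [c1, c2]
  · have hk : (i : ℕ) + 1 < n := by have := i.2; omega
    obtain rfl : j = lo hk := Fin.ext hj
    obtain rfl : j' = hi hk := Fin.ext hj'
    have c1 := h.semiconj_ρ hk (lo_ne_hi hk) ε
    have c2 := h.semiconj_ρ_inv hk (lo_ne_hi hk).symm ε
    rw [Equiv.swap_apply_left] at c1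
    rw [Equiv.swap_apply_right] at c2
    rcases hr with rfl | rfl | rfl | rfl <;>
      simp only [map_mul, map_inv, map_zpow, lρ, lς, lτ] <;> rw [mul_inv_eq_one]
    exacts [c1, h.τ_hi_ρ hk ε hε, h.τ_lo_ρ_inv hk ε hε, c2]

/-- The generators `ρ` and `σ`. -/
def braidGens (n : ℕ) (ρ ς : ℕ → H) : Set H := {g | ∃ k, k + 1 < n ∧ (g = ρ k ∨ g = ς k)}

theorem exists_τ_mul (h : WicketRels ρ ς τ) {g : H}
    (hg : g ∈ braidGens n ρ ς ∨ g⁻¹ ∈ braidGens n ρ ς) (x : Fin n) (ε : ℤ)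
    (hε : ε = 1 ∨ ε = -1) :
    ∃ w ∈ Subgroup.closure (braidGens n ρ ς), ∃ y, τ x ^ ε * g = w * τ y ^ ε := by
  have mρ : ∀ k, k + 1 < n → ρ k ∈ Subgroup.closure (braidGens n ρ ς) :=
    fun k hk => Subgroup.subset_closure ⟨k, hk, Or.inl rfl⟩
  have mς : ∀ k, k + 1 < n → ς k ∈ Subgroup.closure (braidGens n ρ ς) :=
    fun k hk => Subgroup.subset_closure ⟨k, hk, Or.inr rfl⟩
  rcases hg with ⟨k, hk, rfl | rfl⟩ | ⟨k, hk, hg | hg⟩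
  · by_cases hx : x = hi hk
    · subst hx
      exact ⟨_, mul_mem (mul_mem (zpow_mem (mς k hk) _) (inv_mem (mρ k hk)))
        (zpow_mem (mς k hk) _), _, h.τ_hi_ρ hk ε hε⟩
    · exact ⟨_, mρ k hk, _, h.semiconj_ρ hk hx ε⟩
  · have := h.semiconj_ς hk x ε 1 (Or.inl rfl)
    rw [zpow_one] at this
    exact ⟨_, mς k hk, _, this⟩
  · rw [inv_eq_iff_eq_inv] at hg
    subst hg
    by_cases hx : x = lo hk
    · subst hx
      exact ⟨_, mul_mem (mul_mem (zpow_mem (mς k hk) _) (mρ k hk))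
        (zpow_mem (mς k hk) _), _, h.τ_lo_ρ_inv hk ε hε⟩
    · exact ⟨_, inv_mem (mρ k hk), _, h.semiconj_ρ_inv hk hx ε⟩
  · rw [inv_eq_iff_eq_inv] at hg
    subst hg
    have := h.semiconj_ς hk x ε (-1) (Or.inr rfl)
    rw [zpow_neg_one] at this
    exact ⟨_, inv_mem (mς k hk), _, this⟩

theorem exists_τ_mul_of_mem (h : WicketRels ρ ς τ) {w : H}
    (hw : w ∈ Subgroup.closure (braidGens n ρ ς)) (x : Fin n)
    (ε : ℤ) (hε : ε = 1 ∨ ε = -1) :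
    ∃ w' ∈ Subgroup.closure (braidGens n ρ ς), ∃ y, τ x ^ ε * w = w' * τ y ^ ε := by
  induction hw using Subgroup.closure_induction_left generalizing x with
  | one => exact ⟨1, one_mem _, x, by simp⟩
  | mul_left g hg w hw ih =>
    obtain ⟨w₁, hw₁, y, e₁⟩ := h.exists_τ_mul (Or.inl hg) x ε hε
    obtain ⟨w₂, hw₂, z, e₂⟩ := ih y
    exact ⟨_, mul_mem hw₁ hw₂, z, by rw [← mul_assoc, e₁, mul_assoc, e₂, mul_assoc]⟩
  | inv_mul_cancel g hg w hw ih =>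
    obtain ⟨w₁, hw₁, y, e₁⟩ := h.exists_τ_mul (g := g⁻¹) (Or.inr (by rwa [inv_inv])) x ε hε
    obtain ⟨w₂, hw₂, z, e₂⟩ := ih y
    exact ⟨_, mul_mem hw₁ hw₂, z, by rw [← mul_assoc, e₁, mul_assoc, e₂, mul_assoc]⟩

theorem pairwise_commute (h : WicketRels ρ ς τ) : _root_.Pairwise fun i j =>
    ∀ k l : Multiplicative ℤ,
    Commute (zpowersHom H (τ i) k) (zpowersHom H (τ j) l) := fun i j _ k l => by
  simpa using (h.τ_commute i j).zpow_zpow _ _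

/-- The homomorphism with values `τ` on the generators. -/
def turns (h : WicketRels ρ ς τ) : (Fin n → Multiplicative ℤ) →* H :=
  MonoidHom.noncommPiCoprod (fun i => zpowersHom H (τ i)) h.pairwise_commute

theorem turns_mulSingle (h : WicketRels ρ ς τ) (i : Fin n) (k : ℤ) :
    h.turns (Pi.mulSingle i (Multiplicative.ofAdd k)) = τ i ^ k := by
  rw [turns, MonoidHom.noncommPiCoprod_mulSingle]
  simp

/-- Every element is a product of generators `ρ` and `σ` followed by generators `τ`. -/
theorem exists_mul_turns (h : WicketRels ρ ς τ)
    (hgen : Subgroup.closure (braidGens n ρ ς ∪ Set.range τ) = ⊤) (g : H) :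
    ∃ w ∈ Subgroup.closure (braidGens n ρ ς), ∃ a, g = w * h.turns a := by
  have hg : g ∈ Subgroup.closure (braidGens n ρ ς ∪ Set.range τ) := hgen ▸ Subgroup.mem_top g
  have key : ∀ (x : Fin n) (ε : ℤ), (ε = 1 ∨ ε = -1) → ∀ g : H,
      (∃ w ∈ Subgroup.closure (braidGens n ρ ς), ∃ a, g = w * h.turns a) →
      ∃ w ∈ Subgroup.closure (braidGens n ρ ς), ∃ a, τ x ^ ε * g = w * h.turns a := by
    rintro x ε hε g ⟨w, hw, a, rfl⟩
    obtain ⟨w', hw', y, e⟩ := h.exists_τ_mul_of_mem hw x ε hε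
    exact ⟨w', hw', Pi.mulSingle y (Multiplicative.ofAdd ε) * a, by
      rw [← mul_assoc, e, map_mul, turns_mulSingle, mul_assoc]⟩
  induction hg using Subgroup.closure_induction_left with
  | one => exact ⟨1, one_mem _, 1, by simp⟩
  | mul_left g hg w hw ih =>
    rcases hg with hg | ⟨x, rfl⟩
    · obtain ⟨w', hw', a, rfl⟩ := ih
      exact ⟨_, mul_mem (Subgroup.subset_closure hg) hw', a, by rw [mul_assoc]⟩
    · simpa using key x 1 (Or.inl rfl) w ih
  | inv_mul_cancel g hg w hw ih =>
    rcases hg with hg | ⟨x, rfl⟩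
    · obtain ⟨w', hw', a, rfl⟩ := ih
      exact ⟨_, mul_mem (inv_mem (Subgroup.subset_closure hg)) hw', a, by rw [mul_assoc]⟩
    · simpa using key x (-1) (Or.inr rfl) w ih

end WicketRels

/-- The presented group. -/
abbrev WGroup (n : ℕ) : Type := PresentedGroup (wickRels n)

namespace WGroup

/-- The generator `ρ` of the presented group. -/
def ρ (n k : ℕ) : WGroup n := if h : k < n - 1 then PresentedGroup.of (Sum.inl ⟨k, h⟩) else 1

/-- The generator `σ` of the presented group. -/
def ς (n k : ℕ) : WGroup n :=
  if h : k < n - 1 then PresentedGroup.of (Sum.inr (Sum.inl ⟨k, h⟩)) else 1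

/-- The generator `τ` of the presented group. -/
def τ (j : Fin n) : WGroup n := PresentedGroup.of (Sum.inr (Sum.inr j))

theorem mk_wρ (i : Fin (n - 1)) : PresentedGroup.mk (wickRels n) (wρ i) = ρ n i := by
  rw [ρ, dif_pos i.2]; rfl

theorem mk_wσ (i : Fin (n - 1)) : PresentedGroup.mk (wickRels n) (wσ i) = ς n i := by
  rw [ς, dif_pos i.2]; rfl

theorem mk_wτ (j : Fin n) : PresentedGroup.mk (wickRels n) (wτ j) = τ j := rfl

theorem eq_of_mem {a b : FreeGroup (WGen n)} (h : a * b⁻¹ ∈ wickRels n) :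
    PresentedGroup.mk (wickRels n) a = PresentedGroup.mk (wickRels n) b := by
  have := PresentedGroup.one_of_mem h
  rwa [map_mul, map_inv, mul_inv_eq_one] at this

theorem wicketRels (n : ℕ) : WicketRels (ρ n) (ς n) (τ (n := n)) := by
  have ρ1 : ∀ k, ¬ k < n - 1 → ρ n k = 1 := fun k hk => dif_neg hk
  have ς1 : ∀ k, ¬ k < n - 1 → ς n k = 1 := fun k hk => dif_neg hk
  have far : ∀ i j : Fin (n - 1), (i : ℕ) + 2 ≤ j ∨ (j : ℕ) + 2 ≤ i →
      Commute (ρ n i) (ρ n j) ∧ Commute (ς n i) (ς n j) ∧ Commute (ρ n i) (ς n j) := by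
    intro i j hij
    refine ⟨?_, ?_, ?_⟩ <;> rw [Commute, SemiconjBy] <;>
      simp only [← mk_wρ, ← mk_wσ, ← map_mul] <;>
      exact eq_of_mem (by
        simp only [wickRels, Set.mem_union, Set.mem_iUnion, Set.mem_insert_iff,
          Set.mem_singleton_iff]
        exact Or.inl (Or.inl (Or.inl (Or.inl (Or.inl ⟨i, j, hij, by tauto⟩)))))
  have near : ∀ i j : Fin (n - 1), (j : ℕ) = i + 1 →
      ρ n i * ρ n j * ρ n i = ρ n j * ρ n i * ρ n j ∧
      ς n i * ς n j * ς n i = ς n j * ς n i * ς n j ∧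
      ρ n i * ς n j * ς n i = ς n j * ς n i * ρ n j ∧
      ς n i * ς n j * ρ n i = ρ n j * ς n i * ς n j ∧
      ς n i * ρ n j * ρ n i = ρ n j * ρ n i * ς n j := by
    intro i j hij
    refine ⟨?_, ?_, ?_, ?_, ?_⟩ <;>
      simp only [← mk_wρ, ← mk_wσ, ← map_mul] <;>
      exact eq_of_mem (by
        simp only [wickRels, Set.mem_union, Set.mem_iUnion, Set.mem_insert_iff,
          Set.mem_singleton_iff]
        exact Or.inl (Or.inl (Or.inl (Or.inl (Or.inr ⟨i, j, hij, by tauto⟩)))))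
  have fix : ∀ {k} (hk : k + 1 < n) (x : Fin n), x ≠ lo hk → x ≠ hi hk →
      τ x * ρ n k = ρ n k * τ x ∧ τ x * ς n k = ς n k * τ x := by
    intro k hk x h1 h2
    have hx : (x : ℕ) ≠ k ∧ (x : ℕ) ≠ k + 1 := ⟨fun e => h1 (Fin.ext e), fun e => h2 (Fin.ext e)⟩
    have e1 := mk_wρ (n := n) ⟨k, by omega⟩
    have e2 := mk_wσ (n := n) ⟨k, by omega⟩
    simp only at e1 e2
    refine ⟨Eq.symm ?_, Eq.symm ?_⟩ <;>
      simp only [← e1, ← e2, ← mk_wτ, ← map_mul] <;>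
      exact eq_of_mem (by
        simp only [wickRels, Set.mem_union, Set.mem_iUnion, Set.mem_insert_iff,
          Set.mem_singleton_iff]
        exact Or.inl (Or.inl (Or.inr ⟨⟨k, by omega⟩, x, hx, by tauto⟩)))
  have pair : ∀ {k} (hk : k + 1 < n), τ (lo hk) * ς n k = ς n k * τ (hi hk) ∧
      τ (hi hk) * ς n k = ς n k * τ (lo hk) ∧ τ (lo hk) * ρ n k = ρ n k * τ (hi hk) ∧
      (τ (hi hk))⁻¹ * ρ n k = ς n k * (ρ n k)⁻¹ * (ς n k)⁻¹ * (τ (lo hk))⁻¹ := by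
    intro k hk
    have e1 := mk_wρ (n := n) ⟨k, by omega⟩
    have e2 := mk_wσ (n := n) ⟨k, by omega⟩
    simp only at e1 e2
    refine ⟨?_, ?_, ?_, ?_⟩ <;>
      simp only [← e1, ← e2, ← mk_wτ, ← map_mul, ← map_inv]
    · exact eq_of_mem (by
        simp only [wickRels, Set.mem_union, Set.mem_iUnion, Set.mem_insert_iff,
          Set.mem_singleton_iff]
        exact Or.inl (Or.inr ⟨⟨k, by omega⟩, lo hk, hi hk, rfl, rfl, 1, Or.inl rfl, 1, Or.inl rfl,
          by simp only [zpow_one]; tauto⟩))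
    · exact eq_of_mem (by
        simp only [wickRels, Set.mem_union, Set.mem_iUnion, Set.mem_insert_iff,
          Set.mem_singleton_iff]
        exact Or.inl (Or.inr ⟨⟨k, by omega⟩, lo hk, hi hk, rfl, rfl, 1, Or.inl rfl, 1, Or.inl rfl,
          by simp only [zpow_one]; tauto⟩))
    · exact eq_of_mem (by
        simp only [wickRels, Set.mem_union, Set.mem_iUnion, Set.mem_insert_iff,
          Set.mem_singleton_iff]
        exact Or.inr ⟨⟨k, by omega⟩, lo hk, hi hk, rfl, rfl, 1, Or.inl rfl,
          by simp only [zpow_one]; tauto⟩)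
    · exact eq_of_mem (by
        simp only [wickRels, Set.mem_union, Set.mem_iUnion, Set.mem_insert_iff,
          Set.mem_singleton_iff]
        exact Or.inr ⟨⟨k, by omega⟩, lo hk, hi hk, rfl, rfl, -1, Or.inr rfl,
          by simp only [zpow_neg_one, neg_neg, zpow_one]; tauto⟩)
  refine ⟨⟨fun i j hij => ?_, fun i j hij => ?_, fun i j hij => ?_, fun i j hij => ?_,
    fun i _ => (near ⟨i, by omega⟩ ⟨i + 1, by omega⟩ rfl).1,
    fun i _ => (near ⟨i, by omega⟩ ⟨i + 1, by omega⟩ rfl).2.1,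
    fun i _ => (near ⟨i, by omega⟩ ⟨i + 1, by omega⟩ rfl).2.2.1,
    fun i _ => (near ⟨i, by omega⟩ ⟨i + 1, by omega⟩ rfl).2.2.2.1,
    fun i _ => (near ⟨i, by omega⟩ ⟨i + 1, by omega⟩ rfl).2.2.2.2⟩, fun i j => ?_,
    fun {k} hk x => ?_, fun {k} hk {x} hx => ?_, fun {k} hk => ?_⟩
  · by_cases hj : j < n - 1
    · exact (far ⟨i, by omega⟩ ⟨j, hj⟩ (Or.inl hij)).1
    · rw [ρ1 j hj]; exact Commute.one_right _
  · by_cases hj : j < n - 1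
    · exact (far ⟨i, by omega⟩ ⟨j, hj⟩ (Or.inl hij)).2.1
    · rw [ς1 j hj]; exact Commute.one_right _
  · by_cases hj : j < n - 1
    · exact (far ⟨i, by omega⟩ ⟨j, hj⟩ (Or.inl hij)).2.2
    · rw [ς1 j hj]; exact Commute.one_right _
  · by_cases hj : j < n - 1
    · exact (far ⟨j, hj⟩ ⟨i, by omega⟩ (Or.inr hij)).2.2.symm
    · rw [ρ1 j hj]; exact Commute.one_right _
  · rcases eq_or_ne i j with rfl | hij
    · exact Commute.refl _
    · rw [Commute, SemiconjBy]
      simp only [← mk_wτ, ← map_mul]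
      exact eq_of_mem (by
        simp only [wickRels, Set.mem_union, Set.mem_iUnion, Set.mem_singleton_iff]
        exact Or.inl (Or.inl (Or.inl (Or.inr ⟨i, j, hij, rfl⟩))))
  · rcases eq_or_ne x (lo hk) with rfl | h1
    · rw [Equiv.swap_apply_left]; exact (pair hk).1
    rcases eq_or_ne x (hi hk) with rfl | h2
    · rw [Equiv.swap_apply_right]; exact (pair hk).2.1
    · rw [Equiv.swap_apply_of_ne_of_ne h1 h2]; exact (fix hk x h1 h2).2
  · rcases eq_or_ne x (lo hk) with rfl | h1
    · rw [Equiv.swap_apply_left]; exact (pair hk).2.2.1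
    · rw [Equiv.swap_apply_of_ne_of_ne h1 hx]; exact (fix hk x h1 hx).1
  · have := (pair hk).2.2.2
    calc ρ n k * τ (lo hk) * ς n k = τ (hi hk) * ((τ (hi hk))⁻¹ * ρ n k) * τ (lo hk) * ς n k := by
          group
      _ = _ := by rw [this]; group

theorem closure_eq_top (n : ℕ) : Subgroup.closure
    (WicketRels.braidGens n (ρ n) (ς n) ∪ Set.range (τ (n := n))) = ⊤ := by
  rw [eq_top_iff, ← PresentedGroup.closure_range_of (wickRels n), Subgroup.closure_le]
  rintro _ ⟨i | i | j, rfl⟩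
  · refine Subgroup.subset_closure (Or.inl ⟨i, by have := i.2; omega, Or.inl ?_⟩)
    rw [← mk_wρ]; rfl
  · refine Subgroup.subset_closure (Or.inl ⟨i, by have := i.2; omega, Or.inr ?_⟩)
    rw [← mk_wσ]; rfl
  · exact Subgroup.subset_closure (Or.inr ⟨j, rfl⟩)

end WGroup

namespace Evaluation

variable {Γ : Type*} [Group Γ] (E : Evaluation n Γ)

/-- The homomorphism from the presented group. -/
def hom : WGroup n →* Γ := PresentedGroup.toGroup E.wicketRels.lift_eq_one

theorem hom_ρ (k : ℕ) : E.hom (WGroup.ρ n k) = E.rho k := by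
  by_cases h : k < n - 1
  · rw [WGroup.ρ, dif_pos h, hom, PresentedGroup.toGroup.of]; rfl
  · rw [WGroup.ρ, dif_neg h, map_one, E.rho_of_le (by omega)]

theorem hom_ς (k : ℕ) : E.hom (WGroup.ς n k) = E.sig k := by
  by_cases h : k < n - 1
  · rw [WGroup.ς, dif_pos h, hom, PresentedGroup.toGroup.of]; rfl
  · rw [WGroup.ς, dif_neg h, map_one, E.sig_of_le (by omega)]

theorem hom_turns (a : Fin n → Multiplicative ℤ) :
    E.hom ((WGroup.wicketRels n).turns a) = E.turnHom a := by
  have : E.hom.comp (WGroup.wicketRels n).turns = E.turnHom := by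
    refine MonoidHom.pi_ext fun i k => ?_
    have hk : Pi.mulSingle (M := fun _ : Fin n => Multiplicative ℤ) i k =
        Pi.mulSingle i (Multiplicative.ofAdd 1) ^ k.toAdd := by
      rw [← Pi.mulSingle_zpow, ← ofAdd_zsmul, smul_eq_mul, mul_one, ofAdd_toAdd]
    have h1 : E.hom (WGroup.τ i) = E.tau i := by
      rw [WGroup.τ, hom, PresentedGroup.toGroup.of]; rfl
    rw [hk, map_zpow, map_zpow, MonoidHom.comp_apply, WicketRels.turns_mulSingle, zpow_one, h1, tau]
  exact DFunLike.congr_fun this a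

end Evaluation

end Presentation

section Words

open Evaluation

variable {n : ℕ} {H : Type*} [Group H] {ρ ς : ℕ → H}

theorem reorder_adjacent {α : Type*} [DecidableEq α] (A : ℕ → α → α → H) {u w : List α} {a b : α}
    (h : (u ++ a :: b :: w).Nodup) (k : ℕ) :
    reorder A k (u ++ a :: b :: w) (u ++ b :: a :: w) = A (k + u.length) a b := by
  induction u generalizing k with
  | nil =>
    have hab : b ∉ [a] := by simp at h ⊢; tauto
    have := reorder_cons A hab k w (a :: w)
    simp only [List.singleton_append] at this
    rw [List.nil_append, List.nil_append, this, reorder_self, moveDown, moveDown]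
    simp
  | cons x u ih =>
    have := reorder_cons A (x := x) (u := []) (by simp) k (u ++ a :: b :: w) (u ++ b :: a :: w)
    simp only [List.nil_append] at this
    rw [List.cons_append, List.cons_append, this, moveDown, one_mul, ih (List.nodup_cons.1 h).2,
      List.length_cons, add_assoc, add_comm 1]

theorem finRange_eq {k : ℕ} (hk : k + 1 < n) :
    ∃ u w, List.finRange n = u ++ lo hk :: hi hk :: w ∧ u.length = k := by
  have h1 : k < (List.finRange n).length := by simp; omega
  have h2 : k + 1 < (List.finRange n).length := by simpa using hk
  refine ⟨(List.finRange n).take k, (List.finRange n).drop (k + 2), ?_, by simp; omega⟩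
  conv_lhs => rw [← List.take_append_drop k (List.finRange n), List.drop_eq_getElem_cons h1,
    List.drop_eq_getElem_cons h2]
  simp [lo, hi]

/-- The base stack of intervals in a given order. -/
def stackPt (q : Equiv.Perm (Fin n)) : IvlConf n := ⟨stack q short, stack_short_mem⟩

theorem ivlWord_trans (h : BraidRels ρ ς n) {x y z : IvlConf n} (γ : Path x y) (γ' : Path y z) :
    ivlWord h (γ.trans γ') = ivlWord h γ * ivlWord h γ' := (ivlHolonomy h).total_trans _ _ _ _

theorem ivlWord_homotopic (h : BraidRels ρ ς n) {x y : IvlConf n} {γ γ' : Path x y}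
    (hγ : γ.Homotopic γ') : ivlWord h γ = ivlWord h γ' := (ivlHolonomy h).total_homotopic _ _ hγ

theorem ivlWord_refl (h : BraidRels ρ ς n) (x : IvlConf n) : ivlWord h (Path.refl x) = 1 := by
  have := ivlWord_trans h (Path.refl x) (Path.refl x)
  rwa [Path.refl_trans_refl, left_eq_mul] at this

theorem ivlWord_symm (h : BraidRels ρ ς n) {x y : IvlConf n} (γ : Path x y) :
    ivlWord h γ.symm = (ivlWord h γ)⁻¹ := by
  rw [eq_inv_iff_mul_eq_one, ← ivlWord_trans, ← ivlWord_refl h y]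
  exact ivlWord_homotopic h ⟨(Path.Homotopy.reflSymmTrans γ).symm⟩

theorem exists_path_chamber (h : BraidRels ρ ς n) {s : Ivl n} (hs : s ∈ IvlConf n)
    {x y : IvlConf n} (hx : x.1 ∈ chamber s) (hy : y.1 ∈ chamber s) :
    ∃ γ : Path x y, ivlWord h γ = reorder (passGen ρ ς s.a s.b) 0 x.1.order y.1.order := by
  have hj : JoinedIn (chamber s) x.1 y.1 :=
    ((convex_chamber s).isPathConnected ⟨_, hx⟩).joinedIn _ hx _ hy
  refine ⟨toSub (IvlConf n) hj.somePath fun t => chamber_subset hs (hj.somePath_mem t), ?_⟩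
  exact (ivlHolonomy h).total_map _ _ _ (⟨s, hs⟩ : IvlConf n) fun t => hj.somePath_mem t

theorem exists_path_sw (h : BraidRels ρ ς n) {k : ℕ} (hk : k + 1 < n) (q : Equiv.Perm (Fin n))
    {J : Fin n → ℝ × ℝ} (hJ : ∀ i, (J i).1 < (J i).2)
    (hc : NonCrossing (fun i => (J i).1) (fun i => (J i).2) (lo hk) (hi hk)) :
    ∃ γ : Path (stackPt q) (stackPt (sw hk * q)), ivlWord h γ =
      passGen ρ ς (fun i => (J i).1) (fun i => (J i).2) k (lo hk) (hi hk) := by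
  let s : Ivl n := tie (fun i => tieTwo k (q i)) (J ∘ q)
  have hJ' : ∀ i, ((J ∘ q) i).1 < ((J ∘ q) i).2 := fun i => hJ _
  have hs : s ∈ IvlConf n := by
    refine tie_mem hJ' fun i j hij e => ?_
    have hq : ∀ i j, q i = lo hk → q j = hi hk →
        NonCrossing (fun i => ((J ∘ q) i).1) (fun i => ((J ∘ q) i).2) i j := by
      intro i j h1 h2
      simp only [NonCrossing, Function.comp_apply, h1, h2]
      exact hc
    rcases tieTwo_eq (q.injective.ne hij) e with ⟨h1, h2⟩ | ⟨h1, h2⟩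
    · exact hq i j (Fin.ext h1) (Fin.ext h2)
    · exact (hq j i (Fin.ext h2) (Fin.ext h1)).symm
  have hlt : ∀ i j, s.y i < s.y j → tieTwo k (q i) < tieTwo k (q j) :=
    fun i j hij => tie_y_lt_iff.1 hij
  have m1 : stack q (J ∘ q) ∈ chamber s := stack_mem_chamber (self_mem_chamber hs) fun i j hij =>
    lt_of_not_ge fun hle => absurd (monotone_tieTwo (k := k) hle) (not_le.2 (hlt i j hij))
  have m2 : stack (sw hk * q) (J ∘ q) ∈ chamber s :=
    stack_mem_chamber (self_mem_chamber hs) fun i j hij => lt_of_not_ge fun hle => by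
      have := monotone_tieTwo (k := k) hle
      rw [Equiv.Perm.mul_apply, Equiv.Perm.mul_apply, tieTwo_sw, tieTwo_sw] at this
      exact absurd this (not_le.2 (hlt i j hij))
  have ms := fun q : Equiv.Perm (Fin n) => stack_mem_chamber_short (q := q) short_lt
  have mJ := fun q' : Equiv.Perm (Fin n) => stack_mem_chamber_short (q := q') (J := J ∘ q) hJ'
  let y : Equiv.Perm (Fin n) → IvlConf n := fun q' => ⟨stack q' (J ∘ q), stack_mem hJ'⟩
  obtain ⟨γ₁, e₁⟩ := exists_path_chamber h stack_short_mem (x := stackPt q) (y := y q) (ms q) (mJ q)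
  obtain ⟨γ₂, e₂⟩ := exists_path_chamber h hs (x := y q) (y := y (sw hk * q)) m1 m2
  obtain ⟨γ₃, e₃⟩ := exists_path_chamber h stack_short_mem (x := y (sw hk * q))
    (y := stackPt (sw hk * q)) (mJ _) (ms _)
  refine ⟨(γ₁.trans γ₂).trans γ₃, ?_⟩
  have o₁ : ∀ q' : Equiv.Perm (Fin n), (stackPt q').1.order = (List.finRange n).map q'.symm :=
    fun q' => order_stack q' _
  have o₂ : ∀ q' : Equiv.Perm (Fin n), (y q').1.order = (List.finRange n).map q'.symm :=
    fun q' => order_stack q' _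
  rw [ivlWord_trans, ivlWord_trans, e₁, e₂, e₃, o₁, o₁, o₂, o₂, reorder_self, reorder_self,
    one_mul, mul_one]
  obtain ⟨u, w, e, rfl⟩ := finRange_eq hk
  have hnd : (u ++ lo hk :: hi hk :: w).Nodup := e ▸ List.nodup_finRange n
  have hfix : ∀ x, x ∈ u ∨ x ∈ w → sw hk x = x := by
    intro x hx
    rw [List.nodup_append] at hnd
    have h1 := hnd.2.1
    simp only [List.nodup_cons, List.mem_cons, not_or] at h1
    refine Equiv.swap_apply_of_ne_of_ne (fun hx' => ?_) (fun hx' => ?_)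
    · rcases hx with hx | hx
      · exact hnd.2.2 x hx _ (by simp) hx'
      · exact h1.1.2 (hx' ▸ hx)
    · rcases hx with hx | hx
      · exact hnd.2.2 x hx _ (by simp) hx'
      · exact h1.2.1 (hx' ▸ hx)
  have e1 : (List.finRange n).map q.symm =
      u.map q.symm ++ q.symm (lo hk) :: q.symm (hi hk) :: w.map q.symm := by rw [e]; simp
  have e2 : (List.finRange n).map (sw hk * q).symm =
      u.map q.symm ++ q.symm (hi hk) :: q.symm (lo hk) :: w.map q.symm := by
    have hm : ∀ l : List (Fin n), (∀ x ∈ l, sw hk x = x) →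
        l.map (sw hk * q).symm = l.map q.symm := by
      intro l hl
      refine List.map_congr_left fun x hx => ?_
      change q.symm ((sw hk).symm x) = _
      rw [Equiv.symm_swap, hl x hx]
    rw [e, List.map_append, List.map_cons, List.map_cons, hm u fun x hx => hfix x (Or.inl hx),
      hm w fun x hx => hfix x (Or.inr hx)]
    change _ ++ q.symm ((sw hk).symm _) :: q.symm ((sw hk).symm _) :: _ = _
    rw [Equiv.symm_swap, Equiv.swap_apply_left, Equiv.swap_apply_right]
  rw [e1, e2, reorder_adjacent _ (by
    rw [← e1]; exact (List.nodup_finRange n).map q.symm.injective), zero_add, List.length_map]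
  have es : ∀ x, (J ∘ q) (q.symm x) = J x := fun x => by simp
  have ea : ∀ x, s.a (q.symm x) = (J x).1 := fun x => congrArg Prod.fst (es x)
  have eb : ∀ x, s.b (q.symm x) = (J x).2 := fun x => congrArg Prod.snd (es x)
  simp only [passGen, ea, eb]

theorem exists_path_gen (h : BraidRels ρ ς n) {g : H} (hg : g ∈ WicketRels.braidGens n ρ ς) :
    ∃ p : Equiv.Perm (Fin n), p * p = 1 ∧ ∀ q, ∃ γ : Path (stackPt q) (stackPt (p * q)),
      ivlWord h γ = g := by
  obtain ⟨k, hk, rfl | rfl⟩ := hg <;> refine ⟨sw hk, Equiv.swap_mul_self _ _, fun q => ?_⟩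
  · have hi' : (ringIvl (hi hk) (hi hk)).1 < (ringIvl (hi hk) (lo hk)).1 ∧
        (ringIvl (hi hk) (lo hk)).2 < (ringIvl (hi hk) (hi hk)).2 := by
      simp only [ringIvl_self, ringIvl_of_ne (lo_ne_hi hk)]; norm_num
    obtain ⟨γ, e⟩ := exists_path_sw h hk q (ringIvl_lt (hi hk)) (Or.inl hi')
    exact ⟨γ, e.trans (passGen_inside (a := fun i => (ringIvl (hi hk) i).1)
      (b := fun i => (ringIvl (hi hk) i).2) hi')⟩
  · have hr : (sideIvl (lo hk) (hi hk)).2 < (sideIvl (lo hk) (lo hk)).1 := by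
      simp only [sideIvl_self, sideIvl_of_ne (lo_ne_hi hk).symm]; norm_num
    obtain ⟨γ, e⟩ := exists_path_sw h hk q (sideIvl_lt (lo hk)) (Or.inr (Or.inr (Or.inl hr)))
    exact ⟨γ, e.trans (passGen_right (a := fun i => (sideIvl (lo hk) i).1)
      (b := fun i => (sideIvl (lo hk) i).2) (sideIvl_lt _ _) (sideIvl_lt _ _) hr)⟩

/-- Every product of generators is the word of a path of intervals. -/
theorem exists_path_word (h : BraidRels ρ ς n) {w : H}
    (hw : w ∈ Subgroup.closure (WicketRels.braidGens n ρ ς)) :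
    ∃ (q : Equiv.Perm (Fin n)) (γ : Path (stackPt 1) (stackPt q)), ivlWord h γ = w := by
  induction hw using Subgroup.closure_induction_right with
  | one => exact ⟨1, Path.refl _, ivlWord_refl h _⟩
  | mul_right w hw g hg ih =>
    obtain ⟨q, γ, rfl⟩ := ih
    obtain ⟨p, -, hp⟩ := exists_path_gen h hg
    obtain ⟨γ', rfl⟩ := hp q
    exact ⟨p * q, γ.trans γ', ivlWord_trans h _ _⟩
  | mul_inv_cancel w hw g hg ih =>
    obtain ⟨q, γ, rfl⟩ := ih
    obtain ⟨p, hpp, hp⟩ := exists_path_gen h hg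
    have := hp (p * q)
    rw [← mul_assoc, hpp, one_mul] at this
    obtain ⟨γ', rfl⟩ := this
    exact ⟨p * q, γ.trans γ'.symm, by rw [ivlWord_trans, ivlWord_symm]⟩

end Words

section FlatPaths

variable {n : ℕ}

theorem exists_ivl_path {u v : IvlConf n} (δ : Path (ivlToConf u) (ivlToConf v))
    (hδ : ∀ t, δ t ∈ flat (Fin n)) : ∃ γ : Path u v, γ.map ivlToConf.continuous = δ := by
  refine ⟨⟨⟨fun t => ⟨underConf (δ t), underConf_mem (hδ t)⟩,
    (continuous_underConf.comp δ.continuous).subtype_mk _⟩, ?_, ?_⟩, ?_⟩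
  · exact Subtype.ext (by simp [underConf_ivlToConf])
  · exact Subtype.ext (by simp [underConf_ivlToConf])
  · exact Path.ext (funext fun t => Subtype.ext (overIvl_underConf (hδ t)))

theorem homotopic_refl_of_homIn {u : IvlConf n} {γ : Path u u}
    (h : HomIn (flat (Fin n)) (γ.map ivlToConf.continuous) (Path.refl _)) :
    γ.Homotopic (Path.refl u) := by
  obtain ⟨F, hF⟩ := h
  refine ⟨⟨⟨⟨fun p => ⟨underConf (F p), underConf_mem (hF p)⟩,
    (continuous_underConf.comp F.continuous).subtype_mk _⟩, fun t => ?_, fun t => ?_⟩,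
    fun t p hp => ?_⟩⟩
  · exact Subtype.ext (by simp [underConf_ivlToConf])
  · exact Subtype.ext (by simp [underConf_ivlToConf])
  · refine Subtype.ext ?_
    have := F.prop t p hp
    simp only [ContinuousMap.coe_mk]
    refine (congrArg underConf this).trans ?_
    simp [underConf_ivlToConf]

end FlatPaths

section FundamentalGroup

open Evaluation

variable {n : ℕ}

/-- The class of a path, transported to the vertex group at `x₀`. -/
def pathClass {X : Type*} [TopologicalSpace X] (x₀ : X) {a b : X} (f : Path a b) :
    (FundamentalGroup X x₀)ᵐᵒᵖ :=
  groupoidHolonomy (FundamentalGroupoid.mk x₀)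
    (show FundamentalGroupoid.mk a ⟶ FundamentalGroupoid.mk b from Path.Homotopic.Quotient.mk f)

theorem pathClass_congr {X : Type*} [TopologicalSpace X] (x₀ : X) {a b a' b' : X} {f : Path a b}
    {f' : Path a' b'} (h : ∀ t, f t = f' t) : pathClass x₀ f = pathClass x₀ f' := by
  obtain rfl : a = a' := by simpa using h 0
  obtain rfl : b = b' := by simpa using h 1
  obtain rfl : f = f' := by ext t; exact h t
  rfl

theorem pathClass_loop {X : Type*} [TopologicalSpace X] {x₀ : X} (f : Path x₀ x₀) :
    pathClass x₀ f = MulOpposite.op (FundamentalGroup.fromPath (Path.Homotopic.Quotient.mk f)) :=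
  groupoidHolonomy_self _ _

/-- The evaluation of paths in the fundamental group. -/
def pathEvaluation (x₀ : WConf n) : Evaluation n (FundamentalGroup (WConf n) x₀)ᵐᵒᵖ where
  map γ := pathClass x₀ (γ.map continuous_confToWConf)
  map_trans γ γ' := by
    rw [Path.map_trans, pathClass, pathClass, pathClass, ← groupoidHolonomy_comp]
    rfl
  map_homotopic h := by
    unfold pathClass
    congr 1
    exact Path.Homotopic.Quotient.eq.2 (h.map ⟨_, continuous_confToWConf⟩)
  map_congr h := pathClass_congr _ h

/-- The base point. -/
def basePt (n : ℕ) : WConf n := confToWConf (ivlToConf (stackPt 1))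

/-- The evaluation at the base point. -/
abbrev baseEval (n : ℕ) : Evaluation n (FundamentalGroup (WConf n) (basePt n))ᵐᵒᵖ :=
  pathEvaluation (basePt n)

theorem baseEval_map {Y : Conf (Fin n)} (Λ : Path (ivlToConf (stackPt 1)) Y)
    (hY : basePt n = confToWConf Y) : (baseEval n).map Λ = MulOpposite.op
      (FundamentalGroup.fromPath (Path.Homotopic.Quotient.mk
        ((Λ.map continuous_confToWConf).cast rfl hY))) := by
  rw [← pathClass_loop]
  exact pathClass_congr _ fun t => rfl

theorem eq_of_baseEval_eq_one {Y : Conf (Fin n)} (Λ : Path (ivlToConf (stackPt 1)) Y)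
    (hY : basePt n = confToWConf Y) (h : (baseEval n).map Λ = 1) :
    Y = ivlToConf (stackPt 1) := by
  rw [baseEval_map Λ hY] at h
  have h' : Path.Homotopic.Quotient.mk ((Λ.map continuous_confToWConf).cast rfl hY) =
      Path.Homotopic.Quotient.refl (basePt n) := MulOpposite.op_injective h
  have h1 : isCoveringMap_confToWConf.monodromy (Path.Homotopic.Quotient.refl (basePt n))
      ⟨ivlToConf (stackPt 1), rfl⟩ = ⟨Y, hY.symm⟩ := by
    rw [← h']
    exact isCoveringMap_confToWConf.monodromy_eq_of_map_eq
      (ex := ⟨ivlToConf (stackPt 1), rfl⟩) (ey := ⟨Y, hY.symm⟩) (Path.Homotopic.Quotient.mk Λ) rfl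
  rw [IsCoveringMap.monodromy_refl] at h1
  exact (congrArg Subtype.val h1).symm

theorem homotopic_refl_of_baseEval_eq_one
    (Λ : Path (ivlToConf (stackPt 1)) (ivlToConf (n := n) (stackPt 1)))
    (h : (baseEval n).map Λ = 1) : Λ.Homotopic (Path.refl _) := by
  rw [baseEval_map Λ rfl] at h
  have h' : Path.Homotopic.Quotient.mk (Λ.map continuous_confToWConf) =
      Path.Homotopic.Quotient.refl (basePt n) := MulOpposite.op_injective h
  exact Path.Homotopic.Quotient.eq.1
    (isCoveringMap_confToWConf.injective_path_homotopic_map _ _ h')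

theorem comp_mem_conf {X : Fin n → ℂ × ℂ} (hX : X ∈ Conf (Fin n)) (q : Equiv.Perm (Fin n)) :
    X ∘ q ∈ Conf (Fin n) := fun i j hij => hX (q i) (q j) (q.injective.ne hij)

/-- The turned base configurations with other labels. -/
def torusOn (q : Equiv.Perm (Fin n)) : C(Fin n → ℝ, Conf (Fin n)) where
  toFun v := ⟨(torus v).1 ∘ q, comp_mem_conf (torus v).2 q⟩
  continuous_toFun := by
    refine Continuous.subtype_mk (continuous_pi fun i => ?_) _
    exact (continuous_apply (q i)).comp (continuous_subtype_val.comp torus.continuous)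

theorem torusOn_zero (q : Equiv.Perm (Fin n)) : torusOn q 0 = ivlToConf (stackPt q) := by
  refine Subtype.ext (funext fun i => ?_)
  change turn 0 baseConf (q i) = overIvl (stack q short) i
  rw [turn_zero]
  rfl

theorem confToWConf_torusOn (q : Equiv.Perm (Fin n)) (v : Fin n → ℝ) :
    confToWConf (torusOn q v) = confToWConf (torus v) := confToWConf_relabel _ _ q fun _ => rfl

theorem val_torusOn {Γ : Type*} [Group Γ] (E : Evaluation n Γ) (q : Equiv.Perm (Fin n))
    (a : Fin n → Multiplicative ℤ) :
    E.val (torusOn q) 0 (fun i => ((a i).toAdd : ℝ)) = E.turnHom a :=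
  E.val_transfer (f := torusOn q) (g := torus) (ContinuousMap.id _) (ContinuousMap.id _)
    (confToWConf_torusOn q) _ _

theorem confToWConf_torusOn_int (q : Equiv.Perm (Fin n)) (a : Fin n → Multiplicative ℤ) :
    basePt n = confToWConf (torusOn q fun i => ((a i).toAdd : ℝ)) := by
  rw [confToWConf_torusOn]
  exact (confToWConf_turn (fun i => (a i).toAdd) (fun i => rfl) baseConf_mem _).symm

theorem map_stack_path {Γ : Type*} [Group Γ] (E : Evaluation n Γ) {q q' : Equiv.Perm (Fin n)}
    (γ : Path (stackPt q) (stackPt q')) : E.map (γ.map ivlToConf.continuous) =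
      E.hom (ivlWord (WGroup.wicketRels n).braid γ) := by
  rw [E.map_ivlToConf (WGroup.wicketRels n).braid E.hom E.hom_ρ E.hom_ς γ]
  have h : ∀ q : Equiv.Perm (Fin n), E.toStack (stackPt q).1 = 1 := fun q => E.toStack_stack q
  rw [h, h, one_mul, inv_one, mul_one]

theorem eq_one_of_torusOn_eq {q : Equiv.Perm (Fin n)} {a : Fin n → Multiplicative ℤ}
    (h : torusOn q (fun i => ((a i).toAdd : ℝ)) = ivlToConf (stackPt 1)) : q = 1 ∧ a = 1 := by
  have h1 : ∀ i, turn (fun i => ((a i).toAdd : ℝ)) baseConf (q i) = baseConf i :=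
    fun i => congrFun (congrArg Subtype.val h) i
  have hq : q = 1 := by
    refine Equiv.ext fun i => Fin.ext ?_
    have h2 : (((q i : ℕ) : ℝ)) = ((i : ℕ) : ℝ) := congrArg (fun z => z.1.im) (h1 i)
    exact_mod_cast h2
  refine ⟨hq, ?_⟩
  subst hq
  funext i
  have h3 := congrArg (fun z => z.2.im) (h1 i)
  have h4 : (baseConf i).2.im = 0 := Complex.ofReal_im _
  simp only [turn, Equiv.Perm.one_apply, Complex.add_im, h4, zero_add] at h3
  have h5 : (((a i).toAdd : ℝ) : ℂ) * (Real.pi * Complex.I) =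
      (((a i).toAdd * Real.pi : ℝ) : ℂ) * Complex.I := by push_cast; ring
  rw [h5, Complex.mul_I_im, Complex.ofReal_re, mul_eq_zero_iff_right Real.pi_ne_zero,
    Int.cast_eq_zero] at h3
  exact Multiplicative.toAdd.injective h3

theorem hom_injective : Function.Injective (baseEval n).hom := by
  rw [injective_iff_map_eq_one]
  intro g hg
  obtain ⟨w, hw, a, rfl⟩ :=
    (WGroup.wicketRels n).exists_mul_turns (WGroup.closure_eq_top n) g
  obtain ⟨q, γ, rfl⟩ := exists_path_word (WGroup.wicketRels n).braid hw
  let v : Fin n → ℝ := fun i => ((a i).toAdd : ℝ)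
  let β := ((PathConnectedSpace.somePath 0 v).map (torusOn q).continuous).cast
    (torusOn_zero q).symm rfl
  have hβ : (baseEval n).map β = (baseEval n).turnHom a := by
    rw [← val_torusOn _ q]
    exact (baseEval n).map_congr fun t => rfl
  have hΛ : (baseEval n).map ((γ.map ivlToConf.continuous).trans β) = 1 := by
    rw [(baseEval n).map_trans, hβ, map_stack_path, ← hg, map_mul, (baseEval n).hom_turns]
  obtain ⟨rfl, rfl⟩ := eq_one_of_torusOn_eq
    (eq_of_baseEval_eq_one _ (confToWConf_torusOn_int q a) hΛ)
  rw [map_one, mul_one] at hg ⊢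
  rw [← map_stack_path] at hg
  have h1 := inclF_faithful_iff.1 (inclF_flat (Fin n)).2.2 _ (ivlToConf_mem_flat (stackPt 1))
    (γ.map ivlToConf.continuous) (fun t => ivlToConf_mem_flat _)
    (homotopic_refl_of_baseEval_eq_one _ hg)
  rw [ivlWord_homotopic _ (homotopic_refl_of_homIn h1), ivlWord_refl]

theorem exists_eq_torusOn {Y : Conf (Fin n)} (hY : confToWConf Y = basePt n) :
    ∃ (q : Equiv.Perm (Fin n)) (a : Fin n → Multiplicative ℤ),
      Y = torusOn q fun i => ((a i).toAdd : ℝ) := by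
  obtain ⟨d, hd⟩ := isQuotientCoveringMap_confToWConf.apply_eq_iff_mem_orbit.1 hY
  refine ⟨d.right⁻¹, fun j => d.left (d.right j), Subtype.ext (funext fun i => ?_)⟩
  have hd' : d • ivlToConf (stackPt 1) = Y := hd
  rw [← hd', smul_conf_apply]
  have ht : ∀ (q : Equiv.Perm (Fin n)) v, (torusOn q v).1 i = turn v baseConf (q i) :=
    fun _ _ => rfl
  rw [ht]
  refine Prod.ext rfl ?_
  have hi' : d.right (d.right⁻¹ i) = i := d.right.apply_symm_apply i
  simp only [turn, hi']
  push_cast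
  rfl

theorem hom_surjective : Function.Surjective (baseEval n).hom := by
  intro f
  obtain ⟨δ, hδ⟩ : ∃ δ : Path (basePt n) (basePt n), f = MulOpposite.op
      (FundamentalGroup.fromPath (Path.Homotopic.Quotient.mk δ)) := by
    obtain ⟨δ, h⟩ := Path.Homotopic.Quotient.mk_surjective f.unop
    exact ⟨δ, by rw [h]; rfl⟩
  let l := isCoveringMap_confToWConf.liftPath δ.toContinuousMap (ivlToConf (stackPt 1)) δ.source
  have hl : ∀ t, confToWConf (l t) = δ t := fun t =>
    congrFun (isCoveringMap_confToWConf.liftPath_lifts δ.toContinuousMap _ δ.source) t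
  have hY : confToWConf (l 1) = basePt n := (hl 1).trans δ.target
  let Λ : Path (ivlToConf (stackPt 1)) (l 1) := ⟨l, isCoveringMap_confToWConf.liftPath_zero .., rfl⟩
  have hΛ : (baseEval n).map Λ = f := by
    rw [hδ, ← pathClass_loop]
    exact pathClass_congr _ hl
  obtain ⟨q, a, hqa⟩ := exists_eq_torusOn hY
  let v : Fin n → ℝ := fun i => ((a i).toAdd : ℝ)
  let β : Path (l 1) (ivlToConf (stackPt q)) :=
    ((PathConnectedSpace.somePath v 0).map (torusOn q).continuous).cast hqa (torusOn_zero q).symm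
  have hβ : (baseEval n).map β = ((baseEval n).turnHom a)⁻¹ := by
    rw [← val_torusOn _ q, ← Evaluation.val_symm]
    exact (baseEval n).map_congr fun t => rfl
  obtain ⟨ε, hε, he⟩ := inclF_full_iff.1 (inclF_flat (Fin n)).2.1 _ _
    (ivlToConf_mem_flat (stackPt 1)) (ivlToConf_mem_flat (stackPt q)) (Λ.trans β)
  obtain ⟨γ, rfl⟩ := exists_ivl_path ε hε
  have h1 := (baseEval n).map_homotopic he
  rw [(baseEval n).map_trans, hΛ, hβ, map_stack_path, mul_inv_eq_iff_eq_mul,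
    ← (baseEval n).hom_turns, ← map_mul] at h1
  exact ⟨_, h1.symm⟩

theorem joined_basePt (x : WConf n) : Joined x (basePt n) := by
  obtain ⟨X, rfl⟩ := isQuotientMap_confToWConf.surjective x
  obtain ⟨Y, hY, ⟨p⟩⟩ := inclF_essSurj_iff.1 (inclF_flat (Fin n)).1 X
  let u : IvlConf n := ⟨underConf Y, underConf_mem hY⟩
  have hu : ivlToConf u = Y := Subtype.ext (overIvl_underConf hY)
  have m1 := self_mem_chamber u.2
  have m2 := stack_rank_mem m1 u.1.order_perm (order_pairwise_of_mem m1)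
  let y : IvlConf n := ⟨stack (rank u.1.order) fun i => (u.1 i).2, stack_mem u.2.1⟩
  obtain ⟨γ₁, -⟩ := exists_path_chamber (WGroup.wicketRels n).braid u.2 (y := y) m1 m2
  obtain ⟨γ₂, -⟩ := exists_path_chamber (WGroup.wicketRels n).braid stack_short_mem (x := y)
    (y := stackPt (rank u.1.order))
    (stack_mem_chamber_short (q := rank u.1.order) (J := fun i => (u.1 i).2) u.2.1)
    (stack_mem_chamber_short short_lt)
  have hb : basePt n = confToWConf (ivlToConf (stackPt (rank u.1.order))) := by
    rw [← torusOn_zero, confToWConf_torusOn]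
    exact congrArg confToWConf (torusOn_zero 1).symm
  rw [hb]
  refine Joined.trans ⟨(p.symm.map continuous_confToWConf)⟩ ?_
  rw [← hu]
  exact ⟨((γ₁.trans γ₂).map ivlToConf.continuous).map continuous_confToWConf⟩

/-- The fundamental group at the base point is the presented group. -/
def wGroupEquiv : WGroup n ≃* FundamentalGroup (WConf n) (basePt n) :=
  (MulEquiv.ofBijective (baseEval n).hom ⟨hom_injective, hom_surjective⟩).trans
    (MulEquiv.inv' _).symm

end FundamentalGroup

/-- The wicket group `W_n = π₁𝒲_n` is isomorphic to the group presented by the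
generators `ρ_i`, `σ_i`, `τ_i` with the relations listed in `wickRels`. -/
theorem statement15 (n : ℕ) (x : WConf n) :
    Nonempty (FundamentalGroup (WConf n) x ≃* PresentedGroup (wickRels n)) := by
  obtain ⟨p⟩ := joined_basePt x
  exact ⟨(FundamentalGroup.fundamentalGroupMulEquivOfPath p).trans wGroupEquiv.symm⟩
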